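/- Let 𝔸 and 𝔹 be generalized algebraic theories. The assignments [X] ⊗ [Y] := [X ⊗ Y] on objects and [f] ⊗ [g] := [f ⊗ g] on morphisms define a functor ⊗_{𝔸,𝔹} : 𝒞(𝔸) × 𝒞(𝔹) → 𝒞(𝔸⊗𝔹). In particular: (well-definedness) if the context equalities X ≡ X' ctx in 𝔸 and Y ≡ Y' ctx in 𝔹 are derivable, then X⊗Y ≡ X'⊗Y' ctx is derivable in 𝔸⊗𝔹; if the morphism equalities f ≡ f' : X → A in 𝔸 and g ≡ g' : Y → B in 𝔹 are derivable, then f⊗g ≡ f'⊗g' : X⊗Y → A⊗B is derivable in 𝔸⊗𝔹; (functoriality) (x₁,…,x_m) ⊗ (y₁,…,yₙ) is the identity (x₁y₁,…,x_myₙ) of X⊗Y, and (f'∘f) ⊗ (g'∘g) ≡ (f'⊗g') ∘ (f⊗g) is derivable for composable context morphisms. -/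

import Mathlib

set_option linter.unusedVariables false

/-! # Syntax of generalized algebraic theories (following Cartmell / the paper's appendix) -/

namespace GATPaper

/-- A sort-and-term alphabet: a countably infinite set of variables, a set of sort
symbols and a set of term symbols. -/
structure Alphabet : Type 1 where
  Var : Type
  SortSym : Type
  TermSym : Type
  var_infinite : Infinite Var
  var_countable : Countable Var

attribute [instance] Alphabet.var_infinite Alphabet.var_countable

variable {A B : Alphabet}

/-- Term expressions over an alphabet. -/
inductive Expr (A : Alphabet) : Type where
  | var : A.Var → Expr A
  | app : A.TermSym → List (Expr A) → Expr A

/-- Sort expressions: a sort symbol applied to a list of term expressions. -/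
structure SortE (A : Alphabet) : Type where
  head : A.SortSym
  args : List (Expr A)

/-- Occurrence of a variable in a term expression. -/
inductive Occurs (x : A.Var) : Expr A → Prop where
  | var : Occurs x (Expr.var x)
  | app {t : A.TermSym} {es : List (Expr A)} {e : Expr A} :
      e ∈ es → Occurs x e → Occurs x (Expr.app t es)

/-- Occurrence of a variable in a sort expression. -/
def SOccurs (x : A.Var) (U : SortE A) : Prop := ∃ e ∈ U.args, Occurs x e

/-- Simultaneous substitution along a function on variables. -/
def Expr.subst (σ : A.Var → Expr A) : Expr A → Expr A
  | .var x => σ x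
  | .app t es => .app t (es.attach.map fun e => Expr.subst σ e.1)
termination_by e => sizeOf e
decreasing_by
  have := List.sizeOf_lt_of_mem e.2
  simp only [Expr.app.sizeOf_spec]
  omega

def SortE.subst (σ : A.Var → Expr A) (U : SortE A) : SortE A :=
  ⟨U.head, U.args.map (Expr.subst σ)⟩

open Classical in
/-- The function on variables determined by a finite list of substitution pairs
`(zᵢ, uᵢ)` (substituting `uᵢ` for `zᵢ`, first matching pair winning, all other
variables unchanged). -/
noncomputable def lookupV : List (A.Var × Expr A) → A.Var → Expr A
  | [], x => .var x
  | p :: ps, x => if p.1 = x then p.2 else lookupV ps x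

/-- The simultaneous substitution `e[u₁ | z₁, …, u_k | z_k]` where
`ps = [(z₁,u₁),…,(z_k,u_k)]`. -/
noncomputable def Expr.substL (e : Expr A) (ps : List (A.Var × Expr A)) : Expr A :=
  e.subst (lookupV ps)

noncomputable def SortE.substL (U : SortE A) (ps : List (A.Var × Expr A)) : SortE A :=
  U.subst (lookupV ps)

/-- A (pre)context is a finite list of (variable, sort expression) pairs. -/
abbrev PreCtx (A : Alphabet) := List (A.Var × SortE A)

/-- The list of variables of a precontext, as term expressions. -/
def ctxVars (X : PreCtx A) : List (Expr A) := X.map fun p => Expr.var p.1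

/-- The scoping condition of a precontext: the `i`-th sort expression only contains
variables among the first `i` variables. -/
def IsPreCtx (X : PreCtx A) : Prop :=
  ∀ i (hi : i < X.length) (v : A.Var),
    SOccurs v (X[i]'hi).2 → v ∈ (X.take i).map Prod.fst

/-- Substitution pairs sending the variables of `X` to the entries of `f`. -/
def mkSub (X : PreCtx A) (f : List (Expr A)) : List (A.Var × Expr A) :=
  (X.map Prod.fst).zip f

/-- `Xᵢ[f₁ | x₁, …, f_{i-1} | x_{i-1}]` (0-based: the `i`-th sort of `X`
substituted along the first `i` entries of `f`). -/
noncomputable def subPre (X : PreCtx A) (f : List (Expr A)) (i : ℕ) (hi : i < X.length) :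
    SortE A :=
  ((X[i]'hi).2).substL (mkSub (X.take i) (f.take i))

/-- Judgments: context judgments and the four kinds of standard judgments. -/
inductive Judg (A : Alphabet) : Type where
  | ctx (X : PreCtx A)
  | sort (X : PreCtx A) (U : SortE A)
  | term (X : PreCtx A) (u : Expr A) (U : SortE A)
  | sortEq (X : PreCtx A) (U V : SortE A)
  | termEq (X : PreCtx A) (u v : Expr A) (U : SortE A)

/-- The context of a judgment. -/
def Judg.ctxOf : Judg A → PreCtx A
  | .ctx X => X
  | .sort X _ => X
  | .term X _ _ => X
  | .sortEq X _ _ => X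
  | .termEq X _ _ _ => X

/-- The judgment introducing a sort symbol over the context `X`. -/
def introSort (X : PreCtx A) (S : A.SortSym) : Judg A := .sort X ⟨S, ctxVars X⟩

/-- The judgment introducing a term symbol over the context `X`, with sort `U`. -/
def introTerm (X : PreCtx A) (t : A.TermSym) (U : SortE A) : Judg A :=
  .term X (.app t (ctxVars X)) U

/-- A set of axioms is a pretheory if: no axiom is a context judgment, every
axiom's context is a precontext, every sort symbol has a unique introducing sort
axiom and there are no other sort axioms, and likewise for term symbols. -/
structure IsPretheory (Ax : Set (Judg A)) : Prop where
  no_ctx : ∀ X : PreCtx A, Judg.ctx X ∉ Ax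
  wf_ctx : ∀ J ∈ Ax, IsPreCtx J.ctxOf
  sort_intro : ∀ S : A.SortSym, ∃! X : PreCtx A, introSort X S ∈ Ax
  sort_shape : ∀ (X : PreCtx A) (U : SortE A), Judg.sort X U ∈ Ax → U.args = ctxVars X
  term_intro : ∀ t : A.TermSym, ∃! p : PreCtx A × SortE A, introTerm p.1 t p.2 ∈ Ax
  term_shape : ∀ (X : PreCtx A) (u : Expr A) (U : SortE A), Judg.term X u U ∈ Ax →
      ∃ t : A.TermSym, u = Expr.app t (ctxVars X)

/-- One inference step of the paper's system: `Step Ax D J` holds when `J` is the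
conclusion of an instance of one of the sixteen rules all of whose premises
satisfy `D`. -/
inductive Step (Ax : Set (Judg A)) (D : Judg A → Prop) : Judg A → Prop where
  | ctx_nil : Step Ax D (.ctx [])
  | ctx_cons {X : PreCtx A} {U : SortE A} {x : A.Var}
      (hs : D (.sort X U)) (hfresh : ∀ p ∈ X, p.1 ≠ x)
      (hpre : IsPreCtx (X ++ [(x, U)])) :
      Step Ax D (.ctx (X ++ [(x, U)]))
  | s1 {X : PreCtx A} {U : SortE A} (h : D (.sort X U)) : Step Ax D (.sortEq X U U)
  | s2 {X : PreCtx A} {U V : SortE A} (h : D (.sortEq X U V)) : Step Ax D (.sortEq X V U)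
  | s3 {X : PreCtx A} {U V W : SortE A}
      (h1 : D (.sortEq X U V)) (h2 : D (.sortEq X V W)) : Step Ax D (.sortEq X U W)
  | t1 {X : PreCtx A} {u : Expr A} {U : SortE A}
      (h : D (.term X u U)) : Step Ax D (.termEq X u u U)
  | t2 {X : PreCtx A} {u v : Expr A} {U : SortE A}
      (h : D (.termEq X u v U)) : Step Ax D (.termEq X v u U)
  | t3 {X : PreCtx A} {u v w : Expr A} {U : SortE A}
      (h1 : D (.termEq X u v U)) (h2 : D (.termEq X v w U)) : Step Ax D (.termEq X u w U)
  | seqt {X : PreCtx A} {U U' : SortE A} {u : Expr A}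
      (h1 : D (.sortEq X U U')) (h2 : D (.term X u U)) : Step Ax D (.term X u U')
  | seqteq {X : PreCtx A} {U U' : SortE A} {u u' : Expr A}
      (h1 : D (.sortEq X U U')) (h2 : D (.termEq X u u' U))
      (h3 : D (.term X u U')) (h4 : D (.term X u' U')) : Step Ax D (.termEq X u u' U')
  | var {X : PreCtx A} {i : ℕ} (hi : i < X.length)
      (h : D (.sort X (X[i]'hi).2)) :
      Step Ax D (.term X (.var (X[i]'hi).1) (X[i]'hi).2)
  | sA {X : PreCtx A} {U : SortE A} (hax : Judg.sort X U ∈ Ax) (h : D (.ctx X))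
      (hv : ∀ i (hi : i < X.length), D (.term X (.var (X[i]'hi).1) (X[i]'hi).2)) :
      Step Ax D (.sort X U)
  | tA {X : PreCtx A} {u : Expr A} {U : SortE A} (hax : Judg.term X u U ∈ Ax)
      (h : D (.sort X U))
      (hv : ∀ i (hi : i < X.length), D (.term X (.var (X[i]'hi).1) (X[i]'hi).2)) :
      Step Ax D (.term X u U)
  | seqA {X : PreCtx A} {U U' : SortE A} (hax : Judg.sortEq X U U' ∈ Ax)
      (h1 : D (.sort X U)) (h2 : D (.sort X U')) : Step Ax D (.sortEq X U U')
  | teqA {X : PreCtx A} {u u' : Expr A} {U : SortE A} (hax : Judg.termEq X u u' U ∈ Ax)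
      (h1 : D (.term X u U)) (h2 : D (.term X u' U)) : Step Ax D (.termEq X u u' U)
  | sSub {X : PreCtx A} {S : A.SortSym} (hax : introSort X S ∈ Ax)
      {Y : PreCtx A} (hY : IsPreCtx Y) {f : List (Expr A)} (hlen : f.length = X.length)
      (hJ : D (introSort X S)) (hYc : D (.ctx Y))
      (hargs : ∀ i (hi : i < X.length) (hif : i < f.length),
        D (.term Y (f[i]'hif) (subPre X f i hi))) :
      Step Ax D (.sort Y ⟨S, f⟩)
  | tSub {X : PreCtx A} {t : A.TermSym} {U : SortE A} (hax : introTerm X t U ∈ Ax)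
      {Y : PreCtx A} (hY : IsPreCtx Y) {f : List (Expr A)} (hlen : f.length = X.length)
      (hJ : D (introTerm X t U))
      (hU : D (.sort Y (U.substL (mkSub X f))))
      (hargs : ∀ i (hi : i < X.length) (hif : i < f.length),
        D (.term Y (f[i]'hif) (subPre X f i hi))) :
      Step Ax D (.term Y (.app t f) (U.substL (mkSub X f)))
  | seqSub1 {X : PreCtx A} {U U' : SortE A} (hax : Judg.sortEq X U U' ∈ Ax)
      {Y : PreCtx A} (hY : IsPreCtx Y) {f : List (Expr A)} (hlen : f.length = X.length)
      (hJ : D (.sortEq X U U'))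
      (h1 : D (.sort Y (U.substL (mkSub X f)))) (h2 : D (.sort Y (U'.substL (mkSub X f))))
      (hargs : ∀ i (hi : i < X.length) (hif : i < f.length),
        D (.term Y (f[i]'hif) (subPre X f i hi))) :
      Step Ax D (.sortEq Y (U.substL (mkSub X f)) (U'.substL (mkSub X f)))
  | seqSub2 {X : PreCtx A} {S : A.SortSym} (hax : introSort X S ∈ Ax)
      {Y : PreCtx A} (hY : IsPreCtx Y) {f g : List (Expr A)}
      (hlf : f.length = X.length) (hlg : g.length = X.length)
      (hJ : D (introSort X S))
      (h1 : D (.sort Y ⟨S, f⟩)) (h2 : D (.sort Y ⟨S, g⟩))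
      (hargs : ∀ i (hi : i < X.length) (hif : i < f.length) (hig : i < g.length),
        D (.termEq Y (f[i]'hif) (g[i]'hig) (subPre X f i hi))) :
      Step Ax D (.sortEq Y ⟨S, f⟩ ⟨S, g⟩)
  | teqSub1 {X : PreCtx A} {u u' : Expr A} {U : SortE A}
      (hax : Judg.termEq X u u' U ∈ Ax)
      {Y : PreCtx A} (hY : IsPreCtx Y) {f : List (Expr A)} (hlen : f.length = X.length)
      (hJ : D (.termEq X u u' U))
      (h1 : D (.term Y (u.substL (mkSub X f)) (U.substL (mkSub X f))))
      (h2 : D (.term Y (u'.substL (mkSub X f)) (U.substL (mkSub X f))))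
      (hargs : ∀ i (hi : i < X.length) (hif : i < f.length),
        D (.term Y (f[i]'hif) (subPre X f i hi))) :
      Step Ax D (.termEq Y (u.substL (mkSub X f)) (u'.substL (mkSub X f))
        (U.substL (mkSub X f)))
  | teqSub2 {X : PreCtx A} {t : A.TermSym} {U : SortE A} (hax : introTerm X t U ∈ Ax)
      {Y : PreCtx A} (hY : IsPreCtx Y) {f g : List (Expr A)}
      (hlf : f.length = X.length) (hlg : g.length = X.length)
      (hJ : D (introTerm X t U))
      (h1 : D (.term Y (.app t f) (U.substL (mkSub X f))))
      (h2 : D (.term Y (.app t g) (U.substL (mkSub X f))))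
      (hargs : ∀ i (hi : i < X.length) (hif : i < f.length) (hig : i < g.length),
        D (.termEq Y (f[i]'hif) (g[i]'hig) (subPre X f i hi))) :
      Step Ax D (.termEq Y (.app t f) (.app t g) (U.substL (mkSub X f)))

/-- `DerAt Ax n J`: `J` is the conclusion of an inference step in the `n`-th stage
`𝒟ₙ` of the recursive construction of the derivable judgments. -/
def DerAt (Ax : Set (Judg A)) : ℕ → Judg A → Prop
  | 0, _ => False
  | n + 1, J => DerAt Ax n J ∨ Step Ax (DerAt Ax n) J

/-- A judgment is derivable if it is the conclusion of a step of some stage. -/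
def Derivable (Ax : Set (Judg A)) (J : Judg A) : Prop := ∃ n, DerAt Ax n J

/-- The height of a (derivable) judgment: the least stage at which it appears. -/
noncomputable def ht (Ax : Set (Judg A)) (J : Judg A) : ℕ := sInf {n | DerAt Ax n J}

/-- The height of a context: `0` for the empty context, and the height of
`∂X ⊢ Xₙ sort` otherwise. -/
noncomputable def htCtx (Ax : Set (Judg A)) (X : PreCtx A) : ℕ :=
  match X with
  | [] => 0
  | p :: X' =>
      ht Ax (.sort ((p :: X').dropLast) (((p :: X').getLast (List.cons_ne_nil p X')).2))

/-- A generalized algebraic theory: a pretheory all of whose axioms are derivable. -/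
def IsGAT (Ax : Set (Judg A)) : Prop := IsPretheory Ax ∧ ∀ J ∈ Ax, Derivable Ax J

/-- The partial term judgment `X ⊢ u term` is derivable. -/
def DerTerm (Ax : Set (Judg A)) (X : PreCtx A) (u : Expr A) : Prop :=
  ∃ U, Derivable Ax (.term X u U)

/-- The partial term equality judgment `X ⊢ u ≡ v term` is derivable. -/
def DerTermEq (Ax : Set (Judg A)) (X : PreCtx A) (u v : Expr A) : Prop :=
  ∃ U, Derivable Ax (.termEq X u v U)

/-- Height of a derivable partial term judgment: the minimum of the heights of
`X ⊢ u : U` over all `U`. -/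
noncomputable def htTerm (Ax : Set (Judg A)) (X : PreCtx A) (u : Expr A) : ℕ :=
  sInf {n | ∃ U, DerAt Ax n (.term X u U)}

/-- `f` is a context morphism from `X` to `Y`. -/
def IsMor (Ax : Set (Judg A)) (X Y : PreCtx A) (f : List (Expr A)) : Prop :=
  Derivable Ax (.ctx X) ∧ Derivable Ax (.ctx Y) ∧ f.length = Y.length ∧
  ∀ i (hi : i < Y.length) (hif : i < f.length),
    Derivable Ax (.term X (f[i]'hif) (subPre Y f i hi))

/-- The morphism equality `f ≡ g : X → Y` is derivable. -/
def MorEq (Ax : Set (Judg A)) (X Y : PreCtx A) (f g : List (Expr A)) : Prop :=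
  IsMor Ax X Y f ∧ IsMor Ax X Y g ∧
  ∀ i (hi : i < Y.length) (hif : i < f.length) (hig : i < g.length),
    Derivable Ax (.termEq X (f[i]'hif) (g[i]'hig) (subPre Y f i hi))

/-- The context equality `X ≡ Y ctx` is derivable. -/
def CtxEq (Ax : Set (Judg A)) (X Y : PreCtx A) : Prop :=
  X.length = Y.length ∧ Derivable Ax (.ctx X) ∧ Derivable Ax (.ctx Y) ∧
  ∀ i (hX : i < X.length) (hY : i < Y.length),
    Derivable Ax (.sortEq (X.take i) (X[i]'hX).2
      (((Y[i]'hY).2).substL (mkSub (Y.take i) (ctxVars (X.take i)))))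

/-- Height of a context morphism. -/
noncomputable def htMor (Ax : Set (Judg A)) (X Y : PreCtx A) (f : List (Expr A)) : ℕ :=
  max (htCtx Ax X) (max (htCtx Ax Y)
    ((Finset.range Y.length).sup fun i =>
      if h : i < Y.length ∧ i < f.length then
        ht Ax (.term X (f[i]'h.2) (subPre Y f i h.1))
      else 0))

/-- Height of a morphism equality. -/
noncomputable def htMorEq (Ax : Set (Judg A)) (X Y : PreCtx A) (f g : List (Expr A)) : ℕ :=
  max (htMor Ax X Y f) (max (htMor Ax X Y g)
    ((Finset.range Y.length).sup fun i =>
      if h : i < Y.length ∧ i < f.length ∧ i < g.length then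
        ht Ax (.termEq X (f[i]'h.2.1) (g[i]'h.2.2) (subPre Y f i h.1))
      else 0))

/-- The composite `g ∘ f` of tuples of term expressions, where `f : X → Y` and
`g : Y → Z`: the `i`-th entry is `gᵢ[f]`. -/
noncomputable def compMor (Y : PreCtx A) (f g : List (Expr A)) : List (Expr A) :=
  g.map fun e => e.substL (mkSub Y f)

/-- The canonical sort `𝒮(u)` of a term in a context (as a relation). -/
inductive CanonSort (Ax : Set (Judg A)) (X : PreCtx A) : Expr A → SortE A → Prop where
  | var {i : ℕ} (hi : i < X.length) : CanonSort Ax X (.var (X[i]'hi).1) (X[i]'hi).2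
  | app {t : A.TermSym} {f : List (Expr A)} {Xa : PreCtx A} {V : SortE A}
      (hax : introTerm Xa t V ∈ Ax) :
      CanonSort Ax X (.app t f) (V.substL (mkSub Xa f))


/-! ## The tensor product of generalized algebraic theories (§2 of the paper) -/

/-- The tensor product of two sort-and-term alphabets. -/
abbrev Alphabet.tensor (A B : Alphabet) : Alphabet :=
  { Var := A.Var × B.Var
    SortSym := A.SortSym × B.SortSym
    TermSym := (A.SortSym × B.TermSym) ⊕ (A.TermSym × B.SortSym)
    var_infinite := inferInstance
    var_countable := inferInstance }

/-- An input for the tensor term operations `⊗_t`, `●_t`: a derivable term judgment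
`X ⊢ u : U` (notation `u^U`), or an augmented derivable sort judgment
`(X ⊢ U sort, x)` (notation `x^U`), represented with `tm = var x`. -/
structure TArg (A : Alphabet) : Type where
  ctx : PreCtx A
  tm : Expr A
  srt : SortE A

/-- `L` is the lexicographically ordered `m × n` grid whose `(i,j)` entry is `M i j`. -/
def IsGrid {γ : Type} (m n : ℕ) (M : ℕ → ℕ → γ) (L : List γ) : Prop :=
  L.length = m * n ∧
  ∀ i j (hi : i < m) (hj : j < n) (h : i * n + j < L.length), L[i * n + j]'h = M i j

/-- Substitution pairs `[g 1 | x y₁, …, g n | x yₙ]` where the `yⱼ` are the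
variables of `Y`. -/
def pairsR (x : A.Var) (Y : PreCtx B) (g : ℕ → Expr (A.tensor B)) :
    List ((A.tensor B).Var × Expr (A.tensor B)) :=
  (List.finRange Y.length).map fun j => ((x, (Y.get j).1), g j.1)

/-- Substitution pairs `[g 1 | x₁ y, …, g m | x_m y]` where the `xᵢ` are the
variables of `X`. -/
def pairsL (X : PreCtx A) (y : B.Var) (g : ℕ → Expr (A.tensor B)) :
    List ((A.tensor B).Var × Expr (A.tensor B)) :=
  (List.finRange X.length).map fun i => (((X.get i).1, y), g i.1)

variable {A B : Alphabet}

/-- The graph of the tensor term operation on pairs of (augmented sort / term)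
judgments: `TTg TA TB false a b e` means `e = a ⊗_t b` and
`TTg TA TB true a b e` means `e = a ⊗*_t b` (the variant of §8 in which the two
defining substitution formulas for non-variable terms are interchanged). -/
inductive TTg (TA : Set (Judg A)) (TB : Set (Judg B)) :
    Bool → TArg A → TArg B → Expr (A.tensor B) → Prop where
  | varvar {b : Bool} {X : PreCtx A} {U : SortE A} {x : A.Var}
      {Y : PreCtx B} {V : SortE B} {y : B.Var} :
      TTg TA TB b ⟨X, .var x, U⟩ ⟨Y, .var y, V⟩ (.var (x, y))
  | varapp {b : Bool} {X : PreCtx A} {x : A.Var} {S : A.SortSym} {ss : List (Expr A)}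
      {Y : PreCtx B} {t : B.TermSym} {ts : List (Expr B)} {V : SortE B}
      (SS : ℕ → SortE A) (TSf : ℕ → SortE B)
      (hSS : ∀ i (hi : i < ss.length), CanonSort TA X (ss[i]'hi) (SS i))
      (hTS : ∀ j (hj : j < ts.length), CanonSort TB Y (ts[j]'hj) (TSf j))
      (M : ℕ → ℕ → Expr (A.tensor B)) (out : List (Expr (A.tensor B)))
      (hM : ∀ i (hi : i < ss.length), ∀ j (hj : j < ts.length),
          TTg TA TB b ⟨X, ss[i]'hi, SS i⟩ ⟨Y, ts[j]'hj, TSf j⟩ (M i j))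
      (hMx : ∀ j (hj : j < ts.length),
          TTg TA TB b ⟨X, .var x, ⟨S, ss⟩⟩ ⟨Y, ts[j]'hj, TSf j⟩ (M ss.length j))
      (hout : IsGrid (ss.length + 1) ts.length M out) :
      TTg TA TB b ⟨X, .var x, ⟨S, ss⟩⟩ ⟨Y, .app t ts, V⟩ (.app (Sum.inl (S, t)) out)
  | appvar {b : Bool} {X : PreCtx A} {s : A.TermSym} {ss : List (Expr A)} {U : SortE A}
      {Y : PreCtx B} {y : B.Var} {T : B.SortSym} {ts : List (Expr B)}
      (SS : ℕ → SortE A) (TSf : ℕ → SortE B)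
      (hSS : ∀ i (hi : i < ss.length), CanonSort TA X (ss[i]'hi) (SS i))
      (hTS : ∀ j (hj : j < ts.length), CanonSort TB Y (ts[j]'hj) (TSf j))
      (M : ℕ → ℕ → Expr (A.tensor B)) (out : List (Expr (A.tensor B)))
      (hM : ∀ i (hi : i < ss.length), ∀ j (hj : j < ts.length),
          TTg TA TB b ⟨X, ss[i]'hi, SS i⟩ ⟨Y, ts[j]'hj, TSf j⟩ (M i j))
      (hMy : ∀ i (hi : i < ss.length),
          TTg TA TB b ⟨X, ss[i]'hi, SS i⟩ ⟨Y, .var y, ⟨T, ts⟩⟩ (M i ts.length))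
      (hout : IsGrid ss.length (ts.length + 1) M out) :
      TTg TA TB b ⟨X, .app s ss, U⟩ ⟨Y, .var y, ⟨T, ts⟩⟩ (.app (Sum.inr (s, T)) out)
  | appapp_base {X : PreCtx A} {s : A.TermSym} {ss : List (Expr A)} {U : SortE A}
      {Y : PreCtx B} {t : B.TermSym} {ts : List (Expr B)} {V : SortE B} {x : A.Var}
      (hx : ∀ p ∈ X, p.1 ≠ x)
      (e0 : Expr (A.tensor B))
      (h0 : TTg TA TB false ⟨X, .var x, U⟩ ⟨Y, .app t ts, V⟩ e0)
      (g : ℕ → Expr (A.tensor B))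
      (hg : ∀ j (hj : j < Y.length),
          TTg TA TB false ⟨X, .app s ss, U⟩
            ⟨Y.take j, .var (Y[j]'hj).1, (Y[j]'hj).2⟩ (g j)) :
      TTg TA TB false ⟨X, .app s ss, U⟩ ⟨Y, .app t ts, V⟩ (e0.substL (pairsR x Y g))
  | appapp_star {X : PreCtx A} {s : A.TermSym} {ss : List (Expr A)} {U : SortE A}
      {Y : PreCtx B} {t : B.TermSym} {ts : List (Expr B)} {V : SortE B} {y : B.Var}
      (hy : ∀ p ∈ Y, p.1 ≠ y)
      (e0 : Expr (A.tensor B))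
      (h0 : TTg TA TB true ⟨X, .app s ss, U⟩ ⟨Y, .var y, V⟩ e0)
      (g : ℕ → Expr (A.tensor B))
      (hg : ∀ i (hi : i < X.length),
          TTg TA TB true ⟨X.take i, .var (X[i]'hi).1, (X[i]'hi).2⟩
            ⟨Y, .app t ts, V⟩ (g i)) :
      TTg TA TB true ⟨X, .app s ss, U⟩ ⟨Y, .app t ts, V⟩ (e0.substL (pairsL X y g))

/-- The graph of the operation `●_t` (flag `false`), resp. of `●*_t` (flag `true`). -/
inductive TTd (TA : Set (Judg A)) (TB : Set (Judg B)) :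
    Bool → TArg A → TArg B → Expr (A.tensor B) → Prop where
  | varL {b : Bool} {X : PreCtx A} {x : A.Var} {U : SortE A} {bArg : TArg B}
      {e : Expr (A.tensor B)}
      (h : TTg TA TB b ⟨X, .var x, U⟩ bArg e) : TTd TA TB b ⟨X, .var x, U⟩ bArg e
  | varR {b : Bool} {aArg : TArg A} {Y : PreCtx B} {y : B.Var} {V : SortE B}
      {e : Expr (A.tensor B)}
      (h : TTg TA TB b aArg ⟨Y, .var y, V⟩ e) : TTd TA TB b aArg ⟨Y, .var y, V⟩ e
  | appapp_base {X : PreCtx A} {s : A.TermSym} {ss : List (Expr A)} {U : SortE A}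
      {Y : PreCtx B} {t : B.TermSym} {ts : List (Expr B)} {V : SortE B} {y : B.Var}
      (hy : ∀ p ∈ Y, p.1 ≠ y)
      (e0 : Expr (A.tensor B))
      (h0 : TTg TA TB false ⟨X, .app s ss, U⟩ ⟨Y, .var y, V⟩ e0)
      (g : ℕ → Expr (A.tensor B))
      (hg : ∀ i (hi : i < X.length),
          TTg TA TB false ⟨X.take i, .var (X[i]'hi).1, (X[i]'hi).2⟩
            ⟨Y, .app t ts, V⟩ (g i)) :
      TTd TA TB false ⟨X, .app s ss, U⟩ ⟨Y, .app t ts, V⟩ (e0.substL (pairsL X y g))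
  | appapp_star {X : PreCtx A} {s : A.TermSym} {ss : List (Expr A)} {U : SortE A}
      {Y : PreCtx B} {t : B.TermSym} {ts : List (Expr B)} {V : SortE B} {x : A.Var}
      (hx : ∀ p ∈ X, p.1 ≠ x)
      (e0 : Expr (A.tensor B))
      (h0 : TTg TA TB true ⟨X, .var x, U⟩ ⟨Y, .app t ts, V⟩ e0)
      (g : ℕ → Expr (A.tensor B))
      (hg : ∀ j (hj : j < Y.length),
          TTg TA TB true ⟨X, .app s ss, U⟩
            ⟨Y.take j, .var (Y[j]'hj).1, (Y[j]'hj).2⟩ (g j)) :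
      TTd TA TB true ⟨X, .app s ss, U⟩ ⟨Y, .app t ts, V⟩ (e0.substL (pairsR x Y g))

/-- The graph of the tensor sort operation `⊗_s` (resp. `⊗*_s` for flag `true`):
`TSo TA TB b X x U Y y V W` means `W = U^x ⊗ V^y`. -/
inductive TSo (TA : Set (Judg A)) (TB : Set (Judg B)) :
    Bool → PreCtx A → A.Var → SortE A → PreCtx B → B.Var → SortE B →
    SortE (A.tensor B) → Prop where
  | mk {b : Bool} {X : PreCtx A} {x : A.Var} {S : A.SortSym} {ss : List (Expr A)}
      {Y : PreCtx B} {y : B.Var} {T : B.SortSym} {ts : List (Expr B)}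
      (hx : ∀ p ∈ X, p.1 ≠ x) (hy : ∀ p ∈ Y, p.1 ≠ y)
      (SS : ℕ → SortE A) (TSf : ℕ → SortE B)
      (hSS : ∀ i (hi : i < ss.length), CanonSort TA X (ss[i]'hi) (SS i))
      (hTS : ∀ j (hj : j < ts.length), CanonSort TB Y (ts[j]'hj) (TSf j))
      (M : ℕ → ℕ → Expr (A.tensor B)) (out : List (Expr (A.tensor B)))
      (hM : ∀ i (hi : i < ss.length), ∀ j (hj : j < ts.length),
          TTg TA TB b ⟨X, ss[i]'hi, SS i⟩ ⟨Y, ts[j]'hj, TSf j⟩ (M i j))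
      (hMx : ∀ j (hj : j < ts.length),
          TTg TA TB b ⟨X, .var x, ⟨S, ss⟩⟩ ⟨Y, ts[j]'hj, TSf j⟩ (M ss.length j))
      (hMy : ∀ i (hi : i < ss.length),
          TTg TA TB b ⟨X, ss[i]'hi, SS i⟩ ⟨Y, .var y, ⟨T, ts⟩⟩ (M i ts.length))
      (hout : IsGrid (ss.length + 1) (ts.length + 1) M out) :
      TSo TA TB b X x ⟨S, ss⟩ Y y ⟨T, ts⟩ ⟨(S, T), out.dropLast⟩

/-- The tensor precontext `Z = X ⊗ Y`, with entries `xᵢyⱼ : Xᵢ ⊗ Yⱼ` ordered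
lexicographically. -/
def TCtx (TA : Set (Judg A)) (TB : Set (Judg B)) (b : Bool)
    (X : PreCtx A) (Y : PreCtx B) (Z : PreCtx (A.tensor B)) : Prop :=
  Z.length = X.length * Y.length ∧
  ∀ i j (hi : i < X.length) (hj : j < Y.length) (h : i * Y.length + j < Z.length),
    (Z[i * Y.length + j]'h).1 = ((X[i]'hi).1, (Y[j]'hj).1) ∧
    TSo TA TB b (X.take i) (X[i]'hi).1 (X[i]'hi).2
      (Y.take j) (Y[j]'hj).1 (Y[j]'hj).2 (Z[i * Y.length + j]'h).2

/-- The graph of the tensor operation `⊙` on pairs of judgments of the admissible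
kinds of Table 1 (flag `false`), resp. of the interchanged operation `⊙*` of §8
(flag `true`).  `chA` and `chB` are the functions choosing, for each context, a
variable not occurring in it. -/
inductive TJudg (TA : Set (Judg A)) (TB : Set (Judg B))
    (chA : PreCtx A → A.Var) (chB : PreCtx B → B.Var) :
    Bool → Judg A → Judg B → Judg (A.tensor B) → Prop where
  /- sort ⊙ sort -/
  | ss {b : Bool} {X : PreCtx A} {U : SortE A} {Y : PreCtx B} {V : SortE B}
      {Z : PreCtx (A.tensor B)} {W : SortE (A.tensor B)}
      (hZ : TCtx TA TB b (X ++ [(chA X, U)]) (Y ++ [(chB Y, V)]) Z)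
      (hW : TSo TA TB b X (chA X) U Y (chB Y) V W) :
      TJudg TA TB chA chB b (.sort X U) (.sort Y V) (.sort Z.dropLast W)
  /- sort ⊙ term -/
  | st {b : Bool} {X : PreCtx A} {U : SortE A} {Y : PreCtx B} {v : Expr B} {V : SortE B}
      {Z : PreCtx (A.tensor B)} {e : Expr (A.tensor B)} {W : SortE (A.tensor B)}
      {g : ℕ → Expr (A.tensor B)}
      (hZ : TCtx TA TB b (X ++ [(chA X, U)]) Y Z)
      (he : TTg TA TB b ⟨X, .var (chA X), U⟩ ⟨Y, v, V⟩ e)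
      (hW : TSo TA TB b X (chA X) U Y (chB Y) V W)
      (hg : ∀ i (hi : i < X.length),
          TTg TA TB b ⟨X.take i, .var (X[i]'hi).1, (X[i]'hi).2⟩ ⟨Y, v, V⟩ (g i)) :
      TJudg TA TB chA chB b (.sort X U) (.term Y v V)
        (.term Z e (W.substL (pairsL X (chB Y) g)))
  /- term ⊙ sort -/
  | ts {b : Bool} {X : PreCtx A} {u : Expr A} {U : SortE A} {Y : PreCtx B} {V : SortE B}
      {Z : PreCtx (A.tensor B)} {e : Expr (A.tensor B)} {W : SortE (A.tensor B)}
      {g : ℕ → Expr (A.tensor B)}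
      (hZ : TCtx TA TB b X (Y ++ [(chB Y, V)]) Z)
      (he : TTg TA TB b ⟨X, u, U⟩ ⟨Y, .var (chB Y), V⟩ e)
      (hW : TSo TA TB b X (chA X) U Y (chB Y) V W)
      (hg : ∀ j (hj : j < Y.length),
          TTg TA TB b ⟨X, u, U⟩ ⟨Y.take j, .var (Y[j]'hj).1, (Y[j]'hj).2⟩ (g j)) :
      TJudg TA TB chA chB b (.term X u U) (.sort Y V)
        (.term Z e (W.substL (pairsR (chA X) Y g)))
  /- term ⊙ term -/
  | tt {b : Bool} {X : PreCtx A} {u : Expr A} {U : SortE A}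
      {Y : PreCtx B} {v : Expr B} {V : SortE B}
      {Z : PreCtx (A.tensor B)} {e1 e2 : Expr (A.tensor B)} {W : SortE (A.tensor B)}
      {gx gy : ℕ → Expr (A.tensor B)}
      (hZ : TCtx TA TB b X Y Z)
      (he1 : TTg TA TB b ⟨X, u, U⟩ ⟨Y, v, V⟩ e1)
      (he2 : TTd TA TB b ⟨X, u, U⟩ ⟨Y, v, V⟩ e2)
      (hW : TSo TA TB b X (chA X) U Y (chB Y) V W)
      (hgx : ∀ i (hi : i < X.length),
          TTg TA TB b ⟨X.take i, .var (X[i]'hi).1, (X[i]'hi).2⟩ ⟨Y, v, V⟩ (gx i))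
      (hgy : ∀ j (hj : j < Y.length),
          TTg TA TB b ⟨X, u, U⟩ ⟨Y.take j, .var (Y[j]'hj).1, (Y[j]'hj).2⟩ (gy j)) :
      TJudg TA TB chA chB b (.term X u U) (.term Y v V)
        (.termEq Z e1 e2 (W.substL (pairsL X (chB Y) gx ++ pairsR (chA X) Y gy)))
  /- sort ⊙ sort equality -/
  | sseq {b : Bool} {X : PreCtx A} {U : SortE A} {Y : PreCtx B} {V V' : SortE B}
      {Z : PreCtx (A.tensor B)} {W W' : SortE (A.tensor B)}
      (hZ : TCtx TA TB b (X ++ [(chA X, U)]) (Y ++ [(chB Y, V)]) Z)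
      (hW : TSo TA TB b X (chA X) U Y (chB Y) V W)
      (hW' : TSo TA TB b X (chA X) U Y (chB Y) V' W') :
      TJudg TA TB chA chB b (.sort X U) (.sortEq Y V V') (.sortEq Z.dropLast W W')
  /- sort equality ⊙ sort -/
  | seqs {b : Bool} {X : PreCtx A} {U U' : SortE A} {Y : PreCtx B} {V : SortE B}
      {Z : PreCtx (A.tensor B)} {W W' : SortE (A.tensor B)}
      (hZ : TCtx TA TB b (X ++ [(chA X, U)]) (Y ++ [(chB Y, V)]) Z)
      (hW : TSo TA TB b X (chA X) U Y (chB Y) V W)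
      (hW' : TSo TA TB b X (chA X) U' Y (chB Y) V W') :
      TJudg TA TB chA chB b (.sortEq X U U') (.sort Y V) (.sortEq Z.dropLast W W')
  /- sort ⊙ term equality -/
  | steq {b : Bool} {X : PreCtx A} {U : SortE A} {Y : PreCtx B} {v v' : Expr B}
      {V : SortE B} {Z : PreCtx (A.tensor B)} {e e' : Expr (A.tensor B)}
      {W : SortE (A.tensor B)} {g : ℕ → Expr (A.tensor B)}
      (hZ : TCtx TA TB b (X ++ [(chA X, U)]) Y Z)
      (he : TTg TA TB b ⟨X, .var (chA X), U⟩ ⟨Y, v, V⟩ e)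
      (he' : TTg TA TB b ⟨X, .var (chA X), U⟩ ⟨Y, v', V⟩ e')
      (hW : TSo TA TB b X (chA X) U Y (chB Y) V W)
      (hg : ∀ i (hi : i < X.length),
          TTg TA TB b ⟨X.take i, .var (X[i]'hi).1, (X[i]'hi).2⟩ ⟨Y, v, V⟩ (g i)) :
      TJudg TA TB chA chB b (.sort X U) (.termEq Y v v' V)
        (.termEq Z e e' (W.substL (pairsL X (chB Y) g)))
  /- term equality ⊙ sort -/
  | teqs {b : Bool} {X : PreCtx A} {u u' : Expr A} {U : SortE A} {Y : PreCtx B}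
      {V : SortE B} {Z : PreCtx (A.tensor B)} {e e' : Expr (A.tensor B)}
      {W : SortE (A.tensor B)} {g : ℕ → Expr (A.tensor B)}
      (hZ : TCtx TA TB b X (Y ++ [(chB Y, V)]) Z)
      (he : TTg TA TB b ⟨X, u, U⟩ ⟨Y, .var (chB Y), V⟩ e)
      (he' : TTg TA TB b ⟨X, u', U⟩ ⟨Y, .var (chB Y), V⟩ e')
      (hW : TSo TA TB b X (chA X) U Y (chB Y) V W)
      (hg : ∀ j (hj : j < Y.length),
          TTg TA TB b ⟨X, u, U⟩ ⟨Y.take j, .var (Y[j]'hj).1, (Y[j]'hj).2⟩ (g j)) :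
      TJudg TA TB chA chB b (.termEq X u u' U) (.sort Y V)
        (.termEq Z e e' (W.substL (pairsR (chA X) Y g)))
  /- sort equality ⊙ term -/
  | seqt {b : Bool} {X : PreCtx A} {U U' : SortE A} {Y : PreCtx B} {v : Expr B}
      {V : SortE B} {Z : PreCtx (A.tensor B)} {e e' : Expr (A.tensor B)}
      {W : SortE (A.tensor B)} {g : ℕ → Expr (A.tensor B)}
      (hZ : TCtx TA TB b (X ++ [(chA X, U)]) Y Z)
      (he : TTg TA TB b ⟨X, .var (chA X), U⟩ ⟨Y, v, V⟩ e)
      (he' : TTg TA TB b ⟨X, .var (chA X), U'⟩ ⟨Y, v, V⟩ e')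
      (hW : TSo TA TB b X (chA X) U Y (chB Y) V W)
      (hg : ∀ i (hi : i < X.length),
          TTg TA TB b ⟨X.take i, .var (X[i]'hi).1, (X[i]'hi).2⟩ ⟨Y, v, V⟩ (g i)) :
      TJudg TA TB chA chB b (.sortEq X U U') (.term Y v V)
        (.termEq Z e e' (W.substL (pairsL X (chB Y) g)))
  /- term ⊙ sort equality -/
  | tseq {b : Bool} {X : PreCtx A} {u : Expr A} {U : SortE A} {Y : PreCtx B}
      {V V' : SortE B} {Z : PreCtx (A.tensor B)} {e e' : Expr (A.tensor B)}
      {W : SortE (A.tensor B)} {g : ℕ → Expr (A.tensor B)}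
      (hZ : TCtx TA TB b X (Y ++ [(chB Y, V)]) Z)
      (he : TTg TA TB b ⟨X, u, U⟩ ⟨Y, .var (chB Y), V⟩ e)
      (he' : TTg TA TB b ⟨X, u, U⟩ ⟨Y, .var (chB Y), V'⟩ e')
      (hW : TSo TA TB b X (chA X) U Y (chB Y) V W)
      (hg : ∀ j (hj : j < Y.length),
          TTg TA TB b ⟨X, u, U⟩ ⟨Y.take j, .var (Y[j]'hj).1, (Y[j]'hj).2⟩ (g j)) :
      TJudg TA TB chA chB b (.term X u U) (.sortEq Y V V')
        (.termEq Z e e' (W.substL (pairsR (chA X) Y g)))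

/-- A choice, for every precontext, of a variable not contained in it. -/
def FreshCh {A : Alphabet} (ch : PreCtx A → A.Var) : Prop :=
  ∀ X : PreCtx A, ∀ p ∈ X, p.1 ≠ ch X

/-- The set of axioms of the pretheory `𝔸 ⊗ 𝔹`: the judgments `J ⊙ J'` for `J` an
axiom of `𝔸` and `J'` an axiom of `𝔹`. -/
def tensorAx (TA : Set (Judg A)) (TB : Set (Judg B))
    (chA : PreCtx A → A.Var) (chB : PreCtx B → B.Var) : Set (Judg (A.tensor B)) :=
  {K | ∃ J J', J ∈ TA ∧ J' ∈ TB ∧ TJudg TA TB chA chB false J J' K}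

/-- The pair `(𝔸, 𝔹)` is `h`-derivable: `J ⊙ J'` is derivable in the pretheory
`𝔸 ⊗ 𝔹` whenever `J`, `J'` are derivable judgments of `𝔸`, `𝔹` (of admissible
kinds) with `ht J * ht J' ≤ h`. -/
def hDerivable (TA : Set (Judg A)) (TB : Set (Judg B))
    (chA : PreCtx A → A.Var) (chB : PreCtx B → B.Var) (h : ℕ) : Prop :=
  ∀ (J : Judg A) (J' : Judg B) (K : Judg (A.tensor B)),
    Derivable TA J → Derivable TB J' → ht TA J * ht TB J' ≤ h →
    TJudg TA TB chA chB false J J' K → Derivable (tensorAx TA TB chA chB) K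

/-- The tensor `out = f ⊗ g` of two tuples of derivable terms, each entry being
the tensor of terms taken at their canonical sorts, ordered lexicographically. -/
def TMor (TA : Set (Judg A)) (TB : Set (Judg B)) (b : Bool)
    (X : PreCtx A) (f : List (Expr A)) (Y : PreCtx B) (g : List (Expr B))
    (out : List (Expr (A.tensor B))) : Prop :=
  out.length = f.length * g.length ∧
  ∀ i j (hi : i < f.length) (hj : j < g.length) (h : i * g.length + j < out.length),
    ∃ U V, CanonSort TA X (f[i]'hi) U ∧ CanonSort TB Y (g[j]'hj) V ∧
      TTg TA TB b ⟨X, f[i]'hi, U⟩ ⟨Y, g[j]'hj, V⟩ (out[i * g.length + j]'h)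

/-- The tensor `out = f ⊗ Y` of a tuple of derivable terms of `𝔸` with a context
of `𝔹`: entries `fᵢ^{𝒮(fᵢ)} ⊗ yⱼ^{Yⱼ}`. -/
def TMorCtx (TA : Set (Judg A)) (TB : Set (Judg B)) (b : Bool)
    (X : PreCtx A) (f : List (Expr A)) (Y : PreCtx B)
    (out : List (Expr (A.tensor B))) : Prop :=
  out.length = f.length * Y.length ∧
  ∀ i j (hi : i < f.length) (hj : j < Y.length) (h : i * Y.length + j < out.length),
    ∃ U, CanonSort TA X (f[i]'hi) U ∧
      TTg TA TB b ⟨X, f[i]'hi, U⟩ ⟨Y.take j, .var (Y[j]'hj).1, (Y[j]'hj).2⟩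
        (out[i * Y.length + j]'h)

/-- The tensor `out = X ⊗ g` of a context of `𝔸` with a tuple of derivable terms
of `𝔹`: entries `xᵢ^{Xᵢ} ⊗ gⱼ^{𝒮(gⱼ)}`. -/
def TCtxMor (TA : Set (Judg A)) (TB : Set (Judg B)) (b : Bool)
    (X : PreCtx A) (Y : PreCtx B) (g : List (Expr B))
    (out : List (Expr (A.tensor B))) : Prop :=
  out.length = X.length * g.length ∧
  ∀ i j (hi : i < X.length) (hj : j < g.length) (h : i * g.length + j < out.length),
    ∃ V, CanonSort TB Y (g[j]'hj) V ∧
      TTg TA TB b ⟨X.take i, .var (X[i]'hi).1, (X[i]'hi).2⟩ ⟨Y, g[j]'hj, V⟩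
        (out[i * g.length + j]'h)

/-- The tensor `out = (x₁,…,x_m,u^U) ⊗ Y` of the section determined by a term
`X ⊢ u : U` with a context of `𝔹`. -/
def TSecL (TA : Set (Judg A)) (TB : Set (Judg B)) (b : Bool)
    (X : PreCtx A) (u : Expr A) (U : SortE A) (Y : PreCtx B)
    (out : List (Expr (A.tensor B))) : Prop :=
  out.length = (X.length + 1) * Y.length ∧
  (∀ i j (hi : i < X.length) (hj : j < Y.length) (h : i * Y.length + j < out.length),
      TTg TA TB b ⟨X.take i, .var (X[i]'hi).1, (X[i]'hi).2⟩
        ⟨Y.take j, .var (Y[j]'hj).1, (Y[j]'hj).2⟩ (out[i * Y.length + j]'h)) ∧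
  (∀ j (hj : j < Y.length) (h : X.length * Y.length + j < out.length),
      TTg TA TB b ⟨X, u, U⟩ ⟨Y.take j, .var (Y[j]'hj).1, (Y[j]'hj).2⟩
        (out[X.length * Y.length + j]'h))

/-- The tensor `out = X ⊗ (y₁,…,yₙ,v^V)` of a context of `𝔸` with the section
determined by a term `Y ⊢ v : V` of `𝔹`. -/
def TSecR (TA : Set (Judg A)) (TB : Set (Judg B)) (b : Bool)
    (X : PreCtx A) (Y : PreCtx B) (v : Expr B) (V : SortE B)
    (out : List (Expr (A.tensor B))) : Prop :=
  out.length = X.length * (Y.length + 1) ∧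
  (∀ i j (hi : i < X.length) (hj : j < Y.length)
      (h : i * (Y.length + 1) + j < out.length),
      TTg TA TB b ⟨X.take i, .var (X[i]'hi).1, (X[i]'hi).2⟩
        ⟨Y.take j, .var (Y[j]'hj).1, (Y[j]'hj).2⟩ (out[i * (Y.length + 1) + j]'h)) ∧
  (∀ i (hi : i < X.length) (h : i * (Y.length + 1) + Y.length < out.length),
      TTg TA TB b ⟨X.take i, .var (X[i]'hi).1, (X[i]'hi).2⟩ ⟨Y, v, V⟩
        (out[i * (Y.length + 1) + Y.length]'h))


end GATPaper

set_option linter.unusedVariables false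

namespace GATPaper

open List (getElem_mem mem_append mem_append_left mem_append_right mem_map mem_map_of_mem
  map_congr_left getElem_append_left mem_iff_getElem map_map take_succ_eq_append_getElem
  take_subset mem_singleton map_append mem_take_iff_getElem)

/-- Derivability with substitutions given by functions on variables. -/
inductive Der {A : Alphabet} (Ax : Set (Judg A)) : Judg A → Prop where
  | nil : Der Ax (.ctx [])
  | cons {X U x} (h : Der Ax (.sort X U)) (hx : ∀ p ∈ X, p.1 ≠ x) : Der Ax (.ctx (X ++ [(x, U)]))
  | s1 {X U} (h : Der Ax (.sort X U)) : Der Ax (.sortEq X U U)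
  | s2 {X U V} (h : Der Ax (.sortEq X U V)) : Der Ax (.sortEq X V U)
  | s3 {X U V W}
      (h1 : Der Ax (.sortEq X U V)) (h2 : Der Ax (.sortEq X V W)) : Der Ax (.sortEq X U W)
  | t1 {X u U} (h : Der Ax (.term X u U)) : Der Ax (.termEq X u u U)
  | t2 {X u v U} (h : Der Ax (.termEq X u v U)) : Der Ax (.termEq X v u U)
  | t3 {X u v w U}
      (h1 : Der Ax (.termEq X u v U)) (h2 : Der Ax (.termEq X v w U)) : Der Ax (.termEq X u w U)
  | seqt {X U U' u}
      (h1 : Der Ax (.sortEq X U U')) (h2 : Der Ax (.term X u U)) : Der Ax (.term X u U')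
  | seqteq {X U U' u u'}
      (h1 : Der Ax (.sortEq X U U')) (h2 : Der Ax (.termEq X u u' U)) : Der Ax (.termEq X u u' U')
  | var {X x U} (hx : (x, U) ∈ X) (h : Der Ax (.sort X U)) : Der Ax (.term X (.var x) U)
  | sApp {X S} (hax : introSort X S ∈ Ax) (hJ : Der Ax (.ctx X))
      (hv : ∀ p ∈ X, Der Ax (.term X (.var p.1) p.2)) {Y} (hY : Der Ax (.ctx Y)) {σ}
      (hσ : ∀ p ∈ X, Der Ax (.term Y (σ p.1) (p.2.subst σ))) :
      Der Ax (.sort Y (SortE.subst σ ⟨S, ctxVars X⟩))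
  | tApp {X t U} (hax : introTerm X t U ∈ Ax) (hJ : Der Ax (.sort X U))
      (hv : ∀ p ∈ X, Der Ax (.term X (.var p.1) p.2)) {Y σ}
      (hU : Der Ax (.sort Y (U.subst σ))) (hσ : ∀ p ∈ X, Der Ax (.term Y (σ p.1) (p.2.subst σ))) :
      Der Ax (.term Y (Expr.subst σ (.app t (ctxVars X))) (U.subst σ))
  | sEq {X U U'} (hax : Judg.sortEq X U U' ∈ Ax)
      (hJ : Der Ax (.sort X U)) (hJ' : Der Ax (.sort X U'))
      (hv : ∀ p ∈ X, Der Ax (.term X (.var p.1) p.2)) {Y σ}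
      (h1 : Der Ax (.sort Y (U.subst σ))) (h2 : Der Ax (.sort Y (U'.subst σ)))
      (hσ : ∀ p ∈ X, Der Ax (.term Y (σ p.1) (p.2.subst σ))) :
      Der Ax (.sortEq Y (U.subst σ) (U'.subst σ))
  | tEq {X u u' U} (hax : Judg.termEq X u u' U ∈ Ax)
      (hJ : Der Ax (.term X u U)) (hJ' : Der Ax (.term X u' U))
      (hv : ∀ p ∈ X, Der Ax (.term X (.var p.1) p.2)) {Y σ}
      (h1 : Der Ax (.term Y (u.subst σ) (U.subst σ)))
      (h2 : Der Ax (.term Y (u'.subst σ) (U.subst σ)))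
      (hσ : ∀ p ∈ X, Der Ax (.term Y (σ p.1) (p.2.subst σ))) :
      Der Ax (.termEq Y (u.subst σ) (u'.subst σ) (U.subst σ))
  | sCong {X S} (hax : introSort X S ∈ Ax) (hJ : Der Ax (.ctx X))
      (hv : ∀ p ∈ X, Der Ax (.term X (.var p.1) p.2)) {Y σ τ}
      (h1 : Der Ax (.sort Y (SortE.subst σ ⟨S, ctxVars X⟩)))
      (h2 : Der Ax (.sort Y (SortE.subst τ ⟨S, ctxVars X⟩)))
      (hσ : ∀ p ∈ X, Der Ax (.termEq Y (σ p.1) (τ p.1) (p.2.subst σ))) :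
      Der Ax (.sortEq Y (SortE.subst σ ⟨S, ctxVars X⟩) (SortE.subst τ ⟨S, ctxVars X⟩))
  | tCong {X t U} (hax : introTerm X t U ∈ Ax) (hJ : Der Ax (.sort X U))
      (hv : ∀ p ∈ X, Der Ax (.term X (.var p.1) p.2)) {Y σ τ}
      (h1 : Der Ax (.term Y (Expr.subst σ (.app t (ctxVars X))) (U.subst σ)))
      (h2 : Der Ax (.term Y (Expr.subst τ (.app t (ctxVars X))) (U.subst σ)))
      (hσ : ∀ p ∈ X, Der Ax (.termEq Y (σ p.1) (τ p.1) (p.2.subst σ))) :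
      Der Ax (.termEq Y (Expr.subst σ (.app t (ctxVars X))) (Expr.subst τ (.app t (ctxVars X)))
        (U.subst σ))

/-- One application of an inference rule with premises in `D`. -/
inductive LStep {A : Alphabet} (Ax : Set (Judg A)) (D : Judg A → Prop) : Judg A → Prop where
  | nil : LStep Ax D (.ctx [])
  | cons {X x U} (h : D (.sort X U)) (hx : ∀ p ∈ X, p.1 ≠ x) : LStep Ax D (.ctx (X ++ [(x, U)]))
  | s1 {X U} (h : D (.sort X U)) : LStep Ax D (.sortEq X U U)
  | s2 {X U V} (h : D (.sortEq X U V)) : LStep Ax D (.sortEq X V U)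
  | s3 {X U V W} (h1 : D (.sortEq X U V)) (h2 : D (.sortEq X V W)) : LStep Ax D (.sortEq X U W)
  | t1 {X u U} (h : D (.term X u U)) : LStep Ax D (.termEq X u u U)
  | t2 {X u v U} (h : D (.termEq X u v U)) : LStep Ax D (.termEq X v u U)
  | t3 {X u v w U}
      (h1 : D (.termEq X u v U)) (h2 : D (.termEq X v w U)) : LStep Ax D (.termEq X u w U)
  | seqt {X U U' u} (h1 : D (.sortEq X U U')) (h2 : D (.term X u U)) : LStep Ax D (.term X u U')
  | seqteq {X U U' u u'}
      (h1 : D (.sortEq X U U')) (h2 : D (.termEq X u u' U)) : LStep Ax D (.termEq X u u' U')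
  | var {X x U} (hx : (x, U) ∈ X) (h : D (.sort X U)) : LStep Ax D (.term X (.var x) U)
  | sApp {X S} (hax : introSort X S ∈ Ax) (hJ : D (.ctx X))
      (hv : ∀ p ∈ X, D (.term X (.var p.1) p.2)) {Y} (hY : D (.ctx Y)) {σ}
      (hσ : ∀ p ∈ X, D (.term Y (σ p.1) (p.2.subst σ))) :
      LStep Ax D (.sort Y (SortE.subst σ ⟨S, ctxVars X⟩))
  | tApp {X t U} (hax : introTerm X t U ∈ Ax) (hJ : D (.sort X U))
      (hv : ∀ p ∈ X, D (.term X (.var p.1) p.2)) {Y σ} (hU : D (.sort Y (U.subst σ)))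
      (hσ : ∀ p ∈ X, D (.term Y (σ p.1) (p.2.subst σ))) :
      LStep Ax D (.term Y (Expr.subst σ (.app t (ctxVars X))) (U.subst σ))
  | sEq {X U U'} (hax : Judg.sortEq X U U' ∈ Ax) (hJ : D (.sort X U)) (hJ' : D (.sort X U'))
      (hv : ∀ p ∈ X, D (.term X (.var p.1) p.2)) {Y σ}
      (h1 : D (.sort Y (U.subst σ))) (h2 : D (.sort Y (U'.subst σ)))
      (hσ : ∀ p ∈ X, D (.term Y (σ p.1) (p.2.subst σ))) :
      LStep Ax D (.sortEq Y (U.subst σ) (U'.subst σ))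
  | tEq {X u u' U} (hax : Judg.termEq X u u' U ∈ Ax)
      (hJ : D (.term X u U)) (hJ' : D (.term X u' U))
      (hv : ∀ p ∈ X, D (.term X (.var p.1) p.2)) {Y σ}
      (h1 : D (.term Y (u.subst σ) (U.subst σ))) (h2 : D (.term Y (u'.subst σ) (U.subst σ)))
      (hσ : ∀ p ∈ X, D (.term Y (σ p.1) (p.2.subst σ))) :
      LStep Ax D (.termEq Y (u.subst σ) (u'.subst σ) (U.subst σ))
  | sCong {X S} (hax : introSort X S ∈ Ax) (hJ : D (.ctx X))
      (hv : ∀ p ∈ X, D (.term X (.var p.1) p.2)) {Y σ τ}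
      (h1 : D (.sort Y (SortE.subst σ ⟨S, ctxVars X⟩)))
      (h2 : D (.sort Y (SortE.subst τ ⟨S, ctxVars X⟩)))
      (hσ : ∀ p ∈ X, D (.termEq Y (σ p.1) (τ p.1) (p.2.subst σ))) :
      LStep Ax D (.sortEq Y (SortE.subst σ ⟨S, ctxVars X⟩) (SortE.subst τ ⟨S, ctxVars X⟩))
  | tCong {X t U} (hax : introTerm X t U ∈ Ax) (hJ : D (.sort X U))
      (hv : ∀ p ∈ X, D (.term X (.var p.1) p.2)) {Y σ τ}
      (h1 : D (.term Y (Expr.subst σ (.app t (ctxVars X))) (U.subst σ)))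
      (h2 : D (.term Y (Expr.subst τ (.app t (ctxVars X))) (U.subst σ)))
      (hσ : ∀ p ∈ X, D (.termEq Y (σ p.1) (τ p.1) (p.2.subst σ))) :
      LStep Ax D (.termEq Y (Expr.subst σ (.app t (ctxVars X))) (Expr.subst τ (.app t (ctxVars X)))
        (U.subst σ))

section
variable {A : Alphabet} {Ax : Set (Judg A)} {X Y X1 Γ : PreCtx A} {U U' : SortE A}
  {u u' : Expr A} {x : A.Var} {σ τ : A.Var → Expr A}

/-! ### Expressions and substitution -/

theorem Expr.ind {P : Expr A → Prop} (hv : ∀ x, P (.var x))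
    (ha : ∀ t es, (∀ e ∈ es, P e) → P (.app t es)) : ∀ e, P e
  | .var x => hv x
  | .app t es => ha t es fun e he => Expr.ind hv ha e
termination_by e => sizeOf e
decreasing_by
  have := List.sizeOf_lt_of_mem he
  simp only [Expr.app.sizeOf_spec]
  omega

@[simp] theorem Expr.subst_var (σ : A.Var → Expr A) (x) : (Expr.var x).subst σ = σ x := by
  rw [Expr.subst]

@[simp] theorem Expr.subst_app (σ : A.Var → Expr A) (t es) :
    (Expr.app t es).subst σ = .app t (es.map (Expr.subst σ)) := by
  rw [Expr.subst]
  simp only [List.map_attach_eq_pmap, List.pmap_eq_map]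

@[simp] theorem SortE.subst_args (σ : A.Var → Expr A) (U : SortE A) :
    (U.subst σ).args = U.args.map (Expr.subst σ) := rfl

@[simp] theorem occurs_var_iff {y : A.Var} : Occurs x (.var y) ↔ x = y :=
  ⟨fun h => by cases h; rfl, fun h => h ▸ .var⟩

@[simp] theorem occurs_app_iff {t es} :
    Occurs x (.app t es) ↔ ∃ e ∈ es, Occurs x e :=
  ⟨fun h => by cases h with | app h1 h2 => exact ⟨_, h1, h2⟩, fun ⟨_, h1, h2⟩ => .app h1 h2⟩

theorem Expr.subst_congr :
    ∀ e : Expr A, (∀ x, Occurs x e → σ x = τ x) → e.subst σ = e.subst τ := by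
  apply Expr.ind
  · intro x h
    simpa using h x .var
  · intro t es ih h
    simp only [Expr.subst_app, Expr.app.injEq, true_and]
    exact map_congr_left fun e he => ih e he fun x hx => h x (.app he hx)

theorem SortE.subst_congr (U : SortE A) (h : ∀ x, SOccurs x U → σ x = τ x) :
    U.subst σ = U.subst τ := by
  simp only [SortE.subst, SortE.mk.injEq, true_and]
  exact map_congr_left fun e he => Expr.subst_congr e fun x hx => h x ⟨e, he, hx⟩

theorem Expr.subst_subst (σ τ : A.Var → Expr A) :
    ∀ e : Expr A, (e.subst σ).subst τ = e.subst fun x => (σ x).subst τ := by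
  apply Expr.ind
  · intro x; simp
  · intro t es ih
    simp only [Expr.subst_app, map_map, Expr.app.injEq, true_and]
    exact map_congr_left fun e he => ih e he

theorem SortE.subst_subst (σ τ : A.Var → Expr A) (U : SortE A) :
    (U.subst σ).subst τ = U.subst fun x => (σ x).subst τ := by
  simp only [SortE.subst, map_map, SortE.mk.injEq, true_and]
  exact map_congr_left fun e _ => Expr.subst_subst σ τ e

@[simp] theorem Expr.subst_id : ∀ e : Expr A, e.subst Expr.var = e := by
  apply Expr.ind
  · intro x; simp
  · intro t es ih
    simp only [Expr.subst_app, Expr.app.injEq, true_and]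
    conv_rhs => rw [← List.map_id es]
    exact map_congr_left fun e he => ih e he

@[simp] theorem SortE.subst_id (U : SortE A) : U.subst Expr.var = U := by
  cases U with
  | mk S es =>
    simp only [SortE.subst, SortE.mk.injEq, true_and]
    conv_rhs => rw [← List.map_id es]
    exact map_congr_left fun e _ => Expr.subst_id e

@[simp] theorem map_subst_ctxVars (σ : A.Var → Expr A) (X : PreCtx A) :
    (ctxVars X).map (Expr.subst σ) = X.map fun p => σ p.1 := by
  simp [ctxVars]

/-- The substitution sending the variables of `X` to the entries of `f`. -/
noncomputable abbrev sb (X : PreCtx A) (f : List (Expr A)) : A.Var → Expr A := lookupV (mkSub X f)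

theorem lookupV_map_var (l : List A.Var) (σ : A.Var → Expr A) (hx : x ∈ l) :
    lookupV (l.map fun y => (y, σ y)) x = σ x := by
  induction l with
  | nil => simp at hx
  | cons y l ih =>
    simp only [List.map_cons, lookupV]
    split
    · next h => rw [h]
    · next h =>
      apply ih
      simpa [Ne.symm h] using hx

theorem lookupV_of_not_mem (l : List (A.Var × Expr A)) (hx : ∀ p ∈ l, p.1 ≠ x) :
    lookupV l x = .var x := by
  induction l with
  | nil => rfl
  | cons p l ih =>
    simp only [lookupV, if_neg (hx p (by simp))]
    exact ih fun q hq => hx q (by simp [hq])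

theorem sb_map (X : PreCtx A) (σ : A.Var → Expr A) (hx : x ∈ X.map Prod.fst) :
    sb X (X.map fun p => σ p.1) x = σ x := by
  have : mkSub X (X.map fun p => σ p.1) = (X.map Prod.fst).map fun y => (y, σ y) := by
    rw [mkSub, List.zip_map', map_map]; rfl
  rw [sb, this, lookupV_map_var _ _ hx]

theorem map_sb (X : PreCtx A) (hX : (X.map Prod.fst).Nodup) (f : List (Expr A))
    (hf : f.length = X.length) : (X.map fun p => sb X f p.1) = f := by
  induction X generalizing f with
  | nil => simp at hf; simp [hf]
  | cons p X ih =>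
    cases f with
    | nil => simp at hf
    | cons a f =>
      simp only [List.map_cons, List.nodup_cons] at hX
      simp only [List.map_cons, sb, mkSub, List.zip_cons_cons, lookupV, if_true, List.cons.injEq,
        true_and]
      refine Eq.trans (map_congr_left fun q hq => ?_) (ih hX.2 f (by simpa using hf))
      rw [if_neg (fun h : p.1 = q.1 => hX.1 (h ▸ mem_map_of_mem hq))]
      rfl

/-- All variables of a sort expression belong to the context. -/
def SScoped (X : PreCtx A) (U : SortE A) : Prop := ∀ v, SOccurs v U → v ∈ X.map Prod.fst

/-- All variables of a term expression belong to the context. -/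
def EScoped (X : PreCtx A) (u : Expr A) : Prop := ∀ v, Occurs v u → v ∈ X.map Prod.fst

/-- Scoped contexts with distinct variables. -/
def CtxOK (X : PreCtx A) : Prop := IsPreCtx X ∧ (X.map Prod.fst).Nodup

theorem CtxOK.scoped (h : CtxOK X) {p} (hp : p ∈ X) : SScoped X p.2 := by
  obtain ⟨i, hi, rfl⟩ := mem_iff_getElem.1 hp
  intro v hv
  have := h.1 i hi v hv
  rw [List.map_take] at this
  exact List.mem_of_mem_take this

theorem CtxOK.snoc (h : CtxOK X) (hU : SScoped X U) (hx : ∀ p ∈ X, p.1 ≠ x) :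
    CtxOK (X ++ [(x, U)]) := by
  constructor
  · intro i hi v hv
    by_cases hlt : i < X.length
    · rw [getElem_append_left hlt] at hv
      have := h.1 i hlt v hv
      rwa [List.take_append_of_le_length hlt.le]
    · have : i = X.length := by simp at hi; omega
      subst this
      simp at hv
      simpa using hU v hv
  · rw [map_append, List.nodup_append]
    refine ⟨h.2, by simp, ?_⟩
    intro a ha b hb
    simp at hb
    obtain ⟨p, hp, rfl⟩ := mem_map.1 ha
    rw [hb]
    exact hx p hp

theorem subPre_eq (h : CtxOK X) (f : List (Expr A)) (hf : f.length = X.length) (i : ℕ)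
    (hi : i < X.length) : subPre X f i hi = (X[i].2).subst (sb X f) := by
  apply SortE.subst_congr
  intro v hv
  have hm := h.1 i hi v hv
  have e : mkSub X f = mkSub (X.take i) (f.take i) ++ mkSub (X.drop i) (f.drop i) := by
    simp only [mkSub]
    rw [← List.zip_append (by simp [hf]), ← map_append, List.take_append_drop,
      List.take_append_drop]
  rw [sb, e]
  have key : ∀ (l m : List (A.Var × Expr A)), v ∈ l.map Prod.fst →
      lookupV l v = lookupV (l ++ m) v := by
    intro l m hl
    induction l with
    | nil => simp at hl
    | cons p l ih =>
      simp only [List.cons_append, lookupV]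
      split
      · rfl
      · next h' =>
        apply ih
        simpa [Ne.symm h'] using hl
  apply key
  rw [mkSub, List.map_fst_zip]
  · exact hm
  · simp [hf]

/-! ### Derivability -/

theorem Step.mono {D D' : Judg A → Prop} (h : ∀ J, D J → D' J) {J} (s : Step Ax D J) :
    Step Ax D' J := by
  cases s with
  | ctx_nil => exact .ctx_nil
  | ctx_cons hs h1 h2 => exact .ctx_cons (h _ hs) h1 h2
  | s1 h1 => exact .s1 (h _ h1)
  | s2 h1 => exact .s2 (h _ h1)
  | s3 h1 h2 => exact .s3 (h _ h1) (h _ h2)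
  | t1 h1 => exact .t1 (h _ h1)
  | t2 h1 => exact .t2 (h _ h1)
  | t3 h1 h2 => exact .t3 (h _ h1) (h _ h2)
  | seqt h1 h2 => exact .seqt (h _ h1) (h _ h2)
  | seqteq h1 h2 h3 h4 => exact .seqteq (h _ h1) (h _ h2) (h _ h3) (h _ h4)
  | var hi h1 => exact .var hi (h _ h1)
  | sA hax h1 hv => exact .sA hax (h _ h1) fun i hi => h _ (hv i hi)
  | tA hax h1 hv => exact .tA hax (h _ h1) fun i hi => h _ (hv i hi)
  | seqA hax h1 h2 => exact .seqA hax (h _ h1) (h _ h2)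
  | teqA hax h1 h2 => exact .teqA hax (h _ h1) (h _ h2)
  | sSub hax hY hl hJ hc hv => exact .sSub hax hY hl (h _ hJ) (h _ hc) fun i a b => h _ (hv i a b)
  | tSub hax hY hl hJ hc hv => exact .tSub hax hY hl (h _ hJ) (h _ hc) fun i a b => h _ (hv i a b)
  | seqSub1 hax hY hl hJ h1 h2 hv =>
    exact .seqSub1 hax hY hl (h _ hJ) (h _ h1) (h _ h2) fun i a b => h _ (hv i a b)
  | seqSub2 hax hY hl hl' hJ h1 h2 hv =>
    exact .seqSub2 hax hY hl hl' (h _ hJ) (h _ h1) (h _ h2) fun i a b c => h _ (hv i a b c)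
  | teqSub1 hax hY hl hJ h1 h2 hv =>
    exact .teqSub1 hax hY hl (h _ hJ) (h _ h1) (h _ h2) fun i a b => h _ (hv i a b)
  | teqSub2 hax hY hl hl' hJ h1 h2 hv =>
    exact .teqSub2 hax hY hl hl' (h _ hJ) (h _ h1) (h _ h2) fun i a b c => h _ (hv i a b c)

theorem DerAt.succ {n J} (h : DerAt Ax n J) : DerAt Ax (n + 1) J := Or.inl h

theorem DerAt.mono {n m J} (h : DerAt Ax n J) (hnm : n ≤ m) : DerAt Ax m J := by
  induction hnm with
  | refl => exact h
  | step _ ih => exact ih.succ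

theorem derivable_ind {P : Judg A → Prop}
    (h : ∀ J, Step Ax (fun J => Derivable Ax J ∧ P J) J → P J) {J} (hJ : Derivable Ax J) :
    P J := by
  obtain ⟨n, hn⟩ := hJ
  induction n generalizing J with
  | zero => exact hn.elim
  | succ n ih =>
    rcases hn with hn | hn
    · exact ih hn
    · exact h _ (hn.mono fun J hJ => ⟨⟨n, hJ⟩, ih hJ⟩)

theorem Derivable.of_step {J} (s : Step Ax (Derivable Ax) J) : Derivable Ax J := by
  have ex : ∀ {J}, Derivable Ax J → ∀ᶠ n in Filter.atTop, DerAt Ax n J := fun ⟨n, h⟩ =>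
    Filter.eventually_atTop.2 ⟨n, fun M hM => h.mono hM⟩
  have all : ∀ {m} {F : ∀ i, i < m → Judg A}, (∀ i (hi : i < m), Derivable Ax (F i hi)) →
      ∀ᶠ n in Filter.atTop, ∀ i (hi : i < m), DerAt Ax n (F i hi) := fun {m F} h =>
    (Filter.eventually_all.2 fun i : Fin m => ex (h i i.2)).mono fun n h i hi => h ⟨i, hi⟩
  suffices h : ∀ᶠ n in Filter.atTop, Step Ax (DerAt Ax n) J from
    h.exists.elim fun n hn => ⟨n + 1, .inr hn⟩
  cases s with
  | ctx_nil => exact .of_forall fun _ => .ctx_nil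
  | ctx_cons hs h1 h2 => exact (ex hs).mono fun _ h => .ctx_cons h h1 h2
  | s1 h => exact (ex h).mono fun _ h => .s1 h
  | s2 h => exact (ex h).mono fun _ h => .s2 h
  | s3 h h' => exact (ex h).mp ((ex h').mono fun _ h' h => .s3 h h')
  | t1 h => exact (ex h).mono fun _ h => .t1 h
  | t2 h => exact (ex h).mono fun _ h => .t2 h
  | t3 h h' => exact (ex h).mp ((ex h').mono fun _ h' h => .t3 h h')
  | seqt h h' => exact (ex h).mp ((ex h').mono fun _ h' h => .seqt h h')
  | seqteq h1 h2 h3 h4 =>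
    filter_upwards [ex h1, ex h2, ex h3, ex h4] with _ h1 h2 h3 h4 using .seqteq h1 h2 h3 h4
  | var hi h => exact (ex h).mono fun _ h => .var hi h
  | sA hax h hv => exact (ex h).mp ((all hv).mono fun _ hv h => .sA hax h hv)
  | tA hax h hv => exact (ex h).mp ((all hv).mono fun _ hv h => .tA hax h hv)
  | seqA hax h h' => exact (ex h).mp ((ex h').mono fun _ h' h => .seqA hax h h')
  | teqA hax h h' => exact (ex h).mp ((ex h').mono fun _ h' h => .teqA hax h h')
  | sSub hax hY hl h1 h2 hv =>
    filter_upwards [ex h1, ex h2, all fun i hi => hv i hi (by omega)] with _ h1 h2 hv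
      using .sSub hax hY hl h1 h2 fun i hi _ => hv i hi
  | tSub hax hY hl h1 h2 hv =>
    filter_upwards [ex h1, ex h2, all fun i hi => hv i hi (by omega)] with _ h1 h2 hv
      using .tSub hax hY hl h1 h2 fun i hi _ => hv i hi
  | seqSub1 hax hY hl h1 h2 h3 hv =>
    filter_upwards [ex h1, ex h2, ex h3, all fun i hi => hv i hi (by omega)] with _ h1 h2 h3 hv
      using .seqSub1 hax hY hl h1 h2 h3 fun i hi _ => hv i hi
  | teqSub1 hax hY hl h1 h2 h3 hv =>
    filter_upwards [ex h1, ex h2, ex h3, all fun i hi => hv i hi (by omega)] with _ h1 h2 h3 hv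
      using .teqSub1 hax hY hl h1 h2 h3 fun i hi _ => hv i hi
  | seqSub2 hax hY hl hl' h1 h2 h3 hv =>
    filter_upwards [ex h1, ex h2, ex h3, all fun i hi => hv i hi (by omega) (by omega)] with
      _ h1 h2 h3 hv using .seqSub2 hax hY hl hl' h1 h2 h3 fun i hi _ _ => hv i hi
  | teqSub2 hax hY hl hl' h1 h2 h3 hv =>
    filter_upwards [ex h1, ex h2, ex h3, all fun i hi => hv i hi (by omega) (by omega)] with
      _ h1 h2 h3 hv using .teqSub2 hax hY hl hl' h1 h2 h3 fun i hi _ _ => hv i hi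

/-- The part of the pretheory conditions needed for the metatheory. -/
structure PT (Ax : Set (Judg A)) : Prop where
  sort_shape : ∀ (X : PreCtx A) (U : SortE A), Judg.sort X U ∈ Ax → U.args = ctxVars X
  term_shape : ∀ (X : PreCtx A) (u : Expr A) (U : SortE A), Judg.term X u U ∈ Ax →
    ∃ t : A.TermSym, u = Expr.app t (ctxVars X)
  sort_uniq : ∀ {X X' : PreCtx A} {S}, introSort X S ∈ Ax → introSort X' S ∈ Ax → X = X'
  term_uniq : ∀ {X X' : PreCtx A} {t U U'}, introTerm X t U ∈ Ax → introTerm X' t U' ∈ Ax →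
    X = X' ∧ U = U'

variable (hPT : PT Ax)

theorem IsPretheory.pt (h : IsPretheory Ax) : PT Ax where
  sort_shape := h.sort_shape
  term_shape := h.term_shape
  sort_uniq h1 h2 := (h.sort_intro _).unique h1 h2
  term_uniq {X X' t U U'} h1 h2 := by
    have := (h.term_intro t).unique (y₁ := (X, U)) (y₂ := (X', U')) h1 h2
    simpa using this

/-- What a judgment presupposes, together with the scoping of its expressions. -/
def Presup (Ax : Set (Judg A)) : Judg A → Prop
  | .ctx X => CtxOK X
  | .sort X U => Derivable Ax (.ctx X) ∧ CtxOK X ∧ SScoped X U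
  | .term X u U => Derivable Ax (.sort X U) ∧ CtxOK X ∧ SScoped X U ∧ EScoped X u
  | .sortEq X U V => Derivable Ax (.sort X U) ∧ Derivable Ax (.sort X V) ∧ CtxOK X ∧
      SScoped X U ∧ SScoped X V
  | .termEq X u v U => Derivable Ax (.term X u U) ∧ Derivable Ax (.term X v U) ∧ CtxOK X ∧
      SScoped X U ∧ EScoped X u ∧ EScoped X v

theorem sscoped_vars (X : PreCtx A) (S) : SScoped X ⟨S, ctxVars X⟩ := by
  rintro v ⟨e, he, h⟩
  simp only [ctxVars, mem_map] at he
  obtain ⟨p, hp, rfl⟩ := he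
  simp at h
  subst h
  exact mem_map_of_mem hp

theorem escoped_vars (X : PreCtx A) (t) : EScoped X (.app t (ctxVars X)) := by
  intro v h
  rw [occurs_app_iff] at h
  obtain ⟨e, he, h⟩ := h
  simp only [ctxVars, mem_map] at he
  obtain ⟨p, hp, rfl⟩ := he
  simp at h
  subst h
  exact mem_map_of_mem hp

theorem escoped_of_forall {f : List (Expr A)} (hf : f.length = X.length)
    (h : ∀ i (hi : i < X.length) (hif : i < f.length), EScoped Y f[i]) :
    ∀ e ∈ f, EScoped Y e := by
  intro e he
  obtain ⟨i, hi, rfl⟩ := mem_iff_getElem.1 he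
  exact h i (by omega) hi

theorem presup (hPT : PT Ax) {J} (hJ : Derivable Ax J) : Presup Ax J := by
  refine derivable_ind (P := Presup Ax) ?_ hJ
  intro J s
  cases s with
  | ctx_nil => exact ⟨fun i hi => by simp at hi, by simp⟩
  | ctx_cons hs h1 h2 => exact hs.2.2.1.snoc hs.2.2.2 h1
  | s1 h1 => exact ⟨h1.1, h1.1, h1.2.2.1, h1.2.2.2, h1.2.2.2⟩
  | s2 h1 => obtain ⟨_, a, b, c, d, e⟩ := h1; exact ⟨b, a, c, e, d⟩
  | s3 h1 h2 =>
    obtain ⟨_, a, b, c, d, e⟩ := h1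
    obtain ⟨_, a', b', c', d', e'⟩ := h2
    exact ⟨a, b', c, d, e'⟩
  | t1 h1 => exact ⟨h1.1, h1.1, h1.2.2.1, h1.2.2.2.1, h1.2.2.2.2, h1.2.2.2.2⟩
  | t2 h1 => obtain ⟨_, a, b, c, d, e, f⟩ := h1; exact ⟨b, a, c, d, f, e⟩
  | t3 h1 h2 =>
    obtain ⟨_, a, b, c, d, e, f⟩ := h1
    obtain ⟨_, a', b', c', d', e', f'⟩ := h2
    exact ⟨a, b', c, d, e, f'⟩
  | seqt h1 h2 =>
    obtain ⟨_, a, b, c, d, e⟩ := h1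
    obtain ⟨_, a', c', d', e'⟩ := h2
    exact ⟨b, c, e, e'⟩
  | seqteq h1 h2 h3 h4 =>
    exact ⟨h3.1, h4.1, h3.2.2.1, h3.2.2.2.1, h3.2.2.2.2, h4.2.2.2.2⟩
  | var hi h1 =>
    refine ⟨h1.1, h1.2.2.1, h1.2.2.2, fun v hv => ?_⟩
    rw [occurs_var_iff] at hv
    subst hv
    exact mem_map_of_mem (getElem_mem hi)
  | sA hax h1 hv =>
    refine ⟨h1.1, h1.2, ?_⟩
    rename_i X U
    have := hPT.sort_shape _ _ hax
    cases U with
    | mk S es => subst this; exact sscoped_vars _ _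
  | tA hax h1 hv =>
    obtain ⟨t, rfl⟩ := hPT.term_shape _ _ _ hax
    exact ⟨h1.1, h1.2.2.1, h1.2.2.2, escoped_vars _ _⟩
  | seqA hax h1 h2 => exact ⟨h1.1, h2.1, h1.2.2.1, h1.2.2.2, h2.2.2.2⟩
  | teqA hax h1 h2 =>
    exact ⟨h1.1, h2.1, h1.2.2.1, h1.2.2.2.1, h1.2.2.2.2, h2.2.2.2.2⟩
  | sSub hax hY hl hJ hc hv =>
    refine ⟨hc.1, hc.2, ?_⟩
    rintro v ⟨e, he, h⟩
    exact escoped_of_forall hl (fun i hi hif => (hv i hi hif).2.2.2.2) e he v h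
  | tSub hax hY hl hJ hc hv =>
    refine ⟨hc.1, hc.2.2.1, hc.2.2.2, ?_⟩
    intro v h
    rw [occurs_app_iff] at h
    obtain ⟨e, he, h⟩ := h
    exact escoped_of_forall hl (fun i hi hif => (hv i hi hif).2.2.2.2) e he v h
  | seqSub1 hax hY hl hJ h1 h2 hv => exact ⟨h1.1, h2.1, h1.2.2.1, h1.2.2.2, h2.2.2.2⟩
  | seqSub2 hax hY hl hl' hJ h1 h2 hv => exact ⟨h1.1, h2.1, h1.2.2.1, h1.2.2.2, h2.2.2.2⟩
  | teqSub1 hax hY hl hJ h1 h2 hv =>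
    exact ⟨h1.1, h2.1, h1.2.2.1, h1.2.2.2.1, h1.2.2.2.2, h2.2.2.2.2⟩
  | teqSub2 hax hY hl hl' hJ h1 h2 hv =>
    exact ⟨h1.1, h2.1, h1.2.2.1, h1.2.2.2.1, h1.2.2.2.2, h2.2.2.2.2⟩

theorem sortVars_subst_sb (hX : CtxOK X) {f : List (Expr A)} (hf : f.length = X.length)
    (S : A.SortSym) :
    SortE.subst (sb X f) ⟨S, ctxVars X⟩ = ⟨S, f⟩ := by
  simp only [SortE.subst, map_subst_ctxVars, map_sb X hX.2 f hf]

theorem termVars_subst_sb (hX : CtxOK X) {f : List (Expr A)} (hf : f.length = X.length)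
    (t : A.TermSym) :
    Expr.subst (sb X f) (.app t (ctxVars X)) = .app t f := by
  simp only [Expr.subst_app, map_subst_ctxVars, map_sb X hX.2 f hf]

theorem getElem_sb (hX : CtxOK X) {f : List (Expr A)} (hf : f.length = X.length) {i : ℕ}
    (hi : i < X.length) (hif : i < f.length) : f[i] = sb X f X[i].1 := by
  have e := map_sb X hX.2 f hf
  rw [← List.getElem_of_eq e (by simpa using hi)]
  simp

theorem forall_sb (hX : CtxOK X) {f : List (Expr A)} (hf : f.length = X.length)
    {P : Expr A → SortE A → Prop}
    (h : ∀ i (hi : i < X.length) (hif : i < f.length), P f[i] (subPre X f i hi)) :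
    ∀ p ∈ X, P (sb X f p.1) (p.2.subst (sb X f)) := by
  intro p hp
  obtain ⟨i, hi, rfl⟩ := mem_iff_getElem.1 hp
  have := h i hi (by omega)
  rw [subPre_eq hX f hf] at this
  rwa [getElem_sb hX hf hi] at this

theorem forall_sb₂ (hX : CtxOK X) {f g : List (Expr A)} (hf : f.length = X.length)
    (hg : g.length = X.length) {P : Expr A → Expr A → SortE A → Prop}
    (h : ∀ i (hi : i < X.length) (hif : i < f.length) (hig : i < g.length), P f[i] g[i]
      (subPre X f i hi))
    :
    ∀ p ∈ X, P (sb X f p.1) (sb X g p.1) (p.2.subst (sb X f)) := by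
  intro p hp
  obtain ⟨i, hi, rfl⟩ := mem_iff_getElem.1 hp
  have := h i hi (by omega) (by omega)
  rw [subPre_eq hX f hf] at this
  rwa [getElem_sb hX hf hi, getElem_sb hX hg hi] at this

theorem Der.pre {J} (h : Der Ax J) : (match J with
    | .ctx _ => True
    | .sort X _ => Der Ax (.ctx X)
    | .term X _ U => Der Ax (.sort X U)
    | .sortEq X U V => Der Ax (.sort X U) ∧ Der Ax (.sort X V)
    | .termEq X u v U => Der Ax (.term X u U) ∧ Der Ax (.term X v U) : Prop) := by
  induction h with
  | nil => trivial
  | cons => trivial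
  | s1 h _ => exact ⟨h, h⟩
  | s2 _ ih => exact ih.symm
  | s3 _ _ ih1 ih2 => exact ⟨ih1.1, ih2.2⟩
  | t1 h _ => exact ⟨h, h⟩
  | t2 _ ih => exact ih.symm
  | t3 _ _ ih1 ih2 => exact ⟨ih1.1, ih2.2⟩
  | seqt _ _ ih1 _ => exact ih1.2
  | seqteq h1 _ _ ih2 => exact ⟨.seqt h1 ih2.1, .seqt h1 ih2.2⟩
  | var _ h _ => exact h
  | sApp _ _ _ hY => exact hY
  | tApp _ _ _ hU => exact hU
  | sEq _ _ _ _ h1 h2 => exact ⟨h1, h2⟩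
  | tEq _ _ _ _ h1 h2 => exact ⟨h1, h2⟩
  | sCong _ _ _ h1 h2 => exact ⟨h1, h2⟩
  | tCong _ _ _ h1 h2 => exact ⟨h1, h2⟩

theorem Der.sort_ctx {X U} (h : Der Ax (.sort X U)) : Der Ax (.ctx X) := h.pre

theorem Der.term_sort {X u U} (h : Der Ax (.term X u U)) : Der Ax (.sort X U) := h.pre

theorem Der.term_ctx {X u U} (h : Der Ax (.term X u U)) : Der Ax (.ctx X) := h.term_sort.sort_ctx

theorem Der.sortEq_left {X U V} (h : Der Ax (.sortEq X U V)) : Der Ax (.sort X U) := h.pre.1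

theorem Der.sortEq_right {X U V} (h : Der Ax (.sortEq X U V)) : Der Ax (.sort X V) := h.pre.2

theorem Der.termEq_left {X u v U} (h : Der Ax (.termEq X u v U)) : Der Ax (.term X u U) := h.pre.1

theorem Der.termEq_right {X u v U} (h : Der Ax (.termEq X u v U)) : Der Ax (.term X v U) := h.pre.2

/-- Replacing the context of a judgment. -/
def Judg.setCtx (Γ : PreCtx A) : Judg A → Judg A
  | .ctx _ => .ctx Γ
  | .sort _ U => .sort Γ U
  | .term _ u U => .term Γ u U
  | .sortEq _ U V => .sortEq Γ U V
  | .termEq _ u v U => .termEq Γ u v U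

theorem Der.weaken {J} (h : Der Ax J) (hs : J.ctxOf ⊆ Γ) (hΓ : Der Ax (.ctx Γ)) :
    Der Ax (J.setCtx Γ) := by
  induction h with
  | nil => exact hΓ
  | cons => exact hΓ
  | s1 _ ih => exact .s1 (ih hs)
  | s2 _ ih => exact .s2 (ih hs)
  | s3 _ _ ih1 ih2 => exact .s3 (ih1 hs) (ih2 hs)
  | t1 _ ih => exact .t1 (ih hs)
  | t2 _ ih => exact .t2 (ih hs)
  | t3 _ _ ih1 ih2 => exact .t3 (ih1 hs) (ih2 hs)
  | seqt _ _ ih1 ih2 => exact .seqt (ih1 hs) (ih2 hs)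
  | seqteq _ _ ih1 ih2 => exact .seqteq (ih1 hs) (ih2 hs)
  | var hx _ ih => exact .var (hs hx) (ih hs)
  | sApp hax hJ hv _ _ _ _ _ ih => exact .sApp hax hJ hv hΓ fun p hp => ih p hp hs
  | tApp hax hJ hv _ _ _ _ ih1 ih => exact .tApp hax hJ hv (ih1 hs) fun p hp => ih p hp hs
  | sEq hax hJ hJ' hv _ _ _ _ _ _ ih1 ih2 ih =>
    exact .sEq hax hJ hJ' hv (ih1 hs) (ih2 hs) fun p hp => ih p hp hs
  | tEq hax hJ hJ' hv _ _ _ _ _ _ ih1 ih2 ih =>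
    exact .tEq hax hJ hJ' hv (ih1 hs) (ih2 hs) fun p hp => ih p hp hs
  | sCong hax hJ hv _ _ _ _ _ ih1 ih2 ih =>
    exact .sCong hax hJ hv (ih1 hs) (ih2 hs) fun p hp => ih p hp hs
  | tCong hax hJ hv _ _ _ _ _ ih1 ih2 ih =>
    exact .tCong hax hJ hv (ih1 hs) (ih2 hs) fun p hp => ih p hp hs

theorem Der.wk_sort {X Γ U} (h : Der Ax (.sort X U)) (hs : X ⊆ Γ) (hΓ : Der Ax (.ctx Γ)) :
    Der Ax (.sort Γ U) := h.weaken hs hΓ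

theorem Der.wk_term {X Γ u U} (h : Der Ax (.term X u U)) (hs : X ⊆ Γ) (hΓ : Der Ax (.ctx Γ)) :
    Der Ax (.term Γ u U) := h.weaken hs hΓ

theorem Der.wk_sortEq {X Γ U V} (h : Der Ax (.sortEq X U V)) (hs : X ⊆ Γ) (hΓ : Der Ax (.ctx Γ)) :
    Der Ax (.sortEq Γ U V) := h.weaken hs hΓ

theorem Der.wk_termEq {X Γ u v U} (h : Der Ax (.termEq X u v U)) (hs : X ⊆ Γ)
    (hΓ : Der Ax (.ctx Γ)) : Der Ax (.termEq Γ u v U) := h.weaken hs hΓ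

theorem Der.ctx_snoc {p} (h : Der Ax (.ctx (X ++ [p]))) :
    Der Ax (.sort X p.2) ∧ ∀ q ∈ X, q.1 ≠ p.1 := by
  generalize hJ : Judg.ctx (X ++ [p]) = J at h
  cases h with
  | nil => simp at hJ
  | cons h hx =>
    simp only [Judg.ctx.injEq] at hJ
    obtain ⟨rfl, h2⟩ := List.append_inj' hJ rfl
    simp at h2
    subst h2
    exact ⟨h, hx⟩
  | _ => simp at hJ

theorem Der.ctx_split (h : Der Ax (.ctx (X ++ Y))) : Der Ax (.ctx X) := by
  induction Y using List.reverseRecOn with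
  | nil => simpa using h
  | append_singleton Y p ih =>
    rw [← List.append_assoc] at h
    exact ih h.ctx_snoc.1.sort_ctx

theorem Der.vars (h : Der Ax (.ctx X)) {p} (hp : p ∈ X) :
    Der Ax (.term X (.var p.1) p.2) := by
  induction X using List.reverseRecOn with
  | nil => simp at hp
  | append_singleton X q ih =>
    have hX := h.ctx_snoc.1
    rcases mem_append.1 hp with hp | hp
    · exact (ih hX.sort_ctx hp).wk_term (by simp) h
    · simp at hp
      subst hp
      exact .var (by simp) (hX.wk_sort (by simp) h)

/-- A substitution sending the variables of `X` to terms over `Γ`. -/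
def IsSub (Ax : Set (Judg A)) (Γ X : PreCtx A) (σ : A.Var → Expr A) : Prop :=
  ∀ p ∈ X, Der Ax (.term Γ (σ p.1) (p.2.subst σ))

/-- Instantiation of a judgment along a substitution. -/
def Judg.inst (Γ : PreCtx A) (σ : A.Var → Expr A) : Judg A → Judg A
  | .ctx _ => .ctx Γ
  | .sort _ U => .sort Γ (U.subst σ)
  | .term _ u U => .term Γ (u.subst σ) (U.subst σ)
  | .sortEq _ U V => .sortEq Γ (U.subst σ) (V.subst σ)
  | .termEq _ u v U => .termEq Γ (u.subst σ) (v.subst σ) (U.subst σ)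

theorem Der.subst {J} (h : Der Ax J) {τ} (hs : IsSub Ax Γ J.ctxOf τ) (hΓ : Der Ax (.ctx Γ)) :
    Der Ax (J.inst Γ τ) := by
  induction h with
  | nil => exact hΓ
  | cons => exact hΓ
  | s1 _ ih => exact .s1 (ih hs)
  | s2 _ ih => exact .s2 (ih hs)
  | s3 _ _ ih1 ih2 => exact .s3 (ih1 hs) (ih2 hs)
  | t1 _ ih => exact .t1 (ih hs)
  | t2 _ ih => exact .t2 (ih hs)
  | t3 _ _ ih1 ih2 => exact .t3 (ih1 hs) (ih2 hs)
  | seqt _ _ ih1 ih2 => exact .seqt (ih1 hs) (ih2 hs)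
  | seqteq _ _ ih1 ih2 => exact .seqteq (ih1 hs) (ih2 hs)
  | var hx _ ih => simpa [Judg.inst] using hs _ hx
  | sApp hax hJ hv _ _ _ _ _ ih =>
    simp only [Judg.inst, SortE.subst_subst] at ih ⊢
    exact .sApp hax hJ hv hΓ fun p hp => ih p hp hs
  | tApp hax hJ hv _ _ _ _ ih1 ih =>
    simp only [Judg.inst, SortE.subst_subst, Expr.subst_subst] at ih1 ih ⊢
    exact .tApp hax hJ hv (ih1 hs) fun p hp => ih p hp hs
  | sEq hax hJ hJ' hv _ _ _ _ _ _ ih1 ih2 ih =>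
    simp only [Judg.inst, SortE.subst_subst, Expr.subst_subst] at ih1 ih2 ih ⊢
    exact .sEq hax hJ hJ' hv (ih1 hs) (ih2 hs) fun p hp => ih p hp hs
  | tEq hax hJ hJ' hv _ _ _ _ _ _ ih1 ih2 ih =>
    simp only [Judg.inst, SortE.subst_subst, Expr.subst_subst] at ih1 ih2 ih ⊢
    exact .tEq hax hJ hJ' hv (ih1 hs) (ih2 hs) fun p hp => ih p hp hs
  | sCong hax hJ hv _ _ _ _ _ ih1 ih2 ih =>
    simp only [Judg.inst, SortE.subst_subst, Expr.subst_subst] at ih1 ih2 ih ⊢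
    exact .sCong hax hJ hv (ih1 hs) (ih2 hs) fun p hp => ih p hp hs
  | tCong hax hJ hv _ _ _ _ _ ih1 ih2 ih =>
    simp only [Judg.inst, SortE.subst_subst, Expr.subst_subst] at ih1 ih2 ih ⊢
    exact .tCong hax hJ hv (ih1 hs) (ih2 hs) fun p hp => ih p hp hs

theorem Der.sub_sort {X Γ U τ} (h : Der Ax (.sort X U)) (hs : IsSub Ax Γ X τ)
    (hΓ : Der Ax (.ctx Γ)) : Der Ax (.sort Γ (U.subst τ)) := h.subst hs hΓ

theorem Der.sub_term {X Γ u U τ} (h : Der Ax (.term X u U)) (hs : IsSub Ax Γ X τ)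
    (hΓ : Der Ax (.ctx Γ)) : Der Ax (.term Γ (u.subst τ) (U.subst τ)) := h.subst hs hΓ

theorem Der.sub_sortEq {X Γ U V τ} (h : Der Ax (.sortEq X U V)) (hs : IsSub Ax Γ X τ)
    (hΓ : Der Ax (.ctx Γ)) : Der Ax (.sortEq Γ (U.subst τ) (V.subst τ)) := h.subst hs hΓ

theorem Der.sub_termEq {X Γ u v U τ} (h : Der Ax (.termEq X u v U)) (hs : IsSub Ax Γ X τ)
    (hΓ : Der Ax (.ctx Γ)) : Der Ax (.termEq Γ (u.subst τ) (v.subst τ) (U.subst τ)) :=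
  h.subst hs hΓ

theorem Der.isSub_var (h : Der Ax (.ctx X)) : IsSub Ax X X Expr.var :=
  fun p hp => by simpa using h.vars hp

theorem der_of_derivable (hPT : PT Ax) {J} (hJ : Derivable Ax J) : Der Ax J := by
  refine derivable_ind (P := Der Ax) ?_ hJ
  intro J s
  have fs {X Y f} ok hl := forall_sb (X := X) (f := f) (P := fun u U => Der Ax (.term Y u U)) ok hl
  cases s with
  | ctx_nil => exact .nil
  | ctx_cons hs h1 h2 => exact .cons hs.2 h1
  | s1 h1 => exact .s1 h1.2
  | s2 h1 => exact .s2 h1.2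
  | s3 h1 h2 => exact .s3 h1.2 h2.2
  | t1 h1 => exact .t1 h1.2
  | t2 h1 => exact .t2 h1.2
  | t3 h1 h2 => exact .t3 h1.2 h2.2
  | seqt h1 h2 => exact .seqt h1.2 h2.2
  | seqteq h1 h2 h3 h4 => exact .seqteq h1.2 h2.2
  | var hi h1 => exact .var (getElem_mem hi) h1.2
  | @sA X U hax h1 hv =>
    have e := hPT.sort_shape _ _ hax
    obtain ⟨S, es⟩ := U
    subst e
    simpa using Der.sApp hax h1.2 (fun _ => h1.2.vars) h1.2 h1.2.isSub_var
  | @tA X u U hax h1 hv =>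
    obtain ⟨t, rfl⟩ := hPT.term_shape _ _ _ hax
    have := Der.tApp hax h1.2 (fun _ => h1.2.sort_ctx.vars) (σ := Expr.var)
      (by simpa using h1.2) h1.2.sort_ctx.isSub_var
    rwa [Expr.subst_id, SortE.subst_id] at this
  | @seqA X U U' hax h1 h2 =>
    have := Der.sEq hax h1.2 h2.2 (fun _ => h1.2.sort_ctx.vars) (σ := Expr.var)
      (by simpa using h1.2) (by simpa using h2.2)
      h1.2.sort_ctx.isSub_var
    simpa using this
  | @teqA X u u' U hax h1 h2 =>
    have := Der.tEq hax h1.2 h2.2 (fun _ => h1.2.term_ctx.vars) (σ := Expr.var)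
      (by simpa using h1.2) (by simpa using h2.2)
      h1.2.term_ctx.isSub_var
    simpa using this
  | @sSub X S hax Y hY f hl hJ hc hv =>
    have ok : CtxOK _ := (presup hPT hJ.1).2.1
    have := Der.sApp hax hJ.2.sort_ctx (fun _ => hJ.2.sort_ctx.vars) hc.2 (fs ok hl fun i a b =>
      (hv i a b).2)
    rwa [sortVars_subst_sb ok hl] at this
  | @tSub X t U hax Y hY f hl hJ hU hv =>
    have ok : CtxOK _ := (presup hPT hJ.1).2.1
    have := Der.tApp hax hJ.2.term_sort (fun _ => hJ.2.term_ctx.vars) hU.2 (fs ok hl fun i a b =>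
      (hv i a b).2)
    rwa [termVars_subst_sb ok hl] at this
  | @seqSub1 X U U' hax Y hY f hl hJ h1 h2 hv =>
    have ok : CtxOK _ := (presup hPT hJ.1).2.2.1
    exact Der.sEq hax hJ.2.sortEq_left hJ.2.sortEq_right
      (fun _ => hJ.2.sortEq_left.sort_ctx.vars) h1.2 h2.2 (fs ok hl fun i a b => (hv i a b).2)
  | @teqSub1 X u u' U hax Y hY f hl hJ h1 h2 hv =>
    have ok : CtxOK _ := (presup hPT hJ.1).2.2.1
    exact Der.tEq hax hJ.2.termEq_left hJ.2.termEq_right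
      (fun _ => hJ.2.termEq_left.term_ctx.vars) h1.2 h2.2 (fs ok hl fun i a b => (hv i a b).2)
  | @seqSub2 X S hax Y hY f g hl hl' hJ h1 h2 hv =>
    have ok : CtxOK _ := (presup hPT hJ.1).2.1
    have h1 := h1.2
    have h2 := h2.2
    rw [← sortVars_subst_sb ok hl] at h1
    rw [← sortVars_subst_sb ok hl'] at h2
    have := Der.sCong hax hJ.2.sort_ctx (fun _ => hJ.2.sort_ctx.vars) h1 h2
      (forall_sb₂ (P := fun u v U => Der Ax (.termEq Y u v U)) ok hl hl' fun i a b c =>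
        (hv i a b c).2)
    rwa [sortVars_subst_sb ok hl, sortVars_subst_sb ok hl'] at this
  | @teqSub2 X t U hax Y hY f g hl hl' hJ h1 h2 hv =>
    have ok : CtxOK _ := (presup hPT hJ.1).2.1
    have h1 := h1.2
    have h2 := h2.2
    rw [← termVars_subst_sb ok hl] at h1
    rw [← termVars_subst_sb ok hl'] at h2
    have := Der.tCong hax hJ.2.term_sort (fun _ => hJ.2.term_ctx.vars) h1 h2
      (forall_sb₂ (P := fun u v U => Der Ax (.termEq Y u v U)) ok hl hl' fun i a b c =>
        (hv i a b c).2)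
    rwa [termVars_subst_sb ok hl, termVars_subst_sb ok hl'] at this

theorem subPre_map (hX : CtxOK X) (σ : A.Var → Expr A) (i : ℕ) (hi : i < X.length) :
    subPre X (X.map fun p => σ p.1) i hi = X[i].2.subst σ := by
  rw [subPre_eq hX _ (by simp)]
  exact SortE.subst_congr _ fun v hv => sb_map X σ (hX.scoped (getElem_mem hi) v hv)

theorem substL_map (σ : A.Var → Expr A) (hU : SScoped X U) :
    U.substL (mkSub X (X.map fun p => σ p.1)) = U.subst σ :=
  SortE.subst_congr _ fun v hv => sb_map X σ (hU v hv)

theorem esubstL_map (σ : A.Var → Expr A) (hU : EScoped X u) :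
    u.substL (mkSub X (X.map fun p => σ p.1)) = u.subst σ :=
  Expr.subst_congr _ fun v hv => sb_map X σ (hU v hv)

include hPT

theorem derivable_of_der {J} (hJ : Der Ax J) : Derivable Ax J := by
  induction hJ with
  | nil => exact .of_step .ctx_nil
  | cons h hx ih =>
    obtain ⟨a, b, c⟩ := presup hPT ih
    exact .of_step (.ctx_cons ih hx (b.snoc c hx).1)
  | s1 _ ih => exact .of_step (.s1 ih)
  | s2 _ ih => exact .of_step (.s2 ih)
  | s3 _ _ ih1 ih2 => exact .of_step (.s3 ih1 ih2)
  | t1 _ ih => exact .of_step (.t1 ih)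
  | t2 _ ih => exact .of_step (.t2 ih)
  | t3 _ _ ih1 ih2 => exact .of_step (.t3 ih1 ih2)
  | seqt _ _ ih1 ih2 => exact .of_step (.seqt ih1 ih2)
  | seqteq _ _ ih1 ih2 =>
    obtain ⟨a, b, _⟩ := presup hPT ih2
    exact .of_step (.seqteq ih1 ih2 (.of_step (.seqt ih1 a))
      (.of_step (.seqt ih1 b)))
  | @var X x U hx _ ih =>
    obtain ⟨i, hi, e⟩ := mem_iff_getElem.1 hx
    have := Step.var (Ax := Ax) (D := Derivable Ax) hi (by rw [e]; exact ih)
    rw [e] at this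
    exact .of_step this
  | @sApp X S hax hJ hv Y hY σ hσ ihJ ihv ihY ih =>
    have ok : CtxOK X := presup hPT ihJ
    rw [SortE.subst, map_subst_ctxVars]
    refine .of_step (.sSub hax (presup hPT ihY).1 (by simp)
      (.of_step (.sA hax ihJ fun i hi => ihv _ (getElem_mem hi))) ihY fun i hi hif => ?_)
    rw [subPre_map ok]
    simpa using ih _ (getElem_mem hi)
  | @tApp X t U hax hJ hv Y σ hU hσ ihJ ihv ihU ih =>
    obtain ⟨hX, ok, sc⟩ := presup hPT ihJ
    rw [Expr.subst_app, map_subst_ctxVars]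
    rw [← substL_map σ sc] at ihU ⊢
    refine .of_step (.tSub hax (presup hPT ihU).2.1.1 (by simp)
      (.of_step (.tA hax ihJ fun i hi => ihv _ (getElem_mem hi))) ihU fun i hi hif => ?_)
    rw [subPre_map ok]
    simpa using ih _ (getElem_mem hi)
  | @sEq X U U' hax hJ hJ' hv Y σ h1 h2 hσ ihJ ihJ' _ ih1 ih2 ih =>
    obtain ⟨hX, ok, sc⟩ := presup hPT ihJ
    have sc' := (presup hPT ihJ').2.2
    rw [← substL_map σ sc] at ih1 ⊢
    rw [← substL_map σ sc'] at ih2 ⊢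
    refine .of_step (.seqSub1 hax (presup hPT ih1).2.1.1 (by simp)
      (.of_step (.seqA hax ihJ ihJ')) ih1 ih2 fun i hi hif => ?_)
    rw [subPre_map ok]
    simpa using ih _ (getElem_mem hi)
  | @tEq X u u' U hax hJ hJ' hv Y σ h1 h2 hσ ihJ ihJ' _ ih1 ih2 ih =>
    obtain ⟨hX, ok, sc, sct⟩ := presup hPT ihJ
    have sc' := (presup hPT ihJ').2.2.2
    rw [← substL_map σ sc] at ih1 ih2 ⊢
    rw [← esubstL_map σ sc'] at ih2 ⊢
    rw [← esubstL_map σ sct] at ih1 ⊢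
    refine .of_step (.teqSub1 hax (presup hPT ih1).2.1.1 (by simp)
      (.of_step (.teqA hax ihJ ihJ')) ih1 ih2 fun i hi hif => ?_)
    rw [subPre_map ok]
    simpa using ih _ (getElem_mem hi)
  | @sCong X S hax hJ hv Y σ τ h1 h2 hσ ihJ ihv ih1 ih2 ih =>
    have ok : CtxOK X := presup hPT ihJ
    rw [SortE.subst, map_subst_ctxVars] at ih1 ih2 ⊢
    rw [SortE.subst, map_subst_ctxVars]
    refine .of_step (.seqSub2 hax (presup hPT ih1).2.1.1 (by simp) (by simp)
      (.of_step (.sA hax ihJ fun i hi => ihv _ (getElem_mem hi))) ih1 ih2 fun i hi hif hig => ?_)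
    rw [subPre_map ok]
    simpa using ih _ (getElem_mem hi)
  | @tCong X t U hax hJ hv Y σ τ h1 h2 hσ ihJ ihv ih1 ih2 ih =>
    obtain ⟨hX, ok, sc⟩ := presup hPT ihJ
    rw [Expr.subst_app, map_subst_ctxVars] at ih1 ih2 ⊢
    rw [Expr.subst_app, map_subst_ctxVars]
    rw [← substL_map σ sc] at ih1 ih2 ⊢
    refine .of_step (.teqSub2 hax (presup hPT ih1).2.1.1 (by simp) (by simp)
      (.of_step (.tA hax ihJ fun i hi => ihv _ (getElem_mem hi))) ih1 ih2 fun i hi hif hig => ?_)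
    rw [subPre_map ok]
    simpa using ih _ (getElem_mem hi)

theorem derivable_iff {J} : Derivable Ax J ↔ Der Ax J :=
  ⟨der_of_derivable hPT, derivable_of_der hPT⟩

theorem Der.ctxOK (h : Der Ax (.ctx X)) : CtxOK X :=
  presup hPT (derivable_of_der hPT h)

theorem Der.sscoped {U} (h : Der Ax (.sort X U)) : SScoped X U :=
  (presup hPT (derivable_of_der hPT h)).2.2

theorem Der.escoped {u U} (h : Der Ax (.term X u U)) :
    EScoped X u :=
  (presup hPT (derivable_of_der hPT h)).2.2.2

omit hPT

theorem CtxOK.unique (h : CtxOK X) {x U V} (h1 : (x, U) ∈ X) (h2 : (x, V) ∈ X) :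
    U = V := by
  have := List.inj_on_of_nodup_map h.2 h1 h2 rfl
  simpa using this

/-- Pointwise derivable equality of substitutions. -/
def SubEq (Ax : Set (Judg A)) (Γ X : PreCtx A) (σ τ : A.Var → Expr A) : Prop :=
  ∀ p ∈ X, Der Ax (.termEq Γ (σ p.1) (τ p.1) (p.2.subst σ))

theorem Der.subEq {J} (h : Der Ax J) {σ τ} (hσ : IsSub Ax Γ J.ctxOf σ)
    (hτ : IsSub Ax Γ J.ctxOf τ) (he : SubEq Ax Γ J.ctxOf σ τ) (hΓ : Der Ax (.ctx Γ)) :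
    (match J with
      | .sort _ U => Der Ax (.sortEq Γ (U.subst σ) (U.subst τ))
      | .term _ u U => Der Ax (.termEq Γ (u.subst σ) (u.subst τ) (U.subst σ))
      | _ => True : Prop) := by
  induction h with
  | nil => trivial
  | cons => trivial
  | s1 _ ih => trivial
  | s2 _ ih => trivial
  | s3 _ _ ih1 ih2 => trivial
  | t1 _ ih => trivial
  | t2 _ ih => trivial
  | t3 _ _ ih1 ih2 => trivial
  | seqt h1 h2 ih1 ih2 => exact .seqteq (h1.sub_sortEq hσ hΓ) (ih2 hσ hτ he)
  | seqteq => trivial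
  | var hx _ ih => simpa using he _ hx
  | sEq => trivial
  | tEq => trivial
  | sCong => trivial
  | tCong => trivial
  | sApp hax hJ hv hY hs ihJ _ _ ih =>
    simp only [SortE.subst_subst] at ih ⊢
    refine .sCong hax hJ hv ?_ ?_ fun p hp => ih p hp hσ hτ he
    · have := (Der.sApp hax hJ hv hY hs).sub_sort hσ hΓ
      rwa [SortE.subst_subst] at this
    · have := (Der.sApp hax hJ hv hY hs).sub_sort hτ hΓ
      rwa [SortE.subst_subst] at this
  | tApp hax hJ hv hU hs ihJ _ ihU ih =>
    have h1 := (Der.tApp hax hJ hv hU hs).sub_term hσ hΓ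
    have h2 := Der.seqt (.s2 (ihU hσ hτ he)) ((Der.tApp hax hJ hv hU hs).sub_term hτ hΓ)
    simp only [SortE.subst_subst, Expr.subst_subst] at ih h1 h2 ⊢
    exact .tCong hax hJ hv h1 h2 fun p hp => ih p hp hσ hτ he

theorem Der.subEq_sort {U} {σ τ} (h : Der Ax (.sort X U)) (hσ : IsSub Ax Γ X σ)
    (hτ : IsSub Ax Γ X τ) (he : SubEq Ax Γ X σ τ) (hΓ : Der Ax (.ctx Γ)) :
    Der Ax (.sortEq Γ (U.subst σ) (U.subst τ)) := h.subEq hσ hτ he hΓ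

theorem Der.subEq_term {u U} {σ τ} (h : Der Ax (.term X u U)) (hσ : IsSub Ax Γ X σ)
    (hτ : IsSub Ax Γ X τ) (he : SubEq Ax Γ X σ τ) (hΓ : Der Ax (.ctx Γ)) :
    Der Ax (.termEq Γ (u.subst σ) (u.subst τ) (U.subst σ)) := h.subEq hσ hτ he hΓ

/-! ### Inversion and uniqueness of sorts -/

theorem Der.inv_sort {S f} (h : Der Ax (.sort X ⟨S, f⟩)) :
    ∃ (Xa : PreCtx A) (σ : A.Var → Expr A), introSort Xa S ∈ Ax ∧ Der Ax (.ctx Xa) ∧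
      IsSub Ax X Xa σ ∧
      f = Xa.map fun p => σ p.1 := by
  generalize hJ : Judg.sort X ⟨S, f⟩ = J at h
  cases h with
  | sApp hax hJ' hv hY hσ =>
    simp only [SortE.subst, map_subst_ctxVars, Judg.sort.injEq, SortE.mk.injEq] at hJ
    obtain ⟨rfl, rfl, rfl⟩ := hJ
    exact ⟨_, _, hax, hJ', hσ, rfl⟩
  | _ => simp at hJ

/-- The inversion statement for term judgments. -/
def TermInversion (Ax : Set (Judg A)) : Judg A → Prop
  | .term X (.var x) U => ∃ V, (x, V) ∈ X ∧ Der Ax (.sortEq X V U)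
  | .term X (.app t f) U => ∃ (Xa : PreCtx A) (V : SortE A) (σ : A.Var → Expr A),
      introTerm Xa t V ∈ Ax ∧ Der Ax (.sort Xa V) ∧
      IsSub Ax X Xa σ ∧ f = (Xa.map fun p => σ p.1) ∧ Der Ax (.sortEq X (V.subst σ) U)
  | _ => True

theorem Der.inv_term {J} (h : Der Ax J) : TermInversion Ax J := by
  induction h with
  | var hx h => exact ⟨_, hx, .s1 h⟩
  | @seqt X U U' u h1 h2 ih1 ih2 =>
    cases u with
    | var x =>
      obtain ⟨V, hV, e⟩ := ih2
      exact ⟨V, hV, .s3 e h1⟩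
    | app t f =>
      obtain ⟨Xa, V, σ, a, b, c, d, e⟩ := ih2
      exact ⟨Xa, V, σ, a, b, c, d, .s3 e h1⟩
  | @tApp X t U hax hJ hv Y σ hU hs =>
    have e : Expr.subst σ (.app t (ctxVars X)) = .app t (X.map fun p => σ p.1) := by
      rw [Expr.subst_app, map_subst_ctxVars]
    rw [e]
    exact ⟨_, _, _, hax, hJ, hs, rfl, .s1 hU⟩
  | _ => trivial

theorem Der.inv_var {x U} (h : Der Ax (.term X (.var x) U)) :
    ∃ V, (x, V) ∈ X ∧ Der Ax (.sortEq X V U) := h.inv_term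

theorem Der.inv_app {t f U} (h : Der Ax (.term X (.app t f) U)) :
    ∃ (Xa : PreCtx A) (V : SortE A) (σ : A.Var → Expr A),
      introTerm Xa t V ∈ Ax ∧ Der Ax (.sort Xa V) ∧
      IsSub Ax X Xa σ ∧ f = (Xa.map fun p => σ p.1) ∧ Der Ax (.sortEq X (V.subst σ) U) := h.inv_term

theorem subst_eq_of_map_eq (h : (X.map fun p => σ p.1) = X.map fun p => τ p.1)
    (hU : SScoped X U) :
    U.subst σ = U.subst τ := by
  refine SortE.subst_congr _ fun x hx => ?_
  obtain ⟨p, hp, rfl⟩ := mem_map.1 (hU x hx)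
  exact List.map_inj_left.1 h p hp

theorem Der.sort_unique (hPT : PT Ax) {u U V} (h1 : Der Ax (.term X u U))
    (h2 : Der Ax (.term X u V)) : Der Ax (.sortEq X U V) := by
  cases u with
  | var x =>
    obtain ⟨U', a, b⟩ := h1.inv_var
    obtain ⟨V', a', b'⟩ := h2.inv_var
    obtain rfl := (h1.term_ctx.ctxOK hPT).unique a a'
    exact .s3 (.s2 b) b'
  | app t f =>
    obtain ⟨Xa, V, σ, a, b, c, d, e⟩ := h1.inv_app
    obtain ⟨Xa', V', σ', a', b', c', d', e2⟩ := h2.inv_app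
    obtain ⟨rfl, rfl⟩ := hPT.term_uniq a a'
    rw [subst_eq_of_map_eq (d.symm.trans d') (b.sscoped hPT)] at e
    exact .s3 (.s2 e) e2

/-! ### Equality of terms at an unspecified sort -/

/-- Derivable equality of terms, at some sort. -/
def EqT (Ax : Set (Judg A)) (Γ : PreCtx A) (u v : Expr A) : Prop :=
  ∃ U, Der Ax (.termEq Γ u v U)

theorem EqT.at (hPT : PT Ax) {u v U} (h : EqT Ax Γ u v) (hu : Der Ax (.term Γ u U)) :
    Der Ax (.termEq Γ u v U) := by
  obtain ⟨V, h⟩ := h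
  exact .seqteq (h.termEq_left.sort_unique hPT hu) h

theorem EqT.symm {u v} (h : EqT Ax Γ u v) : EqT Ax Γ v u :=
  h.imp fun _ h => .t2 h

theorem EqT.refl {u U} (h : Der Ax (.term Γ u U)) : EqT Ax Γ u u := ⟨U, .t1 h⟩

include hPT

theorem EqT.trans {u v w} (h : EqT Ax Γ u v) (h' : EqT Ax Γ v w) :
    EqT Ax Γ u w := by
  obtain ⟨V, h⟩ := h
  exact ⟨V, .t3 h (h'.at hPT h.termEq_right)⟩

theorem EqT.term_right {u v U} (h : EqT Ax Γ u v) (hu : Der Ax (.term Γ u U)) :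
    Der Ax (.term Γ v U) := (h.at hPT hu).termEq_right

omit hPT

theorem EqT.weaken {Δ : PreCtx A} {u v} (h : EqT Ax Γ u v) (hs : Γ ⊆ Δ) (hΔ : Der Ax (.ctx Δ)) :
    EqT Ax Δ u v := h.imp fun _ h => h.wk_termEq hs hΔ

theorem EqT.subst {u v σ} (h : EqT Ax X u v) (hσ : IsSub Ax Γ X σ) (hΓ : Der Ax (.ctx Γ)) :
    EqT Ax Γ (u.subst σ) (v.subst σ) := by
  obtain ⟨U, h⟩ := h
  exact ⟨_, h.sub_termEq hσ hΓ⟩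

theorem IsSub.mono {σ} (h : IsSub Ax Γ X σ) (hs : Y ⊆ X) : IsSub Ax Γ Y σ :=
  fun p hp => h p (hs hp)

include hPT

theorem IsSub.congr {σ τ} (h : IsSub Ax Γ X σ) (hX : Der Ax (.ctx X))
    (he : ∀ p ∈ X, σ p.1 = τ p.1) : IsSub Ax Γ X τ := by
  intro p hp
  rw [← he p hp, ← SortE.subst_congr p.2]
  · exact h p hp
  · intro x hx
    obtain ⟨q, hq, rfl⟩ := mem_map.1 ((hX.ctxOK hPT).scoped hp x hx)
    exact he q hq

/-- A substitution pointwise equal to a context morphism is a context morphism. -/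
theorem IsSub.of_eqT {σ τ} (hσ : IsSub Ax Γ X σ)
    (he : ∀ p ∈ X, EqT Ax Γ (σ p.1) (τ p.1)) (hX : Der Ax (.ctx X)) (hΓ : Der Ax (.ctx Γ)) :
    IsSub Ax Γ X τ := by
  induction X using List.reverseRecOn with
  | nil => intro p hp; simp at hp
  | append_singleton X p ih =>
    have hp := hX.ctx_snoc.1
    have hσ' : IsSub Ax Γ X σ := hσ.mono (by simp)
    have ih := ih hσ' (fun q hq => he q (by simp [hq])) hp.sort_ctx
    intro q hq
    rcases mem_append.1 hq with hq | hq
    · exact ih q hq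
    · simp at hq
      subst hq
      have h1 := hσ q (by simp)
      have h2 := (he q (by simp)).term_right hPT h1
      exact .seqt (hp.subEq_sort hσ' ih (fun r hr => (he r (by simp [hr])).at hPT (hσ' r hr)) hΓ) h2

theorem SubEq.of_eqT {σ τ} (hσ : IsSub Ax Γ X σ)
    (he : ∀ p ∈ X, EqT Ax Γ (σ p.1) (τ p.1)) : SubEq Ax Γ X σ τ :=
  fun p hp => (he p hp).at hPT (hσ p hp)

theorem EqT.subst_congr {σ τ} {u U} (h : Der Ax (.term X u U))
    (hσ : IsSub Ax Γ X σ) (he : ∀ p ∈ X, EqT Ax Γ (σ p.1) (τ p.1)) (hΓ : Der Ax (.ctx Γ)) :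
    EqT Ax Γ (u.subst σ) (u.subst τ) :=
  ⟨_, h.subEq_term hσ (hσ.of_eqT hPT he h.term_ctx hΓ) (.of_eqT hPT hσ he) hΓ⟩

theorem sortEq_subst_congr {σ τ} {U} (h : Der Ax (.sort X U))
    (hσ : IsSub Ax Γ X σ) (he : ∀ p ∈ X, EqT Ax Γ (σ p.1) (τ p.1)) (hΓ : Der Ax (.ctx Γ)) :
    Der Ax (.sortEq Γ (U.subst σ) (U.subst τ)) :=
  h.subEq_sort hσ (hσ.of_eqT hPT he h.sort_ctx hΓ) (.of_eqT hPT hσ he) hΓ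

theorem forall₂_sub (hX : Der Ax (.ctx X)) {R : Expr A → Expr A → Prop}
    {g : List (Expr A)} (h : List.Forall₂ R (X.map fun p => σ p.1) g) :
    ∃ τ : A.Var → Expr A, g = (X.map fun p => τ p.1) ∧ ∀ p ∈ X, R (σ p.1) (τ p.1) := by
  have hl : g.length = X.length := by simpa using h.length_eq.symm
  have hg := map_sb X (hX.ctxOK hPT).2 g hl
  refine ⟨sb X g, hg.symm, ?_⟩
  rw [← hg] at h
  simp only [List.forall₂_map_left_iff, List.forall₂_map_right_iff, List.forall₂_same] at h
  exact h

theorem EqT.app {t f g U} (h : Der Ax (.term Γ (.app t f) U))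
    (he : List.Forall₂ (EqT Ax Γ) f g) : EqT Ax Γ (.app t f) (.app t g) := by
  obtain ⟨X, V, σ, hax, hV, hσ, rfl, e⟩ := h.inv_app
  obtain ⟨τ, rfl, he'⟩ := forall₂_sub hPT hV.sort_ctx he
  have hΓ := h.term_ctx
  have hv := fun p (hp : p ∈ X) => hV.sort_ctx.vars hp
  have hT := Der.tApp hax hV hv (by simpa using hV) hV.sort_ctx.isSub_var
  rw [Expr.subst_id] at hT
  simpa using EqT.subst_congr hPT hT hσ he' hΓ

theorem sortEq_congr {S f g} (h : Der Ax (.sort Γ ⟨S, f⟩))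
    (he : List.Forall₂ (EqT Ax Γ) f g) : Der Ax (.sortEq Γ ⟨S, f⟩ ⟨S, g⟩) := by
  obtain ⟨X, σ, hax, hX, hσ, rfl⟩ := h.inv_sort
  obtain ⟨τ, rfl, he'⟩ := forall₂_sub hPT hX he
  have hT := Der.sApp hax hX (fun p => hX.vars) hX hX.isSub_var
  rw [SortE.subst_id] at hT
  have := sortEq_subst_congr hPT hT hσ he' h.sort_ctx
  rwa [SortE.subst, SortE.subst, map_subst_ctxVars, map_subst_ctxVars] at this

omit hPT

theorem IsSub.comp {σ τ} (hσ : IsSub Ax X Y σ) (hτ : IsSub Ax Γ X τ) (hΓ : Der Ax (.ctx Γ)) :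
    IsSub Ax Γ Y fun y => (σ y).subst τ := by
  intro p hp
  have := (hσ p hp).sub_term hτ hΓ
  rwa [SortE.subst_subst] at this

theorem Der.sA {S} (hax : introSort X S ∈ Ax) (h : Der Ax (.ctx X)) :
    Der Ax (introSort X S) := by
  have hT := Der.sApp hax h (fun p => h.vars) h h.isSub_var
  rwa [SortE.subst_id] at hT

theorem Der.tA {t U} (hax : introTerm X t U ∈ Ax) (h : Der Ax (.sort X U)) :
    Der Ax (introTerm X t U) := by
  have hv := fun p (hp : p ∈ X) => h.sort_ctx.vars hp
  have hT := Der.tApp hax h hv (by simpa using h) h.sort_ctx.isSub_var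
  rwa [Expr.subst_id, SortE.subst_id] at hT

theorem Der.seqA {U V} (hax : .sortEq X U V ∈ Ax) (h : Der Ax (.sort X U))
    (h' : Der Ax (.sort X V)) : Der Ax (.sortEq X U V) := by
  have hT := Der.sEq hax h h' (fun _ => h.sort_ctx.vars) (by simpa using h)
    (by simpa using h') h.sort_ctx.isSub_var
  rwa [SortE.subst_id, SortE.subst_id] at hT

theorem Der.teqA {u v U} (hax : .termEq X u v U ∈ Ax) (h : Der Ax (.term X u U))
    (h' : Der Ax (.term X v U)) : Der Ax (.termEq X u v U) := by
  have hT := Der.tEq hax h h' (fun _ => h.term_ctx.vars) (by simpa using h)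
    (by simpa using h') h.term_ctx.isSub_var
  rwa [SortE.subst_id, Expr.subst_id, Expr.subst_id] at hT

/-! ### Levelled derivability -/

/-- The presuppositions of a judgment satisfy `D`. -/
def Judg.Pre (D : Judg A → Prop) : Judg A → Prop
  | .ctx _ => True
  | .sort X _ => D (.ctx X)
  | .term X _ U => D (.sort X U)
  | .sortEq X U V => D (.sort X U) ∧ D (.sort X V)
  | .termEq X u v U => D (.term X u U) ∧ D (.term X v U)

theorem Judg.Pre.mono {D D' : Judg A → Prop} (hD : ∀ J, D J → D' J) {J : Judg A} (h : J.Pre D) :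
    J.Pre D' := by
  cases J with
  | ctx => trivial
  | sort => exact hD _ h
  | term => exact hD _ h
  | sortEq => exact ⟨hD _ h.1, hD _ h.2⟩
  | termEq => exact ⟨hD _ h.1, hD _ h.2⟩

/-- Derivability in at most `n` levels, with presuppositions derivable earlier. -/
def Lv (Ax : Set (Judg A)) : ℕ → Judg A → Prop
  | 0, _ => False
  | n + 1, J => Lv Ax n J ∨ (LStep Ax (Lv Ax n) J ∧ J.Pre (Lv Ax n))

theorem Lv.mono {m n : ℕ} (h : m ≤ n) {J} (hJ : Lv Ax m J) : Lv Ax n J := by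
  induction h with
  | refl => exact hJ
  | step _ ih => exact .inl ih

theorem Lv.step {n : ℕ} {J} (h : Lv Ax (n + 1) J) :
    ∃ k ≤ n, LStep Ax (Lv Ax k) J ∧ J.Pre (Lv Ax k) := by
  induction n with
  | zero =>
    rcases h with h | h
    · exact h.elim
    · exact ⟨0, le_rfl, h⟩
  | succ n ih =>
    rcases h with h | h
    · obtain ⟨k, hk, h⟩ := ih h
      exact ⟨k, by omega, h⟩
    · exact ⟨n + 1, le_rfl, h⟩

theorem Lv.pre {n : ℕ} {J} (h : Lv Ax n J) : J.Pre (Lv Ax n) := by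
  cases n with
  | zero => exact h.elim
  | succ n =>
    obtain ⟨k, hk, -, h⟩ := h.step
    exact h.mono fun J => Lv.mono (by omega)

theorem Lv.pre_succ {n : ℕ} {J} (h : Lv Ax (n + 1) J) : J.Pre (Lv Ax n) := by
  obtain ⟨k, hk, -, h⟩ := h.step
  exact h.mono fun J => Lv.mono hk

theorem Lv.der {n : ℕ} {J} (h : Lv Ax n J) : Der Ax J := by
  induction n generalizing J with
  | zero => exact h.elim
  | succ n ih =>
    obtain ⟨k, hk, hst, -⟩ := h.step
    have ih : ∀ {J}, Lv Ax k J → Der Ax J := fun h => ih (h.mono hk)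
    have all : ∀ {X : PreCtx A} {F : A.Var × SortE A → Judg A}, (∀ p ∈ X, Lv Ax k (F p)) →
        ∀ p ∈ X, Der Ax (F p) := fun h p hp => ih (h p hp)
    clear h
    cases hst with
    | nil => exact .nil
    | cons h hx => exact .cons (ih h) hx
    | s1 h => exact .s1 (ih h)
    | s2 h => exact .s2 (ih h)
    | s3 h1 h2 => exact .s3 (ih h1) (ih h2)
    | t1 h => exact .t1 (ih h)
    | t2 h => exact .t2 (ih h)
    | t3 h1 h2 => exact .t3 (ih h1) (ih h2)
    | seqt h1 h2 => exact .seqt (ih h1) (ih h2)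
    | seqteq h1 h2 => exact .seqteq (ih h1) (ih h2)
    | var hx h => exact .var hx (ih h)
    | sApp hax hJ hv hY hσ => exact .sApp hax (ih hJ) (all hv) (ih hY) (all hσ)
    | tApp hax hJ hv hY hσ => exact .tApp hax (ih hJ) (all hv) (ih hY) (all hσ)
    | sEq hax hJ hJ' hv h1 h2 hσ =>
      exact .sEq hax (ih hJ) (ih hJ') (all hv) (ih h1) (ih h2) (all hσ)
    | tEq hax hJ hJ' hv h1 h2 hσ =>
      exact .tEq hax (ih hJ) (ih hJ') (all hv) (ih h1) (ih h2) (all hσ)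
    | sCong hax hJ hv h1 h2 hσ => exact .sCong hax (ih hJ) (all hv) (ih h1) (ih h2) (all hσ)
    | tCong hax hJ hv h1 h2 hσ => exact .tCong hax (ih hJ) (all hv) (ih h1) (ih h2) (all hσ)

theorem eventually_lv {α : Type} {l : List α} {F : α → Judg A}
    (h : ∀ a ∈ l, ∀ᶠ n in Filter.atTop, Lv Ax n (F a)) :
    ∀ᶠ n in Filter.atTop, ∀ a ∈ l, Lv Ax n (F a) :=
  (Filter.eventually_all_finite l.finite_toSet).2 h

theorem Lv.eventually {n : ℕ} {J} (h : Lv Ax n J) : ∀ᶠ n in Filter.atTop, Lv Ax n J :=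
  Filter.eventually_atTop.2 ⟨n, fun _ hm => h.mono hm⟩

theorem Der.lv {J} (h : Der Ax J) : ∃ n, Lv Ax n J := by
  refine Filter.Eventually.exists (f := Filter.atTop) ?_
  have mk : ∀ {J}, (∀ᶠ n in Filter.atTop, LStep Ax (Lv Ax n) J ∧ J.Pre (Lv Ax n)) →
      ∀ᶠ n in Filter.atTop, Lv Ax n J := fun h =>
    h.exists.elim fun n hn => Lv.eventually (n := n + 1) (.inr hn)
  induction h with
  | nil => exact mk (.of_forall fun _ => ⟨.nil, trivial⟩)
  | cons _ hx ih => exact mk (ih.mono fun _ h => ⟨.cons h hx, trivial⟩)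
  | s1 _ ih => exact mk (ih.mono fun _ h => ⟨.s1 h, h, h⟩)
  | s2 _ ih => exact mk (ih.mono fun _ h => ⟨.s2 h, h.pre.2, h.pre.1⟩)
  | s3 _ _ ih ih' => exact mk (ih.mp (ih'.mono fun _ h' h => ⟨.s3 h h', h.pre.1, h'.pre.2⟩))
  | t1 _ ih => exact mk (ih.mono fun _ h => ⟨.t1 h, h, h⟩)
  | t2 _ ih => exact mk (ih.mono fun _ h => ⟨.t2 h, h.pre.2, h.pre.1⟩)
  | t3 _ _ ih ih' => exact mk (ih.mp (ih'.mono fun _ h' h => ⟨.t3 h h', h.pre.1, h'.pre.2⟩))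
  | seqt _ _ ih ih' => exact mk (ih.mp (ih'.mono fun _ h' h => ⟨.seqt h h', h.pre.2⟩))
  | seqteq _ _ ih ih' =>
    obtain ⟨n, h, h'⟩ := (ih.and ih').exists
    exact Lv.eventually (n := n + 2) (.inr ⟨.seqteq (.inl h) (.inl h'),
      .inr ⟨.seqt h h'.pre.1, h.pre.2⟩, .inr ⟨.seqt h h'.pre.2, h.pre.2⟩⟩)
  | var hx _ ih => exact mk (ih.mono fun _ h => ⟨.var hx h, h⟩)
  | sApp hax _ _ _ _ ih ihv ihY ihσ =>
    refine mk ?_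
    filter_upwards [ih, eventually_lv ihv, ihY, eventually_lv ihσ] with _ a b c d
      using ⟨.sApp hax a b c d, c⟩
  | tApp hax _ _ _ _ ih ihv ihY ihσ =>
    refine mk ?_
    filter_upwards [ih, eventually_lv ihv, ihY, eventually_lv ihσ] with _ a b c d
      using ⟨.tApp hax a b c d, c⟩
  | sEq hax _ _ _ _ _ _ ih ih' ihv ih1 ih2 ihσ =>
    refine mk ?_
    filter_upwards [ih, ih', eventually_lv ihv, ih1, ih2, eventually_lv ihσ] with _ a a' b c c' d
      using ⟨.sEq hax a a' b c c' d, c, c'⟩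
  | tEq hax _ _ _ _ _ _ ih ih' ihv ih1 ih2 ihσ =>
    refine mk ?_
    filter_upwards [ih, ih', eventually_lv ihv, ih1, ih2, eventually_lv ihσ] with _ a a' b c c' d
      using ⟨.tEq hax a a' b c c' d, c, c'⟩
  | sCong hax _ _ _ _ _ ih ihv ih1 ih2 ihσ =>
    refine mk ?_
    filter_upwards [ih, eventually_lv ihv, ih1, ih2, eventually_lv ihσ] with _ a b c c' d
      using ⟨.sCong hax a b c c' d, c, c'⟩
  | tCong hax _ _ _ _ _ ih ihv ih1 ih2 ihσ =>
    refine mk ?_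
    filter_upwards [ih, eventually_lv ihv, ih1, ih2, eventually_lv ihσ] with _ a b c r d
      using ⟨.tCong hax a b c r d, c, r⟩

/-- Contexts each of whose sorts is derivable at level `p` over a subcontext. -/
inductive EC (Ax : Set (Judg A)) (p : ℕ) : PreCtx A → Prop where
  | nil : EC Ax p []
  | snoc {X X0 : PreCtx A} {x U} (h : EC Ax p X) (hs : X0 ⊆ X) (hU : Lv Ax p (.sort X0 U))
      (hx : ∀ q ∈ X, q.1 ≠ x) : EC Ax p (X ++ [(x, U)])

theorem EC.mono {m n : ℕ} (hmn : m ≤ n) {X} (h : EC Ax m X) : EC Ax n X := by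
  induction h with
  | nil => exact .nil
  | snoc _ hs hU hx ih => exact .snoc ih hs (hU.mono hmn) hx

theorem EC.der {p : ℕ} {X} (h : EC Ax p X) : Der Ax (.ctx X) := by
  induction h with
  | nil => exact .nil
  | snoc _ hs hU hx ih => exact .cons (hU.der.wk_sort hs ih) hx

theorem EC.of_snoc {p : ℕ} {X x} (h : EC Ax p (X ++ [x])) : EC Ax p X ∧
    (∃ X0 ⊆ X, Lv Ax p (.sort X0 x.2)) ∧ ∀ q ∈ X, q.1 ≠ x.1 := by
  generalize hY : X ++ [x] = Y at h
  cases h with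
  | nil => simp at hY
  | snoc h hs hU hx =>
    obtain ⟨rfl, h2⟩ := List.append_inj' hY rfl
    simp at h2
    subst h2
    exact ⟨h, ⟨_, hs, hU⟩, hx⟩

theorem EC.of_lv {p : ℕ} {X} (h : Lv Ax (p + 1) (.ctx X)) : EC Ax p X := by
  induction p using Nat.strong_induction_on generalizing X with
  | _ p ih =>
    obtain ⟨k, hk, hst, -⟩ := h.step
    clear h
    cases hst with
    | nil => exact .nil
    | cons h hx =>
      refine .snoc ?_ (fun _ => id) (h.mono hk) hx
      rcases k with _ | _ | k
      · exact h.elim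
      · exact h.pre_succ.elim
      · exact (ih k (by omega) h.pre_succ).mono (by omega)

theorem EC.of_lv' {p : ℕ} {X} (h : Lv Ax p (.ctx X)) : EC Ax p X := by
  cases p with
  | zero => exact h.elim
  | succ p => exact (EC.of_lv h).mono (by omega)

theorem Lv.sort_ec {p X U} (h : Lv Ax p (.sort X U)) : EC Ax p X := .of_lv' h.pre

theorem Lv.term_ec {p X u U} (h : Lv Ax p (.term X u U)) : EC Ax p X := Lv.sort_ec h.pre

/-- Sorts derivable at level `p` over a subcontext. -/
def SdS (Ax : Set (Judg A)) (p : ℕ) (X : PreCtx A) (U : SortE A) : Prop :=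
  ∃ X0 ⊆ X, Lv Ax p (.sort X0 U)

/-- Terms that are variables or derivable at level `p` over a subcontext. -/
def TmS (Ax : Set (Judg A)) (p : ℕ) (X : PreCtx A) (u : Expr A) (U : SortE A) : Prop :=
  (∃ z, u = .var z ∧ (z, U) ∈ X) ∨ ∃ X0 ⊆ X, Lv Ax p (.term X0 u U)

theorem SdS.mono {p X Y U} (h : SdS Ax p X U) (hs : X ⊆ Y) : SdS Ax p Y U :=
  let ⟨Z, a, b⟩ := h
  ⟨Z, List.Subset.trans a hs, b⟩

theorem TmS.mono {p X Y u U} (h : TmS Ax p X u U) (hs : X ⊆ Y) : TmS Ax p Y u U := by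
  rcases h with ⟨z, a, b⟩ | ⟨Z, a, b⟩
  · exact .inl ⟨z, a, hs b⟩
  · exact .inr ⟨Z, List.Subset.trans a hs, b⟩

theorem TmS.mono_level {p q X u U} (h : TmS Ax p X u U) (hs : p ≤ q) : TmS Ax q X u U := by
  rcases h with ⟨z, a, b⟩ | ⟨Z, a, b⟩
  · exact .inl ⟨z, a, b⟩
  · exact .inr ⟨Z, a, b.mono hs⟩

theorem TmS.of_lv {p X u U} (h : Lv Ax p (.term X u U)) : TmS Ax p X u U :=
  .inr ⟨X, fun _ => id, h⟩

theorem TmS.of_mem {p X x} (h : (x, U) ∈ X) : TmS Ax p X (.var x) U :=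
  .inl ⟨x, rfl, h⟩

theorem SdS.of_lv {p X U} (h : Lv Ax p (.sort X U)) : SdS Ax p X U := ⟨X, fun _ => id, h⟩

theorem TmS.der {p X u U} (h : TmS Ax p X u U) (hX : Der Ax (.ctx X)) : Der Ax (.term X u U) := by
  rcases h with ⟨z, rfl, b⟩ | ⟨Z, a, b⟩
  · exact hX.vars b
  · exact b.der.wk_term a hX

theorem EC.sds {p X} (h : EC Ax p X) {z} (hz : z ∈ X) : SdS Ax p X z.2 := by
  induction h with
  | nil => simp at hz
  | snoc h hs hU hx ih =>
    rcases mem_append.1 hz with hz | hz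
    · exact (ih hz).mono (by simp)
    · simp at hz
      subst hz
      exact ⟨_, List.Subset.trans hs (by simp), hU⟩

theorem TmS.sds {p X u U} (h : TmS Ax p X u U) (hX : EC Ax p X) : SdS Ax p X U := by
  rcases h with ⟨z, rfl, b⟩ | ⟨Z, a, b⟩
  · exact hX.sds b
  · exact ⟨Z, a, b.pre⟩

/-! ### Canonical sorts -/

theorem canonSort_var {x U} : CanonSort Ax X (.var x) U ↔ (x, U) ∈ X := by
  constructor
  · intro h
    generalize hu : Expr.var x = u at h
    cases h with
    | var hi =>
      simp only [Expr.var.injEq] at hu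
      subst hu
      exact getElem_mem hi
    | app => simp at hu
  · intro h
    obtain ⟨i, hi, e⟩ := mem_iff_getElem.1 h
    have := CanonSort.var (Ax := Ax) hi
    rwa [e] at this

theorem CanonSort.mono {u U} (h : CanonSort Ax X u U) (hs : X ⊆ Y) :
    CanonSort Ax Y u U := by
  cases h with
  | var hi => exact canonSort_var.2 (hs (getElem_mem hi))
  | app hax => exact .app hax

include hPT

theorem CanonSort.unique (hX : CtxOK X) {u U V} (h : CanonSort Ax X u U)
    (h' : CanonSort Ax X u V) : U = V := by
  cases u with
  | var x => exact hX.unique (canonSort_var.1 h) (canonSort_var.1 h')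
  | app t f =>
    cases h with
    | app hax =>
      cases h' with
      | app hax' =>
        obtain ⟨rfl, rfl⟩ := hPT.term_uniq hax hax'
        rfl

theorem CanonSort.app_map {Xa : PreCtx A} {t V} (hax : introTerm Xa t V ∈ Ax)
    (hV : Der Ax (.sort Xa V)) (σ : A.Var → Expr A) :
    CanonSort Ax X (.app t (Xa.map fun p => σ p.1)) (V.subst σ) := by
  rw [← substL_map σ (hV.sscoped hPT)]
  exact .app hax

theorem CanonSort.app_inv {Xa : PreCtx A} {t V U} (hax : introTerm Xa t V ∈ Ax)
    (hV : Der Ax (.sort Xa V)) (h : CanonSort Ax X (.app t (Xa.map fun p => σ p.1)) U) :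
    U = V.subst σ := by
  cases h with
  | app hax' =>
    obtain ⟨rfl, rfl⟩ := hPT.term_uniq hax hax'
    rw [← substL_map σ (hV.sscoped hPT)]

theorem Lv.canon {p X u U} (h : Lv Ax p (.term X u U)) :
    ∃ C, CanonSort Ax X u C ∧ Lv Ax p (.term X u C) ∧ (C = U ∨ Lv Ax p (.sortEq X C U)) := by
  induction p using Nat.strong_induction_on generalizing u U with
  | _ p ih =>
    cases p with
    | zero => exact h.elim
    | succ p =>
      have h0 := h
      obtain ⟨k, hk, h, -⟩ := h.step
      cases h with
      | seqt h1 h2 =>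
        obtain ⟨C, a, b, c⟩ := ih k (by omega) h2
        refine ⟨C, a, b.mono (by omega), .inr ?_⟩
        rcases c with rfl | c
        · exact h1.mono (by omega)
        · exact Lv.mono (show k + 1 ≤ p + 1 by omega) (.inr ⟨.s3 c h1, c.pre.1, h1.pre.2⟩)
      | var hx h => exact ⟨_, canonSort_var.2 hx, h0, .inl rfl⟩
      | tApp hax hJ hv hU hσ =>
        refine ⟨_, ?_, h0, .inl rfl⟩
        rw [Expr.subst_app, map_subst_ctxVars]
        exact .app_map hPT hax hJ.der _

/-- A term has a canonical sort, at which it is typed in the same level. -/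
theorem TmS.canon {p X u U} (h : TmS Ax p X u U) :
    ∃ C, CanonSort Ax X u C ∧ TmS Ax p X u C ∧ (C = U ∨ ∃ X0 ⊆ X, Lv Ax p (.sortEq X0 C U)) := by
  rcases h with ⟨z, rfl, b⟩ | ⟨Z, a, b⟩
  · exact ⟨U, canonSort_var.2 b, .of_mem b, .inl rfl⟩
  · obtain ⟨C, c, d, e⟩ := b.canon hPT
    exact ⟨C, c.mono a, .inr ⟨Z, a, d⟩, e.imp id fun e => ⟨Z, a, e⟩⟩

theorem Der.canon {X u U} (h : Der Ax (.term X u U)) :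
    ∃ C, CanonSort Ax X u C ∧ Der Ax (.term X u C) := by
  obtain ⟨n, hn⟩ := h.lv
  obtain ⟨C, a, b, -⟩ := hn.canon hPT
  exact ⟨C, a, b.der⟩

/-! ### Inversion with levels -/

omit hPT

/-- Data of a sort expression derivable at level `p + 1`. -/
structure SortInv (Ax : Set (Judg A)) (p : ℕ) (X : PreCtx A) (S : A.SortSym) (ss : List (Expr A))
    (Xa : PreCtx A) (σ : A.Var → Expr A) : Prop where
  ax : introSort Xa S ∈ Ax
  args : ss = Xa.map fun p => σ p.1
  sub : ∀ q ∈ Xa, Lv Ax p (.term X (σ q.1) (q.2.subst σ))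
  ecX : EC Ax p X
  ec : EC Ax p Xa
  gen : Lv Ax (p + 1) (introSort Xa S)

theorem Lv.inv_sort {p X S ss} (h : Lv Ax (p + 1) (.sort X ⟨S, ss⟩)) :
    ∃ Xa σ, SortInv Ax p X S ss Xa σ := by
  obtain ⟨k, hk, h, -⟩ := h.step
  generalize hJ : Judg.sort X ⟨S, ss⟩ = J at h
  cases h with
  | @sApp Xa S hax hJ' hv Y hY σ hσ =>
    simp only [SortE.subst, map_subst_ctxVars, Judg.sort.injEq, SortE.mk.injEq] at hJ
    obtain ⟨rfl, rfl, rfl⟩ := hJ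
    refine ⟨Xa, σ, hax, rfl, fun q hq => (hσ q hq).mono hk, (EC.of_lv' hY).mono hk,
      (EC.of_lv' hJ').mono hk, Lv.mono (show k + 1 ≤ p + 1 by omega) (.inr ⟨?_, hJ'⟩)⟩
    have := LStep.sApp (D := Lv Ax k) hax hJ' hv hJ' (σ := Expr.var) (by simpa using hv)
    rwa [SortE.subst_id] at this
  | _ => simp at hJ

/-- Data of an application derivable at level `p + 1`. -/
structure TermInv (Ax : Set (Judg A)) (p : ℕ) (X : PreCtx A) (t : A.TermSym) (ts : List (Expr A))
    (Xa : PreCtx A) (V : SortE A) (σ : A.Var → Expr A) : Prop where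
  ax : introTerm Xa t V ∈ Ax
  args : ts = Xa.map fun p => σ p.1
  sub : ∀ q ∈ Xa, Lv Ax p (.term X (σ q.1) (q.2.subst σ))
  ecX : EC Ax p X
  ec : EC Ax p Xa
  sort : Lv Ax p (.sort Xa V)
  canon : Lv Ax p (.sort X (V.subst σ))
  gen : Lv Ax (p + 1) (introTerm Xa t V)

theorem Lv.inv_app {p X t ts U} (h : Lv Ax (p + 1) (.term X (.app t ts) U)) :
    ∃ Xa V σ, TermInv Ax p X t ts Xa V σ := by
  induction p using Nat.strong_induction_on generalizing U with
  | _ p ih =>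
    obtain ⟨k, hk, h, -⟩ := h.step
    generalize hJ : Judg.term X (.app t ts) U = J at h
    cases h with
    | seqt h1 h2 =>
      simp only [Judg.term.injEq] at hJ
      obtain ⟨rfl, rfl, rfl⟩ := hJ
      cases k with
      | zero => exact h2.elim
      | succ k =>
        obtain ⟨Xa, V, σ, h⟩ := ih k (by omega) h2
        exact ⟨Xa, V, σ, h.ax, h.args, fun q hq => (h.sub q hq).mono (by omega),
          h.ecX.mono (by omega), h.ec.mono (by omega), h.sort.mono (by omega),
          h.canon.mono (by omega), h.gen.mono (by omega)⟩
    | @tApp Xa t V hax hJ' hv Y σ hU hσ =>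
      rw [Expr.subst_app, map_subst_ctxVars] at hJ
      simp only [Judg.term.injEq, Expr.app.injEq] at hJ
      obtain ⟨rfl, ⟨rfl, rfl⟩, rfl⟩ := hJ
      refine ⟨Xa, V, σ, hax, rfl, fun q hq => (hσ q hq).mono hk, hU.sort_ec.mono hk,
        hJ'.sort_ec.mono hk, hJ'.mono hk, hU.mono hk,
        Lv.mono (show k + 1 ≤ p + 1 by omega) (.inr ⟨?_, hJ'⟩)⟩
      have := LStep.tApp (D := Lv Ax k) hax hJ' hv (σ := Expr.var) (by simpa using hJ')
        (by simpa using hv)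
      rwa [Expr.subst_id, SortE.subst_id] at this
    | _ => simp at hJ

theorem Lv.sort_args {p X} (h : Lv Ax (p + 1) (.sort X U)) {a} (ha : a ∈ U.args) :
    ∃ V, Lv Ax p (.term X a V) := by
  obtain ⟨S, ss⟩ := U
  obtain ⟨Xa, σ, h⟩ := h.inv_sort
  simp only [h.args, mem_map] at ha
  obtain ⟨q, hq, rfl⟩ := ha
  exact ⟨_, h.sub q hq⟩

theorem Lv.app_args {p X t ts} (h : Lv Ax (p + 1) (.term X (.app t ts) U)) {a} (ha : a ∈ ts) :
    ∃ V, Lv Ax p (.term X a V) := by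
  obtain ⟨Xa, V, σ, h⟩ := h.inv_app
  simp only [h.args, mem_map] at ha
  obtain ⟨q, hq, rfl⟩ := ha
  exact ⟨_, h.sub q hq⟩

theorem SdS.args {p X} (h : SdS Ax p X U) {a} (ha : a ∈ U.args) :
    ∃ V, TmS Ax p X a V := by
  obtain ⟨Z, hs, h⟩ := h
  cases p with
  | zero => exact h.elim
  | succ p =>
    obtain ⟨V, h⟩ := h.sort_args ha
    exact ⟨V, .inr ⟨Z, hs, h.mono (by omega)⟩⟩

theorem TmS.args {p X t ts} (h : TmS Ax p X (.app t ts) U) {a} (ha : a ∈ ts) :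
    ∃ V, TmS Ax p X a V := by
  rcases h with ⟨z, e, -⟩ | ⟨Z, hs, h⟩
  · simp at e
  · cases p with
    | zero => exact h.elim
    | succ p =>
      obtain ⟨V, h⟩ := h.app_args ha
      exact ⟨V, .inr ⟨Z, hs, h.mono (by omega)⟩⟩

/-- Well-typed terms. -/
def WT (Ax : Set (Judg A)) (X : PreCtx A) (u : Expr A) : Prop := ∃ U, Der Ax (.term X u U)

theorem WT.wk {u} (h : WT Ax X u) (hs : X ⊆ Y) (hY : Der Ax (.ctx Y)) :
    WT Ax Y u := h.imp fun _ h => h.wk_term hs hY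

theorem Der.sort_args {X} (h : Der Ax (.sort X U)) {a} (ha : a ∈ U.args) :
    WT Ax X a := by
  obtain ⟨S, ss⟩ := U
  obtain ⟨Xa, σ, -, -, h1, rfl⟩ := h.inv_sort
  simp only [mem_map] at ha
  obtain ⟨q, hq, rfl⟩ := ha
  exact ⟨_, h1 q hq⟩

theorem WT.var_mem {x} (h : WT Ax X (.var x)) : ∃ U, (x, U) ∈ X :=
  let ⟨_, h⟩ := h
  let ⟨V, h, _⟩ := h.inv_var
  ⟨V, h⟩

end

section
variable {A B C : Alphabet} {TA : Set (Judg A)} {TB : Set (Judg B)}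
  {TC : Set (Judg C)} {p q : ℕ} {X X' X1 : PreCtx A} {Y Y' Y1 : PreCtx B} {Γ : PreCtx C}
  {τ : A.Var → Expr A} {ρ : B.Var → Expr B} {U U' : SortE A} {V : SortE B} {x : A.Var} {y : B.Var}
  {u : Expr A}

/-! ### Abstract tensor operations -/

/-- The data of a tensor operation on expressions. -/
structure TOps (A B C : Alphabet) where
  v : A.Var → B.Var → C.Var
  pa : C.Var → A.Var
  pb : C.Var → B.Var
  gS : A.SortSym → B.SortSym → C.SortSym
  gL : A.SortSym → B.TermSym → C.TermSym
  gR : A.TermSym → B.SortSym → C.TermSym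
  fL : Prop
  fR : Prop
  grid : ∀ {α β γ : Type}, (α → β → γ) → List α → List β → List γ
  T : PreCtx A → PreCtx B → Expr A → Expr B → Expr C
  chA : PreCtx A → A.Var
  chB : PreCtx B → B.Var

variable {O : TOps A B C}

namespace TOps

variable (O : TOps A B C)

/-- Exchanging the two factors. -/
def op : TOps B A C where
  v b a := O.v a b
  pa := O.pb
  pb := O.pa
  gS b a := O.gS a b
  gL b a := O.gR a b
  gR b a := O.gL a b
  fL := O.fR
  fR := O.fL
  grid f l2 l1 := O.grid (fun a b => f b a) l1 l2
  T Y X v u := O.T X Y u v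
  chA := O.chB
  chB := O.chA

/-- The left expansion of the tensor of a term with an application. -/
def L (X : PreCtx A) (Y : PreCtx B) (U : SortE A) (u : Expr A) (t : B.TermSym)
    (ts : List (Expr B)) : Expr C :=
  .app (O.gL U.head t) (O.grid (O.T X Y) (U.args ++ [u]) ts)

/-- The tensor of two sorts with terms. -/
def W (X : PreCtx A) (Y : PreCtx B) (U : SortE A) (u : Expr A) (V : SortE B) (v : Expr B) :
    SortE C :=
  ⟨O.gS U.head V.head, (O.grid (O.T X Y) (U.args ++ [u]) (V.args ++ [v])).dropLast⟩

/-- The tensor of two contexts. -/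
def ten (X : PreCtx A) (Y : PreCtx B) : PreCtx C :=
  O.grid (fun p q => (O.v p.1 q.1, O.W X Y p.2 (.var p.1) q.2 (.var q.1))) X Y

/-- The tensor of two context extensions, without its last entry. -/
def par (X : PreCtx A) (Y : PreCtx B) : PreCtx C := (O.ten X Y).dropLast

/-- The tensor of two substitutions. -/
def TS (X : PreCtx A) (Y : PreCtx B) (τ : A.Var → Expr A) (ρ : B.Var → Expr B) (z : C.Var) :
    Expr C := O.T X Y (τ (O.pa z)) (ρ (O.pb z))

end TOps

/-- Extension of a context by its chosen fresh variable. -/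
def snocCh (ch : PreCtx A → A.Var) (X : PreCtx A) (U : SortE A) : PreCtx A := X ++ [(ch X, U)]

/-- Update of a substitution. -/
noncomputable def upd (τ : A.Var → Expr A) (x : A.Var) (u : Expr A) : A.Var → Expr A := by
  classical exact fun z => if z = x then u else τ z

theorem upd_self (τ : A.Var → Expr A) (x : A.Var) (u : Expr A) : upd τ x u x = u := by
  simp [upd]

theorem upd_ne (τ : A.Var → Expr A) (u : Expr A) {z} (h : z ≠ x) :
    upd τ x u z = τ z := by
  simp [upd, h]

/-- Half of the laws of a tensor operation. -/
structure TDh (O : TOps A B C) (TA : Set (Judg A)) (TB : Set (Judg B)) (TC : Set (Judg C)) :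
    Prop where
  pt : PT TA
  ptC : PT TC
  fresh : ∀ X : PreCtx A, ∀ p ∈ X, p.1 ≠ O.chA X
  pa_v : ∀ x y, O.pa (O.v x y) = x
  ff : O.fL ∨ O.fR
  T_vv : ∀ X Y x y, O.T X Y (.var x) (.var y) = .var (O.v x y)
  T_L : ∀ {X Y u U t ts}, Der TA (.ctx X) → Der TB (.ctx Y) → WT TA X u → CanonSort TA X u U →
    WT TB Y (.app t ts) → ((∃ x, u = .var x) ∨ O.fL) →
    O.T X Y u (.app t ts) = O.L X Y U u t ts
  grid_map : ∀ {α β γ δ : Type} (f : α → β → γ) (h : γ → δ) (l1 : List α) (l2 : List β),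
    (O.grid f l1 l2).map h = O.grid (fun a b => h (f a b)) l1 l2
  grid_mapL : ∀ {α α' β γ : Type} (f : α → β → γ) (h : α' → α) (l1 : List α') (l2 : List β),
    O.grid f (l1.map h) l2 = O.grid (fun a b => f (h a) b) l1 l2
  mem_grid : ∀ {α β γ : Type} (f : α → β → γ) (l1 : List α) (l2 : List β) z,
    z ∈ O.grid f l1 l2 ↔ ∃ a ∈ l1, ∃ b ∈ l2, f a b = z
  mem_dropLast : ∀ {α β γ : Type} (f : α → β → γ) (l1 : List α) a (l2 : List β) b z,
    z ∈ (O.grid f (l1 ++ [a]) (l2 ++ [b])).dropLast ↔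
      (∃ a' ∈ l1, ∃ b' ∈ l2 ++ [b], f a' b' = z) ∨ (∃ a' ∈ l1 ++ [a], ∃ b' ∈ l2, f a' b' = z)
  grid_split : ∀ {α β γ : Type} (f : α → β → γ) (l1 : List α) (l2 : List β) (pre : List γ) z,
    (pre ++ [z]) <+: O.grid f l1 l2 →
    ∃ a1 a b1 b, (a1 ++ [a]) <+: l1 ∧ (b1 ++ [b]) <+: l2 ∧ z = f a b ∧
      (∀ a' ∈ a1, ∀ b' ∈ b1 ++ [b], f a' b' ∈ pre) ∧ (∀ a' ∈ a1 ++ [a], ∀ b' ∈ b1, f a' b' ∈ pre)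
  grid_nodup : ∀ {α β γ : Type} (f : α → β → γ) (l1 : List α) (l2 : List β), l1.Nodup → l2.Nodup →
    (∀ a b a' b', f a b = f a' b' → a = a' ∧ b = b') → (O.grid f l1 l2).Nodup
  ruleSS : ∀ {X S Y T}, introSort X S ∈ TA → introSort Y T ∈ TB →
    Der TA (.ctx X) → Der TB (.ctx Y) →
    Der TC (.ctx (O.par (snocCh O.chA X ⟨S, ctxVars X⟩) (snocCh O.chB Y ⟨T, ctxVars Y⟩))) →
    Der TC (.sort (O.par (snocCh O.chA X ⟨S, ctxVars X⟩) (snocCh O.chB Y ⟨T, ctxVars Y⟩))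
      (O.W (snocCh O.chA X ⟨S, ctxVars X⟩) (snocCh O.chB Y ⟨T, ctxVars Y⟩)
        ⟨S, ctxVars X⟩ (.var (O.chA X)) ⟨T, ctxVars Y⟩ (.var (O.chB Y))))
  ruleST : ∀ {X S Y t V W}, introSort X S ∈ TA → introTerm Y t V ∈ TB →
    Der TA (.ctx X) → Der TB (introTerm Y t V) →
    W = (O.W (snocCh O.chA X ⟨S, ctxVars X⟩) (snocCh O.chB Y V)
        ⟨S, ctxVars X⟩ (.var (O.chA X)) V (.var (O.chB Y))).subst
          (O.TS (snocCh O.chA X ⟨S, ctxVars X⟩) Y .var (upd .var (O.chB Y) (.app t (ctxVars Y)))) →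
    Der TC (.sort (O.ten (snocCh O.chA X ⟨S, ctxVars X⟩) Y) W) →
    Der TC (.term (O.ten (snocCh O.chA X ⟨S, ctxVars X⟩) Y)
      (O.T (snocCh O.chA X ⟨S, ctxVars X⟩) Y (.var (O.chA X)) (.app t (ctxVars Y))) W)
  ruleTT : ∀ {X s U Y t V W}, introTerm X s U ∈ TA → introTerm Y t V ∈ TB →
    Der TA (introTerm X s U) → Der TB (introTerm Y t V) →
    W = (O.W (snocCh O.chA X U) (snocCh O.chB Y V) U (.var (O.chA X)) V (.var (O.chB Y))).subst
      (O.TS X Y (upd .var (O.chA X) (.app s (ctxVars X))) (upd .var (O.chB Y) (.app t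
        (ctxVars Y)))) →
    Der TC (.term (O.ten X Y) (O.L X Y U (.app s (ctxVars X)) t (ctxVars Y)) W) →
    Der TC (.term (O.ten X Y) (O.op.L Y X V (.app t (ctxVars Y)) s (ctxVars X)) W) →
    Der TC (.termEq (O.ten X Y) (O.L X Y U (.app s (ctxVars X)) t (ctxVars Y))
      (O.op.L Y X V (.app t (ctxVars Y)) s (ctxVars X)) W)
  ruleSEs : ∀ {X U U' Y T}, .sortEq X U U' ∈ TA → introSort Y T ∈ TB →
    Der TA (.sortEq X U U') → Der TB (.ctx Y) →
    Der TC (.sort (O.par (snocCh O.chA X U) (snocCh O.chB Y ⟨T, ctxVars Y⟩))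
      (O.W (snocCh O.chA X U) (snocCh O.chB Y ⟨T, ctxVars Y⟩)
        U (.var (O.chA X)) ⟨T, ctxVars Y⟩ (.var (O.chB Y)))) →
    Der TC (.sort (O.par (snocCh O.chA X U) (snocCh O.chB Y ⟨T, ctxVars Y⟩))
      (O.W (snocCh O.chA X U') (snocCh O.chB Y ⟨T, ctxVars Y⟩)
        U' (.var (O.chA X)) ⟨T, ctxVars Y⟩ (.var (O.chB Y)))) →
    Der TC (.sortEq (O.par (snocCh O.chA X U) (snocCh O.chB Y ⟨T, ctxVars Y⟩))
      (O.W (snocCh O.chA X U) (snocCh O.chB Y ⟨T, ctxVars Y⟩)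
        U (.var (O.chA X)) ⟨T, ctxVars Y⟩ (.var (O.chB Y)))
      (O.W (snocCh O.chA X U') (snocCh O.chB Y ⟨T, ctxVars Y⟩)
        U' (.var (O.chA X)) ⟨T, ctxVars Y⟩ (.var (O.chB Y))))
  ruleSEt : ∀ {X U U' Y t V W}, .sortEq X U U' ∈ TA → introTerm Y t V ∈ TB →
    Der TA (.sortEq X U U') → Der TB (introTerm Y t V) →
    W = (O.W (snocCh O.chA X U) (snocCh O.chB Y V)
        U (.var (O.chA X)) V (.var (O.chB Y))).subst
          (O.TS (snocCh O.chA X U) Y .var (upd .var (O.chB Y) (.app t (ctxVars Y)))) →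
    Der TC (.term (O.ten (snocCh O.chA X U) Y)
      (O.T (snocCh O.chA X U) Y (.var (O.chA X)) (.app t (ctxVars Y))) W) →
    Der TC (.term (O.ten (snocCh O.chA X U) Y)
      (O.T (snocCh O.chA X U') Y (.var (O.chA X)) (.app t (ctxVars Y))) W) →
    Der TC (.termEq (O.ten (snocCh O.chA X U) Y)
      (O.T (snocCh O.chA X U) Y (.var (O.chA X)) (.app t (ctxVars Y)))
      (O.T (snocCh O.chA X U') Y (.var (O.chA X)) (.app t (ctxVars Y))) W)
  ruleTEs : ∀ {X u u' U Y T W}, .termEq X u u' U ∈ TA → introSort Y T ∈ TB →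
    Der TA (.termEq X u u' U) → Der TB (.ctx Y) →
    W = (O.W (snocCh O.chA X U) (snocCh O.chB Y ⟨T, ctxVars Y⟩)
        U (.var (O.chA X)) ⟨T, ctxVars Y⟩ (.var (O.chB Y))).subst
          (O.TS X (snocCh O.chB Y ⟨T, ctxVars Y⟩) (upd .var (O.chA X) u) .var) →
    Der TC (.term (O.ten X (snocCh O.chB Y ⟨T, ctxVars Y⟩))
      (O.T X (snocCh O.chB Y ⟨T, ctxVars Y⟩) u (.var (O.chB Y))) W) →
    Der TC (.term (O.ten X (snocCh O.chB Y ⟨T, ctxVars Y⟩))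
      (O.T X (snocCh O.chB Y ⟨T, ctxVars Y⟩) u' (.var (O.chB Y))) W) →
    Der TC (.termEq (O.ten X (snocCh O.chB Y ⟨T, ctxVars Y⟩))
      (O.T X (snocCh O.chB Y ⟨T, ctxVars Y⟩) u (.var (O.chB Y)))
      (O.T X (snocCh O.chB Y ⟨T, ctxVars Y⟩) u' (.var (O.chB Y))) W)

/-- The laws of a tensor operation. -/
structure TD (O : TOps A B C) (TA : Set (Judg A)) (TB : Set (Judg B)) (TC : Set (Judg C)) :
    Prop where
  l : TDh O TA TB TC
  r : TDh O.op TB TA TC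

variable (D : TD O TA TB TC)

namespace TD

include D

theorem op : TD O.op TB TA TC := ⟨D.r, D.l⟩

theorem T_ind {P : Expr A → Expr B → Prop}
    (vv : ∀ x y, WT TA X (.var x) → WT TB Y (.var y) → P (.var x) (.var y))
    (hL : ∀ u U t ts, CanonSort TA X u U → Der TA (.term X u U) → WT TB Y (.app t ts) → ((∃ x,
      u = .var x) ∨ O.fL) → (∀ a ∈ U.args ++ [u], WT TA X a) → (∀ b ∈ ts, WT TB Y b) →
      (∀ a ∈ U.args ++ [u], ∀ b ∈ ts, P a b) → P u (.app t ts))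
    (hR : ∀ v V s ss, CanonSort TB Y v V → Der TB (.term Y v V) → WT TA X (.app s ss) → ((∃ y,
      v = .var y) ∨ O.fR) → (∀ b ∈ V.args ++ [v], WT TB Y b) → (∀ a ∈ ss, WT TA X a) →
      (∀ b ∈ V.args ++ [v], ∀ a ∈ ss, P a b) → P (.app s ss) v)
    {u v} (hu : WT TA X u) (hv : WT TB Y v) : P u v := by
  obtain ⟨U, hu⟩ := hu
  obtain ⟨V, hv⟩ := hv
  replace hu := hu.lv
  replace hv := hv.lv
  obtain ⟨p, hu⟩ := hu
  obtain ⟨q, hv⟩ := hv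
  generalize hn : p + q = n
  induction n using Nat.strong_induction_on generalizing p q u v U V with
  | _ n ih =>
  have key1 : ∀ t ts, v = .app t ts → ((∃ x, u = .var x) ∨ O.fL) → P u v := by
    rintro t ts rfl h
    obtain ⟨C, hC, hC', -⟩ := hu.canon D.l.pt
    have ha : ∀ a ∈ C.args ++ [u], ∃ U, Lv TA p (.term X a U) := by
      intro a ha
      rcases mem_append.1 ha with ha | ha
      · have h2 := hC'.pre
        rcases p with _ | p
        · exact h2.elim
        · obtain ⟨V, h3⟩ := h2.sort_args ha
          exact ⟨V, h3.mono (by omega)⟩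
      · simp at ha
        subst ha
        exact ⟨U, hu⟩
    rcases q with _ | q
    · exact hv.elim
    have hb : ∀ b ∈ ts, ∃ V, Lv TB q (.term Y b V) := fun b hb => hv.app_args hb
    refine hL u C t ts hC hC'.der ⟨V, hv.der⟩ h (fun a h => (ha a h).imp fun _ h => h.der)
      (fun a h => (hb a h).imp fun _ h => h.der) fun a h1 b h2 => ?_
    obtain ⟨_, h1⟩ := ha a h1
    obtain ⟨_, h2⟩ := hb b h2
    exact ih (p + q) (by omega) _ _ p h1 q h2 rfl
  have key2 : ∀ s ss, u = .app s ss → ((∃ y, v = .var y) ∨ O.fR) → P u v := by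
    rintro t ts rfl h
    obtain ⟨C, hC, hC', -⟩ := hv.canon D.r.pt
    have ha : ∀ a ∈ C.args ++ [v], ∃ U, Lv TB q (.term Y a U) := by
      intro a ha
      rcases mem_append.1 ha with ha | ha
      · have h2 := hC'.pre
        rcases q with _ | q
        · exact h2.elim
        · obtain ⟨V, h3⟩ := h2.sort_args ha
          exact ⟨V, h3.mono (by omega)⟩
      · simp at ha
        subst ha
        exact ⟨V, hv⟩
    rcases p with _ | p
    · exact hu.elim
    have hb : ∀ b ∈ ts, ∃ V, Lv TA p (.term X b V) := fun b hb => hu.app_args hb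
    refine hR v C t ts hC hC'.der ⟨U, hu.der⟩ h (fun a h => (ha a h).imp fun _ h => h.der)
      (fun a h => (hb a h).imp fun _ h => h.der) fun a h1 b h2 => ?_
    obtain ⟨_, h1⟩ := ha a h1
    obtain ⟨_, h2⟩ := hb b h2
    exact ih (p + q) (by omega) _ _ p h2 q h1 rfl
  cases u with
  | var x =>
    cases v with
    | var y => exact vv x y ⟨U, hu.der⟩ ⟨V, hv.der⟩
    | app t ts => exact key1 t ts rfl (.inl ⟨x, rfl⟩)
  | app s ss =>
    cases v with
    | var y => exact key2 s ss rfl (.inl ⟨y, rfl⟩)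
    | app t ts =>
      rcases D.l.ff with h | h
      · exact key1 t ts rfl (.inr h)
      · exact key2 s ss rfl (.inr h)

theorem grid_congr {α β γ : Type} {f g : α → β → γ} {l1 l2}
    (h : ∀ a ∈ l1, ∀ b ∈ l2, f a b = g a b) : O.grid f l1 l2 = O.grid g l1 l2 := by
  have e (f : α → β → γ) : O.grid f l1 l2 = (O.grid Prod.mk l1 l2).map fun p => f p.1 p.2 := by
    rw [D.l.grid_map]
  rw [e f, e g]
  refine map_congr_left fun z hz => ?_
  obtain ⟨a, ha, b, hb, rfl⟩ := (D.l.mem_grid _ _ _ _).1 hz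
  exact h a ha b hb

theorem T_mono (hX : Der TA (.ctx X)) (hX1 : Der TA (.ctx X1))
    (hY : Der TB (.ctx Y)) (hY1 : Der TB (.ctx Y1)) (hXs : X ⊆ X1) (hYs : Y ⊆ Y1) {u v}
    (hu : WT TA X u) (hv : WT TB Y v) : O.T X Y u v = O.T X1 Y1 u v := by
  refine D.T_ind (P := fun u v => O.T X Y u v = O.T X1 Y1 u v) ?_ ?_ ?_ hu hv
  · intro x y _ _
    rw [D.l.T_vv, D.l.T_vv]
  · intro u U t ts hU hu hv h _ _ ih
    rw [D.l.T_L hX hY ⟨_, hu⟩ hU hv h,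
      D.l.T_L hX1 hY1 (.wk ⟨_, hu⟩ hXs hX1) (hU.mono hXs) (hv.wk hYs hY1) h, TOps.L, TOps.L,
      D.grid_congr ih]
  · intro v V s ss hV hv hu h _ _ ih
    have e1 := D.r.T_L hY hX ⟨_, hv⟩ hV hu h
    have e2 := D.r.T_L hY1 hX1 (.wk ⟨_, hv⟩ hYs hY1) (hV.mono hYs) (hu.wk hXs hX1) h
    have e3 := D.op.grid_congr (f := O.op.T Y X) (g := O.op.T Y1 X1) ih
    rw [TOps.L] at e1 e2
    rw [e3] at e1
    exact e1.trans e2.symm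

theorem L_occurs {X Y U u t ts z} :
    Occurs z (O.L X Y U u t ts) ↔ ∃ a ∈ U.args ++ [u], ∃ b ∈ ts, Occurs z (O.T X Y a b) := by
  simp only [TOps.L, occurs_app_iff, D.l.mem_grid]
  aesop

theorem T_scope (hX : Der TA (.ctx X)) (hY : Der TB (.ctx Y)) {u v}
    (hu : WT TA X u) (hv : WT TB Y v) :
    ∀ z, Occurs z (O.T X Y u v) → ∃ p ∈ X, ∃ q ∈ Y, z = O.v p.1 q.1 := by
  refine D.T_ind (P := fun u v => ∀ z, Occurs z (O.T X Y u v) → ∃ p ∈ X, ∃ q ∈ Y, z = O.v p.1 q.1)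
    ?_ ?_ ?_ hu hv
  · intro x y hx hy z hz
    rw [D.l.T_vv, occurs_var_iff] at hz
    obtain ⟨U, hx⟩ := hx.var_mem
    obtain ⟨V, hy⟩ := hy.var_mem
    exact ⟨_, hx, _, hy, hz⟩
  · intro u U t ts hU hu hv h _ _ ih z hz
    rw [D.l.T_L hX hY ⟨_, hu⟩ hU hv h, D.L_occurs] at hz
    obtain ⟨a, ha, b, hb, hz⟩ := hz
    exact ih a ha b hb z hz
  · intro v V s ss hV hv hu h _ _ ih z hz
    have e1 : O.T X Y (.app s ss) v = O.op.L Y X V v s ss := D.r.T_L hY hX ⟨_, hv⟩ hV hu h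
    rw [e1, D.op.L_occurs] at hz
    obtain ⟨a, ha, b, hb, hz⟩ := hz
    exact ih a ha b hb z hz

omit D

end TD

namespace TD

/-! ### Grids, sorts and contexts -/

include D

theorem grid_eq {α β γ : Type} (f : α → β → γ) (l1 l2) :
    O.grid f l1 l2 = (O.grid Prod.mk l1 l2).map fun p => f p.1 p.2 := by
  rw [D.l.grid_map]

theorem grid_mapR {α β β' γ : Type} (f : α → β → γ) (h : β' → β) (l1 : List α) (l2 : List β') :
    O.grid f l1 (l2.map h) = O.grid (fun a b => f a (h b)) l1 l2 :=
  D.r.grid_mapL (fun b a => f a b) h l2 l1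

theorem grid_mk_map {α α' β β' : Type} (g : α' → α) (h : β' → β) (l1 : List α')
    (l2 : List β') :
    O.grid Prod.mk (l1.map g) (l2.map h) = (O.grid Prod.mk l1 l2).map fun p => (g p.1, h p.2) := by
  rw [D.l.grid_mapL, D.grid_mapR, D.l.grid_map]

theorem mem_ten {X Y z} : z ∈ O.ten X Y ↔ ∃ p ∈ X, ∃ q ∈ Y,
    (O.v p.1 q.1, O.W X Y p.2 (.var p.1) q.2 (.var q.1)) = z := D.l.mem_grid _ _ _ _

theorem mem_ten_of {X Y x U y V} (hx : (x, U) ∈ X) (hy : (y, V) ∈ Y) :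
    (O.v x y, O.W X Y U (.var x) V (.var y)) ∈ O.ten X Y :=
  D.mem_ten.2 ⟨_, hx, _, hy, rfl⟩

theorem v_inj {x y x' y'} (h : O.v x y = O.v x' y') : x = x' ∧ y = y' := by
  constructor
  · rw [← D.l.pa_v x y, h, D.l.pa_v]
  · have e := D.r.pa_v y x
    have e' := D.r.pa_v y' x'
    have h : O.op.v y x = O.op.v y' x' := h
    rw [← e, h, e']

theorem TS_v {X Y τ ρ x y} : O.TS X Y τ ρ (O.v x y) = O.T X Y (τ x) (ρ y) := by
  have e : O.pb (O.v x y) = y := D.r.pa_v y x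
  rw [TOps.TS, D.l.pa_v, e]

omit D

/-- The pairs of arguments appearing in the tensor of two sorts with terms. -/
def pairs (O : TOps A B C) (U : SortE A) (u : Expr A) (V : SortE B) (v : Expr B) :
    List (Expr A × Expr B) :=
  (O.grid Prod.mk (U.args ++ [u]) (V.args ++ [v])).dropLast

include D

theorem mem_pairs {u} {v} {p : Expr A × Expr B} :
    p ∈ pairs O U u V v ↔ (p.1 ∈ U.args ∧ p.2 ∈ V.args ++ [v]) ∨
      (p.1 ∈ U.args ++ [u] ∧ p.2 ∈ V.args) := by
  obtain ⟨a, b⟩ := p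
  rw [pairs, D.l.mem_dropLast]
  simp only [Prod.mk.injEq]
  constructor
  · rintro (⟨a', h1, b', h2, rfl, rfl⟩ | ⟨a', h1, b', h2, rfl, rfl⟩)
    · exact .inl ⟨h1, h2⟩
    · exact .inr ⟨h1, h2⟩
  · rintro (⟨h1, h2⟩ | ⟨h1, h2⟩)
    · exact .inl ⟨_, h1, _, h2, rfl, rfl⟩
    · exact .inr ⟨_, h1, _, h2, rfl, rfl⟩

theorem W_eq (X Y) (U : SortE A) (u) (V : SortE B) (v) :
    O.W X Y U u V v = ⟨O.gS U.head V.head, (pairs O U u V v).map fun p => O.T X Y p.1 p.2⟩ := by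
  rw [TOps.W, D.grid_eq, pairs, List.map_dropLast]

theorem pairs_subst (U : SortE A) (u) (V : SortE B) (v) (τ ρ) :
    pairs O (U.subst τ) (u.subst τ) (V.subst ρ) (v.subst ρ) =
      (pairs O U u V v).map fun p => (p.1.subst τ, p.2.subst ρ) := by
  rw [pairs, pairs, List.map_dropLast, ← D.grid_mk_map]
  simp

theorem W_congr {X Y X1 Y1} {u} {v}
    (h : ∀ a b, (a ∈ U.args ∧ b ∈ V.args ++ [v]) ∨ (a ∈ U.args ++ [u] ∧ b ∈ V.args) →
      O.T X Y a b = O.T X1 Y1 a b) :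
    O.W X Y U u V v = O.W X1 Y1 U u V v := by
  rw [D.W_eq, D.W_eq, map_congr_left]
  intro p hp
  exact h _ _ (D.mem_pairs.1 hp)

omit D

theorem args_wt {u} (hU : Der TA (.sort X U)) (hu : WT TA X u) {a} (ha : a ∈ U.args ++ [u]) :
    WT TA X a := by
  rcases mem_append.1 ha with h | h
  · exact hU.sort_args h
  · simp at h
    exact h ▸ hu

theorem pair_cases {u} {v} (hU : Der TA (.sort X U)) (hu : WT TA X u) (hV : Der TB (.sort Y V))
    (hv : WT TB Y v) {a b}
    (h : (a ∈ U.args ∧ b ∈ V.args ++ [v]) ∨ (a ∈ U.args ++ [u] ∧ b ∈ V.args)) :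
    WT TA X a ∧ WT TB Y b := by
  rcases h with h | h
  · exact ⟨hU.sort_args h.1, args_wt hV hv h.2⟩
  · exact ⟨args_wt hU hu h.1, hV.sort_args h.2⟩

include D

theorem W_mono (hX1 : Der TA (.ctx X1)) (hY1 : Der TB (.ctx Y1))
    (hXs : X ⊆ X1) (hYs : Y ⊆ Y1) {U u V v} (hU : Der TA (.sort X U)) (hu : WT TA X u)
    (hV : Der TB (.sort Y V)) (hv : WT TB Y v) : O.W X Y U u V v = O.W X1 Y1 U u V v :=
  D.W_congr fun a b h => by
    obtain ⟨ha, hb⟩ := pair_cases hU hu hV hv h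
    exact D.T_mono hU.sort_ctx hX1 hV.sort_ctx hY1 hXs hYs ha hb

theorem ten_mono (hX : Der TA (.ctx X)) (hX1 : Der TA (.ctx X1))
    (hY : Der TB (.ctx Y)) (hY1 : Der TB (.ctx Y1)) (hXs : X ⊆ X1) (hYs : Y ⊆ Y1) :
    O.ten X Y ⊆ O.ten X1 Y1 := by
  intro z hz
  obtain ⟨p, hp, q, hq, rfl⟩ := D.mem_ten.1 hz
  have h1 := hX.vars hp
  have h2 := hY.vars hq
  rw [D.W_mono hX1 hY1 hXs hYs h1.term_sort ⟨_, h1⟩ h2.term_sort ⟨_, h2⟩]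
  exact D.mem_ten_of (hXs hp) (hYs hq)

theorem mem_par {p q z} :
    z ∈ O.par (X ++ [p]) (Y ++ [q]) ↔
      (∃ p' ∈ X, ∃ q' ∈ Y ++ [q], (O.v p'.1 q'.1,
        O.W (X ++ [p]) (Y ++ [q]) p'.2 (.var p'.1) q'.2 (.var q'.1)) = z) ∨
      (∃ p' ∈ X ++ [p], ∃ q' ∈ Y, (O.v p'.1 q'.1,
        O.W (X ++ [p]) (Y ++ [q]) p'.2 (.var p'.1) q'.2 (.var q'.1)) = z) :=
  D.l.mem_dropLast _ _ _ _ _ _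

theorem par_sub {p q Γ} (hX : Der TA (.ctx (X ++ [p])))
    (hY : Der TB (.ctx (Y ++ [q]))) :
    O.par (X ++ [p]) (Y ++ [q]) ⊆ Γ ↔ O.ten X (Y ++ [q]) ⊆ Γ ∧ O.ten (X ++ [p]) Y ⊆ Γ := by
  have hX' := hX.ctx_split
  have hY' := hY.ctx_split
  constructor
  · intro h
    constructor
    · intro z hz
      obtain ⟨p', hp, q', hq, rfl⟩ := D.mem_ten.1 hz
      refine h (D.mem_par.2 (.inl ⟨p', hp, q', hq, ?_⟩))
      have h1 := hX'.vars hp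
      have h2 := hY.vars hq
      rw [D.W_mono hX hY (X := X) (by simp) (fun _ => id) h1.term_sort ⟨_, h1⟩ h2.term_sort ⟨_, h2⟩]
    · intro z hz
      obtain ⟨p', hp, q', hq, rfl⟩ := D.mem_ten.1 hz
      refine h (D.mem_par.2 (.inr ⟨p', hp, q', hq, ?_⟩))
      have h1 := hX.vars hp
      have h2 := hY'.vars hq
      rw [D.W_mono hX hY (Y := Y) (fun _ => id) (by simp) h1.term_sort ⟨_, h1⟩ h2.term_sort ⟨_, h2⟩]
  · rintro ⟨h, h'⟩ z hz
    rcases D.mem_par.1 hz with ⟨p', hp, q', hq, rfl⟩ | ⟨p', hp, q', hq, rfl⟩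
    · have h1 := hX'.vars hp
      have h2 := hY.vars hq
      rw [← D.W_mono hX hY (X := X) (by simp) (fun _ => id) h1.term_sort ⟨_, h1⟩ h2.term_sort ⟨_,
        h2⟩]
      exact h (D.mem_ten_of hp hq)
    · have h1 := hX.vars hp
      have h2 := hY'.vars hq
      rw [← D.W_mono hX hY (Y := Y) (fun _ => id) (by simp) h1.term_sort ⟨_, h1⟩ h2.term_sort ⟨_,
        h2⟩]
      exact h' (D.mem_ten_of hp hq)

theorem nodup_ten (hX : Der TA (.ctx X)) (hY : Der TB (.ctx Y)) :
    ((O.ten X Y).map Prod.fst).Nodup := by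
  have e : (O.ten X Y).map Prod.fst = O.grid O.v (X.map Prod.fst) (Y.map Prod.fst) := by
    rw [TOps.ten, D.l.grid_map, D.l.grid_mapL, D.grid_mapR]
  rw [e]
  exact D.l.grid_nodup _ _ _ (hX.ctxOK D.l.pt).2 (hY.ctxOK D.r.pt).2 fun a b a' b' => D.v_inj

theorem ctx_initial (hX : Der TA (.ctx X)) (hY : Der TB (.ctx Y)) {Γ}
    (hΓ : Γ <+: O.ten X Y)
    (H : ∀ X1 p Y1 q Δ z, (Δ ++ [z]) <+: Γ → X1 ++ [p] <+: X → Y1 ++ [q] <+: Y → Der TC (.ctx Δ) →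
      O.ten X1 (Y1 ++ [q]) ⊆ Δ → O.ten (X1 ++ [p]) Y1 ⊆ Δ → Der TC (.sort Δ (O.W (X1 ++ [p])
      (Y1 ++ [q]) p.2 (.var p.1) q.2 (.var q.1))))
    :
    Der TC (.ctx Γ) := by
  induction Γ using List.reverseRecOn with
  | nil => exact .nil
  | append_singleton Δ z ih =>
    have hΔ : Der TC (.ctx Δ) := ih (.trans (by simp) hΓ) fun X1 p Y1 q Δ' z' hh => H X1 p Y1 q Δ'
      z'
      (hh.trans (by simp))
    obtain ⟨X1, p, Y1, q, hX1, hY1, rfl, h1, h2⟩ := D.l.grid_split _ _ _ _ _ hΓ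
    have dX1 : Der TA (.ctx (X1 ++ [p])) := by
      obtain ⟨X2, rfl⟩ := hX1
      exact hX.ctx_split
    have dY1 : Der TB (.ctx (Y1 ++ [q])) := by
      obtain ⟨X2, rfl⟩ := hY1
      exact hY.ctx_split
    have vp := dX1.vars (p := p) (by simp)
    have vq := dY1.vars (p := q) (by simp)
    have k1 : O.ten X1 (Y1 ++ [q]) ⊆ Δ := by
      intro z hz
      obtain ⟨p', hp, q', hq, rfl⟩ := D.mem_ten.1 hz
      have v1 := dX1.ctx_split.vars hp
      have v2 := dY1.vars hq
      rw [D.W_mono hX hY (List.Subset.trans (by simp) hX1.subset) hY1.subset v1.term_sort ⟨_, v1⟩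
        v2.term_sort ⟨_, v2⟩]
      exact h1 _ hp _ hq
    have k2 : O.ten (X1 ++ [p]) Y1 ⊆ Δ := by
      intro z hz
      obtain ⟨p', hp, q', hq, rfl⟩ := D.mem_ten.1 hz
      have v1 := dX1.vars hp
      have v2 := dY1.ctx_split.vars hq
      rw [D.W_mono hX hY hX1.subset (List.Subset.trans (by simp) hY1.subset) v1.term_sort ⟨_, v1⟩
        v2.term_sort ⟨_, v2⟩]
      exact h2 _ hp _ hq
    have hs := H X1 p Y1 q Δ _ List.prefix_rfl hX1 hY1 hΔ k1 k2
    rw [D.W_mono hX hY hX1.subset hY1.subset vp.term_sort ⟨_, vp⟩ vq.term_sort ⟨_, vq⟩] at hs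
    refine .cons hs fun r hr e => ?_
    have nd := (D.nodup_ten hX hY).sublist (hΓ.map Prod.fst).sublist
    rw [map_append, List.nodup_append] at nd
    exact nd.2.2 _ (mem_map_of_mem hr) _ (by simp) e

omit D

end TD

/-! ### Levelwise facts about tensors -/

/-- Derivable sort equalities of bounded level, in either orientation. -/
def SQ (Ax : Set (Judg A)) (p : ℕ) (X : PreCtx A) (U U' : SortE A) : Prop :=
  Lv Ax p (.sortEq X U U') ∨ Lv Ax p (.sortEq X U' U)

theorem SQ.left {Ax : Set (Judg A)} {p X} {U U'} (h : SQ Ax p X U U') : Lv Ax p (.sort X U) := by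
  rcases h with h | h
  · exact h.pre.1
  · exact h.pre.2

theorem SQ.symm {Ax : Set (Judg A)} {p X} {U U'} (h : SQ Ax p X U U') : SQ Ax p X U' U := Or.symm h

theorem SQ.right {Ax : Set (Judg A)} {p X} {U U'} (h : SQ Ax p X U U') : Lv Ax p (.sort X U') :=
  h.symm.left

/-- The facts symmetric in the two factors. -/
structure Self (O : TOps A B C) (TA : Set (Judg A)) (TB : Set (Judg B)) (TC : Set (Judg C))
    (p q : ℕ) : Prop where
  sw : ∀ {X X0 Y Y0 Γ u U v V}, EC TA p X → EC TB q Y → X0 ⊆ X → Y0 ⊆ Y → TmS TA p X u U →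
    Lv TA p (.sort X0 U) → TmS TB q Y v V → Lv TB q (.sort Y0 V) → Der TC (.ctx Γ) →
    O.ten X Y0 ⊆ Γ → O.ten X0 Y ⊆ Γ → Der TC (.sort Γ (O.W X Y U u V v))
  t : ∀ {X Y Γ u U v V}, EC TA p X → EC TB q Y → CanonSort TA X u U → TmS TA p X u U →
    CanonSort TB Y v V → TmS TB q Y v V → Der TC (.ctx Γ) → O.ten X Y ⊆ Γ →
    Der TC (.term Γ (O.T X Y u v) (O.W X Y U u V v))
  e : ∀ {X Y Γ s ss U t ts V}, EC TA p X → EC TB q Y → CanonSort TA X (.app s ss) U →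
    TmS TA p X (.app s ss) U → CanonSort TB Y (.app t ts) V → TmS TB q Y (.app t ts) V →
    Der TC (.ctx Γ) → O.ten X Y ⊆ Γ →
    EqT TC Γ (O.L X Y U (.app s ss) t ts) (O.op.L Y X V (.app t ts) s ss)

/-- The facts about equalities in the first factor. -/
structure Half (O : TOps A B C) (TA : Set (Judg A)) (TB : Set (Judg B)) (TC : Set (Judg C))
    (p q : ℕ) : Prop where
  set : ∀ {X x U U' Y Γ v V}, SQ TA p X U U' → (∀ r ∈ X, r.1 ≠ x) → EC TB q Y → TmS TB q Y v V →
    Der TC (.ctx Γ) → O.ten (X ++ [(x, U)]) Y ⊆ Γ →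
    EqT TC Γ (O.T (X ++ [(x, U)]) Y (.var x) v) (O.T (X ++ [(x, U')]) Y (.var x) v)
  sew : ∀ {X x U U' Y Γ y V}, SQ TA p X U U' → (∀ r ∈ X, r.1 ≠ x) → EC TB q (Y ++ [(y, V)]) →
    Der TC (.ctx Γ) → O.ten (X ++ [(x, U)]) Y ⊆ Γ → O.ten X (Y ++ [(y, V)]) ⊆ Γ →
    Der TC (.sortEq Γ (O.W (X ++ [(x, U)]) (Y ++ [(y, V)]) U (.var x) V (.var y))
      (O.W (X ++ [(x, U')]) (Y ++ [(y, V)]) U' (.var x) V (.var y)))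
  te : ∀ {X u u' U Y Γ v V}, Lv TA p (.termEq X u u' U) → EC TB q Y → TmS TB q Y v V →
    Der TC (.ctx Γ) → O.ten X Y ⊆ Γ → EqT TC Γ (O.T X Y u v) (O.T X Y u' v)

/-- All facts at given levels. -/
structure Good (O : TOps A B C) (TA : Set (Judg A)) (TB : Set (Judg B)) (TC : Set (Judg C))
    (p q : ℕ) : Prop where
  self : Self O TA TB TC p q
  l : Half O TA TB TC p q
  r : Half O.op TB TA TC q p

variable (H1 : Good O TA TB TC p (q + 1))
  (H2 : Good O TA TB TC (p + 1) q) (H : Good O TA TB TC p q)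

theorem Self.op (H : Self O TA TB TC p q) : Self O.op TB TA TC q p where
  sw hX hY hXs hYs hu hU hv hV hΓ h1 h2 := by
    have := H.sw hY hX hYs hXs hv hV hu hU hΓ h2 h1
    exact this
  t hX hY hu hu' hv hv' hΓ h := by
    have := H.t hY hX hv hv' hu hu' hΓ h
    exact this
  e hX hY hu hu' hv hv' hΓ h := (H.e hY hX hv hv' hu hu' hΓ h).symm

include H

theorem Good.op : Good O.op TB TA TC q p := ⟨H.self.op, H.r, H.l⟩

omit H

theorem EC.initial {Ax : Set (Judg A)} (h : EC Ax p X) (hs : X1 <+: X) :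
    EC Ax p X1 := by
  obtain ⟨X2, rfl⟩ := hs
  induction X2 using List.reverseRecOn with
  | nil => simpa using h
  | append_singleton X2 z ih =>
    rw [← List.append_assoc] at h
    exact ih h.of_snoc.1

include D

theorem Self.ctx_ten (H : Self O TA TB TC p q) {X Y} (hX : EC TA p X)
    (hY : EC TB q Y) : Der TC (.ctx (O.ten X Y)) := by
  refine D.ctx_initial hX.der hY.der List.prefix_rfl ?_
  intro X1 r Y1 s Δ z _ h1 h2 hΔ h3 h4
  have e1 := hX.initial h1
  have e2 := hY.initial h2
  obtain ⟨e3, ⟨X0, hX0, l0⟩, -⟩ := e1.of_snoc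
  obtain ⟨e4, ⟨Y0, hY0, l1⟩, -⟩ := e2.of_snoc
  exact H.sw e1 e2 (List.Subset.trans hX0 (by simp)) (List.Subset.trans hY0 (by simp))
    (.of_mem (by simp)) l0 (.of_mem (by simp)) l1 hΔ
    (List.Subset.trans (D.ten_mono e1.der e1.der l1.sort_ec.der e4.der (fun _ => id) hY0) h4)
    (List.Subset.trans (D.ten_mono l0.sort_ec.der e3.der e2.der e2.der hX0 (fun _ => id)) h3)

omit D

/-- Substitutions of bounded level. -/
def LSub (Ax : Set (Judg A)) (p : ℕ) (X X' : PreCtx A) (τ : A.Var → Expr A) : Prop :=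
  ∀ z ∈ X', TmS Ax p X (τ z.1) (z.2.subst τ)

theorem LSub.isSub {Ax : Set (Judg A)} {τ} (h : LSub Ax p X X' τ) (hX : Der Ax (.ctx X)) :
    IsSub Ax X X' τ := fun z hz => (h z hz).der hX

namespace TD

include D

theorem forall₂_grid {α β : Type} {R : Expr C → Expr C → Prop}
    {f g : α → β → Expr C} {l1 l2}
    (h : ∀ a ∈ l1, ∀ b ∈ l2, R (f a b) (g a b)) :
    List.Forall₂ R (O.grid f l1 l2) (O.grid g l1 l2) := by
  rw [D.grid_eq f, D.grid_eq g, List.forall₂_map_left_iff, List.forall₂_map_right_iff,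
    List.forall₂_same]
  intro z hz
  obtain ⟨a, ha, b, hb, rfl⟩ := (D.l.mem_grid _ _ _ _).1 hz
  exact h a ha b hb

theorem L_eqT {Γ X Y X1 Y1} {u t ts} {W}
    (hd : Der TC (.term Γ (O.L X Y U u t ts) W)) (σ1 : A.Var → Expr A) (ρ1 : B.Var → Expr B)
    (θ : C.Var → Expr C) {V : SortE A} {v : Expr A} {bs : List (Expr B)} (e1 : U = V.subst σ1)
    (e2 : u = v.subst σ1) (e3 : ts = bs.map (Expr.subst ρ1))
    (h : ∀ a ∈ V.args ++ [v], ∀ b ∈ bs, EqT TC Γ (O.T X Y (a.subst σ1) (b.subst ρ1))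
      ((O.T X1 Y1 a b).subst θ))
    :
    EqT TC Γ (O.L X Y U u t ts) ((O.L X1 Y1 V v t bs).subst θ) := by
  subst e1 e2 e3
  rw [TOps.L] at hd ⊢
  rw [TOps.L, Expr.subst_app, D.l.grid_map]
  refine EqT.app D.l.ptC hd ?_
  have e : (V.subst σ1).args ++ [v.subst σ1] = (V.args ++ [v]).map (Expr.subst σ1) := by simp
  rw [e, D.l.grid_mapL, D.grid_mapR]
  exact D.forall₂_grid h

theorem W_subst_gen {X Y X' Y' τ ρ XS YT} {S : A.SortSym} {T : B.SortSym} {x y} :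
    (O.W X' Y' ⟨S, ctxVars XS⟩ (.var x) ⟨T, ctxVars YT⟩ (.var y)).subst (O.TS X Y τ ρ) =
      O.W X Y (SortE.subst τ ⟨S, ctxVars XS⟩) (τ x) (SortE.subst ρ ⟨T, ctxVars YT⟩) (ρ y) := by
  have e := D.pairs_subst ⟨S, ctxVars XS⟩ (.var x) ⟨T, ctxVars YT⟩ (.var y) τ ρ
  rw [Expr.subst_var, Expr.subst_var] at e
  rw [D.W_eq X Y, e, D.W_eq]
  simp only [SortE.subst, map_map]
  congr 1
  refine map_congr_left fun r hr => ?_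
  have hh := D.mem_pairs.1 hr
  obtain ⟨a, b⟩ := r
  have ha : ∃ z, a = .var z := by
    simp only [ctxVars, mem_append, mem_map, mem_singleton] at hh
    rcases hh with ⟨⟨z, -, h⟩, -⟩ | ⟨⟨z, -, h⟩ | h, -⟩
    · exact ⟨_, h.symm⟩
    · exact ⟨_, h.symm⟩
    · exact ⟨_, h⟩
  have hb : ∃ z, b = .var z := by
    simp only [ctxVars, mem_append, mem_map, mem_singleton] at hh
    rcases hh with ⟨-, ⟨z, -, h⟩ | h⟩ | ⟨-, ⟨z, -, h⟩⟩
    · exact ⟨_, h.symm⟩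
    · exact ⟨_, h⟩
    · exact ⟨_, h.symm⟩
  obtain ⟨a, rfl⟩ := ha
  obtain ⟨b, rfl⟩ := hb
  simp [D.l.T_vv, D.TS_v]

omit D

end TD

/-- A pair of substitutions of bounded levels, together with an ambient context for the tensor. -/
structure Sit (O : TOps A B C) (TA : Set (Judg A)) (TB : Set (Judg B)) (TC : Set (Judg C))
    (p q : ℕ) (X : PreCtx A) (Y : PreCtx B) (Γ : PreCtx C) (X' : PreCtx A) (Y' : PreCtx B)
    (τ : A.Var → Expr A) (ρ : B.Var → Expr B) : Prop where
  eX : EC TA p X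
  eY : EC TB q Y
  dΓ : Der TC (.ctx Γ)
  sub : O.ten X Y ⊆ Γ
  dX : Der TA (.ctx X')
  dY : Der TB (.ctx Y')
  lτ : LSub TA p X X' τ
  lρ : LSub TB q Y Y' ρ

theorem Sit.op (h : Sit O TA TB TC p q X Y Γ X' Y' τ ρ) : Sit O.op TB TA TC q p Y X Γ Y' X' ρ τ :=
  ⟨h.eY, h.eX, h.dΓ, h.sub, h.dY, h.dX, h.lρ, h.lτ⟩

/-- Compatibility of the tensor of two terms with a substitution. -/
def S1 (O : TOps A B C) (TC : Set (Judg C)) (X : PreCtx A) (Y : PreCtx B)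
    (Γ : PreCtx C) (X' : PreCtx A) (Y' : PreCtx B) (τ : A.Var → Expr A) (ρ : B.Var → Expr B)
      (u' : Expr A) (v' : Expr B) : Prop :=
  EqT TC Γ (O.T X Y (u'.subst τ) (v'.subst ρ)) ((O.T X' Y' u' v').subst (O.TS X Y τ ρ))

/-- The tensor of substitution entries with applications expands at the left. -/
def HL (O : TOps A B C) (TB : Set (Judg B)) (TC : Set (Judg C)) (q : ℕ) (X : PreCtx A)
    (Y : PreCtx B) (Γ : PreCtx C) (X' : PreCtx A) (τ : A.Var → Expr A) : Prop :=
  ∀ z ∈ X', ∀ t ts V, TmS TB q Y (.app t ts) V →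
    EqT TC Γ (O.T X Y (τ z.1) (.app t ts)) (O.L X Y (z.2.subst τ) (τ z.1) t ts)

include D

/-- The tensor of a term with two substitutable terms is derivable. -/
theorem Self.wt (H : Self O TA TB TC p q) (hX : EC TA p X) (hY : EC TB q Y)
    (hΓ : Der TC (.ctx Γ)) (hs : O.ten X Y ⊆ Γ) {u U v V} (hu : TmS TA p X u U)
    (hv : TmS TB q Y v V) : WT TC Γ (O.T X Y u v) := by
  obtain ⟨C, h1, h2, -⟩ := hu.canon D.l.pt
  obtain ⟨C', h3, h4, -⟩ := hv.canon D.r.pt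
  exact ⟨_, H.t hX hY h1 h2 h3 h4 hΓ hs⟩

theorem S1_caseL (H : Self O TA TB TC p q)
    (h : Sit O TA TB TC p q X Y Γ X' Y' τ ρ) (hL : HL O TB TC q X Y Γ X' τ) {u U t ts}
    (hU : CanonSort TA X' u U) (hu : Der TA (.term X' u U)) (hv : WT TB Y' (.app t ts))
    (hf : (∃ x, u = .var x) ∨ O.fL)
    (ih : ∀ a ∈ U.args ++ [u], ∀ b ∈ ts, (∃ U, TmS TA p X (a.subst τ) U) →
      (∃ V, TmS TB q Y (b.subst ρ) V) → S1 O TC X Y Γ X' Y' τ ρ a b)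
    (hu' : ∃ U, TmS TA p X (u.subst τ) U) (hv' : ∃ V, TmS TB q Y (Expr.subst ρ (.app t ts)) V) :
    S1 O TC X Y Γ X' Y' τ ρ u (.app t ts) := by
  obtain ⟨V, hv'⟩ := hv'
  obtain ⟨U1, hu'⟩ := hu'
  rw [S1, D.l.T_L h.dX h.dY ⟨_, hu⟩ hU hv hf]
  rw [Expr.subst_app] at hv' ⊢
  have key : TmS TA p X (u.subst τ) (U.subst τ) ∧
      EqT TC Γ (O.T X Y (u.subst τ) (.app t (ts.map (Expr.subst ρ))))
        (O.L X Y (U.subst τ) (u.subst τ) t (ts.map (Expr.subst ρ))) := by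
    cases u with
    | var x =>
      have hx := canonSort_var.1 hU
      rw [Expr.subst_var]
      exact ⟨h.lτ _ hx, hL _ hx _ _ _ hv'⟩
    | app s ss =>
      have hf : O.fL := by simpa using hf
      obtain ⟨C, c1, c2, -⟩ := hu'.canon D.l.pt
      have e : C = U.subst τ := by
        obtain ⟨Xa, V, σ, hax, hV, hσ, rfl, -⟩ := hu.inv_app
        obtain rfl := hU.app_inv D.l.pt hax hV
        have e2 : Expr.subst τ (.app s (Xa.map fun p => σ p.1)) =
            .app s (Xa.map fun p => (σ p.1).subst τ) := by simp [Function.comp_def]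
        rw [e2] at c1
        rw [c1.app_inv D.l.pt hax hV (σ := fun z => (σ z).subst τ), SortE.subst_subst]
      subst e
      refine ⟨c2, ?_⟩
      obtain ⟨W, hW⟩ := H.wt D h.eX h.eY h.dΓ h.sub c2 hv'
      rw [D.l.T_L h.eX.der h.eY.der ⟨_, c2.der h.eX.der⟩ c1 ⟨_, hv'.der h.eY.der⟩ (.inr hf)] at hW ⊢
      exact .refl hW
  obtain ⟨k1, k2⟩ := key
  have k3 : WT TC Γ (O.L X Y (U.subst τ) (u.subst τ) t (ts.map (Expr.subst ρ))) := by
    obtain ⟨W, k2⟩ := k2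
    exact ⟨W, k2.termEq_right⟩
  obtain ⟨W, k3⟩ := k3
  refine k2.trans D.l.ptC (D.L_eqT (X1 := X') (Y1 := Y') k3 τ ρ
    (O.TS X Y τ ρ) rfl rfl rfl fun a ha b hb => ih a ha b hb ?_ (hv'.args (mem_map_of_mem hb)))
  rcases mem_append.1 ha with ha | ha
  · exact (k1.sds h.eX).args (a := a.subst τ) (by simpa using mem_map_of_mem ha)
  · simp at ha
    subst ha
    exact ⟨_, k1⟩

theorem S1_core (H : Self O TA TB TC p q)
    (h : Sit O TA TB TC p q X Y Γ X' Y' τ ρ) (hL : HL O TB TC q X Y Γ X' τ)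
    (hR : HL O.op TA TC p Y X Γ Y' ρ) {u v} (hu : WT TA X' u) (hv : WT TB Y' v)
    (hu' : ∃ U, TmS TA p X (u.subst τ) U) (hv' : ∃ V, TmS TB q Y (v.subst ρ) V) :
    S1 O TC X Y Γ X' Y' τ ρ u v := by
  revert hu' hv'
  refine D.T_ind (P := fun u v => (∃ U, TmS TA p X (u.subst τ) U) →
    (∃ V, TmS TB q Y (v.subst ρ) V) → S1 O TC X Y Γ X' Y' τ ρ u v) ?_ ?_ ?_ hu hv
  · rintro x y hx hy ⟨U, hu⟩ ⟨V, hv⟩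
    obtain ⟨W, hW⟩ := H.wt D h.eX h.eY h.dΓ h.sub hu hv
    rw [S1, D.l.T_vv]
    rw [Expr.subst_var, Expr.subst_var] at hW ⊢
    rw [Expr.subst_var, D.TS_v]
    exact .refl hW
  · intro u U t ts hU hu hv hf _ _ ih hu' hv'
    exact S1_caseL D H h hL hU hu hv hf ih hu' hv'
  · intro v V s ss hV hv hu hf _ _ ih hu' hv'
    exact S1_caseL D.op H.op h.op hR hV hv hu hf (fun b hb a ha h1 h2 => ih b hb a ha h2 h1) hv' hu'

theorem W_S1 {u} {v}
    (h : ∀ a b, (a ∈ U.args ∧ b ∈ V.args ++ [v]) ∨ (a ∈ U.args ++ [u] ∧ b ∈ V.args) →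
      S1 O TC X Y Γ X' Y' τ ρ a b)
    (hd : Der TC (.sort Γ (O.W X Y (U.subst τ) (u.subst τ) (V.subst ρ) (v.subst ρ))) ∨ Der TC
      (.sort Γ ((O.W X' Y' U u V v).subst (O.TS X Y τ ρ))))
    :
    Der TC (.sortEq Γ (O.W X Y (U.subst τ) (u.subst τ) (V.subst ρ) (v.subst ρ))
      ((O.W X' Y' U u V v).subst (O.TS X Y τ ρ))) := by
  have e1 : O.W X Y (U.subst τ) (u.subst τ) (V.subst ρ) (v.subst ρ) = ⟨O.gS U.head V.head,
      (TD.pairs O U u V v).map fun p => O.T X Y (p.1.subst τ) (p.2.subst ρ)⟩ := by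
    rw [D.W_eq, D.pairs_subst, map_map]
    rfl
  have e2 : (O.W X' Y' U u V v).subst (O.TS X Y τ ρ) = ⟨O.gS U.head V.head,
      (TD.pairs O U u V v).map fun p => (O.T X' Y' p.1 p.2).subst (O.TS X Y τ ρ)⟩ := by
    rw [D.W_eq, SortE.subst, map_map]
    rfl
  rw [e1, e2] at hd ⊢
  rcases hd with hd | hd
  · refine sortEq_congr D.l.ptC hd ?_
    rw [List.forall₂_map_left_iff, List.forall₂_map_right_iff, List.forall₂_same]
    exact fun r hr => h _ _ (D.mem_pairs.1 hr)
  · refine (sortEq_congr D.l.ptC hd ?_).s2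
    rw [List.forall₂_map_left_iff, List.forall₂_map_right_iff, List.forall₂_same]
    exact fun r hr => (h _ _ (D.mem_pairs.1 hr)).symm

/-! ### Updates of substitutions -/

omit D

theorem sort_upd {Ax : Set (Judg A)} (hPT : PT Ax) {U} {x u} (h : Der Ax (.sort X U))
    (hx : ∀ r ∈ X, r.1 ≠ x) : U.subst (upd τ x u) = U.subst τ := by
  refine SortE.subst_congr _ fun z hz => upd_ne _ _ ?_
  obtain ⟨r, hr, rfl⟩ := mem_map.1 (h.sscoped hPT z hz)
  exact hx r hr

theorem term_upd {Ax : Set (Judg A)} (hPT : PT Ax) {v} {x u} (h : WT Ax X v)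
    (hx : ∀ r ∈ X, r.1 ≠ x) : v.subst (upd τ x u) = v.subst τ := by
  obtain ⟨V, h⟩ := h
  refine Expr.subst_congr _ fun z hz => upd_ne _ _ ?_
  obtain ⟨r, hr, rfl⟩ := mem_map.1 (h.escoped hPT z hz)
  exact hx r hr

theorem upd_snoc {Ax : Set (Judg A)} (hPT : PT Ax) {U} {x u} (h : Der Ax (.ctx (X ++ [(x, U)])))
    {P : Expr A → SortE A → Prop} (h1 : ∀ z ∈ X, P (τ z.1) (z.2.subst τ)) (h2 : P u (U.subst τ)) :
    ∀ z ∈ X ++ [(x, U)], P (upd τ x u z.1) (z.2.subst (upd τ x u)) := by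
  obtain ⟨hU, hx⟩ := h.ctx_snoc
  intro z hz
  rcases mem_append.1 hz with hz | hz
  · have hz' := (hU.sort_ctx.vars hz).term_sort
    rw [sort_upd hPT hz' hx, upd_ne _ _ (hx z hz)]
    exact h1 z hz
  · simp at hz
    subst hz
    rw [sort_upd hPT hU hx, upd_self]
    exact h2

theorem upd_snoc_var {Ax : Set (Judg A)} (hPT : PT Ax) {U} {x u}
    (h : Der Ax (.ctx (X ++ [(x, U)]))) {P : Expr A → SortE A → Prop}
    (h1 : ∀ z ∈ X, P (.var z.1) z.2) (h2 : P u U) :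
    ∀ z ∈ X ++ [(x, U)], P (upd Expr.var x u z.1) (z.2.subst (upd Expr.var x u)) :=
  upd_snoc hPT h (by simpa [SortE.subst_id] using h1) (by simpa [SortE.subst_id] using h2)

theorem LSub.var {Ax : Set (Judg A)} : LSub Ax p X X Expr.var := fun z hz => by
  rw [SortE.subst_id]
  exact .of_mem hz

/-! ### Substitution and canonical sorts -/

include D

theorem TL (H : Self O TA TB TC p q) (hX : EC TA p X) (hY : EC TB q Y)
    (hΓ : Der TC (.ctx Γ)) (hs : O.ten X Y ⊆ Γ) {u U t ts V} (hu : CanonSort TA X u U)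
    (hu' : TmS TA p X u U) (hv : TmS TB q Y (.app t ts) V) :
    EqT TC Γ (O.T X Y u (.app t ts)) (O.L X Y U u t ts) := by
  obtain ⟨W, hW⟩ := H.wt D hX hY hΓ hs hu' hv
  by_cases hf : (∃ x, u = .var x) ∨ O.fL
  · rw [D.l.T_L hX.der hY.der ⟨_, hu'.der hX.der⟩ hu ⟨_, hv.der hY.der⟩ hf] at hW ⊢
    exact .refl hW
  · rw [not_or] at hf
    have hR : O.fR := D.l.ff.resolve_left hf.2
    cases u with
    | var x => exact (hf.1 ⟨x, rfl⟩).elim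
    | app s ss =>
      obtain ⟨C', h3, h4, -⟩ := hv.canon D.r.pt
      have e : O.T X Y (.app s ss) (.app t ts) = O.op.L Y X C' (.app t ts) s ss :=
        D.r.T_L hY.der hX.der ⟨_, h4.der hY.der⟩ h3 ⟨_, hu'.der hX.der⟩ (.inr hR)
      rw [e]
      exact (H.e hX hY hu hu' h3 h4 hΓ hs).symm

theorem Sit.HL_canon (H : Self O TA TB TC p q)
    (h : Sit O TA TB TC p q X Y Γ X' Y' τ ρ)
    (hc : ∀ z ∈ X', CanonSort TA X (τ z.1) (z.2.subst τ)) : HL O TB TC q X Y Γ X' τ :=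
  fun z hz _ _ _ ht => TL D H h.eX h.eY h.dΓ h.sub (hc z hz) (h.lτ z hz) ht

omit D

/-- Compatibility with a pair of substitutions for all substitutable terms. -/
def S1All (O : TOps A B C) (TA : Set (Judg A)) (TB : Set (Judg B)) (TC : Set (Judg C)) (p q : ℕ)
    (X : PreCtx A) (Y : PreCtx B)
    (Γ : PreCtx C) (X' : PreCtx A) (Y' : PreCtx B) (τ : A.Var → Expr A) (ρ : B.Var → Expr B) :
    Prop :=
  ∀ {u v}, WT TA X' u → WT TB Y' v → (∃ U, TmS TA p X (u.subst τ) U) →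
    (∃ V, TmS TB q Y (v.subst ρ) V) → S1 O TC X Y Γ X' Y' τ ρ u v

include D

theorem W_sit (h : Sit O TA TB TC p q X Y Γ X' Y' τ ρ)
    (hS : S1All O TA TB TC p q X Y Γ X' Y' τ ρ) {U u V v} (hu : Der TA (.term X' u U))
    (hu' : TmS TA p X (u.subst τ) (U.subst τ)) (hv : Der TB (.term Y' v V))
    (hv' : TmS TB q Y (v.subst ρ) (V.subst ρ))
    (hd : Der TC (.sort Γ (O.W X Y (U.subst τ) (u.subst τ) (V.subst ρ) (v.subst ρ))) ∨
      Der TC (.sort Γ ((O.W X' Y' U u V v).subst (O.TS X Y τ ρ)))) :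
    Der TC (.sortEq Γ (O.W X Y (U.subst τ) (u.subst τ) (V.subst ρ) (v.subst ρ))
      ((O.W X' Y' U u V v).subst (O.TS X Y τ ρ))) := by
  refine W_S1 D (fun a b hab => ?_) hd
  obtain ⟨h1, h2⟩ := TD.pair_cases hu.term_sort ⟨_, hu⟩ hv.term_sort ⟨_, hv⟩ hab
  have k1 : ∀ a ∈ U.args, ∃ U, TmS TA p X (a.subst τ) U := fun a ha =>
    (hu'.sds h.eX).args (by simpa using mem_map_of_mem ha)
  have k2 : ∀ b ∈ V.args, ∃ U, TmS TB q Y (b.subst ρ) U := fun a ha =>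
    (hv'.sds h.eY).args (by simpa using mem_map_of_mem ha)
  refine hS h1 h2 ?_ ?_
  · rcases hab with ⟨h, -⟩ | ⟨h, -⟩
    · exact k1 a h
    · rcases mem_append.1 h with h | h
      · exact k1 a h
      · simp at h
        exact h ▸ ⟨_, hu'⟩
  · rcases hab with ⟨-, h⟩ | ⟨-, h⟩
    · rcases mem_append.1 h with h | h
      · exact k2 b h
      · simp at h
        exact h ▸ ⟨_, hv'⟩
    · exact k2 b h

omit D

/-- The tensor of two terms is derivable at the tensor of their sorts. -/
def PairOK (O : TOps A B C) (TC : Set (Judg C)) (X : PreCtx A) (Y : PreCtx B) (Γ : PreCtx C)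
    (U : SortE A) (u : Expr A) (V : SortE B) (v : Expr B) : Prop :=
  Der TC (.term Γ (O.T X Y u v) (O.W X Y U u V v))

include D

theorem Sit.mor_core (h : Sit O TA TB TC p q X Y Γ X' Y' τ ρ)
    (hS : S1All O TA TB TC p q X Y Γ X' Y' τ ρ)
    (hP : ∀ z ∈ X', ∀ w ∈ Y', PairOK O TC X Y Γ (z.2.subst τ) (τ z.1) (w.2.subst ρ) (ρ w.1)) :
    IsSub TC Γ (O.ten X' Y') (O.TS X Y τ ρ) := by
  intro r hr
  obtain ⟨z, hz, w, hw, rfl⟩ := D.mem_ten.1 hr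
  have h1 := hP z hz w hw
  have w := W_sit D h hS (h.dX.vars hz) (by rw [Expr.subst_var]; exact h.lτ z hz)
    (h.dY.vars hw) (by rw [Expr.subst_var]; exact h.lρ w hw)
    (.inl (by rw [Expr.subst_var, Expr.subst_var]; exact h1.term_sort))
  rw [Expr.subst_var, Expr.subst_var] at w
  rw [D.TS_v]
  exact .seqt w h1

theorem Sit.s1_canon (H : Self O TA TB TC p q)
    (h : Sit O TA TB TC p q X Y Γ X' Y' τ ρ)
    (hc : ∀ z ∈ X', CanonSort TA X (τ z.1) (z.2.subst τ))
    (hc' : ∀ z ∈ Y', CanonSort TB Y (ρ z.1) (z.2.subst ρ)) :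
    S1All O TA TB TC p q X Y Γ X' Y' τ ρ := fun hu hv hu' hv' =>
  S1_core D H h (h.HL_canon D H hc) (h.op.HL_canon D.op H.op hc') hu hv hu' hv'

theorem Sit.mor_canon (H : Self O TA TB TC p q)
    (h : Sit O TA TB TC p q X Y Γ X' Y' τ ρ)
    (hc : ∀ z ∈ X', CanonSort TA X (τ z.1) (z.2.subst τ))
    (hc' : ∀ z ∈ Y', CanonSort TB Y (ρ z.1) (z.2.subst ρ)) :
    IsSub TC Γ (O.ten X' Y') (O.TS X Y τ ρ) :=
  h.mor_core D (h.s1_canon D H hc hc') fun z hz w hw =>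
    H.t h.eX h.eY (hc z hz) (h.lτ z hz) (hc' w hw) (h.lρ w hw) h.dΓ h.sub

theorem sit_upd (hX : EC TA p X) (hY : EC TB q Y)
    (hΓ : Der TC (.ctx Γ)) (hs : O.ten X Y ⊆ Γ) {X0 U x u} (hX0 : X0 ⊆ X)
    (hU : Der TA (.sort X0 U)) (hx : ∀ r ∈ X, r.1 ≠ x) (hu : TmS TA p X u U) :
    Sit O TA TB TC p q X Y Γ (X0 ++ [(x, U)]) Y (upd .var x u) .var where
  eX := hX
  eY := hY
  dΓ := hΓ
  sub := hs
  dX := .cons hU fun r hr => hx r (hX0 hr)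
  dY := hY.der
  lτ := upd_snoc_var D.l.pt (.cons hU fun r hr => hx r (hX0 hr)) (fun z hz => .of_mem (hX0 hz)) hu
  lρ := .var

theorem var_eq_insert {U x} (hX : Der TA (.ctx X)) (hY : Der TB (.ctx Y))
    (hx : ∀ r ∈ X, r.1 ≠ x) {u a v} (ha : WT TA X a) (hv : WT TB Y v)
    (hU : Der TA (.sort X U)) :
    (O.T (X ++ [(x, U)]) Y a v).subst (O.TS X Y (upd .var x u) .var) = O.T X Y a v := by
  rw [← D.T_mono hX (.cons hU hx) hY hY (by simp) (fun _ => id) ha hv]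
  conv_rhs => rw [← Expr.subst_id (O.T X Y a v)]
  refine Expr.subst_congr _ fun z hz => ?_
  obtain ⟨r, hr, w, hw, rfl⟩ := D.T_scope hX hY ha hv z hz
  rw [D.TS_v, upd_ne _ _ (hx r hr), D.l.T_vv]

include H

theorem T_insert (hX : EC TA p X) (hY : EC TB q Y)
    (hΓ : Der TC (.ctx Γ)) (hs : O.ten X Y ⊆ Γ) {u U v V x} (hu : TmS TA p X u U)
    (hv : TmS TB q Y v V) (hx : ∀ r ∈ X, r.1 ≠ x) :
    EqT TC Γ ((O.T (X ++ [(x, U)]) Y (.var x) v).subst (O.TS X Y (upd .var x u) .var))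
      (O.T X Y u v) := by
  obtain ⟨C, c1, c2, c3⟩ := hu.canon D.l.pt
  have hv' : WT TB Y v := ⟨_, hv.der hY.der⟩
  have canon {X0} (hX0 : X0 ⊆ X) (hC : Der TA (.sort X0 C)) :
      IsSub TC Γ (O.ten (X0 ++ [(x, C)]) Y) (O.TS X Y (upd .var x u) .var) ∧
      EqT TC Γ ((O.T (X0 ++ [(x, C)]) Y (.var x) v).subst (O.TS X Y (upd .var x u) .var))
        (O.T X Y u v) := by
    have k := sit_upd D hX hY hΓ hs hX0 hC hx c2
    have k1 := upd_snoc_var (P := CanonSort TA X) D.l.pt k.dX (u := u)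
      (fun z hz => canonSort_var.2 (hX0 hz)) c1
    have k2 : ∀ z ∈ Y, CanonSort TB Y (Expr.var z.1) (z.2.subst Expr.var) := fun z hz => by
      rw [SortE.subst_id]
      exact canonSort_var.2 hz
    refine ⟨k.mor_canon D H.self k1 k2, ?_⟩
    have s := k.s1_canon D H.self k1 k2 (u := .var x) (v := v)
      ⟨_, k.dX.vars (p := (x, C)) (by simp)⟩ hv' ⟨C, by simpa [upd_self] using c2⟩
      ⟨V, by simpa [Expr.subst_id] using hv⟩
    rw [S1, Expr.subst_var, upd_self, Expr.subst_id] at s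
    exact s.symm
  rcases c3 with rfl | ⟨X0, hX0, c3⟩
  · exact (canon (fun _ => id) (c2.der hX.der).term_sort).2
  · obtain ⟨m, e⟩ := canon hX0 c3.pre.1.der
    have hx0 : ∀ r ∈ X0, r.1 ≠ x := fun r hr => hx r (hX0 hr)
    have hΔ := H.self.ctx_ten D (X := X0 ++ [(x, C)]) (.snoc c3.pre.1.sort_ec
      (fun _ => id) c3.pre.1 hx0) hY
    have k := (H.l.set (.inl c3) hx0 hY hv hΔ (fun _ => id)).subst m hΓ
    have hxU : Der TA (.ctx (X ++ [(x, U)])) := .cons (hu.der hX.der).term_sort hx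
    have hxU0 : Der TA (.ctx (X0 ++ [(x, U)])) := .cons c3.der.sortEq_right hx0
    rw [D.T_mono hxU0 hxU hY.der hY.der (by
      intro z hz
      simp only [mem_append] at hz ⊢
      exact hz.imp_left fun h => hX0 h) (fun _ => id) ⟨_, hxU0.vars (p := (x, U))
        (by simp)⟩ hv'] at k
    exact k.symm.trans D.l.ptC e

theorem TL_typed (hX : EC TA p X) (hY : EC TB q Y)
    (hΓ : Der TC (.ctx Γ)) (hs : O.ten X Y ⊆ Γ) {u U t ts V} (hu : TmS TA p X u U)
    (hv : TmS TB q Y (.app t ts) V) :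
    EqT TC Γ (O.T X Y u (.app t ts)) (O.L X Y U u t ts) := by
  have hx : ∀ r ∈ X, r.1 ≠ O.chA X := D.l.fresh X
  generalize O.chA X = x at hx
  have hU := (hu.der hX.der).term_sort
  have hxU : Der TA (.ctx (X ++ [(x, U)])) := .cons hU hx
  have hv' : WT TB Y (.app t ts) := ⟨_, hv.der hY.der⟩
  have h1 := T_insert D H hX hY hΓ hs hu hv hx
  rw [D.l.T_L (U := U) hxU hY.der ⟨_, hxU.vars (p := (x, U)) (by simp)⟩
    (canonSort_var.2 (by simp)) hv' (.inl ⟨x, rfl⟩)] at h1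
  refine h1.symm.trans D.l.ptC ?_
  obtain ⟨W, h1⟩ := h1
  replace h1 := h1.termEq_left
  rw [TOps.L, Expr.subst_app, D.l.grid_map] at h1 ⊢
  rw [TOps.L]
  refine EqT.app D.l.ptC h1 ?_
  have e : U.args ++ [u] = (U.args ++ [Expr.var x]).map (Expr.subst (upd .var x u)) := by
    rw [map_append]
    congr 1
    · rw [map_congr_left (g := id), List.map_id]
      intro a ha
      rw [term_upd D.l.pt (hU.sort_args ha) hx, Expr.subst_id, id]
    · simp [upd_self]
  rw [e, D.l.grid_mapL]
  refine D.forall₂_grid fun a ha b hb => ?_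
  obtain ⟨Vb, hb⟩ := hv.args hb
  rcases mem_append.1 ha with ha | ha
  · rw [var_eq_insert D hX.der hY.der hx (hU.sort_args ha) ⟨_, hb.der hY.der⟩ hU,
      term_upd D.l.pt (hU.sort_args ha) hx, Expr.subst_id]
    obtain ⟨Ua, ha⟩ := (hu.sds hX).args ha
    obtain ⟨W, hW⟩ := H.self.wt D hX hY hΓ hs ha hb
    exact .refl hW
  · simp at ha
    subst ha
    rw [Expr.subst_var, upd_self]
    exact T_insert D H hX hY hΓ hs hu hb hx

theorem Sit.s1
    (h : Sit O TA TB TC p q X Y Γ X' Y' τ ρ) : S1All O TA TB TC p q X Y Γ X' Y' τ ρ :=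
  fun hu hv hu' hv' => S1_core D H.self h
    (fun z hz _ _ _ ht => TL_typed D H h.eX h.eY h.dΓ h.sub (h.lτ z hz) ht)
    (fun z hz _ _ _ ht => TL_typed D.op H.op h.eY h.eX h.dΓ h.sub (h.lρ z hz) ht) hu hv hu' hv'

theorem retype (hX : EC TA p X) (hY : EC TB q Y)
    (hΓ : Der TC (.ctx Γ)) (hs : O.ten X Y ⊆ Γ) {u U v V} (hu : TmS TA p X u U)
    (hv : TmS TB q Y v V)
    (hc : ∀ u C, CanonSort TA X u C → TmS TA p X u C → PairOK O TC X Y Γ C u V v) :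
    PairOK O TC X Y Γ U u V v := by
  obtain ⟨C, c1, c2, c3⟩ := hu.canon D.l.pt
  have h0 := hc u C c1 c2
  rcases c3 with rfl | ⟨X0, hX0, c3⟩
  · exact h0
  refine .seqt ?_ h0
  have hx : ∀ r ∈ X, r.1 ≠ O.chA X := D.l.fresh X
  have hy : ∀ r ∈ Y, r.1 ≠ O.chB Y := D.r.fresh Y
  generalize O.chA X = x at hx
  generalize O.chB Y = y at hy
  have hx0 : ∀ r ∈ X0, r.1 ≠ x := fun r hr => hx r (hX0 hr)
  have eC : EC TA p (X0 ++ [(x, C)]) := .snoc c3.pre.1.sort_ec (fun _ => id) c3.pre.1 hx0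
  have eU : EC TA p (X0 ++ [(x, U)]) := .snoc c3.pre.1.sort_ec (fun _ => id) c3.pre.2 hx0
  have eV : EC TB q (Y ++ [(y, V)]) := by
    obtain ⟨Y0, hY0, h⟩ := hv.sds hY
    exact .snoc hY hY0 h hy
  have hΔ := H.self.ctx_ten D eC eV
  have k := H.l.sew (.inl c3) hx0 eV hΔ (D.ten_mono eC.der eC.der hY.der eV.der (fun _ => id)
    (by simp))
    (D.ten_mono c3.pre.1.sort_ec.der eC.der eV.der eV.der (by simp) (fun _ => id))
  have lρ : LSub TB q Y (Y ++ [(y, V)]) (upd .var y v) :=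
    upd_snoc_var D.r.pt eV.der (fun z hz => .of_mem hz) hv
  have mk {C} (hC : Der TA (.sort X0 C)) (hu : TmS TA p X u C) :
      Sit O TA TB TC p q X Y Γ (X0 ++ [(x, C)]) (Y ++ [(y, V)]) (upd .var x u) (upd .var y v) :=
    ⟨hX, hY, hΓ, hs, .cons hC hx0, eV.der,
      upd_snoc_var D.l.pt (.cons hC hx0) (fun z hz => .of_mem (hX0 hz)) hu, lρ⟩
  have sC := mk c3.pre.1.der c2
  have sU := mk c3.pre.2.der hu
  have m : IsSub TC Γ (O.ten (X0 ++ [(x, C)]) (Y ++ [(y, V)])) (O.TS X Y (upd .var x u)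
    (upd .var y v)) := by
    refine sC.mor_core D (sC.s1 D H) ?_
    have kC := upd_snoc_var (P := fun u C => CanonSort TA X u C ∧ TmS TA p X u C) D.l.pt sC.dX
      (u := u)
      (fun z hz => ⟨canonSort_var.2 (hX0 hz), .of_mem (hX0 hz)⟩) ⟨c1, c2⟩
    intro z hz
    refine upd_snoc_var (P := fun v V => PairOK O TC X Y Γ _ _ V v) D.r.pt eV.der (u := v) ?_ ?_
    · intro w hw
      exact H.self.t hX hY (kC z hz).1 (kC z hz).2 (canonSort_var.2 hw) (.of_mem hw) hΓ hs
    · exact hc _ _ (kC z hz).1 (kC z hz).2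
  have k' := k.sub_sortEq m hΓ
  have vV := eV.der.vars (p := (y, V)) (by simp)
  have fV : TmS TB q Y ((Expr.var y).subst (upd .var y v)) (V.subst (upd .var y v)) := by
    rw [Expr.subst_var]
    exact lρ (y, V) (by simp)
  have w {C} (hC : Der TA (.sort X0 C)) (hu : TmS TA p X u C)
      (hd : Der TC (.sort Γ ((O.W (X0 ++ [(x, C)]) (Y ++ [(y, V)]) C (.var x) V (.var y)).subst
        (O.TS X Y (upd .var x u) (upd .var y v))))) :
      Der TC (.sortEq Γ (O.W X Y C u V v)
        ((O.W (X0 ++ [(x, C)]) (Y ++ [(y, V)]) C (.var x) V (.var y)).subst (O.TS X Y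
          (upd .var x u) (upd .var y v)))) := by
    have s := mk hC hu
    have w := W_sit D s (s.s1 D H) (s.dX.vars (p := (x, C)) (by simp)) 
      (by rw [Expr.subst_var]; exact s.lτ (x, C) (by simp)) vV fV (.inr hd)
    rw [sort_upd D.l.pt hC hx0, SortE.subst_id, sort_upd D.r.pt eV.der.ctx_snoc.1 hy,
      SortE.subst_id, Expr.subst_var, Expr.subst_var, upd_self, upd_self] at w
    exact w
  exact .s3 (w c3.pre.1.der c2 k'.sortEq_left) (.s3 k' (w c3.pre.2.der hu k'.sortEq_right).s2)

theorem pairOK (hX : EC TA p X) (hY : EC TB q Y)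
    (hΓ : Der TC (.ctx Γ)) (hs : O.ten X Y ⊆ Γ) {u U v V} (hu : TmS TA p X u U)
    (hv : TmS TB q Y v V) : PairOK O TC X Y Γ U u V v :=
  retype D.op H.op hY hX hΓ hs hv hu fun v C c1 c2 =>
    retype D H hX hY hΓ hs hu c2 fun u C' c3 c4 => H.self.t hX hY c3 c4 c1 c2 hΓ hs

theorem Sit.mor
    (h : Sit O TA TB TC p q X Y Γ X' Y' τ ρ) : IsSub TC Γ (O.ten X' Y') (O.TS X Y τ ρ) :=
  h.mor_core D (h.s1 D H) fun z hz w hw =>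
    pairOK D H h.eX h.eY h.dΓ h.sub (h.lτ z hz) (h.lρ w hw)

/-! ### Ambient contexts -/

omit H

theorem TS_mono {X1 Y1} (hX : Der TA (.ctx X)) (hX1 : Der TA (.ctx X1))
    (hY : Der TB (.ctx Y)) (hY1 : Der TB (.ctx Y1)) (hXs : X ⊆ X1) (hYs : Y ⊆ Y1)
    (hτ : IsSub TA X X' τ) (hρ : IsSub TB Y Y' ρ) {z w} (hz : z ∈ X') (hw : w ∈ Y') :
    O.TS X Y τ ρ (O.v z.1 w.1) = O.TS X1 Y1 τ ρ (O.v z.1 w.1) := by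
  rw [D.TS_v, D.TS_v]
  exact D.T_mono hX hX1 hY hY1 hXs hYs ⟨_, hτ z hz⟩ ⟨_, hρ w hw⟩

include H

theorem Sit.mor_amb
    (h : Sit O TA TB TC p q X Y Γ X' Y' τ ρ) (hΔ : Der TC (.ctx (O.ten X' Y'))) {X1 Y1}
    (hX1 : Der TA (.ctx X1))
    (hY1 : Der TB (.ctx Y1)) (hXs : X ⊆ X1) (hYs : Y ⊆ Y1) :
    IsSub TC Γ (O.ten X' Y') (O.TS X1 Y1 τ ρ) := by
  refine (h.mor D H).congr D.l.ptC hΔ fun r hr => ?_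
  obtain ⟨z, hz, w, hw, rfl⟩ := D.mem_ten.1 hr
  exact TS_mono D h.eX.der hX1 h.eY.der hY1 hXs hYs (h.lτ.isSub h.eX.der)
    (h.lρ.isSub h.eY.der) hz hw

theorem Sit.s1_amb
    (h : Sit O TA TB TC p q X Y Γ X' Y' τ ρ) {X1 Y1}
    (hX1 : Der TA (.ctx X1))
    (hY1 : Der TB (.ctx Y1)) (hXs : X ⊆ X1) (hYs : Y ⊆ Y1) {u v} (hu : WT TA X' u) (hv : WT TB Y' v)
    (hu' : ∃ U, TmS TA p X (u.subst τ) U) (hv' : ∃ V, TmS TB q Y (v.subst ρ) V) :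
    S1 O TC X1 Y1 Γ X' Y' τ ρ u v := by
  have k := h.s1 D H hu hv hu' hv'
  rw [S1, D.T_mono h.eX.der hX1 h.eY.der hY1 hXs hYs ⟨_, hu'.choose_spec.der h.eX.der⟩
    ⟨_, hv'.choose_spec.der h.eY.der⟩, Expr.subst_congr (O.T X' Y' u v) (τ := O.TS X1 Y1 τ ρ)] at k
  · exact k
  · intro z hz
    obtain ⟨r, hr, w, hw, rfl⟩ := D.T_scope h.dX h.dY hu hv z hz
    exact TS_mono D h.eX.der hX1 h.eY.der hY1 hXs hYs (h.lτ.isSub h.eX.der)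
      (h.lρ.isSub h.eY.der) hr hw

/-! ### Monotonicity in the levels -/

omit D H

theorem LSub.mono {Ax : Set (Judg A)} (h : LSub Ax p X X' τ) (hX : X ⊆ X1) (hpq : p ≤ q) :
    LSub Ax q X1 X' τ :=
  fun z hz => ((h z hz).mono hX).mono_level hpq

theorem SQ.mono {Ax : Set (Judg A)} {U U'} (h : SQ Ax p X U U') (hpq : p ≤ q) : SQ Ax q X U U' :=
  h.imp (·.mono hpq) (·.mono hpq)

theorem Half.mono {p' q'} (H : Half O TA TB TC p q) (hp : p' ≤ p) (hq : q' ≤ q) :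
    Half O TA TB TC p' q' where
  set h hx hY hv := H.set (h.mono hp) hx (hY.mono hq) (hv.mono_level hq)
  sew h hx hY := H.sew (h.mono hp) hx (hY.mono hq)
  te h hY hv := H.te (h.mono hp) (hY.mono hq) (hv.mono_level hq)

theorem Self.mono {p' q'} (H : Self O TA TB TC p q) (hp : p' ≤ p) (hq : q' ≤ q) :
    Self O TA TB TC p' q' where
  sw hX hY h1 h2 hu hU hv hV := H.sw (hX.mono hp) (hY.mono hq) h1 h2 (hu.mono_level hp)
    (hU.mono hp) (hv.mono_level hq) (hV.mono hq)
  t hX hY hu hu' hv hv' := H.t (hX.mono hp) (hY.mono hq) hu (hu'.mono_level hp) hv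
    (hv'.mono_level hq)
  e hX hY hu hu' hv hv' := H.e (hX.mono hp) (hY.mono hq) hu (hu'.mono_level hp) hv
    (hv'.mono_level hq)

include H

theorem Good.mono {p' q'} (hp : p' ≤ p) (hq : q' ≤ q) :
    Good O TA TB TC p' q' := ⟨H.self.mono hp hq, H.l.mono hp hq, H.r.mono hq hp⟩

/-! ### Contexts for the rules -/

omit H
include D

theorem Self.sw_last (H : Self O TA TB TC p q) {r s} (e1 : EC TA p (X ++ [r]))
    (e2 : EC TB q (Y ++ [s])) (hΓ : Der TC (.ctx Γ)) (h1 : O.ten X (Y ++ [s]) ⊆ Γ)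
    (h2 : O.ten (X ++ [r]) Y ⊆ Γ) :
    Der TC (.sort Γ (O.W (X ++ [r]) (Y ++ [s]) r.2 (.var r.1) s.2 (.var s.1))) := by
  obtain ⟨e3, ⟨X0, hX0, l0⟩, -⟩ := e1.of_snoc
  obtain ⟨e4, ⟨Y0, hY0, l1⟩, -⟩ := e2.of_snoc
  exact H.sw e1 e2 (List.Subset.trans hX0 (by simp)) (List.Subset.trans hY0 (by simp))
    (.of_mem (by simp)) l0 (.of_mem (by simp)) l1 hΓ
    (List.Subset.trans (D.ten_mono e1.der e1.der l1.sort_ec.der e4.der (fun _ => id) hY0) h2)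
    (List.Subset.trans (D.ten_mono l0.sort_ec.der e3.der e2.der e2.der hX0 (fun _ => id)) h1)

theorem ctx_par {p' q'} (H1 : Self O TA TB TC p q') (H2 : Self O TA TB TC p' q)
    {r s} (hX : EC TA p X) (hX' : EC TA p' (X ++ [r])) (hY : EC TB q Y) (hY' : EC TB q'
      (Y ++ [s])) :
    Der TC (.ctx (O.par (X ++ [r]) (Y ++ [s]))) := by
  refine D.ctx_initial hX'.der hY'.der (List.dropLast_prefix _) ?_
  intro X1 r' Y1 s' Δ z hz h1 h2 hΔ h3 h4
  rcases List.prefix_concat_iff.1 h1 with e1 | e1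
  · rcases List.prefix_concat_iff.1 h2 with e2 | e2
    · obtain ⟨rfl, e1⟩ := List.append_inj' e1 rfl
      obtain ⟨rfl, e2⟩ := List.append_inj' e2 rfl
      simp at e1 e2
      subst e1 e2
      exfalso
      have hs := (D.par_sub hX'.der hY'.der).2 ⟨h3, h4⟩
      have hm : z ∈ Δ := hs (hz.subset (by simp))
      have hn := (D.nodup_ten hX'.der hY'.der).sublist
        ((hz.trans (List.dropLast_prefix _)).sublist.map Prod.fst)
      simp only [map_append, List.map_cons, List.map_nil, List.nodup_append] at hn
      exact hn.2.2 _ (mem_map_of_mem hm) z.1 (by simp) rfl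
    · exact H2.sw_last D (hX'.initial h1) (hY.initial e2) hΔ h3 h4
  · exact H1.sw_last D (hX.initial e1) (hY'.initial h2) hΔ h3 h4

/-! ### Instances of axioms -/

omit D

/-- A sort with a term of that sort, presented as an instance of an axiom. -/
structure SX (Ax : Set (Judg A)) (ch : PreCtx A → A.Var) (p : ℕ) (X X0 : PreCtx A) (U : SortE A)
    (u : Expr A) (Xa : PreCtx A) (S : A.SortSym) (τ : A.Var → Expr A) : Prop where
  ax : introSort Xa S ∈ Ax
  hU : SortE.subst τ ⟨S, ctxVars Xa⟩ = U
  hu : τ (ch Xa) = u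
  ne : ∀ r ∈ Xa, r.1 ≠ ch Xa
  eXa : EC Ax p Xa
  eX0 : EC Ax p X0
  gen : Lv Ax (p + 1) (introSort Xa S)
  eX : EC Ax (p + 1) X
  eX' : EC Ax (p + 1) (snocCh ch Xa ⟨S, ctxVars Xa⟩)
  lo : LSub Ax p X0 Xa τ
  hi : LSub Ax (p + 1) X (snocCh ch Xa ⟨S, ctxVars Xa⟩) τ

/-- A term presented as an instance of an axiom. -/
structure TX (Ax : Set (Judg A)) (p : ℕ) (X X0 : PreCtx A) (s : A.TermSym) (ss : List (Expr A))
    (U : SortE A) (Xa : PreCtx A) (Ua : SortE A) (σ : A.Var → Expr A) : Prop where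
  ax : introTerm Xa s Ua ∈ Ax
  hU : Ua.subst σ = U
  hs : (ctxVars Xa).map (Expr.subst σ) = ss
  eXa : EC Ax p Xa
  eX0 : EC Ax p X0
  eX : EC Ax (p + 1) X
  sub : X0 ⊆ X
  gen : Lv Ax (p + 1) (introTerm Xa s Ua)
  sort : Lv Ax p (.sort Xa Ua)
  canon : Lv Ax p (.sort X0 U)
  tm : TmS Ax (p + 1) X (.app s ss) U
  lo : LSub Ax p X0 Xa σ

theorem exists_SX {Ax : Set (Judg A)} {ch : PreCtx A → A.Var} (hPT : PT Ax)
    (fresh : ∀ X : PreCtx A, ∀ r ∈ X, r.1 ≠ ch X) {X0 U u} (hX : EC Ax (p + 1) X) (hs : X0 ⊆ X)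
    (hu : TmS Ax (p + 1) X u U) (hU : Lv Ax (p + 1) (.sort X0 U)) :
    ∃ Xa S τ, SX Ax ch p X X0 U u Xa S τ := by
  obtain ⟨S, ss⟩ := U
  obtain ⟨Xa, σ, I⟩ := hU.inv_sort
  have ne := fresh Xa
  have gen : Lv Ax (p + 1) (.sort Xa ⟨S, ctxVars Xa⟩) := I.gen
  have hX' : EC Ax (p + 1) (snocCh ch Xa ⟨S, ctxVars Xa⟩) :=
    .snoc (I.ec.mono (by omega)) (fun _ => id) gen ne
  have hU : SortE.subst σ ⟨S, ctxVars Xa⟩ = ⟨S, ss⟩ := by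
    rw [I.args, SortE.subst]
    simp [ctxVars, Function.comp_def]
  refine ⟨Xa, S, upd σ (ch Xa) u, I.ax, ?_, upd_self _ _ _, ne, I.ec, I.ecX, I.gen, hX, hX', ?_, ?_⟩
  · rw [sort_upd hPT gen.der ne, hU]
  · intro z hz
    rw [upd_ne _ _ (ne z hz), sort_upd hPT (I.ec.der.vars hz).term_sort ne]
    exact .of_lv (I.sub z hz)
  · exact upd_snoc (P := fun u U => TmS Ax (p + 1) X u U) hPT hX'.der
      (fun z hz => ((TmS.of_lv (I.sub z hz)).mono hs).mono_level (by omega)) (by rwa [hU])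

theorem exists_TX {Ax : Set (Judg A)} (hPT : PT Ax) {s ss U} (hX : EC Ax (p + 1) X)
    (hU : CanonSort Ax X (.app s ss) U) (hs : TmS Ax (p + 1) X (.app s ss) U) :
    ∃ X0 Xa Ua σ, TX Ax p X X0 s ss U Xa Ua σ := by
  rcases id hs with ⟨z, hz, -⟩ | ⟨X0, hX0, l⟩
  · cases hz
  obtain ⟨Xa, Ua, σ, I⟩ := l.inv_app
  have e := I.args
  subst e
  obtain rfl := hU.app_inv hPT I.ax I.sort.der
  exact ⟨X0, Xa, Ua, σ, I.ax, rfl, by simp [ctxVars, Function.comp_def], I.ec, I.ecX, hX, hX0,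
    I.gen, I.sort, I.canon, hs, fun z hz => .of_lv (I.sub z hz)⟩

include D

theorem S1.mono_target {X2 Y2} {u v} (hX : Der TA (.ctx X'))
    (hX1 : Der TA (.ctx X1)) (hY : Der TB (.ctx Y')) (hY1 : Der TB (.ctx Y1)) (hXs : X' ⊆ X1)
    (hYs : Y' ⊆ Y1) (hu : WT TA X' u) (hv : WT TB Y' v) (h : S1 O TC X2 Y2 Γ X' Y' τ ρ u v) :
    S1 O TC X2 Y2 Γ X1 Y1 τ ρ u v := by
  rw [S1, ← D.T_mono hX hX1 hY hY1 hXs hYs hu hv]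
  exact h

include H1 H2

theorem self_sw {X0 Y0 U u V v} (hX : EC TA (p + 1) X)
    (hY : EC TB (q + 1) Y) (hXs : X0 ⊆ X) (hYs : Y0 ⊆ Y) (hu : TmS TA (p + 1) X u U)
    (hU : Lv TA (p + 1) (.sort X0 U)) (hv : TmS TB (q + 1) Y v V)
    (hV : Lv TB (q + 1) (.sort Y0 V)) (hΓ : Der TC (.ctx Γ))
    (h1 : O.ten X Y0 ⊆ Γ) (h2 : O.ten X0 Y ⊆ Γ) : Der TC (.sort Γ (O.W X Y U u V v)) := by
  obtain ⟨Xa, S, τ, I⟩ := exists_SX (ch := O.chA) D.l.pt D.l.fresh hX hXs hu hU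
  obtain ⟨Ya, T, ρ, J⟩ := exists_SX (ch := O.chB) D.r.pt D.r.fresh hY hYs hv hV
  have k := D.l.ruleSS I.ax J.ax I.eXa.der J.eXa.der
    (ctx_par D H1.self H2.self I.eXa I.eX' J.eXa J.eX')
  have s1 : Sit O TA TB TC p (q + 1) X0 Y Γ Xa (snocCh O.chB Ya ⟨T, ctxVars Ya⟩) τ ρ :=
    ⟨I.eX0, hY, hΓ, h2, I.eXa.der, J.eX'.der, I.lo, J.hi⟩
  have s2 : Sit O TA TB TC (p + 1) q X Y0 Γ (snocCh O.chA Xa ⟨S, ctxVars Xa⟩) Ya τ ρ :=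
    ⟨hX, J.eX0, hΓ, h1, I.eX'.der, J.eXa.der, I.hi, J.lo⟩
  have m1 := s1.mor_amb D H1 (H1.self.ctx_ten D I.eXa J.eX') hX.der hY.der hXs (fun _ => id)
  have m2 := s2.mor_amb D H2 (H2.self.ctx_ten D I.eX' J.eXa) hX.der hY.der (fun _ => id) hYs
  have m : IsSub TC Γ (O.par (snocCh O.chA Xa ⟨S, ctxVars Xa⟩) (snocCh O.chB Ya ⟨T, ctxVars Ya⟩))
      (O.TS X Y τ ρ) := by
    intro z hz
    have hz' := (D.par_sub (Γ := O.ten Xa (snocCh O.chB Ya ⟨T, ctxVars Ya⟩) ++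
      O.ten (snocCh O.chA Xa ⟨S, ctxVars Xa⟩) Ya) I.eX'.der J.eX'.der).2
      ⟨List.subset_append_left _ _, List.subset_append_right _ _⟩ hz
    rcases mem_append.1 hz' with h | h
    · exact m1 z h
    · exact m2 z h
  have k2 := k.sub_sort m hΓ
  rw [D.W_subst_gen, I.hU, I.hu, J.hU, J.hu] at k2
  exact k2

omit H1 H2

theorem TD.W_subst_vars {S} {x Xa V y v} (hX : Der TA (.ctx X))
    (hx : Der TA (.term X (.var x) ⟨S, ctxVars Xa⟩)) (hV : Der TB (.sort Y V))
    (hv : WT TB Y v) (hy : ∀ r ∈ Y, r.1 ≠ y) :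
    (O.W X (Y ++ [(y, V)]) ⟨S, ctxVars Xa⟩ (.var x) V (.var y)).subst
      (O.TS X Y .var (upd .var y v)) = O.W X Y ⟨S, ctxVars Xa⟩ (.var x) V v := by
  have hY' : Der TB (.ctx (Y ++ [(y, V)])) := .cons hV hy
  have e := D.pairs_subst ⟨S, ctxVars Xa⟩ (.var x) V (.var y) .var (upd .var y v)
  rw [Expr.subst_var, Expr.subst_var, SortE.subst_id, sort_upd D.r.pt hV hy, SortE.subst_id,
    upd_self] at e
  rw [D.W_eq X Y, e, D.W_eq]
  simp only [SortE.subst, map_map]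
  congr 1
  refine map_congr_left fun r hr => ?_
  have hh := D.mem_pairs.1 hr
  obtain ⟨a, b⟩ := r
  have hab := TD.pair_cases hx.term_sort ⟨_, hx⟩ (hV.wk_sort (by simp) hY')
    ⟨_, hY'.vars (p := (y, V)) (by simp)⟩ hh
  have ha : ∃ z, a = .var z := by
    simp only [ctxVars, mem_append, mem_map, mem_singleton] at hh
    rcases hh with ⟨⟨z, -, h⟩, -⟩ | ⟨⟨z, -, h⟩ | h, -⟩
    · exact ⟨_, h.symm⟩
    · exact ⟨_, h.symm⟩
    · exact ⟨_, h⟩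
  obtain ⟨z, rfl⟩ := ha
  have hb : b = .var y ∨ b ∈ V.args := by
    simp only [mem_append, mem_singleton] at hh
    tauto
  rcases hb with rfl | hb
  · simp [D.l.T_vv, D.TS_v, upd_self]
  · have hb' := hV.sort_args hb
    simp only [Function.comp_apply, Expr.subst_id]
    rw [term_upd D.r.pt hb' hy, Expr.subst_id]
    exact var_eq_insert D.op hV.sort_ctx hX hy hb' hab.1 hV

theorem TD.L_subst_vars {S x Xa t Ya} :
    (O.L X' Y' ⟨S, ctxVars Xa⟩ (.var x) t (ctxVars Ya)).subst (O.TS X Y τ ρ) =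
      O.L X Y (SortE.subst τ ⟨S, ctxVars Xa⟩) (τ x) t ((ctxVars Ya).map (Expr.subst ρ)) := by
  have e : (SortE.subst τ ⟨S, ctxVars Xa⟩).args ++ [τ x] =
      (ctxVars Xa ++ [Expr.var x]).map (Expr.subst τ) := by simp [SortE.subst]
  rw [TOps.L, TOps.L, e, D.l.grid_mapL, D.grid_mapR, Expr.subst_app, D.l.grid_map]
  congr 1
  refine D.grid_congr fun a ha b hb => ?_
  have ha : ∃ z, a = .var z := by
    simp only [ctxVars, mem_append, mem_map, mem_singleton] at ha
    rcases ha with ⟨z, -, h⟩ | h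
    · exact ⟨_, h.symm⟩
    · exact ⟨_, h⟩
  have hb : ∃ z, b = .var z := by
    simp only [ctxVars, mem_map] at hb
    obtain ⟨z, -, h⟩ := hb
    exact ⟨_, h.symm⟩
  obtain ⟨a, rfl⟩ := ha
  obtain ⟨b, rfl⟩ := hb
  simp [D.l.T_vv, D.TS_v]

omit D

theorem TX.arg {Ax : Set (Judg A)} {X0 s ss U Xa Ua} (J : TX Ax p X X0 s ss U Xa Ua τ) {b}
    (hb : b ∈ Ua.args) : ∃ V, TmS Ax p X0 (b.subst τ) V := by
  have := J.canon
  rw [← J.hU] at this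
  exact (SdS.of_lv this).args (by simpa using mem_map_of_mem hb)

theorem TX.subst_app {Ax : Set (Judg A)} {X0 s ss U Xa Ua} (J : TX Ax p X X0 s ss U Xa Ua τ) :
    Expr.subst τ (.app s (ctxVars Xa)) = .app s ss := by
  rw [Expr.subst_app, J.hs]

theorem TX.lo' {Ax : Set (Judg A)} {X0 s ss U Xa Ua} (J : TX Ax p X X0 s ss U Xa Ua τ) :
    LSub Ax (p + 1) X Xa τ := J.lo.mono J.sub (by omega)

theorem TX.args_app {Ax : Set (Judg A)} {X0 s ss U Xa Ua} (J : TX Ax p X X0 s ss U Xa Ua τ) {b}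
    (hb : b ∈ Ua.args ++ [.app s (ctxVars Xa)]) :
    WT Ax Xa b ∧ ∃ V, TmS Ax (p + 1) X (b.subst τ) V := by
  rcases mem_append.1 hb with h | h
  · obtain ⟨V, hV⟩ := J.arg h
    exact ⟨J.sort.der.sort_args h, V, (hV.mono J.sub).mono_level (by omega)⟩
  · simp only [mem_singleton] at h
    subst h
    rw [J.subst_app]
    exact ⟨⟨_, J.gen.der⟩, _, J.tm⟩

theorem LSub.ctxVars {Ax : Set (Judg A)} (h : LSub Ax p X X' τ) (hX' : Der Ax (.ctx X')) {a}
    (ha : a ∈ ctxVars X') : WT Ax X' a ∧ ∃ V, TmS Ax p X (a.subst τ) V := by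
  simp only [GATPaper.ctxVars, mem_map] at ha
  obtain ⟨z, hz, rfl⟩ := ha
  rw [Expr.subst_var]
  exact ⟨⟨_, hX'.vars hz⟩, _, h z hz⟩

theorem ctxVars_append (X Y : PreCtx A) : ctxVars (X ++ Y) = ctxVars X ++ ctxVars Y := by
  simp [ctxVars]

theorem canon_generic {Ax : Set (Judg A)} (hPT : PT Ax) {s Xa Ua} (hax : introTerm Xa s Ua ∈ Ax)
    (h : Der Ax (.sort Xa Ua)) : CanonSort Ax Xa (.app s (ctxVars Xa)) Ua := by
  have := CanonSort.app_map hPT (X := Xa) hax h Expr.var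
  rwa [SortE.subst_id] at this

include D H1 H2

theorem L_typed {u U t ts V} (hX : EC TA (p + 1) X)
    (hY : EC TB (q + 1) Y) (hu : TmS TA (p + 1) X u U) (hv : CanonSort TB Y (.app t ts) V)
    (hv' : TmS TB (q + 1) Y (.app t ts) V) (hΓ : Der TC (.ctx Γ)) (hs : O.ten X Y ⊆ Γ) :
    Der TC (.term Γ (O.L X Y U u t ts) (O.W X Y U u V (.app t ts))) := by
  obtain ⟨X0, hX0, lU⟩ := hu.sds hX
  obtain ⟨Xa, S, τ, I⟩ := exists_SX (ch := O.chA) D.l.pt D.l.fresh hX hX0 hu lU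
  obtain ⟨Y0, Ya, Va, ρ, J⟩ := exists_TX D.r.pt hY hv hv'
  have hΔ := H2.self.ctx_ten D I.eX' J.eXa
  have hsub : Xa ⊆ snocCh O.chA Xa ⟨S, ctxVars Xa⟩ := by simp [snocCh]
  have hmem : (O.chA Xa, ⟨S, ctxVars Xa⟩) ∈ snocCh O.chA Xa ⟨S, ctxVars Xa⟩ := by simp [snocCh]
  have hx := I.eX'.der.vars hmem
  have hg : Der TB (.term Ya (.app t (ctxVars Ya)) Va) := J.gen.der
  have k0 := self_sw D H1 H2 (Y0 := Ya) (u := .var (O.chA Xa)) I.eX' (J.eXa.mono (by omega)) hsub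
    (fun _ => id) (.of_mem hmem) I.gen (.of_lv J.gen) (J.sort.mono (by omega)) hΔ (fun _ => id)
    (D.ten_mono I.eXa.der I.eX'.der J.eXa.der J.eXa.der hsub (fun _ => id))
  have k1 := D.l.ruleST I.ax J.ax I.eXa.der J.gen.der
    (D.W_subst_vars I.eX'.der hx J.sort.der ⟨_, hg⟩ (D.r.fresh Ya)).symm k0
  rw [D.l.T_L I.eX'.der J.eXa.der ⟨_, hx⟩ (canonSort_var.2 hmem) ⟨_, hg⟩ (.inl ⟨_, rfl⟩)] at k1
  have s1 : Sit O TA TB TC p (q + 1) X0 Y Γ Xa Ya τ ρ :=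
    ⟨I.eX0, hY, hΓ, List.Subset.trans (D.ten_mono I.eX0.der hX.der hY.der hY.der hX0
      (fun _ => id)) hs,
      I.eXa.der, J.eXa.der, I.lo, J.lo'⟩
  have s2 : Sit O TA TB TC (p + 1) q X Y0 Γ (snocCh O.chA Xa ⟨S, ctxVars Xa⟩) Ya τ ρ :=
    ⟨hX, J.eX0, hΓ, List.Subset.trans (D.ten_mono hX.der hX.der J.eX0.der hY.der
      (fun _ => id) J.sub) hs,
      I.eX'.der, J.eXa.der, I.hi, J.lo⟩
  have k2 := k1.sub_term (s2.mor_amb D H2 hΔ hX.der hY.der (fun _ => id) J.sub) hΓ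
  rw [D.L_subst_vars, I.hU, I.hu, J.hs] at k2
  have w := W_S1 (X := X) (Y := Y) (Γ := Γ) (X' := snocCh O.chA Xa ⟨S, ctxVars Xa⟩) (Y' := Ya)
    (τ := τ) (ρ := ρ) D (U := ⟨S, ctxVars Xa⟩) (u := .var (O.chA Xa)) (V := Va)
    (v := .app t (ctxVars Ya)) ?_ (.inr k2.term_sort)
  · rw [I.hU, Expr.subst_var, I.hu, J.hU, J.subst_app] at w
    exact .seqt w.s2 k2
  · rintro a b (⟨ha, hb⟩ | ⟨ha, hb⟩)
    · obtain ⟨a1, a2⟩ := I.lo.ctxVars I.eXa.der ha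
      obtain ⟨b1, b2⟩ := J.args_app hb
      exact .mono_target D I.eXa.der I.eX'.der J.eXa.der J.eXa.der hsub (fun _ => id) a1 b1
        (s1.s1_amb D H1 hX.der hY.der hX0 (fun _ => id) a1 b1 a2 b2)
    · obtain ⟨a1, a2⟩ := I.hi.ctxVars I.eX'.der (a := a) (by rw [snocCh, ctxVars_append]; exact ha)
      exact s2.s1_amb D H2 hX.der hY.der (fun _ => id) J.sub a1 (J.sort.der.sort_args hb) a2
        (J.arg hb)

theorem self_t {u U v V} (hX : EC TA (p + 1) X)
    (hY : EC TB (q + 1) Y) (hu : CanonSort TA X u U) (hu' : TmS TA (p + 1) X u U)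
    (hv : CanonSort TB Y v V)
    (hv' : TmS TB (q + 1) Y v V) (hΓ : Der TC (.ctx Γ)) (hs : O.ten X Y ⊆ Γ) :
    Der TC (.term Γ (O.T X Y u v) (O.W X Y U u V v)) := by
  have kL : ∀ t ts, v = .app t ts → ((∃ x, u = .var x) ∨ O.fL) →
      Der TC (.term Γ (O.T X Y u v) (O.W X Y U u V v)) := by
    rintro t ts rfl hf
    rw [D.l.T_L hX.der hY.der ⟨_, hu'.der hX.der⟩ hu ⟨_, hv'.der hY.der⟩ hf]
    exact L_typed D H1 H2 hX hY hu' hv hv' hΓ hs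
  have kR : ∀ s ss, u = .app s ss → ((∃ x, v = .var x) ∨ O.fR) →
      Der TC (.term Γ (O.T X Y u v) (O.W X Y U u V v)) := by
    rintro t ts rfl hf
    have e : O.T X Y (.app t ts) v = O.op.L Y X V v t ts :=
      D.r.T_L hY.der hX.der ⟨_, hv'.der hY.der⟩ hv ⟨_, hu'.der hX.der⟩ hf
    rw [e]
    exact L_typed D.op H2.op H1.op hY hX hv' hu hu' hΓ hs
  cases u with
  | var x =>
    cases v with
    | var y =>
      rw [D.l.T_vv]
      exact hΓ.vars (hs (D.mem_ten_of (canonSort_var.1 hu) (canonSort_var.1 hv)))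
    | app t ts => exact kL _ _ rfl (.inl ⟨x, rfl⟩)
  | app s ss =>
    cases v with
    | var y => exact kR _ _ rfl (.inl ⟨y, rfl⟩)
    | app t ts => exact D.l.ff.elim (fun h => kL _ _ rfl (.inr h)) (fun h => kR _ _ rfl (.inr h))

theorem L_generic {s ss U t ts V X0 Xa Ua σ Y0 Ya Va ρ}
    (hv : CanonSort TB Y (.app t ts) V)
    (I : TX TA p X X0 s ss U Xa Ua σ) (J : TX TB q Y Y0 t ts V Ya Va ρ)
    (hΓ : Der TC (.ctx Γ)) (hs : O.ten X Y ⊆ Γ) :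
    EqT TC Γ (O.L X Y U (.app s ss) t ts)
      ((O.L Xa Ya Ua (.app s (ctxVars Xa)) t (ctxVars Ya)).subst (O.TS X Y σ ρ)) := by
  have s2 : Sit O TA TB TC (p + 1) q X Y0 Γ Xa Ya σ ρ :=
    ⟨I.eX, J.eX0, hΓ, List.Subset.trans
      (D.ten_mono I.eX.der I.eX.der J.eX0.der J.eX.der (fun _ => id) J.sub) hs,
      I.eXa.der, J.eXa.der, I.lo', J.lo⟩
  refine D.L_eqT (L_typed D H1 H2 I.eX J.eX I.tm hv J.tm hΓ hs) σ ρ _ I.hU.symm I.subst_app.symm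
    J.hs.symm fun a ha b hb => ?_
  obtain ⟨a1, a2⟩ := I.args_app ha
  obtain ⟨b1, b2⟩ := J.lo.ctxVars J.eXa.der hb
  exact s2.s1_amb D H2 I.eX.der J.eX.der (fun _ => id) J.sub a1 b1 a2 b2

omit D H1 H2

theorem LSub.upd_var {Ax : Set (Judg A)} (hPT : PT Ax) (hX : Der Ax (.ctx X)) {x u}
    (hx : ∀ r ∈ X, r.1 ≠ x) : LSub Ax p X X (upd .var x u) := by
  intro z hz
  rw [upd_ne _ _ (hx z hz), sort_upd hPT (hX.vars hz).term_sort hx, SortE.subst_id]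
  exact .of_mem hz

include D H1 H2

theorem self_e {s ss U t ts V} (hX : EC TA (p + 1) X)
    (hY : EC TB (q + 1) Y) (hu : CanonSort TA X (.app s ss) U)
    (hu' : TmS TA (p + 1) X (.app s ss) U) (hv : CanonSort TB Y (.app t ts) V)
    (hv' : TmS TB (q + 1) Y (.app t ts) V) (hΓ : Der TC (.ctx Γ)) (hs : O.ten X Y ⊆ Γ) :
    EqT TC Γ (O.L X Y U (.app s ss) t ts) (O.op.L Y X V (.app t ts) s ss) := by
  obtain ⟨X0, Xa, Ua, σ, I⟩ := exists_TX D.l.pt hX hu hu'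
  obtain ⟨Y0, Ya, Va, ρ, J⟩ := exists_TX D.r.pt hY hv hv'
  have H0 := H1.mono le_rfl (Nat.le_succ q)
  have hΔ := H0.self.ctx_ten D I.eXa J.eXa
  have eXa := I.eXa.mono (Nat.le_succ p)
  have eYa := J.eXa.mono (Nat.le_succ q)
  have cX := canon_generic D.l.pt I.ax I.sort.der
  have cY := canon_generic D.r.pt J.ax J.sort.der
  have fx : ∀ r ∈ Xa, r.1 ≠ O.chA Xa := D.l.fresh Xa
  have fy : ∀ r ∈ Ya, r.1 ≠ O.chB Ya := D.r.fresh Ya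
  have kL := L_typed D H1 H2 eXa eYa (.of_lv I.gen) cY (.of_lv J.gen) hΔ (fun _ => id)
  have kR := L_typed D.op H2.op H1.op eYa eXa (.of_lv J.gen) cX (.of_lv I.gen) hΔ (fun _ => id)
  have dX : Der TA (.ctx (snocCh O.chA Xa Ua)) := .cons I.sort.der fx
  have dY : Der TB (.ctx (snocCh O.chB Ya Va)) := .cons J.sort.der fy
  have uX : LSub TA (p + 1) Xa (snocCh O.chA Xa Ua) (upd .var (O.chA Xa) (.app s (ctxVars Xa))) :=
    upd_snoc_var D.l.pt dX (fun z hz => .of_mem hz) (.of_lv I.gen)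
  have uY : LSub TB (q + 1) Ya (snocCh O.chB Ya Va) (upd .var (O.chB Ya) (.app t (ctxVars Ya))) :=
    upd_snoc_var D.r.pt dY (fun z hz => .of_mem hz) (.of_lv J.gen)
  have lX : LSub TA p Xa Xa (upd .var (O.chA Xa) (.app s (ctxVars Xa))) :=
    .upd_var D.l.pt I.eXa.der fx
  have lY : LSub TB q Ya Ya (upd .var (O.chB Ya) (.app t (ctxVars Ya))) :=
    .upd_var D.r.pt J.eXa.der fy
  have s1 : Sit O TA TB TC p (q + 1) Xa Ya _ Xa (snocCh O.chB Ya Va) _ _ :=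
    ⟨I.eXa, eYa, hΔ, fun _ => id, I.eXa.der, dY, lX, uY⟩
  have s2 : Sit O TA TB TC (p + 1) q Xa Ya _ (snocCh O.chA Xa Ua) Ya _ _ :=
    ⟨eXa, J.eXa, hΔ, fun _ => id, dX, J.eXa.der, uX, lY⟩
  have subX : Xa ⊆ snocCh O.chA Xa Ua := by simp [snocCh]
  have subY : Ya ⊆ snocCh O.chB Ya Va := by simp [snocCh]
  have aX {a} (ha : a ∈ Ua.args) : WT TA Xa a ∧
      ∃ U, TmS TA p Xa (a.subst (upd .var (O.chA Xa) (.app s (ctxVars Xa)))) U := by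
    have h := I.sort.der.sort_args ha
    rw [term_upd D.l.pt h fx, Expr.subst_id]
    exact ⟨h, (SdS.of_lv I.sort).args ha⟩
  have aY {a} (ha : a ∈ Va.args) : WT TB Ya a ∧
      ∃ U, TmS TB q Ya (a.subst (upd .var (O.chB Ya) (.app t (ctxVars Ya)))) U := by
    have h := J.sort.der.sort_args ha
    rw [term_upd D.r.pt h fy, Expr.subst_id]
    exact ⟨h, (SdS.of_lv J.sort).args ha⟩
  have aX' {a} (ha : a ∈ Ua.args ++ [.var (O.chA Xa)]) : WT TA (snocCh O.chA Xa Ua) a ∧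
      ∃ U, TmS TA (p + 1) Xa (a.subst (upd .var (O.chA Xa) (.app s (ctxVars Xa)))) U := by
    rcases mem_append.1 ha with h | h
    · obtain ⟨h1, U, h2⟩ := aX h
      exact ⟨h1.wk subX dX, U, h2.mono_level (Nat.le_succ p)⟩
    · exact uX.ctxVars dX (by rw [snocCh, ctxVars_append]; exact mem_append_right _ h)
  have aY' {a} (ha : a ∈ Va.args ++ [.var (O.chB Ya)]) : WT TB (snocCh O.chB Ya Va) a ∧
      ∃ U, TmS TB (q + 1) Ya (a.subst (upd .var (O.chB Ya) (.app t (ctxVars Ya)))) U := by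
    rcases mem_append.1 ha with h | h
    · obtain ⟨h1, U, h2⟩ := aY h
      exact ⟨h1.wk subY dY, U, h2.mono_level (Nat.le_succ q)⟩
    · exact uY.ctxVars dY (by rw [snocCh, ctxVars_append]; exact mem_append_right _ h)
  have w := W_S1 D (X := Xa) (Y := Ya) (X' := snocCh O.chA Xa Ua) (Y' := snocCh O.chB Ya Va)
    (τ := upd .var (O.chA Xa) (.app s (ctxVars Xa))) (ρ := upd .var (O.chB Ya) (.app t
      (ctxVars Ya)))
    (U := Ua) (u := .var (O.chA Xa)) (V := Va) (v := .var (O.chB Ya)) (Γ := O.ten Xa Ya) ?_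
      (.inl ?_)
  · rw [sort_upd D.l.pt I.sort.der fx, sort_upd D.r.pt J.sort.der fy, SortE.subst_id,
      SortE.subst_id, Expr.subst_var, Expr.subst_var, upd_self, upd_self] at w
    have k := D.l.ruleTT I.ax J.ax I.gen.der J.gen.der rfl (.seqt w kL) (.seqt w kR)
    have s0 : Sit O TA TB TC p q X0 Y0 Γ Xa Ya σ ρ :=
      ⟨I.eX0, J.eX0, hΓ, List.Subset.trans
        (D.ten_mono I.eX0.der hX.der J.eX0.der hY.der I.sub J.sub) hs,
        I.eXa.der, J.eXa.der, I.lo, J.lo⟩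
    have k2 : EqT TC Γ _ _ := ⟨_, k.sub_termEq
      (s0.mor_amb D H0 hΔ hX.der hY.der I.sub J.sub) hΓ⟩
    exact ((L_generic D H1 H2 hv I J hΓ hs).trans D.l.ptC k2).trans D.l.ptC
      (L_generic D.op H2.op H1.op hu J I hΓ hs).symm
  · rintro a b (⟨ha, hb⟩ | ⟨ha, hb⟩)
    · obtain ⟨a1, a2⟩ := aX ha
      obtain ⟨b1, b2⟩ := aY' hb
      exact .mono_target D I.eXa.der dX dY dY subX (fun _ => id) a1 b1 (s1.s1 D H1 a1 b1 a2 b2)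
    · obtain ⟨a1, a2⟩ := aX' ha
      obtain ⟨b1, b2⟩ := aY hb
      exact .mono_target D dX dX J.eXa.der dY (fun _ => id) subY a1 b1 (s2.s1 D H2 a1 b1 a2 b2)
  · rw [sort_upd D.l.pt I.sort.der fx, sort_upd D.r.pt J.sort.der fy, SortE.subst_id,
      SortE.subst_id, Expr.subst_var, Expr.subst_var, upd_self, upd_self]
    exact kL.term_sort

theorem self_step : Self O TA TB TC (p + 1) (q + 1) where
  sw hX hY hXs hYs hu hU hv hV hΓ h1 h2 := self_sw D H1 H2 hX hY hXs hYs hu hU hv hV hΓ h1 h2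
  t hX hY hu hu' hv hv' hΓ h := self_t D H1 H2 hX hY hu hu' hv hv' hΓ h
  e hX hY hu hu' hv hv' hΓ h := self_e D H1 H2 hX hY hu hu' hv hv' hΓ h

omit D H1 H2

/-- Sort equalities obtained from an axiom. -/
structure AxI (Ax : Set (Judg A)) (p : ℕ) (X : PreCtx A) (U U' : SortE A) (X0 : PreCtx A)
    (U0 U0' : SortE A) (σ : A.Var → Expr A) : Prop where
  ax : .sortEq X0 U0 U0' ∈ Ax
  s : Lv Ax p (.sort X0 U0)
  s' : Lv Ax p (.sort X0 U0')
  sub : LSub Ax p X X0 σ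
  e : U0.subst σ = U
  e' : U0'.subst σ = U'
  lv : Lv Ax (p + 1) (.sortEq X0 U0 U0')

/-- Sort equalities obtained by congruence. -/
structure CgI (Ax : Set (Judg A)) (p : ℕ) (X : PreCtx A) (U U' : SortE A) (S : A.SortSym)
    (X0 : PreCtx A) (f g : A.Var → Expr A) : Prop where
  e : U = ⟨S, X0.map fun r => f r.1⟩
  e' : U' = ⟨S, X0.map fun r => g r.1⟩
  eq : ∀ r ∈ X0, ∃ V, Lv Ax p (.termEq X (f r.1) (g r.1) V)

theorem subst_ctxVars (S : A.SortSym) (X : PreCtx A) (σ : A.Var → Expr A) :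
    SortE.subst σ ⟨S, ctxVars X⟩ = ⟨S, X.map fun r => σ r.1⟩ := by
  simp [SortE.subst, ctxVars, Function.comp_def]

theorem Lv.sortEq_dec {Ax : Set (Judg A)} {U U'} (h : Lv Ax (p + 1) (.sortEq X U U')) :
    Lv Ax p (.sort X U) ∧ Lv Ax p (.sort X U') ∧ (U = U' ∨ SQ Ax p X U U' ∨
      (∃ V, SQ Ax p X U V ∧ SQ Ax p X V U') ∨ (∃ X0 U0 U0' σ, AxI Ax p X U U' X0 U0 U0' σ) ∨
      ∃ S X0 f g, CgI Ax p X U U' S X0 f g) := by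
  obtain ⟨k, hk, hst, h1, h2⟩ := h.step
  refine ⟨h1.mono hk, h2.mono hk, ?_⟩
  clear h
  cases hst with
  | s1 h => exact .inl rfl
  | s2 h => exact .inr (.inl (.inr (h.mono hk)))
  | s3 h h' => exact .inr (.inr (.inl ⟨_, .inl (h.mono hk), .inl (h'.mono hk)⟩))
  | sEq hax hJ hJ' hv a1 a2 hσ =>
    refine .inr (.inr (.inr (.inl ⟨_, _, _, _, hax, hJ.mono hk, hJ'.mono hk,
      fun z hz => .of_lv ((hσ z hz).mono hk), rfl, rfl, ?_⟩)))
    have : LStep Ax (Lv Ax k) _ := .sEq hax hJ hJ' hv (σ := .var) (by rwa [SortE.subst_id])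
      (by rwa [SortE.subst_id]) (fun p hp => by rw [SortE.subst_id]; exact hv p hp)
    rw [SortE.subst_id, SortE.subst_id] at this
    exact Lv.mono (Nat.succ_le_succ hk) (show Lv Ax (k + 1) _ from .inr ⟨this, hJ, hJ'⟩)
  | sCong hax hJ hv a1 a2 hσ =>
    exact .inr (.inr (.inr (.inr ⟨_, _, _, _, subst_ctxVars _ _ _, subst_ctxVars _ _ _,
      fun r hr => ⟨_, (hσ r hr).mono hk⟩⟩)))

/-- Analysis of sort equalities in either orientation. -/
theorem SQ.dec {Ax : Set (Judg A)} {U U'} (h : SQ Ax (p + 1) X U U') :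
    Lv Ax p (.sort X U) ∧ Lv Ax p (.sort X U') ∧ (U = U' ∨ SQ Ax p X U U' ∨
      (∃ V, SQ Ax p X U V ∧ SQ Ax p X V U') ∨
      (∃ X0 U0 U0' σ, AxI Ax p X U U' X0 U0 U0' σ ∨ AxI Ax p X U' U X0 U0 U0' σ) ∨
      ∃ S X0 f g, CgI Ax p X U U' S X0 f g ∨ CgI Ax p X U' U S X0 f g) := by
  rcases h with h | h
  · obtain ⟨h1, h2, h3 | h3 | h3 | ⟨X0, U0, U0', σ, h3⟩ | ⟨S, X0, f, g, h3⟩⟩ := h.sortEq_dec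
    · exact ⟨h1, h2, .inl h3⟩
    · exact ⟨h1, h2, .inr (.inl h3)⟩
    · exact ⟨h1, h2, .inr (.inr (.inl h3))⟩
    · exact ⟨h1, h2, .inr (.inr (.inr (.inl ⟨X0, U0, U0', σ, .inl h3⟩)))⟩
    · exact ⟨h1, h2, .inr (.inr (.inr (.inr ⟨S, X0, f, g, .inl h3⟩)))⟩
  · obtain ⟨h1, h2, h3 | h3 | ⟨V, h3, h4⟩ | ⟨X0, U0, U0', σ, h3⟩ | ⟨S, X0, f, g, h3⟩⟩ :=
      h.sortEq_dec
    · exact ⟨h2, h1, .inl h3.symm⟩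
    · exact ⟨h2, h1, .inr (.inl h3.symm)⟩
    · exact ⟨h2, h1, .inr (.inr (.inl ⟨V, h4.symm, h3.symm⟩))⟩
    · exact ⟨h2, h1, .inr (.inr (.inr (.inl ⟨X0, U0, U0', σ, .inr h3⟩)))⟩
    · exact ⟨h2, h1, .inr (.inr (.inr (.inr ⟨S, X0, f, g, .inr h3⟩)))⟩

theorem EC.snoc_lv {Ax : Set (Judg A)} {U x} (h : Lv Ax p (.sort X U)) (hx : ∀ r ∈ X, r.1 ≠ x) :
    EC Ax p (X ++ [(x, U)]) := .snoc h.sort_ec (fun _ => id) h hx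

include D

theorem TD.L_congr {X1 Y1} {u u' t ts ts'} {W} {α β : Type} {l1 : List α}
    {l2 : List β} {f g : α → Expr A} {f' g' : β → Expr B}
    (hd : Der TC (.term Γ (O.L X Y U u t ts) W)) (e : U.head = U'.head)
    (e1 : U.args ++ [u] = l1.map f) (e2 : U'.args ++ [u'] = l1.map g) (e3 : ts = l2.map f')
    (e4 : ts' = l2.map g')
    (h : ∀ a ∈ l1, ∀ b ∈ l2, EqT TC Γ (O.T X Y (f a) (f' b)) (O.T X1 Y1 (g a) (g' b))) :
    EqT TC Γ (O.L X Y U u t ts) (O.L X1 Y1 U' u' t ts') := by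
  subst e3 e4
  unfold TOps.L at hd ⊢
  rw [← e, e1, e2] at *
  rw [D.l.grid_mapL, D.grid_mapR] at hd ⊢
  rw [D.l.grid_mapL, D.grid_mapR]
  exact .app D.l.ptC hd (D.forall₂_grid h)

theorem TD.W_congrT {X1 Y1} {u u'} {V' : SortE B} {v v'} {α β : Type}
    {l1 : List α} {a0 : α} {l2 : List β} {b0 : β} {f g : α → Expr A} {f' g' : β → Expr B}
    (hd : Der TC (.sort Γ (O.W X Y U u V v)) ∨ Der TC (.sort Γ (O.W X1 Y1 U' u' V' v')))
    (e : U.head = U'.head) (e' : V.head = V'.head) (e1 : U.args = l1.map f)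
    (e2 : U'.args = l1.map g) (e3 : V.args = l2.map f') (e4 : V'.args = l2.map g')
    (i1 : u = f a0) (i2 : u' = g a0) (i3 : v = f' b0) (i4 : v' = g' b0)
    (h : ∀ a b, (a ∈ l1 ∧ b ∈ l2 ++ [b0]) ∨ (a ∈ l1 ++ [a0] ∧ b ∈ l2) → EqT TC Γ (O.T X Y (f a)
      (f' b)) (O.T X1 Y1 (g a) (g' b)))
    :
    Der TC (.sortEq Γ (O.W X Y U u V v) (O.W X1 Y1 U' u' V' v')) := by
  have key : ∀ (X : PreCtx A) (Y : PreCtx B) (U : SortE A) u (V : SortE B) v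
      (f : α → Expr A) (f' : β → Expr B),
      U.args = l1.map f → V.args = l2.map f' → u = f a0 → v = f' b0 →
      O.W X Y U u V v = ⟨O.gS U.head V.head,
        ((O.grid Prod.mk (l1 ++ [a0]) (l2 ++ [b0])).dropLast).map fun r => O.T X Y (f r.1)
          (f' r.2)⟩ := by
    intro X Y U u V v f f' e1 e3 i1 i3
    have j1 : U.args ++ [u] = (l1 ++ [a0]).map f := by simp [e1, i1]
    have j3 : V.args ++ [v] = (l2 ++ [b0]).map f' := by simp [e3, i3]
    rw [TOps.W, j1, j3, D.grid_eq, D.grid_mk_map, map_map, ← List.map_dropLast]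
    rfl
  have k1 := key X Y U u V v f f' e1 e3 i1 i3
  have k2 := key X1 Y1 U' u' V' v' g g' e2 e4 i2 i4
  rw [← e, ← e'] at k2
  have hF : List.Forall₂ (EqT TC Γ)
      (((O.grid Prod.mk (l1 ++ [a0]) (l2 ++ [b0])).dropLast).map fun r => O.T X Y (f r.1) (f' r.2))
      (((O.grid Prod.mk (l1 ++ [a0]) (l2 ++ [b0])).dropLast).map
        fun r => O.T X1 Y1 (g r.1) (g' r.2)) := by
    rw [List.forall₂_map_left_iff, List.forall₂_map_right_iff, List.forall₂_same]
    rintro ⟨a, b⟩ hr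
    refine h a b ?_
    rw [D.l.mem_dropLast] at hr
    rcases hr with ⟨a', ha, b', hb, e⟩ | ⟨a', ha, b', hb, e⟩ <;> cases e
    · exact .inl ⟨ha, hb⟩
    · exact .inr ⟨ha, hb⟩
  rw [k1, k2]
  rcases hd with hd | hd
  · rw [k1] at hd
    exact sortEq_congr D.l.ptC hd hF
  · rw [k2] at hd
    exact .s2 (sortEq_congr D.l.ptC hd (hF.flip.imp fun _ _ h => EqT.symm h))

/-- Identities between tensors of contexts with equal last sorts. -/
theorem Half.conv (H : Half O TA TB TC p q) {x U U'} (h : SQ TA p X U U')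
    (hx : ∀ r ∈ X, r.1 ≠ x) (hY : EC TB q Y) (hΓ : Der TC (.ctx Γ))
    (hs : O.ten (X ++ [(x, U)]) Y ⊆ Γ) : IsSub TC Γ (O.ten (X ++ [(x, U')]) Y) .var := by
  have d1 : Der TA (.ctx (X ++ [(x, U)])) := .cons h.left.der hx
  have d2 : Der TA (.ctx (X ++ [(x, U')])) := .cons h.right.der hx
  intro z hz
  rw [SortE.subst_id]
  obtain ⟨⟨a, S⟩, ha, ⟨b, V⟩, hb, rfl⟩ := D.mem_ten.1 hz
  rcases mem_append.1 ha with ha' | ha'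
  · have hS := h.left.der.sort_ctx.vars ha'
    have hV := hY.der.vars hb
    rw [← D.W_mono d2 hY.der (X := X) (Y := Y) (by simp) (fun _ => id) hS.term_sort ⟨_, hS⟩
      hV.term_sort ⟨_, hV⟩, D.W_mono d1 hY.der (X := X) (Y := Y) (by simp) (fun _ => id)
      hS.term_sort ⟨_, hS⟩ hV.term_sort ⟨_, hV⟩]
    exact hΓ.vars (hs (D.mem_ten_of (mem_append_left _ ha') hb))
  · obtain ⟨rfl, rfl⟩ : a = x ∧ S = U' := by simpa using ha'
    obtain ⟨Y1, Y2, e⟩ := List.append_of_mem hb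
    have hp : Y1 ++ [(b, V)] <+: Y := ⟨Y2, by simp [e]⟩
    have eY := hY.initial hp
    have sY : Y1 ++ [(b, V)] ⊆ Y := hp.subset
    have dV := (Der.ctx_snoc eY.der).1
    have hV := eY.der.vars (p := (b, V)) (by simp)
    have mU {U} (dd : Der TA (.ctx (X ++ [(a, U)]))) := dd.vars (p := (a, U)) (by simp)
    have k := H.sew (y := b) h hx eY hΓ
      (List.Subset.trans (D.ten_mono d1 d1 dV.sort_ctx hY.der (fun _ => id)
        (fun r hr => sY (mem_append_left _ hr))) hs)
      (List.Subset.trans (D.ten_mono h.left.der.sort_ctx d1 eY.der hY.der (by simp) sY) hs)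
    rw [D.W_mono d1 hY.der (fun _ => id) sY (mU d1).term_sort ⟨_, mU d1⟩ hV.term_sort ⟨_, hV⟩,
      D.W_mono d2 hY.der (fun _ => id) sY (mU d2).term_sort ⟨_, mU d2⟩ hV.term_sort ⟨_, hV⟩] at k
    exact .seqt k (hΓ.vars (hs (D.mem_ten_of (by simp) hb)))

omit D

theorem isSub_append {Ax : Set (Judg A)} {Γ Y : PreCtx A} {σ} (h1 : IsSub Ax Γ X σ)
    (h2 : IsSub Ax Γ Y σ) : IsSub Ax Γ (X ++ Y) σ := fun z hz =>
  (mem_append.1 hz).elim (h1 z) (h2 z)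

include D

theorem isSub_par {r s θ} (hX : Der TA (.ctx (X ++ [r])))
    (hY : Der TB (.ctx (Y ++ [s]))) (h1 : IsSub TC Γ (O.ten X (Y ++ [s])) θ)
    (h2 : IsSub TC Γ (O.ten (X ++ [r]) Y) θ) : IsSub TC Γ (O.par (X ++ [r]) (Y ++ [s])) θ :=
  (isSub_append h1 h2).mono ((D.par_sub hX hY).2 ⟨by simp, by simp⟩)

omit D

theorem isSub_of_subset {Ax : Set (Judg A)} {Γ : PreCtx A} (h : X ⊆ Γ) (hΓ : Der Ax (.ctx Γ)) :
    IsSub Ax Γ X .var := fun z hz => by rw [SortE.subst_id]; exact hΓ.vars (h hz)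

theorem EqT.conv {Ax : Set (Judg A)} {Γ Δ : PreCtx A} {u v} (h : EqT Ax Δ u v)
    (hσ : IsSub Ax Γ Δ .var) (hΓ : Der Ax (.ctx Γ)) : EqT Ax Γ u v := by
  have := h.subst hσ hΓ
  rwa [Expr.subst_id, Expr.subst_id] at this

theorem mem_snocCh {ch : PreCtx A → A.Var} {U} : (ch X, U) ∈ snocCh ch X U := by simp [snocCh]

theorem sub_snocCh {ch : PreCtx A → A.Var} {U} : X ⊆ snocCh ch X U := by simp [snocCh]

include D

theorem TD.freshB (Y : PreCtx B) : ∀ r ∈ Y, r.1 ≠ O.chB Y := D.r.fresh Y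

include H1

theorem SEt_typed {X0 U0 Ya t Va}
    (hU : Lv TA p (.sort X0 U0)) (ec : EC TB q Ya) (hV : Lv TB q (.sort Ya Va))
    (gen : Lv TB (q + 1) (introTerm Ya t Va)) :
    Sit O TA TB TC p (q + 1) (snocCh O.chA X0 U0) Ya (O.ten (snocCh O.chA X0 U0) Ya)
      (snocCh O.chA X0 U0) (snocCh O.chB Ya Va) .var (upd .var (O.chB Ya) (.app t (ctxVars Ya))) ∧
    Der TC (.term (O.ten (snocCh O.chA X0 U0) Ya)
      (O.T (snocCh O.chA X0 U0) Ya (.var (O.chA X0)) (.app t (ctxVars Ya)))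
      ((O.W (snocCh O.chA X0 U0) (snocCh O.chB Ya Va) U0 (.var (O.chA X0)) Va
        (.var (O.chB Ya))).subst (O.TS (snocCh O.chA X0 U0) Ya .var
          (upd .var (O.chB Ya) (.app t (ctxVars Ya)))))) := by
  have eX : EC TA p (snocCh O.chA X0 U0) := EC.snoc_lv hU (D.l.fresh X0)
  have eY : EC TB (q + 1) Ya := ec.mono (by omega)
  have hΔ := H1.self.ctx_ten D eX eY
  have tg : TmS TB (q + 1) Ya (.app t (ctxVars Ya)) Va := .of_lv gen
  have tx : TmS TA p (snocCh O.chA X0 U0) (.var (O.chA X0)) U0 := .of_mem mem_snocCh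
  have S : Sit O TA TB TC p (q + 1) (snocCh O.chA X0 U0) Ya (O.ten (snocCh O.chA X0 U0) Ya)
      (snocCh O.chA X0 U0) (snocCh O.chB Ya Va) .var (upd .var (O.chB Ya) (.app t (ctxVars Ya))) :=
    (sit_upd D.op (Γ := O.ten (snocCh O.chA X0 U0) Ya) eY eX hΔ (fun _ => id) (fun _ => id) hV.der
      (D.freshB Ya) tg).op
  refine ⟨S, ?_⟩
  have k := pairOK D H1 eX eY hΔ (fun _ => id) tx tg
  have su : Va.subst (upd .var (O.chB Ya) (.app t (ctxVars Ya))) = Va := by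
    rw [sort_upd D.r.pt hV.der (D.freshB Ya), SortE.subst_id]
  have w := W_sit D S (S.s1 D H1) (U := U0) (u := .var (O.chA X0)) (V := Va) (v := .var (O.chB Ya))
    (tx.der eX.der) (by rwa [SortE.subst_id, Expr.subst_var]) (S.dY.vars mem_snocCh)
    (by rwa [Expr.subst_var, upd_self, su])
    (.inl (by rw [Expr.subst_var, Expr.subst_var, upd_self, su,
      SortE.subst_id]; exact Der.term_sort k))
  rw [Expr.subst_var, Expr.subst_var, upd_self, su, SortE.subst_id] at w
  exact .seqt w k

include H2

theorem SEt_ax {X0 U0 U0' Ya t Va} (ax : .sortEq X0 U0 U0' ∈ TA)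
    (lv : Lv TA (p + 1) (.sortEq X0 U0 U0')) (hU : Lv TA p (.sort X0 U0))
    (hU' : Lv TA p (.sort X0 U0')) (ax' : introTerm Ya t Va ∈ TB) (ec : EC TB q Ya)
    (hV : Lv TB q (.sort Ya Va)) (gen : Lv TB (q + 1) (introTerm Ya t Va)) :
    EqT TC (O.ten (snocCh O.chA X0 U0) Ya)
      (O.T (snocCh O.chA X0 U0) Ya (.var (O.chA X0)) (.app t (ctxVars Ya)))
      (O.T (snocCh O.chA X0 U0') Ya (.var (O.chA X0)) (.app t (ctxVars Ya))) := by
  obtain ⟨S1, k1⟩ := SEt_typed D H1 hU ec hV gen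
  obtain ⟨S2, k2⟩ := SEt_typed D H1 hU' ec hV gen
  have sq : SQ TA (p + 1) X0 U0 U0' := .inl lv
  have eX := S1.eX
  have eX' := S2.eX
  have eYs : EC TB q (snocCh O.chB Ya Va) := EC.snoc_lv hV (D.freshB Ya)
  have hΔ := S1.dΓ
  have cv := H2.l.conv D sq (D.l.fresh X0) ec hΔ (fun _ => id)
  have k3 := k2.sub_term cv hΔ
  rw [Expr.subst_id, SortE.subst_id] at k3
  have hΘ {U} (h : EC TA p (snocCh O.chA X0 U)) := H2.self.ctx_ten D (h.mono (by omega)) eYs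
  have hP {U} (h : EC TA p (snocCh O.chA X0 U)) :
      Der TC (.ctx (O.par (snocCh O.chA X0 U) (snocCh O.chB Ya Va))) :=
    ctx_par D H1.self H2.self (hU.sort_ec) (h.mono (Nat.le_succ p)) ec (eYs.mono (by omega))
  have p1 {U} (h : EC TA p (snocCh O.chA X0 U)) := (D.par_sub h.der eYs.der).1 (fun _ => id)
  have w1 := H2.l.sew (x := O.chA X0) sq (D.l.fresh X0) eYs (hP eX) (p1 eX).2 (p1 eX).1
  have sub1 := (S1.mor D H1).mono (Y := O.par (snocCh O.chA X0 U0) (snocCh O.chB Ya Va))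
    (List.dropLast_subset _)
  have w2 := w1.sub_sortEq sub1 hΔ
  have sw := H1.self.sw_last D eX' (eYs.mono (by omega)) (hP eX') (p1 eX').1 (p1 eX').2
  have e : (O.W (snocCh O.chA X0 U0') (snocCh O.chB Ya Va) U0' (.var (O.chA X0)) Va
        (.var (O.chB Ya))).subst (O.TS (snocCh O.chA X0 U0) Ya .var
          (upd .var (O.chB Ya) (.app t (ctxVars Ya)))) =
      (O.W (snocCh O.chA X0 U0') (snocCh O.chB Ya Va) U0' (.var (O.chA X0)) Va
        (.var (O.chB Ya))).subst (O.TS (snocCh O.chA X0 U0') Ya .var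
          (upd .var (O.chB Ya) (.app t (ctxVars Ya)))) := by
    refine SortE.subst_congr _ fun z hz => ?_
    have := sw.sscoped D.l.ptC z hz
    obtain ⟨w, hw, rfl⟩ := mem_map.1 this
    rcases D.mem_par.1 hw with ⟨a, ha, b, hb, rfl⟩ | ⟨a, ha, b, hb, rfl⟩
    · dsimp only
      rw [D.TS_v, D.TS_v]
      have wa := hU.sort_ec.der.vars ha
      have wb : WT TB Ya (upd Expr.var (O.chB Ya) (.app t (ctxVars Ya)) b.1) := by
        rcases mem_append.1 hb with hb | hb
        · rw [upd_ne _ _ (D.freshB Ya b hb)]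
          exact ⟨_, ec.der.vars hb⟩
        · obtain rfl : b = (O.chB Ya, Va) := by simpa using hb
          rw [upd_self]
          exact ⟨_, gen.der⟩
      rw [← D.T_mono hU.sort_ec.der eX.der ec.der ec.der sub_snocCh (fun _ => id) ⟨_, wa⟩ wb,
        ← D.T_mono hU.sort_ec.der eX'.der ec.der ec.der sub_snocCh (fun _ => id) ⟨_, wa⟩ wb]
    · dsimp only
      rw [D.TS_v, D.TS_v, upd_ne _ _ (D.freshB Ya b hb), D.l.T_vv, D.l.T_vv]
  have w3 : Der TC (.sortEq (O.ten (snocCh O.chA X0 U0) Ya)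
      ((O.W (snocCh O.chA X0 U0) (snocCh O.chB Ya Va) U0 (.var (O.chA X0)) Va
        (.var (O.chB Ya))).subst (O.TS (snocCh O.chA X0 U0) Ya .var
          (upd .var (O.chB Ya) (.app t (ctxVars Ya)))))
      ((O.W (snocCh O.chA X0 U0') (snocCh O.chB Ya Va) U0' (.var (O.chA X0)) Va
        (.var (O.chB Ya))).subst (O.TS (snocCh O.chA X0 U0') Ya .var
          (upd .var (O.chB Ya) (.app t (ctxVars Ya)))))) := by
    rw [← e]; exact w2
  exact ⟨_, D.l.ruleSEt ax ax' lv.der gen.der rfl k1 (.seqt w3.s2 k3)⟩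

omit D H1 H2

theorem LSub.snoc {Ax : Set (Judg A)} (hPT : PT Ax) {ch : PreCtx A → A.Var}
    (fresh : ∀ X : PreCtx A, ∀ r ∈ X, r.1 ≠ ch X) {X0 U0 x} (h : LSub Ax p X X0 τ)
    (hU : Der Ax (.sort X0 U0)) :
    LSub Ax p (X ++ [(x, U0.subst τ)]) (snocCh ch X0 U0) (upd τ (ch X0) (.var x)) :=
  upd_snoc hPT (.cons hU (fresh X0)) (P := fun u U => TmS Ax p (X ++ [(x, U0.subst τ)]) u U)
    (fun z hz => (h z hz).mono (by simp)) (.of_mem (by simp))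

include D H

/-- Changing the sort of the last variable does not affect the tensor. -/
theorem Good.set_pt {x U U' a w V}
    (h : SQ TA p X U U') (hx : ∀ r ∈ X, r.1 ≠ x) (hY : EC TB q Y) (hw : TmS TB q Y w V)
    (hΓ : Der TC (.ctx Γ)) (hs : O.ten (X ++ [(x, U)]) Y ⊆ Γ)
    (ha : a = .var x ∨ ∃ S, TmS TA p X a S) :
    EqT TC Γ (O.T (X ++ [(x, U)]) Y a w) (O.T (X ++ [(x, U')]) Y a w) := by
  rcases ha with rfl | ⟨S, ha⟩
  · exact H.l.set h hx hY hw hΓ hs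
  · have eX : EC TA p (X ++ [(x, U)]) := EC.snoc_lv h.left hx
    have eX' : EC TA p (X ++ [(x, U')]) := EC.snoc_lv h.right hx
    obtain ⟨W, hW⟩ := H.self.wt D eX hY hΓ hs (ha.mono (by simp)) hw
    have k := hW
    rw [← D.T_mono eX.of_snoc.1.der eX.der hY.der hY.der (by simp) (fun _ => id)
      ⟨_, ha.der eX.of_snoc.1.der⟩ ⟨_, hw.der hY.der⟩] at k
    rw [← D.T_mono eX.of_snoc.1.der eX.der hY.der hY.der (by simp) (fun _ => id)
      ⟨_, ha.der eX.of_snoc.1.der⟩ ⟨_, hw.der hY.der⟩,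
      ← D.T_mono eX.of_snoc.1.der eX'.der hY.der hY.der (by simp) (fun _ => id)
      ⟨_, ha.der eX.of_snoc.1.der⟩ ⟨_, hw.der hY.der⟩]
    exact .refl k

omit D H

theorem upd_cases {ch : PreCtx A → A.Var} (fresh : ∀ X : PreCtx A, ∀ r ∈ X, r.1 ≠ ch X)
    {Ax : Set (Judg A)} {X0 U0 x} (h : LSub Ax p X X0 τ) {z} (hz : z ∈ snocCh ch X0 U0) :
    upd τ (ch X0) (.var x) z.1 = .var x ∨ ∃ S, TmS Ax p X (upd τ (ch X0) (.var x) z.1) S := by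
  rcases mem_append.1 hz with hz | hz
  · rw [upd_ne _ _ (fresh X0 z hz)]
    exact .inr ⟨_, h z hz⟩
  · obtain rfl : z = (ch X0, U0) := by simpa using hz
    exact .inl (upd_self _ _ _)

include D H1 H2

theorem half_set_ax {x U U' X0 U0 U0' σ t ts Ya Va Y0 V}
    (hsq : SQ TA (p + 1) X U U') (hU : Lv TA p (.sort X U)) (hU' : Lv TA p (.sort X U'))
    (I : AxI TA p X U U' X0 U0 U0' σ) (hx : ∀ r ∈ X, r.1 ≠ x)
    (J : TermInv TB q Y0 t ts Ya Va ρ) (hv : Lv TB (q + 1) (.term Y0 (.app t ts) V)) :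
    EqT TC (O.ten (X ++ [(x, U)]) Y0) (O.T (X ++ [(x, U)]) Y0 (.var x) (.app t ts))
      (O.T (X ++ [(x, U')]) Y0 (.var x) (.app t ts)) := by
  have k := SEt_ax D H1 H2 I.ax I.lv I.s I.s' J.ax J.ec J.sort J.gen
  have eX : EC TA p (X ++ [(x, U)]) := EC.snoc_lv hU hx
  have eX' : EC TA p (X ++ [(x, U')]) := EC.snoc_lv hU' hx
  have eY : EC TB (q + 1) Y0 := J.ecX.mono (by omega)
  have hΓ := H1.self.ctx_ten D eX eY
  have lρ : LSub TB (q + 1) Y0 Ya ρ := fun z hz => .of_lv ((J.sub z hz).mono (by omega))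
  have hts : Expr.subst ρ (.app t (ctxVars Ya)) = .app t ts := by
    simp [J.args, ctxVars, Function.comp_def]
  have sit {W W0} (eW : W0.subst σ = W) (hW : Lv TA p (.sort X W)) (hW0 : Lv TA p (.sort X0 W0)) :
      Sit O TA TB TC p (q + 1) (X ++ [(x, W)]) Y0 (O.ten (X ++ [(x, W)]) Y0) (snocCh O.chA X0 W0) Ya
        (upd σ (O.chA X0) (.var x)) ρ := by
    have eX : EC TA p (X ++ [(x, W)]) := EC.snoc_lv hW hx
    refine ⟨eX, eY, H1.self.ctx_ten D eX eY, fun _ => id, (EC.snoc_lv hW0 (D.l.fresh X0)).der,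
      J.ec.der, ?_, lρ⟩
    subst eW
    exact I.sub.snoc D.l.pt D.l.fresh hW0.der
  have s1 {W W0} (eW : W0.subst σ = W) (hW : Lv TA p (.sort X W)) (hW0 : Lv TA p (.sort X0 W0)) :
      EqT TC (O.ten (X ++ [(x, W)]) Y0) (O.T (X ++ [(x, W)]) Y0 (.var x) (.app t ts))
        ((O.T (snocCh O.chA X0 W0) Ya (.var (O.chA X0)) (.app t (ctxVars Ya))).subst
          (O.TS (X ++ [(x, W)]) Y0 (upd σ (O.chA X0) (.var x)) ρ)) := by
    have S := sit eW hW hW0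
    have := S.s1 D H1 (u := .var (O.chA X0)) (v := .app t (ctxVars Ya))
      ⟨_, S.dX.vars mem_snocCh⟩ ⟨_, J.gen.der⟩
      (by rw [Expr.subst_var]; exact ⟨_, S.lτ _ mem_snocCh⟩) (by rw [hts]; exact ⟨_, .of_lv hv⟩)
    unfold S1 at this
    rwa [Expr.subst_var, upd_self, hts] at this
  have S := sit I.e hU I.s
  have S' := sit I.e' hU' I.s'
  have c1 := s1 I.e hU I.s
  have cv := H2.l.conv D hsq hx J.ecX hΓ (fun _ => id)
  have c2 := (s1 I.e' hU' I.s').conv cv hΓ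
  have m := S.mor D H1
  have m' := (S'.mor D H1).comp cv hΓ
  simp only [Expr.subst_id] at m'
  have pt : ∀ z ∈ O.ten (snocCh O.chA X0 U0') Ya,
      EqT TC (O.ten (X ++ [(x, U)]) Y0) (O.TS (X ++ [(x, U')]) Y0 (upd σ (O.chA X0) (.var x)) ρ z.1)
      (O.TS (X ++ [(x, U)]) Y0 (upd σ (O.chA X0) (.var x)) ρ z.1) := by
    intro z hz
    obtain ⟨a, ha, b, hb, rfl⟩ := D.mem_ten.1 hz
    dsimp only
    rw [D.TS_v, D.TS_v]
    have := I.sub.mono (fun _ => id) (Nat.le_succ p)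
    exact (H2.set_pt D hsq hx J.ecX (TmS.of_lv (J.sub b hb)) hΓ (fun _ => id)
      (upd_cases D.l.fresh this ha)).symm
  have hW := (SEt_typed D H1 I.s' J.ec J.sort J.gen).2
  have c3 := EqT.subst_congr D.l.ptC hW m' pt hΓ
  have c4 := k.subst m hΓ
  exact (c1.trans D.l.ptC c4).trans D.l.ptC ((c2.trans D.l.ptC c3).symm)

omit H1 H2

/-- Two sides of a congruence, related inside the tensor with a term of the other theory. -/
theorem cg_pair (H1 : Good O TA TB TC p q) {x U U' u u' W b V}
    (hU : Lv TA p (.sort X U)) (hU' : Lv TA p (.sort X U')) (hx : ∀ r ∈ X, r.1 ≠ x)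
    (hY : EC TB q Y) (hb : TmS TB q Y b V) (h : Lv TA p (.termEq X u u' W))
    (hΓ : Der TC (.ctx Γ)) (hs : O.ten X Y ⊆ Γ) :
    EqT TC Γ (O.T (X ++ [(x, U)]) Y u b) (O.T (X ++ [(x, U')]) Y u' b) := by
  have eX : EC TA p (X ++ [(x, U)]) := EC.snoc_lv hU hx
  have eX' : EC TA p (X ++ [(x, U')]) := EC.snoc_lv hU' hx
  rw [← D.T_mono eX.of_snoc.1.der eX.der hY.der hY.der (by simp) (fun _ => id)
      ⟨_, h.der.termEq_left⟩ ⟨_, hb.der hY.der⟩,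
    ← D.T_mono eX.of_snoc.1.der eX'.der hY.der hY.der (by simp) (fun _ => id)
      ⟨_, h.der.termEq_right⟩ ⟨_, hb.der hY.der⟩]
  exact H1.l.te h hY hb hΓ hs

theorem ten_left_sub {r : A.Var × SortE A} (h : Der TA (.ctx (X ++ [r])))
    (hX : Der TA (.ctx X)) (hY : Der TB (.ctx Y)) : O.ten X Y ⊆ O.ten (X ++ [r]) Y :=
  D.ten_mono hX h hY hY (by simp) fun _ => id

include H1 H2

theorem half_set_cg {x U U' S X0 f g t ts Ya Va Y0 V}
    (hsq : SQ TA (p + 1) X U U') (hU : Lv TA p (.sort X U)) (hU' : Lv TA p (.sort X U'))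
    (I : CgI TA p X U U' S X0 f g) (hx : ∀ r ∈ X, r.1 ≠ x)
    (J : TermInv TB q Y0 t ts Ya Va ρ) (hv : Lv TB (q + 1) (.term Y0 (.app t ts) V)) :
    EqT TC (O.ten (X ++ [(x, U)]) Y0) (O.T (X ++ [(x, U)]) Y0 (.var x) (.app t ts))
      (O.T (X ++ [(x, U')]) Y0 (.var x) (.app t ts)) := by
  have eX : EC TA p (X ++ [(x, U)]) := EC.snoc_lv hU hx
  have eX' : EC TA p (X ++ [(x, U')]) := EC.snoc_lv hU' hx
  have eY : EC TB (q + 1) Y0 := J.ecX.mono (by omega)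
  have hΓ := H1.self.ctx_ten D eX eY
  obtain ⟨W, hW⟩ := H1.self.wt D eX eY hΓ (fun _ => id) (u := .var x) (.of_mem (U := U) (by simp))
    (.of_lv hv)
  have e (U) (eX : EC TA p (X ++ [(x, U)])) : O.T (X ++ [(x, U)]) Y0 (.var x) (.app t ts) =
      O.L (X ++ [(x, U)]) Y0 U (.var x) t ts :=
    D.l.T_L eX.der eY.der ⟨_, eX.der.vars (p := (x, U)) (by simp)⟩ (canonSort_var.2 (by simp))
      ⟨_, hv.der⟩ (.inl ⟨_, rfl⟩)
  rw [e _ eX] at hW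
  rw [e _ eX, e _ eX']
  refine D.L_congr hW (by rw [I.e, I.e']) (l1 := X0.map some ++ [none]) (l2 := ts)
    (f := fun o => o.elim (.var x) fun r => f r.1) (g := fun o => o.elim (.var x) fun r => g r.1)
    (f' := id) (g' := id) (by simp [I.e, Function.comp_def]) (by simp [I.e', Function.comp_def])
    (by simp) (by simp) ?_
  intro a ha b hb
  obtain ⟨Vb, hbl⟩ := hv.app_args hb
  rcases mem_append.1 ha with ha | ha
  · obtain ⟨r, hr, rfl⟩ := mem_map.1 ha
    obtain ⟨W', hW'⟩ := I.eq r hr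
    exact cg_pair D H1 hU hU' hx eY ((TmS.of_lv hbl).mono_level (Nat.le_succ q)) hW' hΓ
      (ten_left_sub D eX.der eX.of_snoc.1.der eY.der)
  · obtain rfl : a = none := by simpa using ha
    exact H2.l.set hsq hx J.ecX (.of_lv hbl) hΓ fun _ => id

theorem half_set_app {x U U' t ts Y0 V}
    (hsq : SQ TA (p + 1) X U U') (hx : ∀ r ∈ X, r.1 ≠ x)
    (hv : Lv TB (q + 1) (.term Y0 (.app t ts) V)) :
    EqT TC (O.ten (X ++ [(x, U)]) Y0) (O.T (X ++ [(x, U)]) Y0 (.var x) (.app t ts))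
      (O.T (X ++ [(x, U')]) Y0 (.var x) (.app t ts)) := by
  obtain ⟨hU, hU', h⟩ := hsq.dec
  obtain ⟨Ya, Va, ρ, J⟩ := hv.inv_app
  have eX : EC TA p (X ++ [(x, U)]) := EC.snoc_lv hU hx
  have eX' : EC TA p (X ++ [(x, U')]) := EC.snoc_lv hU' hx
  have eY : EC TB (q + 1) Y0 := J.ecX.mono (by omega)
  have hΓ := H1.self.ctx_ten D eX eY
  have hv' : TmS TB (q + 1) Y0 (.app t ts) V := .of_lv hv
  have flip : ∀ {P : Prop}, (SQ TA (p + 1) X U' U → EqT TC (O.ten (X ++ [(x, U')]) Y0)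
      (O.T (X ++ [(x, U')]) Y0 (.var x) (.app t ts)) (O.T (X ++ [(x, U)]) Y0 (.var x) (.app t ts)))
      → EqT TC (O.ten (X ++ [(x, U)]) Y0) (O.T (X ++ [(x, U)]) Y0 (.var x) (.app t ts))
      (O.T (X ++ [(x, U')]) Y0 (.var x) (.app t ts)) := fun {_} k =>
    ((k hsq.symm).conv (H2.l.conv D hsq hx J.ecX hΓ fun _ => id) hΓ).symm
  rcases h with rfl | h | ⟨W, h, h'⟩ | ⟨X0, U0, U0', σ, I | I⟩ | ⟨S, X0, f, g, I | I⟩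
  · obtain ⟨W, hW⟩ := H1.self.wt D eX eY hΓ (fun _ => id) (u := .var x)
      (.of_mem (U := U) (by simp)) hv'
    exact .refl hW
  · exact H1.l.set h hx eY hv' hΓ fun _ => id
  · have hW := H1.self.ctx_ten D (EC.snoc_lv h.right hx) eY
    exact (H1.l.set h hx eY hv' hΓ fun _ => id).trans D.l.ptC
      ((H1.l.set h' hx eY hv' hW fun _ => id).conv (H1.l.conv D h hx eY hΓ fun _ => id) hΓ)
  · exact half_set_ax D H1 H2 hsq hU hU' I hx J hv
  · exact flip (P := True) fun k => half_set_ax D H1 H2 k hU' hU I hx J hv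
  · exact half_set_cg D H1 H2 hsq hU hU' I hx J hv
  · exact flip (P := True) fun k => half_set_cg D H1 H2 k hU' hU I hx J hv

theorem half_set (S : Self O TA TB TC (p + 1) (q + 1)) {x U U' v V}
    (hsq : SQ TA (p + 1) X U U') (hx : ∀ r ∈ X, r.1 ≠ x) (hY : EC TB (q + 1) Y)
    (hv : TmS TB (q + 1) Y v V) (hΓ : Der TC (.ctx Γ)) (hs : O.ten (X ++ [(x, U)]) Y ⊆ Γ) :
    EqT TC Γ (O.T (X ++ [(x, U)]) Y (.var x) v) (O.T (X ++ [(x, U')]) Y (.var x) v) := by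
  have eX : EC TA (p + 1) (X ++ [(x, U)]) := EC.snoc_lv hsq.left hx
  have eX' : EC TA (p + 1) (X ++ [(x, U')]) := EC.snoc_lv hsq.right hx
  obtain ⟨W, hW⟩ := S.wt D eX hY hΓ hs (u := .var x) (.of_mem (U := U) (by simp)) hv
  cases v with
  | var y => rw [D.l.T_vv] at hW ⊢; rw [D.l.T_vv]; exact .refl hW
  | app t ts =>
    obtain ⟨z, h, -⟩ | ⟨Y0, hs0, hl⟩ := hv
    · cases h
    have e0 : EC TB (q + 1) Y0 := hl.term_ec
    have h0 := half_set_app D H1 H2 hsq hx hl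
    have w {U} (h : EC TA (p + 1) (X ++ [(x, U)])) : WT TA (X ++ [(x, U)]) (.var x) :=
      ⟨_, h.der.vars (p := (x, U)) (by simp)⟩
    rw [D.T_mono eX.der eX.der e0.der hY.der (fun _ => id) hs0 (w eX) ⟨_, hl.der⟩,
      D.T_mono eX'.der eX'.der e0.der hY.der (fun _ => id) hs0 (w eX') ⟨_, hl.der⟩] at h0
    exact h0.weaken (List.Subset.trans (D.ten_mono eX.der eX.der e0.der hY.der
      (fun _ => id) hs0) hs) hΓ

theorem half_sew_cg {x U U' S X0 f g Y0 y V}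
    (hsq : SQ TA (p + 1) X U U') (hU : Lv TA p (.sort X U)) (hU' : Lv TA p (.sort X U'))
    (I : CgI TA p X U U' S X0 f g) (hx : ∀ r ∈ X, r.1 ≠ x) (hY : EC TB (q + 1) (Y ++ [(y, V)]))
    (hs0 : Y0 ⊆ Y) (hV : Lv TB (q + 1) (.sort Y0 V)) (e0 : EC TB q Y0)
    (hΓ : Der TC (.ctx Γ)) (hs : O.ten X (Y ++ [(y, V)]) ⊆ Γ)
    (c : IsSub TC Γ (O.ten (X ++ [(x, U)]) Y0) .var)
    (hd : Der TC (.sort Γ (O.W (X ++ [(x, U)]) (Y ++ [(y, V)]) U (.var x) V (.var y))) ∨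
      Der TC (.sort Γ (O.W (X ++ [(x, U')]) (Y ++ [(y, V)]) U' (.var x) V (.var y)))) :
    Der TC (.sortEq Γ (O.W (X ++ [(x, U)]) (Y ++ [(y, V)]) U (.var x) V (.var y))
      (O.W (X ++ [(x, U')]) (Y ++ [(y, V)]) U' (.var x) V (.var y))) := by
  have eX : EC TA p (X ++ [(x, U)]) := EC.snoc_lv hU hx
  have eX' : EC TA p (X ++ [(x, U')]) := EC.snoc_lv hU' hx
  have e0' : EC TB (q + 1) Y0 := e0.mono (by omega)
  have hΓ0 := H1.self.ctx_ten D eX e0'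
  refine D.W_congrT hd (by rw [I.e, I.e']) rfl (l1 := X0.map some) (a0 := none) (l2 := V.args)
    (b0 := .var y)
    (f := fun o => o.elim (.var x) fun r => f r.1) (g := fun o => o.elim (.var x) fun r => g r.1)
    (f' := id) (g' := id) (by simp [I.e, Function.comp_def]) (by simp [I.e', Function.comp_def])
    (by simp) (by simp) rfl rfl rfl rfl ?_
  have key : ∀ b, (∃ W, TmS TB (q + 1) (Y ++ [(y, V)]) b W) → ∀ a ∈ X0.map some,
      EqT TC Γ (O.T (X ++ [(x, U)]) (Y ++ [(y, V)]) (Option.elim a (.var x) fun r => f r.1) b)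
      (O.T (X ++ [(x, U')]) (Y ++ [(y, V)]) (Option.elim a (.var x) fun r => g r.1) b) := by
    rintro b ⟨W, hb⟩ a ha
    obtain ⟨r, hr, rfl⟩ := mem_map.1 ha
    obtain ⟨W', hW'⟩ := I.eq r hr
    exact cg_pair D H1 hU hU' hx hY hb hW' hΓ hs
  have arg {b} (hb : b ∈ V.args) : ∃ W, TmS TB q Y0 b W :=
    let ⟨W, h⟩ := hV.sort_args hb; ⟨W, .of_lv h⟩
  have sub : Y0 ⊆ Y ++ [(y, V)] := List.Subset.trans hs0 (by simp)
  rintro a b (⟨ha, hb⟩ | ⟨ha, hb⟩)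
  · refine key b ?_ a ha
    rcases mem_append.1 hb with hb | hb
    · obtain ⟨W, h⟩ := arg hb
      exact ⟨W, (h.mono sub).mono_level (Nat.le_succ q)⟩
    · obtain rfl : b = .var y := by simpa using hb
      exact ⟨V, .of_mem (by simp)⟩
  · obtain ⟨W, h⟩ := arg hb
    rcases mem_append.1 ha with ha | ha
    · exact key b ⟨W, (h.mono sub).mono_level (Nat.le_succ q)⟩ a ha
    · obtain rfl : a = none := by simpa using ha
      have k := (H2.l.set hsq hx e0 h hΓ0 fun _ => id).conv c hΓ
      have w {U} (h : EC TA p (X ++ [(x, U)])) : WT TA (X ++ [(x, U)]) (.var x) :=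
        ⟨_, h.der.vars (p := (x, U)) (by simp)⟩
      rwa [D.T_mono eX.der eX.der e0.der hY.der (fun _ => id) sub (w eX) ⟨_, h.der e0.der⟩,
        D.T_mono eX'.der eX'.der e0.der hY.der (fun _ => id) sub (w eX') ⟨_, h.der e0.der⟩] at k

omit D H1 H2

theorem LSub.upd {Ax : Set (Judg A)} (hPT : PT Ax) {X0 : PreCtx A} (h : LSub Ax p X X0 τ)
    (h0 : Der Ax (.ctx X0)) {x u} (hx : ∀ r ∈ X0, r.1 ≠ x) : LSub Ax p X X0 (upd τ x u) := by
  intro z hz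
  rw [upd_ne _ _ (hx z hz), sort_upd hPT (h0.vars hz).term_sort hx]
  exact h z hz

include D H1

theorem SEs_par {X0 : PreCtx A} {U0 Ya T}
    (hU : Lv TA p (.sort X0 U0)) (ec : EC TB q Ya)
    (gen : EC TB (q + 1) (snocCh O.chB Ya ⟨T, ctxVars Ya⟩)) :
    O.ten X0 (snocCh O.chB Ya ⟨T, ctxVars Ya⟩) ⊆
      O.par (snocCh O.chA X0 U0) (snocCh O.chB Ya ⟨T, ctxVars Ya⟩) ∧
    O.ten (snocCh O.chA X0 U0) Ya ⊆
      O.par (snocCh O.chA X0 U0) (snocCh O.chB Ya ⟨T, ctxVars Ya⟩) ∧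
    Der TC (.ctx (O.par (snocCh O.chA X0 U0) (snocCh O.chB Ya ⟨T, ctxVars Ya⟩))) ∧
    Der TC (.sort (O.par (snocCh O.chA X0 U0) (snocCh O.chB Ya ⟨T, ctxVars Ya⟩))
      (O.W (snocCh O.chA X0 U0) (snocCh O.chB Ya ⟨T, ctxVars Ya⟩)
        U0 (.var (O.chA X0)) ⟨T, ctxVars Ya⟩ (.var (O.chB Ya)))) := by
  have eX : EC TA p (snocCh O.chA X0 U0) := EC.snoc_lv hU (D.l.fresh X0)
  have hΘ := ctx_par D H1.self H1.self eX.of_snoc.1 eX (ec.mono (Nat.le_succ q)) gen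
  have hs := (D.par_sub eX.der gen.der).1 (fun _ => id)
  exact ⟨hs.1, hs.2, hΘ, H1.self.sw_last D eX gen hΘ hs.1 hs.2⟩

include H2

theorem SEs_ax {X0 U0 U0' Ya T} (ax : .sortEq X0 U0 U0' ∈ TA)
    (lv : Lv TA (p + 1) (.sortEq X0 U0 U0')) (hU : Lv TA p (.sort X0 U0))
    (hU' : Lv TA p (.sort X0 U0')) (ax' : introSort Ya T ∈ TB) (ec : EC TB q Ya)
    (gen : EC TB (q + 1) (snocCh O.chB Ya ⟨T, ctxVars Ya⟩)) :
    Der TC (.sortEq (O.par (snocCh O.chA X0 U0) (snocCh O.chB Ya ⟨T, ctxVars Ya⟩))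
      (O.W (snocCh O.chA X0 U0) (snocCh O.chB Ya ⟨T, ctxVars Ya⟩)
        U0 (.var (O.chA X0)) ⟨T, ctxVars Ya⟩ (.var (O.chB Ya)))
      (O.W (snocCh O.chA X0 U0') (snocCh O.chB Ya ⟨T, ctxVars Ya⟩)
        U0' (.var (O.chA X0)) ⟨T, ctxVars Ya⟩ (.var (O.chB Ya)))) := by
  obtain ⟨s1, s2, hΘ, w⟩ := SEs_par D H1 hU ec gen
  obtain ⟨s1', s2', hΘ', w'⟩ := SEs_par D H1 hU' ec gen
  refine D.l.ruleSEs ax ax' lv.der ec.der w ?_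
  have := w'.sub_sort (isSub_par D (EC.snoc_lv hU' (D.l.fresh X0)).der gen.der
    (isSub_of_subset s1 hΘ) (H2.l.conv D (.inl lv) (D.l.fresh X0) ec hΘ s2)) hΘ
  simpa using this

omit H2

theorem sew_side {x U U0 X0 σ Y0 y V Ya T}
    (hU : Lv TA p (.sort X U)) (hU0 : Lv TA p (.sort X0 U0)) (sub : LSub TA p X X0 σ)
    (e : U0.subst σ = U) (hx : ∀ r ∈ X, r.1 ≠ x) (hY : EC TB (q + 1) (Y ++ [(y, V)]))
    (hs0 : Y0 ⊆ Y) (J : SX TB O.chB q (Y ++ [(y, V)]) Y0 V (.var y) Ya T ρ)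
    (hΓ : Der TC (.ctx Γ)) (hs : O.ten X (Y ++ [(y, V)]) ⊆ Γ)
    (c : IsSub TC Γ (O.ten (X ++ [(x, U)]) Y0) .var) :
    IsSub TC Γ (O.par (snocCh O.chA X0 U0) (snocCh O.chB Ya ⟨T, ctxVars Ya⟩))
      (O.TS (X ++ [(x, U)]) (Y ++ [(y, V)]) (upd σ (O.chA X0) (.var x)) ρ) ∧
    (Der TC (.sort Γ ((O.W (snocCh O.chA X0 U0) (snocCh O.chB Ya ⟨T, ctxVars Ya⟩)
        U0 (.var (O.chA X0)) ⟨T, ctxVars Ya⟩ (.var (O.chB Ya))).subst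
          (O.TS (X ++ [(x, U)]) (Y ++ [(y, V)]) (upd σ (O.chA X0) (.var x)) ρ))) →
      Der TC (.sortEq Γ (O.W (X ++ [(x, U)]) (Y ++ [(y, V)]) U (.var x) V (.var y))
        ((O.W (snocCh O.chA X0 U0) (snocCh O.chB Ya ⟨T, ctxVars Ya⟩)
        U0 (.var (O.chA X0)) ⟨T, ctxVars Ya⟩ (.var (O.chB Ya))).subst
          (O.TS (X ++ [(x, U)]) (Y ++ [(y, V)]) (upd σ (O.chA X0) (.var x)) ρ)))) := by
  have eX : EC TA p (X ++ [(x, U)]) := EC.snoc_lv hU hx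
  have eXs : EC TA p (snocCh O.chA X0 U0) := EC.snoc_lv hU0 (D.l.fresh X0)
  have e0 : EC TB (q + 1) Y0 := J.eX0.mono (by omega)
  have sub0 : Y0 ⊆ Y ++ [(y, V)] := List.Subset.trans hs0 (by simp)
  have hΓ0 := H1.self.ctx_ten D eX e0
  have l1 : Sit O TA TB TC p (q + 1) X (Y ++ [(y, V)]) Γ X0 (snocCh O.chB Ya ⟨T, ctxVars Ya⟩)
      (upd σ (O.chA X0) (.var x)) ρ :=
    ⟨eX.of_snoc.1, hY, hΓ, hs, eXs.of_snoc.1.der, J.eX'.der,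
      sub.upd D.l.pt eXs.of_snoc.1.der (D.l.fresh X0), J.hi⟩
  have lxs : LSub TA p (X ++ [(x, U)]) (snocCh O.chA X0 U0) (upd σ (O.chA X0) (.var x)) := by
    subst e
    exact sub.snoc D.l.pt D.l.fresh hU0.der
  have l2 : Sit O TA TB TC p (q + 1) (X ++ [(x, U)]) Y0 (O.ten (X ++ [(x, U)]) Y0)
      (snocCh O.chA X0 U0) Ya (upd σ (O.chA X0) (.var x)) ρ :=
    ⟨eX, e0, hΓ0, fun _ => id, eXs.der, J.eXa.der, lxs, J.lo.mono (fun _ => id) (Nat.le_succ q)⟩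
  have m1 := l1.mor_amb D H1 (H1.self.ctx_ten D eXs.of_snoc.1 J.eX') eX.der hY.der (by simp)
    fun _ => id
  have m2 := (l2.mor_amb D H1 (H1.self.ctx_ten D eXs (J.eXa.mono (Nat.le_succ q))) eX.der hY.der
    (fun _ => id) sub0).comp c hΓ
  simp only [Expr.subst_id] at m2
  refine ⟨isSub_par D eXs.der J.eX'.der m1 m2, fun hd => ?_⟩
  have hU1 : U0.subst (upd σ (O.chA X0) (.var x)) = U := by
    rw [sort_upd D.l.pt hU0.der (D.l.fresh X0), e]
  have key := W_S1 D (X := X ++ [(x, U)]) (Y := Y ++ [(y, V)]) (Γ := Γ) (X' := snocCh O.chA X0 U0)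
    (Y' := snocCh O.chB Ya ⟨T, ctxVars Ya⟩) (τ := upd σ (O.chA X0) (.var x)) (ρ := ρ) (U := U0)
    (u := .var (O.chA X0)) (V := ⟨T, ctxVars Ya⟩) (v := .var (O.chB Ya)) ?_ (.inr hd)
  · rwa [hU1, J.hU, Expr.subst_var, Expr.subst_var, J.hu, upd_self] at key
  have vb {b} (hb : b ∈ ctxVars Ya) := J.lo.ctxVars J.eXa.der hb
  have ua {a} (ha : a ∈ U0.args) : WT TA X0 a ∧ ∃ V, TmS TA p X
      (a.subst (upd σ (O.chA X0) (.var x))) V := by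
    refine ⟨hU0.der.sort_args ha, (SdS.of_lv hU).args ?_⟩
    rw [← hU1, SortE.subst_args]
    exact mem_map_of_mem ha
  have k1 : ∀ a ∈ U0.args, ∀ b ∈ ctxVars Ya ++ [.var (O.chB Ya)],
      S1 O TC (X ++ [(x, U)]) (Y ++ [(y, V)]) Γ (snocCh O.chA X0 U0)
        (snocCh O.chB Ya ⟨T, ctxVars Ya⟩) (upd σ (O.chA X0) (.var x)) ρ a b := by
    intro a ha b hb
    have hb' : b ∈ ctxVars (snocCh O.chB Ya ⟨T, ctxVars Ya⟩) := by
      rw [snocCh, ctxVars_append]; exact hb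
    obtain ⟨w1, w2⟩ := ua ha
    obtain ⟨w3, w4⟩ := J.hi.ctxVars J.eX'.der hb'
    exact (l1.s1_amb D H1 eX.der hY.der (by simp) (fun _ => id) w1 w3 w2 w4).mono_target D
      l1.dX eXs.der l1.dY l1.dY sub_snocCh (fun _ => id) w1 w3
  rintro a b (⟨ha, hb⟩ | ⟨ha, hb⟩)
  · exact k1 a ha b hb
  · rcases mem_append.1 ha with ha | ha
    · exact k1 a ha b (mem_append_left _ hb)
    · obtain rfl : a = .var (O.chA X0) := by simpa using ha
      obtain ⟨w3, V', w4⟩ := vb hb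
      have w1 : WT TA (snocCh O.chA X0 U0) (.var (O.chA X0)) := ⟨_, eXs.der.vars mem_snocCh⟩
      have k := l2.s1_amb D H1 eX.der hY.der (fun _ => id) sub0 w1 w3
        (by rw [Expr.subst_var]; exact ⟨_, lxs _ mem_snocCh⟩) ⟨V', w4.mono_level (Nat.le_succ q)⟩
      have k' := k.mono_target D l2.dX eXs.der l2.dY J.eX'.der (fun _ => id) sub_snocCh w1 w3
      unfold S1 at k' ⊢
      exact k'.conv c hΓ

include H2

theorem half_sew_ax {x U U' X0 U0 U0' σ Y0 y V Ya T}
    (hsq : SQ TA (p + 1) X U U') (hU : Lv TA p (.sort X U)) (hU' : Lv TA p (.sort X U'))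
    (I : AxI TA p X U U' X0 U0 U0' σ) (hx : ∀ r ∈ X, r.1 ≠ x)
    (hY : EC TB (q + 1) (Y ++ [(y, V)]))
    (hs0 : Y0 ⊆ Y) (J : SX TB O.chB q (Y ++ [(y, V)]) Y0 V (.var y) Ya T ρ)
    (hΓ : Der TC (.ctx Γ)) (hs : O.ten X (Y ++ [(y, V)]) ⊆ Γ)
    (c : IsSub TC Γ (O.ten (X ++ [(x, U)]) Y0) .var)
    (c' : IsSub TC Γ (O.ten (X ++ [(x, U')]) Y0) .var) :
    Der TC (.sortEq Γ (O.W (X ++ [(x, U)]) (Y ++ [(y, V)]) U (.var x) V (.var y))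
      (O.W (X ++ [(x, U')]) (Y ++ [(y, V)]) U' (.var x) V (.var y))) := by
  have k := SEs_ax D H1 H2 I.ax I.lv I.s I.s' J.ax J.eXa J.eX'
  obtain ⟨m, r⟩ := sew_side D H1 hU I.s I.sub I.e hx hY hs0 J hΓ hs c
  obtain ⟨m', r'⟩ := sew_side D H1 hU' I.s' I.sub I.e' hx hY hs0 J hΓ hs c'
  obtain ⟨-, -, hΘ', w'⟩ := SEs_par D H1 I.s' J.eXa J.eX'
  have eX : EC TA p (X ++ [(x, U)]) := EC.snoc_lv hU hx
  have eX' : EC TA p (X ++ [(x, U')]) := EC.snoc_lv hU' hx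
  have eXs' : EC TA p (snocCh O.chA X0 U0') := EC.snoc_lv I.s' (D.l.fresh X0)
  have e0 : EC TB (q + 1) Y0 := J.eX0.mono (by omega)
  have sub0 : Y0 ⊆ Y ++ [(y, V)] := List.Subset.trans hs0 (by simp)
  have hΓ0 := H1.self.ctx_ten D eX e0
  have kθ := k.sub_sortEq m hΓ
  have cc : Der TC (.sortEq Γ ((O.W (snocCh O.chA X0 U0') (snocCh O.chB Ya ⟨T, ctxVars Ya⟩)
        U0' (.var (O.chA X0)) ⟨T, ctxVars Ya⟩ (.var (O.chB Ya))).subst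
          (O.TS (X ++ [(x, U')]) (Y ++ [(y, V)]) (upd σ (O.chA X0) (.var x)) ρ))
      ((O.W (snocCh O.chA X0 U0') (snocCh O.chB Ya ⟨T, ctxVars Ya⟩)
        U0' (.var (O.chA X0)) ⟨T, ctxVars Ya⟩ (.var (O.chB Ya))).subst
          (O.TS (X ++ [(x, U)]) (Y ++ [(y, V)]) (upd σ (O.chA X0) (.var x)) ρ))) := by
    refine sortEq_subst_congr D.l.ptC w' m' (fun z hz => ?_) hΓ
    rcases (D.mem_par (X := X0) (Y := Ya)).1 hz with ⟨a, ha, b, hb, rfl⟩ | ⟨a, ha, b, hb, rfl⟩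
    · dsimp only
      rw [D.TS_v, D.TS_v, upd_ne _ _ (D.l.fresh X0 a ha)]
      have ta : TmS TA p X (σ a.1) (a.2.subst σ) := I.sub a ha
      have tb : TmS TB (q + 1) (Y ++ [(y, V)]) (ρ b.1) (b.2.subst ρ) := J.hi b hb
      rw [← D.T_mono eX.of_snoc.1.der eX'.der hY.der hY.der (by simp) (fun _ => id)
          ⟨_, ta.der eX.of_snoc.1.der⟩ ⟨_, tb.der hY.der⟩,
        ← D.T_mono eX.of_snoc.1.der eX.der hY.der hY.der (by simp) (fun _ => id)
          ⟨_, ta.der eX.of_snoc.1.der⟩ ⟨_, tb.der hY.der⟩]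
      obtain ⟨W, hW⟩ := H1.self.wt D eX.of_snoc.1 hY hΓ hs ta tb
      exact .refl hW
    · dsimp only
      rw [D.TS_v, D.TS_v]
      have tb : TmS TB q Y0 (ρ b.1) (b.2.subst ρ) := J.lo b hb
      have hc := upd_cases (x := x) D.l.fresh (I.sub.mono (fun _ => id) (Nat.le_succ p)) ha
      have hk := ((H2.set_pt D hsq hx J.eX0 tb hΓ0 (fun _ => id) hc).conv c hΓ).symm
      have wa {U} (h : EC TA p (X ++ [(x, U)])) : WT TA (X ++ [(x, U)])
          (upd σ (O.chA X0) (.var x) a.1) := by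
        rcases hc with hc | ⟨S, hc⟩
        · rw [hc]
          exact ⟨_, h.der.vars (p := (x, U)) (by simp)⟩
        · exact ⟨S, (hc.mono (by simp)).der h.der⟩
      rwa [D.T_mono eX'.der eX'.der e0.der hY.der (fun _ => id) sub0 (wa eX') ⟨_, tb.der e0.der⟩,
        D.T_mono eX.der eX.der e0.der hY.der (fun _ => id) sub0 (wa eX) ⟨_, tb.der e0.der⟩] at hk
  exact ((r kθ.sortEq_left).s3 kθ).s3 (cc.s2.s3 (r' (w'.sub_sort m' hΓ)).s2)

theorem half_sew (S : Self O TA TB TC (p + 1) (q + 1)) {x U U' y V}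
    (hsq : SQ TA (p + 1) X U U') (hx : ∀ r ∈ X, r.1 ≠ x) (hY : EC TB (q + 1) (Y ++ [(y, V)]))
    (hΓ : Der TC (.ctx Γ)) (h1 : O.ten (X ++ [(x, U)]) Y ⊆ Γ)
    (h2 : O.ten X (Y ++ [(y, V)]) ⊆ Γ) :
    Der TC (.sortEq Γ (O.W (X ++ [(x, U)]) (Y ++ [(y, V)]) U (.var x) V (.var y))
      (O.W (X ++ [(x, U')]) (Y ++ [(y, V)]) U' (.var x) V (.var y))) := by
  obtain ⟨hU, hU', h⟩ := hsq.dec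
  have eX : EC TA p (X ++ [(x, U)]) := EC.snoc_lv hU hx
  have eX' : EC TA p (X ++ [(x, U')]) := EC.snoc_lv hU' hx
  have hd := H1.self.sw_last D eX hY hΓ h2 h1
  obtain ⟨Y0, hs0, hV⟩ := hY.of_snoc.2.1
  have sub0 : Y0 ⊆ Y ++ [(y, V)] := List.Subset.trans hs0 (by simp)
  obtain ⟨Ya, T, ρ, J⟩ := exists_SX (ch := O.chB) D.r.pt D.freshB hY sub0
    (.of_mem (x := y) (U := V) (by simp)) hV
  have s0 : O.ten (X ++ [(x, U)]) Y0 ⊆ Γ := List.Subset.trans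
    (D.ten_mono eX.der eX.der J.eX0.der hY.of_snoc.1.der (fun _ => id) hs0) h1
  have c := isSub_of_subset s0 hΓ
  have c' := H2.l.conv D hsq hx J.eX0 hΓ s0
  rcases h with rfl | h | ⟨W, h, h'⟩ | ⟨X0, U0, U0', σ, I | I⟩ | ⟨S, X0, f, g, I | I⟩
  · exact .s1 hd
  · exact H1.l.sew h hx hY hΓ h1 h2
  · have eW : EC TA p (X ++ [(x, W)]) := EC.snoc_lv h.right hx
    have hΘ := ctx_par D H1.self H1.self eW.of_snoc.1 eW hY.of_snoc.1 hY
    have hs := (D.par_sub eW.der hY.der).1 (fun _ => id)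
    have k := H1.l.sew h' hx hY hΘ hs.2 hs.1
    have cΘ : IsSub TC Γ (O.par (X ++ [(x, W)]) (Y ++ [(y, V)])) .var :=
      isSub_par D eW.der hY.der (isSub_of_subset h2 hΓ) (H1.l.conv D h hx hY.of_snoc.1 hΓ h1)
    have k' := k.sub_sortEq cΘ hΓ
    simp only [SortE.subst_id] at k'
    exact (H1.l.sew h hx hY hΓ h1 h2).s3 k'
  · exact half_sew_ax D H1 H2 hsq hU hU' I hx hY hs0 J hΓ h2 c c'
  · exact (half_sew_ax D H1 H2 hsq.symm hU' hU I hx hY hs0 J hΓ h2 c' c).s2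
  · exact half_sew_cg D H1 H2 hsq hU hU' I hx hY hs0 hV J.eX0 hΓ h2 c (.inl hd)
  · exact (half_sew_cg D H1 H2 hsq.symm hU' hU I hx hY hs0 hV J.eX0 hΓ h2 c' (.inr hd)).s2

theorem half_te_app {u u' U t ts Y0 V}
    (h : Lv TA (p + 1) (.termEq X u u' U)) (hl : Lv TB (q + 1) (.term Y0 (.app t ts) V)) :
    EqT TC (O.ten X Y0) (O.T X Y0 u (.app t ts)) (O.T X Y0 u' (.app t ts)) := by
  obtain ⟨hu, hu'⟩ := h.pre_succ
  obtain ⟨Ya, Va, ρ, J⟩ := hl.inv_app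
  have eX : EC TA p X := hu.term_ec
  have eY : EC TB (q + 1) Y0 := J.ecX.mono (Nat.le_succ q)
  have hΓ := H1.self.ctx_ten D eX eY
  have k := TL_typed D H1 eX eY hΓ (fun _ => id) (.of_lv hu) (.of_lv hl)
  have k' := TL_typed D H1 eX eY hΓ (fun _ => id) (.of_lv hu') (.of_lv hl)
  obtain ⟨W, hW⟩ := k
  refine EqT.trans D.l.ptC ⟨W, hW⟩ (EqT.trans D.l.ptC ?_ k'.symm)
  refine D.L_congr hW.termEq_right rfl (l1 := U.args.map (fun a => (a, a)) ++ [(u, u')]) (l2 := ts)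
    (f := Prod.fst) (g := Prod.snd) (f' := id) (g' := id) (by simp [Function.comp_def])
    (by simp [Function.comp_def]) (by simp) (by simp) ?_
  intro a ha b hb
  obtain ⟨Vb, hb⟩ := hl.app_args hb
  rcases mem_append.1 ha with ha | ha
  · obtain ⟨a, ha', rfl⟩ := mem_map.1 ha
    obtain ⟨Ua, hUa⟩ := SdS.args (SdS.of_lv hu.pre) ha'
    obtain ⟨W, hW⟩ := H1.self.wt D eX eY hΓ (fun _ => id) hUa
      ((TmS.of_lv hb).mono_level (Nat.le_succ q))
    exact .refl hW
  · obtain rfl : a = (u, u') := by simpa using ha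
    exact H2.l.te h J.ecX (.of_lv hb) hΓ fun _ => id

theorem TEs_ax {X0 u u' U Ya T} (ax : .termEq X0 u u' U ∈ TA)
    (lv : Lv TA (p + 1) (.termEq X0 u u' U)) (ax' : introSort Ya T ∈ TB) (ec : EC TB q Ya)
    (gen : EC TB (q + 1) (snocCh O.chB Ya ⟨T, ctxVars Ya⟩)) :
    EqT TC (O.ten X0 (snocCh O.chB Ya ⟨T, ctxVars Ya⟩))
      (O.T X0 (snocCh O.chB Ya ⟨T, ctxVars Ya⟩) u (.var (O.chB Ya)))
      (O.T X0 (snocCh O.chB Ya ⟨T, ctxVars Ya⟩) u' (.var (O.chB Ya))) := by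
  obtain ⟨hu, hu'⟩ := lv.pre_succ
  have eX : EC TA p X0 := hu.term_ec
  have hΔ := H1.self.ctx_ten D eX gen
  have tb : TmS TB (q + 1) (snocCh O.chB Ya ⟨T, ctxVars Ya⟩) (.var (O.chB Ya)) ⟨T, ctxVars Ya⟩ :=
    .of_mem mem_snocCh
  have p1 := pairOK D H1 eX gen hΔ (fun _ => id) (.of_lv hu) tb
  have p2 := pairOK D H1 eX gen hΔ (fun _ => id) (.of_lv hu') tb
  have hU : Der TA (.sort X0 U) := hu.der.term_sort
  have S := sit_upd D eX gen hΔ (fun _ => id) (fun _ => id) hU (D.l.fresh X0) (.of_lv hu)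
  have hUe : U.subst (upd .var (O.chA X0) u) = U := by
    rw [sort_upd D.l.pt hU (D.l.fresh X0), SortE.subst_id]
  have w := W_sit D S (S.s1 D H1) (u := .var (O.chA X0)) (U := U) (v := .var (O.chB Ya))
    (V := ⟨T, ctxVars Ya⟩) (S.dX.vars (p := (O.chA X0, U)) (by simp))
    (by rw [Expr.subst_var, upd_self, hUe]; exact .of_lv hu) (gen.der.vars mem_snocCh)
    (by rw [Expr.subst_id, SortE.subst_id]; exact tb)
  rw [hUe, Expr.subst_var, upd_self, Expr.subst_id, SortE.subst_id] at w
  have w := w (.inl p1.term_sort)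
  have w2 : Der TC (.sortEq (O.ten X0 (snocCh O.chB Ya ⟨T, ctxVars Ya⟩))
      (O.W X0 (snocCh O.chB Ya ⟨T, ctxVars Ya⟩) U u' ⟨T, ctxVars Ya⟩ (.var (O.chB Ya)))
      (O.W X0 (snocCh O.chB Ya ⟨T, ctxVars Ya⟩) U u ⟨T, ctxVars Ya⟩ (.var (O.chB Ya)))) := by
    refine D.W_congrT (.inl p2.term_sort) rfl rfl (l1 := U.args.map fun a => (a, a))
      (a0 := (u', u)) (l2 := ctxVars Ya) (b0 := .var (O.chB Ya)) (f := Prod.fst) (g := Prod.snd)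
      (f' := id) (g' := id) (by simp [Function.comp_def])
      (by simp [Function.comp_def]) (by simp) (by simp) rfl rfl rfl rfl ?_
    have key : ∀ a ∈ U.args.map (fun a => (a, a)), ∀ b ∈ ctxVars (snocCh O.chB Ya ⟨T, ctxVars Ya⟩),
        EqT TC (O.ten X0 (snocCh O.chB Ya ⟨T, ctxVars Ya⟩))
          (O.T X0 (snocCh O.chB Ya ⟨T, ctxVars Ya⟩) (Prod.fst a) b)
          (O.T X0 (snocCh O.chB Ya ⟨T, ctxVars Ya⟩) (Prod.snd a) b) := by
      intro a ha b hb
      obtain ⟨a, ha', rfl⟩ := mem_map.1 ha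
      obtain ⟨z, hz, rfl⟩ := mem_map.1 hb
      obtain ⟨Ua, hUa⟩ := SdS.args (SdS.of_lv hu.pre) ha'
      obtain ⟨W, hW⟩ := H1.self.wt D eX gen hΔ (fun _ => id) hUa (.of_mem hz)
      exact .refl hW
    rintro a b (⟨ha, hb⟩ | ⟨ha, hb⟩)
    · exact key a ha b (by rw [snocCh, ctxVars_append]; exact hb)
    · rcases mem_append.1 ha with ha | ha
      · exact key a ha b (by rw [snocCh, ctxVars_append]; exact mem_append_left _ hb)
      · obtain rfl : a = (u', u) := by simpa using ha
        obtain ⟨z, hz, rfl⟩ := mem_map.1 hb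
        have sub := D.ten_mono eX.der eX.der ec.der gen.der (fun _ => id) sub_snocCh
        have e := H2.l.te lv ec (.of_mem hz) hΔ sub
        have wz : WT TB Ya (.var z.1) := ⟨_, ec.der.vars hz⟩
        rw [D.T_mono eX.der eX.der ec.der gen.der (fun _ => id) sub_snocCh ⟨_, hu.der⟩ wz,
          D.T_mono eX.der eX.der ec.der gen.der (fun _ => id) sub_snocCh ⟨_, hu'.der⟩ wz] at e
        exact e.symm
  exact ⟨_, D.l.ruleTEs ax ax' lv.der ec.der rfl (.seqt w p1) (.seqt (w2.s3 w) p2)⟩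

theorem half_te_var {u u' U y V}
    (h : Lv TA (p + 1) (.termEq X u u' U)) (hY : EC TB (q + 1) Y) (hy : (y, V) ∈ Y)
    (hΓ : Der TC (.ctx Γ)) (hs : O.ten X Y ⊆ Γ) :
    EqT TC Γ (O.T X Y u (.var y)) (O.T X Y u' (.var y)) := by
  have tb : TmS TB (q + 1) Y (.var y) V := .of_mem hy
  obtain ⟨hu, hu'⟩ := h.pre_succ
  have eX : EC TA p X := hu.term_ec
  obtain ⟨k, hk, h, hp⟩ := h.step
  have up {J} (h : Lv TA k J) : Lv TA p J := h.mono hk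
  cases h with
  | t1 h =>
    obtain ⟨W, hW⟩ := H1.self.wt D eX hY hΓ hs (.of_lv hu) tb
    exact .refl hW
  | t2 h => exact (H1.l.te (up h) hY tb hΓ hs).symm
  | t3 h h' => exact (H1.l.te (up h) hY tb hΓ hs).trans D.l.ptC (H1.l.te (up h') hY tb hΓ hs)
  | seqteq h h' => exact H1.l.te (up h') hY tb hΓ hs
  | @tEq X0 u0 u0' U0 hax hJ hJ' hv _ σ h1 h2 hσ =>
    obtain ⟨Y0, hs0, hV⟩ := hY.sds hy
    obtain ⟨Ya, T, ρ, J⟩ := exists_SX (ch := O.chB) D.r.pt D.freshB hY hs0 tb hV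
    have lv : Lv TA (p + 1) (.termEq X0 u0 u0' U0) := by
      have : Lv TA (k + 1) (.termEq X0 u0 u0' U0) := by
        refine .inr ⟨?_, hJ, hJ'⟩
        have := LStep.tEq (σ := .var) hax hJ hJ' hv (by simpa using hJ) (by simpa using hJ')
          (by simpa using hv)
        simpa using this
      exact this.mono (by omega)
    have k := TEs_ax D H1 H2 hax lv J.ax J.eXa J.eX'
    have S : Sit O TA TB TC p (q + 1) X Y Γ X0 (snocCh O.chB Ya ⟨T, ctxVars Ya⟩) σ ρ :=
      ⟨eX, hY, hΓ, hs, (up hJ).term_ec.der, J.eX'.der, fun z hz => .of_lv (up (hσ z hz)), J.hi⟩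
    have kk := k.subst (S.mor D H1) hΓ
    have s {u1} (hu1 : Lv TA p (.term X0 u1 U0)) (hu2 : Lv TA p (.term X (u1.subst σ)
      (U0.subst σ))) :
        EqT TC Γ (O.T X Y (u1.subst σ) (.var y))
        ((O.T X0 (snocCh O.chB Ya ⟨T, ctxVars Ya⟩) u1 (.var (O.chB Ya))).subst (O.TS X Y σ ρ)) := by
      have e := S.s1 D H1 (u := u1) (v := .var (O.chB Ya)) ⟨_, hu1.der⟩
        ⟨_, J.eX'.der.vars mem_snocCh⟩ ⟨_, .of_lv hu2⟩
        (by rw [Expr.subst_var, J.hu]; exact ⟨_, tb⟩)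
      unfold S1 at e
      rwa [Expr.subst_var, J.hu] at e
    exact (s (up hJ) (up h1)).trans D.l.ptC (kk.trans D.l.ptC (s (up hJ') (up h2)).symm)
  | @tCong X0 s U0 hax hJ hv _ σ σ' h1 h2 hσ =>
    have e (σ : A.Var → Expr A) : Expr.subst σ (.app s (ctxVars X0)) =
        .app s (X0.map fun r => σ r.1) := by simp [ctxVars, Function.comp_def]
    rw [e] at h1 h2 ⊢
    rw [e]
    obtain ⟨W, hW⟩ := H1.self.wt D eX hY hΓ hs (.of_lv (up h1)) tb
    have r {ss U} (h : Der TA (.term X (.app s ss) U)) :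
        O.T X Y (.app s ss) (.var y) = O.op.L Y X V (.var y) s ss :=
      D.r.T_L hY.der eX.der ⟨_, hY.der.vars hy⟩ (canonSort_var.2 hy) ⟨_, h⟩ (.inl ⟨_, rfl⟩)
    rw [r h1.der] at hW ⊢
    rw [r h2.der]
    refine D.op.L_congr hW rfl (l1 := V.args ++ [.var y]) (l2 := X0) (f := id) (g := id)
      (f' := fun r => σ r.1) (g' := fun r => σ' r.1) (by simp) (by simp) rfl rfl ?_
    intro b hb a ha
    have : ∃ W, TmS TB (q + 1) Y b W := by
      rcases mem_append.1 hb with hb | hb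
      · exact SdS.args (hY.sds hy) hb
      · obtain rfl : b = .var y := by simpa using hb
        exact ⟨_, tb⟩
    obtain ⟨W, hb'⟩ := this
    exact H1.l.te (up (hσ a ha)) hY hb' hΓ hs

theorem half_te {u u' U v V}
    (h : Lv TA (p + 1) (.termEq X u u' U)) (hY : EC TB (q + 1) Y) (hv : TmS TB (q + 1) Y v V)
    (hΓ : Der TC (.ctx Γ)) (hs : O.ten X Y ⊆ Γ) :
    EqT TC Γ (O.T X Y u v) (O.T X Y u' v) := by
  have eX := h.pre_succ.1.term_ec
  cases v with
  | var y =>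
    obtain ⟨V, hy⟩ := WT.var_mem ⟨_, hv.der hY.der⟩
    exact half_te_var D H1 H2 h hY hy hΓ hs
  | app t ts =>
    obtain ⟨z, h, -⟩ | ⟨Y0, hs0, hl⟩ := hv
    · cases h
    have h0 := half_te_app D H1 H2 h hl
    have e0 : EC TB (q + 1) Y0 := hl.term_ec
    rw [D.T_mono eX.der eX.der e0.der hY.der (fun _ => id) hs0 ⟨_, h.pre_succ.1.der⟩ ⟨_, hl.der⟩,
      D.T_mono eX.der eX.der e0.der hY.der (fun _ => id) hs0 ⟨_, h.pre_succ.2.der⟩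
        ⟨_, hl.der⟩] at h0
    exact h0.weaken
      (List.Subset.trans (D.ten_mono eX.der eX.der e0.der hY.der (fun _ => id) hs0) hs) hΓ

theorem half_step (S : Self O TA TB TC (p + 1) (q + 1)) :
    Half O TA TB TC (p + 1) (q + 1) where
  set hsq hx hY hv hΓ hs := half_set D H1 H2 S hsq hx hY hv hΓ hs
  sew hsq hx hY hΓ h1 h2 := half_sew D H1 H2 S hsq hx hY hΓ h1 h2
  te h hY hv hΓ hs := half_te D H1 H2 h hY hv hΓ hs

theorem good_step : Good O TA TB TC (p + 1) (q + 1) :=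
  have S := self_step D H1 H2
  ⟨S, half_step D H1 H2 S, half_step D.op H2.op H1.op S.op⟩

omit D H1 H2

theorem EC.eq_nil {Ax : Set (Judg A)} (h : EC Ax 0 X) : X = [] := by
  cases h with
  | nil => rfl
  | snoc h hs hU hx => exact hU.elim

theorem TmS.not_zero {Ax : Set (Judg A)} {u U} (h : TmS Ax 0 [] u U) : False := by
  obtain ⟨z, -, h⟩ | ⟨X0, -, h⟩ := h
  · simp at h
  · exact h

theorem TmS.not_zero' {Ax : Set (Judg A)} {u U} (hX : EC Ax 0 X) (h : TmS Ax 0 X u U) : False := by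
  obtain rfl := hX.eq_nil
  exact h.not_zero

theorem SQ.not_zero {Ax : Set (Judg A)} {U U'} (h : SQ Ax 0 X U U') : False := h.elim id id

theorem half_zero_left : Half O TA TB TC 0 q where
  set h := h.not_zero.elim
  sew h := h.not_zero.elim
  te h := False.elim h

theorem half_zero_right : Half O TA TB TC p 0 where
  set _ _ hY hv := (hv.not_zero' hY).elim
  sew _ _ hY := by simpa using hY.eq_nil
  te _ hY hv := (hv.not_zero' hY).elim

theorem self_zero_left : Self O TA TB TC 0 q where
  sw hX _ _ _ hu := (hu.not_zero' hX).elim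
  t hX _ _ hu := (hu.not_zero' hX).elim
  e hX _ _ hu := (hu.not_zero' hX).elim

theorem good_zero_left : Good O TA TB TC 0 q := ⟨self_zero_left, half_zero_left, half_zero_right⟩

theorem good_zero_right : Good O TA TB TC p 0 :=
  (good_zero_left (O := O.op) (TA := TB) (TB := TA) (TC := TC) (q := p)).op

include D

theorem good_all : ∀ p q, Good O TA TB TC p q
  | 0, _ => good_zero_left
  | p + 1, 0 => good_zero_right
  | p + 1, q + 1 => good_step D (good_all p (q + 1)) (good_all (p + 1) q)

omit D

theorem Der.exists_ec {Ax : Set (Judg A)} (h : Der Ax (.ctx X)) : ∃ p, EC Ax p X :=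
  let ⟨p, hp⟩ := h.lv
  ⟨p, .of_lv' hp⟩

theorem IsSub.exists_lsub {Ax : Set (Judg A)} (h : IsSub Ax X X' τ) : ∃ p, LSub Ax p X X' τ :=
  let ⟨p, hp⟩ := (eventually_lv fun z hz => (h z hz).lv.elim fun _ h => h.eventually).exists
  ⟨p, fun z hz => .of_lv (hp z hz)⟩

theorem LSub.mono_level {Ax : Set (Judg A)} (h : LSub Ax p X X' τ) (hpq : p ≤ q) :
    LSub Ax q X X' τ := h.mono (List.Subset.refl _) hpq

theorem IsSub.exists_level {Ax : Set (Judg A)} (h : IsSub Ax X X' τ) (hX : Der Ax (.ctx X)) :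
    ∃ p, ∀ r, p ≤ r → EC Ax r X ∧ LSub Ax r X X' τ :=
  let ⟨m, hm⟩ := hX.exists_ec
  let ⟨n, hn⟩ := h.exists_lsub
  ⟨m + n, fun _ hr => ⟨hm.mono (by omega), hn.mono_level (by omega)⟩⟩

include D

theorem TD.ctx_ten (hX : Der TA (.ctx X)) (hY : Der TB (.ctx Y)) :
    Der TC (.ctx (O.ten X Y)) :=
  let ⟨p, hp⟩ := hX.exists_ec
  let ⟨q, hq⟩ := hY.exists_ec
  (good_all D p q).self.ctx_ten D hp hq

theorem TD.mor (hX : Der TA (.ctx X)) (hX' : Der TA (.ctx X'))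
    (hτ : IsSub TA X X' τ) (hY : Der TB (.ctx Y)) (hY' : Der TB (.ctx Y'))
    (hρ : IsSub TB Y Y' ρ) : IsSub TC (O.ten X Y) (O.ten X' Y') (O.TS X Y τ ρ) :=
  let ⟨p, hp⟩ := hτ.exists_level hX
  let ⟨q, hq⟩ := hρ.exists_level hY
  Sit.mor D (good_all D p q) ⟨(hp p le_rfl).1, (hq q le_rfl).1, D.ctx_ten hX hY,
    List.Subset.refl _, hX', hY', (hp p le_rfl).2, (hq q le_rfl).2⟩

theorem TD.s1 (hX : Der TA (.ctx X)) (hX' : Der TA (.ctx X'))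
    (hτ : IsSub TA X X' τ) (hY : Der TB (.ctx Y)) (hY' : Der TB (.ctx Y'))
    (hρ : IsSub TB Y Y' ρ) {u v} (hu : WT TA X' u) (hv : WT TB Y' v) :
    S1 O TC X Y (O.ten X Y) X' Y' τ ρ u v := by
  obtain ⟨p, hp⟩ := hτ.exists_level hX
  obtain ⟨q, hq⟩ := hρ.exists_level hY
  obtain ⟨U, hU⟩ := hu
  obtain ⟨V, hV⟩ := hv
  obtain ⟨p', hp'⟩ := (hU.sub_term hτ hX).lv
  obtain ⟨q', hq'⟩ := (hV.sub_term hρ hY).lv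
  have e1 := hp (p + p') (by omega)
  have e2 := hq (q + q') (by omega)
  exact Sit.s1 D (good_all D (p + p') (q + q')) ⟨e1.1, e2.1, D.ctx_ten hX hY,
    List.Subset.refl _, hX', hY', e1.2, e2.2⟩ ⟨_, hU⟩ ⟨_, hV⟩
    ⟨_, .of_lv (hp'.mono (by omega))⟩ ⟨_, .of_lv (hq'.mono (by omega))⟩

theorem TD.te {u u' U v V} (hu : Der TA (.termEq X u u' U))
    (hv : Der TB (.term Y v V)) : EqT TC (O.ten X Y) (O.T X Y u v) (O.T X Y u' v) := by
  obtain ⟨p, hp⟩ := hu.lv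
  obtain ⟨q, hq⟩ := hv.lv
  exact (good_all D p q).l.te hp hq.term_ec (.of_lv hq)
    (D.ctx_ten hu.termEq_left.term_ctx hv.term_ctx) (List.Subset.refl _)

omit D

/-- A step of a context equality: contexts `X, x : U` and `X', x' : U'` such that `σ` exhibits `X`
as equal to `X'`, and `U` is equal to the image of `U'`. -/
structure CStep (Ax : Set (Judg A)) (p : ℕ) (X : PreCtx A) (x : A.Var) (U : SortE A)
    (X' : PreCtx A) (x' : A.Var) (U' : SortE A) (σ : A.Var → Expr A) : Prop where
  sq : SQ Ax p X U (U'.subst σ)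
  sub : LSub Ax p X X' σ
  ctx : Der Ax (.ctx (X' ++ [(x', U')]))
  var : σ x' = .var x
  ne : ∀ r ∈ X, r.1 ≠ x

theorem CStep.ec {Ax : Set (Judg A)} {x U x' U'} (h : CStep Ax p X x U X' x' U' τ) :
    EC Ax p (X ++ [(x, U)]) := .snoc_lv h.sq.left h.ne

theorem CStep.ec' {Ax : Set (Judg A)} {x U x' U'} (h : CStep Ax p X x U X' x' U' τ) :
    EC Ax p (X ++ [(x, U'.subst τ)]) := .snoc_lv h.sq.right h.ne

theorem CStep.lsub {Ax : Set (Judg A)} {x U x' U'} (h : CStep Ax p X x U X' x' U' τ) :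
    LSub Ax p (X ++ [(x, U'.subst τ)]) (X' ++ [(x', U')]) τ := by
  intro z hz
  rcases mem_append.1 hz with hz | hz
  · exact (h.sub z hz).mono (by simp)
  · obtain rfl := mem_singleton.1 hz
    rw [h.var]
    exact .of_mem (by simp)

theorem SE_sub_var {Ax : Set (Judg A)} {Δ Γ : PreCtx A} {U V} (h : Der Ax (.sortEq Δ U V))
    (hs : IsSub Ax Γ Δ .var) (hΓ : Der Ax (.ctx Γ)) : Der Ax (.sortEq Γ U V) := by
  have := h.sub_sortEq hs hΓ
  rwa [SortE.subst_id, SortE.subst_id] at this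

theorem CStep.arg {Ax : Set (Judg A)} {x U x' U'} (h : CStep Ax p X x U X' x' U' τ) {a}
    (ha : a ∈ U'.args) : WT Ax X' a ∧ ∃ V, TmS Ax p X (a.subst τ) V :=
  ⟨h.ctx.ctx_snoc.1.sort_args ha,
    (SdS.of_lv h.sq.right).args (mem_map_of_mem (f := Expr.subst τ) ha)⟩

theorem CStep.args {Ax : Set (Judg A)} {x U x' U'} (h : CStep Ax p X x U X' x' U' τ) {a}
    (ha : a ∈ U'.args ++ [.var x']) : WT Ax (X' ++ [(x', U')]) a ∧
      ∃ V, TmS Ax p (X ++ [(x, U'.subst τ)]) (a.subst τ) V := by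
  rcases mem_append.1 ha with ha | ha
  · obtain ⟨⟨V, hV⟩, V', hV'⟩ := h.arg ha
    exact ⟨⟨V, hV.wk_term (by simp) h.ctx⟩, V', hV'.mono (by simp)⟩
  · obtain rfl := mem_singleton.1 ha
    rw [Expr.subst_var]
    exact ⟨⟨U', h.ctx.vars (p := (x', U')) (by simp)⟩, U'.subst τ, h.lsub (x', U') (by simp)⟩

include D

theorem CStep.s1 {x U x' U' y V y' V'}
    (hX : CStep TA p X x U X' x' U' τ) (hY : CStep TB q Y y V Y' y' V' ρ)
    (hΓ : Der TC (.ctx Γ)) (hs : O.ten X (Y ++ [(y, V'.subst ρ)]) ⊆ Γ) {a b}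
    (ha : a ∈ U'.args) (hb : b ∈ V'.args ++ [.var y']) :
    S1 O TC (X ++ [(x, U'.subst τ)]) (Y ++ [(y, V'.subst ρ)]) Γ (X' ++ [(x', U')])
      (Y' ++ [(y', V')]) τ ρ a b := by
  have dX' := hX.ctx.ctx_snoc.1.sort_ctx
  have st : Sit O TA TB TC p q X (Y ++ [(y, V'.subst ρ)]) Γ X' (Y' ++ [(y', V')]) τ ρ :=
    ⟨hX.sq.left.sort_ec, hY.ec', hΓ, hs, dX', hY.ctx, hX.sub, hY.lsub⟩
  obtain ⟨wa, ta⟩ := hX.arg ha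
  obtain ⟨wb, tb⟩ := hY.args hb
  exact S1.mono_target D dX' hX.ctx hY.ctx hY.ctx (by simp) (List.Subset.refl _) wa wb
    (st.s1_amb D (good_all D p q) hX.ec'.der hY.ec'.der (by simp) (List.Subset.refl _) wa wb ta tb)

theorem CStep.sortEq {x U x' U' y V y' V'}
    (hX : CStep TA p X x U X' x' U' τ) (hY : CStep TB q Y y V Y' y' V' ρ)
    (hΓ : Der TC (.ctx Γ)) (h1 : O.ten X (Y ++ [(y, V)]) ⊆ Γ)
    (h2 : O.ten (X ++ [(x, U)]) Y ⊆ Γ) :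
    Der TC (.sortEq Γ (O.W (X ++ [(x, U)]) (Y ++ [(y, V)]) U (.var x) V (.var y))
      ((O.W (X' ++ [(x', U')]) (Y' ++ [(y', V')]) U' (.var x') V' (.var y')).subst
        (O.TS (X ++ [(x, U'.subst τ)]) (Y ++ [(y, V'.subst ρ)]) τ ρ))) := by
  have G := good_all D p q
  have eX := hX.sq.left.sort_ec
  have eY := hY.sq.left.sort_ec
  have i1 : IsSub TC Γ (O.ten X (Y ++ [(y, V)])) .var := fun z hz => by
    simpa using hΓ.vars (h1 hz)
  have j1 : IsSub TC Γ (O.ten (X ++ [(x, U'.subst τ)]) Y) .var :=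
    G.l.conv D hX.sq hX.ne eY hΓ h2
  have j2 : IsSub TC Γ (O.ten X (Y ++ [(y, V'.subst ρ)])) .var :=
    Half.conv D.op G.r hY.sq hY.ne eX hΓ h1
  have s1 := G.l.sew hX.sq hX.ne hY.ec hΓ h2 h1
  have c1 := ctx_par D G.self G.self eX hX.ec' eY hY.ec
  have k1 := (D.par_sub hX.ec'.der hY.ec.der).1 (List.Subset.refl _)
  have s2 := SE_sub_var (G.r.sew hY.sq hY.ne hX.ec' c1 k1.1 k1.2)
    (isSub_par D hX.ec'.der hY.ec.der i1 j1) hΓ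
  have c2 := ctx_par D G.self G.self eX hX.ec' eY hY.ec'
  have k2 := (D.par_sub hX.ec'.der hY.ec'.der).1 (List.Subset.refl _)
  have s3 := W_S1 D (fun a b h => by
      rcases h with ⟨ha, hb⟩ | ⟨ha, hb⟩
      · exact hX.s1 D hY c2 k2.1 ha hb
      · exact hY.s1 D.op hX c2 k2.2 hb ha)
    (.inl (by
      have := G.self.sw_last D hX.ec' hY.ec' c2 k2.1 k2.2
      rwa [Expr.subst_var, Expr.subst_var, hX.var, hY.var]))
  rw [Expr.subst_var, Expr.subst_var, hX.var, hY.var] at s3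
  exact (s1.s3 s2).s3 (SE_sub_var s3 (isSub_par D hX.ec'.der hY.ec'.der j2 j1) hΓ)

omit D

end

section
variable {A B C : Alphabet} {TA : Set (Judg A)} {TB : Set (Judg B)} {TC : Set (Judg C)}
  {X X1 : PreCtx A} {Y Y1 : PreCtx B} {U : SortE A} {V : SortE B}

variable (pA : PT TA) (pB : PT TB)

/-! ### The lexicographic grid -/

/-- The lexicographically ordered grid. -/
def lex {α β γ : Type} (f : α → β → γ) (l1 : List α) (l2 : List β) : List γ :=
  l1.flatMap fun a => l2.map (f a)

section lex

variable {α α' β β' γ δ : Type} (f : α → β → γ)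

theorem mem_lex (l1 : List α) (l2 : List β) (z : γ) :
    z ∈ lex f l1 l2 ↔ ∃ a ∈ l1, ∃ b ∈ l2, f a b = z := by
  simp [lex]

theorem lex_map (h : γ → δ) (l1 : List α) (l2 : List β) :
    (lex f l1 l2).map h = lex (fun a b => h (f a b)) l1 l2 := by
  simp [lex, List.map_flatMap, Function.comp_def]

theorem lex_mapL (h : α' → α) (l1 : List α') (l2 : List β) :
    lex f (l1.map h) l2 = lex (fun a b => f (h a) b) l1 l2 := by
  simp [lex, List.flatMap_map]

theorem lex_mapR (h : β' → β) (l1 : List α) (l2 : List β') :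
    lex f l1 (l2.map h) = lex (fun a b => f a (h b)) l1 l2 := by
  simp [lex, Function.comp_def]

theorem length_lex (l1 : List α) (l2 : List β) :
    (lex f l1 l2).length = l1.length * l2.length := by
  simp [lex, List.length_flatMap]

theorem lex_cons (a : α) (l1 : List α) (l2 : List β) :
    lex f (a :: l1) l2 = l2.map (f a) ++ lex f l1 l2 := by
  simp [lex]

theorem lex_append (l1 l1' : List α) (l2 : List β) :
    lex f (l1 ++ l1') l2 = lex f l1 l2 ++ lex f l1' l2 := by
  simp [lex]

theorem lex_single (a : α) (l2 : List β) : lex f [a] l2 = l2.map (f a) := by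
  simp [lex]

theorem lex_congr {f g : α → β → γ} {l1 : List α} {l2 : List β}
    (h : ∀ a ∈ l1, ∀ b ∈ l2, f a b = g a b) : lex f l1 l2 = lex g l1 l2 := by
  induction l1 with
  | nil => rfl
  | cons a l1 ih =>
    rw [lex_cons, lex_cons, ih fun a ha => h a (List.mem_cons_of_mem _ ha),
      map_congr_left (h a (List.mem_cons_self ..))]

theorem getElem_lex (l1 : List α) (l2 : List β) {i j : ℕ} (hi : i < l1.length) (hj : j < l2.length)
    (h : i * l2.length + j < (lex f l1 l2).length) :
    (lex f l1 l2)[i * l2.length + j] = f l1[i] l2[j] := by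
  induction l1 generalizing i with
  | nil => simp at hi
  | cons a l1 ih =>
    rcases i with _ | i
    · simp only [lex_cons]
      rw [getElem_append_left (by simpa using hj)]
      simp
    · simp only [lex_cons]
      have e : (i + 1) * l2.length + j = l2.length + (i * l2.length + j) := by ring
      rw [List.getElem_append_right (by simp [e])]
      simp only [List.length_map, e, Nat.add_sub_cancel_left]
      rw [ih]
      · simp
      · simpa using hi

theorem grid_index {m n k : ℕ} (h : k < m * n) : ∃ i < m, ∃ j < n, k = i * n + j := by
  have hn : 0 < n := Nat.pos_of_ne_zero fun e => by simp [e] at h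
  exact ⟨k / n, Nat.div_lt_of_lt_mul (by rwa [Nat.mul_comm]), k % n, Nat.mod_lt _ hn,
    (Nat.div_add_mod' k n).symm⟩

theorem grid_index_lt {m n i j : ℕ} (hi : i < m) (hj : j < n) : i * n + j < m * n := by
  calc i * n + j < i * n + n := by omega
    _ = (i + 1) * n := by ring
    _ ≤ m * n := Nat.mul_le_mul_right _ hi

theorem isGrid_lex {m n : ℕ} {M : ℕ → ℕ → γ} {l1 : List α} {l2 : List β} (hm : l1.length = m)
    (hn : l2.length = n) (h : ∀ i j (hi : i < l1.length) (hj : j < l2.length),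
      M i j = f l1[i] l2[j])
    {L : List γ} : IsGrid m n M L ↔ L = lex f l1 l2 := by
  subst hm hn
  constructor
  · rintro ⟨h1, h2⟩
    refine List.ext_getElem (by rw [h1, length_lex]) fun k hk hk' => ?_
    obtain ⟨i, hi, j, hj, rfl⟩ := grid_index (h1 ▸ hk)
    rw [h2 i j hi hj, getElem_lex f l1 l2 hi hj, h i j hi hj]
  · rintro rfl
    exact ⟨length_lex f l1 l2, fun i j hi hj _ => by rw [getElem_lex f l1 l2 hi hj, h i j hi hj]⟩

theorem isGrid_dropLast {m n : ℕ} {M : ℕ → ℕ → γ} {l1 : List α} {l2 : List β} {a b}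
    (hm : l1.length = m) (hn : l2.length = n)
    (h : ∀ i j (hi : i < l1.length) (hj : j < l2.length), M i j = f l1[i] l2[j])
    (h1 : ∀ i (hi : i < l1.length), M i n = f l1[i] b)
    (h2 : ∀ j (hj : j < l2.length), M m j = f a l2[j]) {L : List γ}
    (hL : IsGrid (m + 1) (n + 1) M L) : L.dropLast = (lex f (l1 ++ [a]) (l2 ++ [b])).dropLast := by
  classical
  subst hm hn
  obtain ⟨e1, e2⟩ := hL
  have e3 := length_lex f (l1 ++ [a]) (l2 ++ [b])
  simp only [List.length_append, List.length_singleton] at e3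
  refine List.ext_getElem (by simp [e1, e3]) fun k hk hk' => ?_
  simp only [List.length_dropLast, e1] at hk
  have hk2 : k < (l1.length + 1) * (l2.length + 1) := by omega
  obtain ⟨i, hi, j, hj, rfl⟩ := grid_index hk2
  have hl := getElem_lex f (l1 ++ [a]) (l2 ++ [b]) (i := i) (j := j) (by simpa using hi)
    (by simpa using hj) (by simpa [e3] using hk2)
  rw [List.getElem_dropLast, List.getElem_dropLast, e2 i j hi hj]
  simp only [List.length_append, List.length_singleton] at hl
  rw [hl]
  rcases Nat.lt_succ_iff_lt_or_eq.1 hi with hi | rfl <;>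
    rcases Nat.lt_succ_iff_lt_or_eq.1 hj with hj | rfl
  · rw [h i j hi hj, getElem_append_left hi, getElem_append_left hj]
  · rw [h1 i hi, getElem_append_left hi]
    simp
  · rw [h2 j hj, getElem_append_left hj]
    simp
  · exfalso
    have : (l1.length + 1) * (l2.length + 1) = l1.length *
      (l2.length + 1) + l2.length + 1 := by ring
    omega

theorem lex_snoc (l1 : List α) (a : α) (l2 : List β) (b : β) :
    lex f (l1 ++ [a]) (l2 ++ [b]) = lex f l1 (l2 ++ [b]) ++ l2.map (f a) ++ [f a b] := by
  simp [lex]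

theorem mem_dropLast_lex (l1 : List α) (a : α) (l2 : List β) (b : β) (z : γ) :
    z ∈ (lex f (l1 ++ [a]) (l2 ++ [b])).dropLast ↔
      (∃ a' ∈ l1, ∃ b' ∈ l2 ++ [b], f a' b' = z) ∨ (∃ a' ∈ l1 ++ [a], ∃ b' ∈ l2, f a' b' = z) := by
  rw [lex_snoc, List.dropLast_concat, mem_append, mem_lex, mem_map]
  constructor
  · rintro (h | ⟨b', hb, h⟩)
    · exact .inl h
    · exact .inr ⟨a, by simp, b', hb, h⟩
  · rintro (h | ⟨a', ha, b', hb, h⟩)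
    · exact .inl h
    · rcases mem_append.1 ha with ha | ha
      · exact .inl ⟨a', ha, b', by simp [hb], h⟩
      · obtain rfl : a' = a := by simpa using ha
        exact .inr ⟨b', hb, h⟩

theorem map_split {l : List β} {g : β → γ} {pre z} (h : (pre ++ [z]) <+: l.map g) :
    ∃ b1 b, (b1 ++ [b]) <+: l ∧ z = g b ∧ pre = b1.map g := by
  obtain ⟨r, h⟩ := h
  obtain ⟨l1, l2, rfl, h1, h2⟩ := List.map_eq_append_iff.1 h.symm
  obtain ⟨l3, l4, rfl, h3, h4⟩ := List.map_eq_append_iff.1 h1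
  obtain ⟨b, rfl⟩ : ∃ b, l4 = [b] := List.length_eq_one_iff.1
    (by simpa using congrArg List.length h4)
  exact ⟨l3, b, ⟨l2, by simp⟩, by simpa using h4.symm, h3.symm⟩

theorem lex_split (l1 : List α) (l2 : List β) (pre : List γ) (z : γ)
    (h : (pre ++ [z]) <+: lex f l1 l2) :
    ∃ a1 a b1 b, (a1 ++ [a]) <+: l1 ∧ (b1 ++ [b]) <+: l2 ∧ z = f a b ∧
      (∀ a' ∈ a1, ∀ b' ∈ b1 ++ [b], f a' b' ∈ pre) ∧
      (∀ a' ∈ a1 ++ [a], ∀ b' ∈ b1, f a' b' ∈ pre) := by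
  induction l1 using List.reverseRecOn with
  | nil => simp [lex] at h
  | append_singleton l1 a ih =>
    rw [lex_append, lex_single] at h
    rcases List.prefix_or_prefix_of_prefix h (List.prefix_append _ _) with h1 | h1
    · obtain ⟨a1, a', b1, b, e, r⟩ := ih h1
      exact ⟨a1, a', b1, b, e.trans (List.prefix_append _ _), r⟩
    · rcases List.prefix_concat_iff.1 h1 with h1 | h1
      · obtain ⟨a1, a', b1, b, e, r⟩ := ih (h1 ▸ List.prefix_refl _)
        exact ⟨a1, a', b1, b, e.trans (List.prefix_append _ _), r⟩
      obtain ⟨r, rfl⟩ := h1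
      rw [List.append_assoc, List.prefix_append_right_inj] at h
      obtain ⟨b1, b, e, rfl, rfl⟩ := map_split h
      refine ⟨l1, a, b1, b, List.prefix_refl _, e, rfl, fun a' ha b' hb => ?_,
        fun a' ha b' hb => ?_⟩
      · exact mem_append_left _ ((mem_lex ..).2 ⟨a', ha, b', e.subset hb, rfl⟩)
      · rcases mem_append.1 ha with ha | ha
        · exact mem_append_left _
            ((mem_lex ..).2 ⟨a', ha, b', e.subset (mem_append_left _ hb), rfl⟩)
        · obtain rfl : a' = a := by simpa using ha
          exact mem_append_right _ (mem_map_of_mem hb)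

theorem nodup_lex (l1 : List α) (l2 : List β) (h1 : l1.Nodup) (h2 : l2.Nodup)
    (hf : ∀ a b a' b', f a b = f a' b' → a = a' ∧ b = b') : (lex f l1 l2).Nodup := by
  rw [lex, List.nodup_flatMap]
  refine ⟨fun a _ => h2.map fun b b' h => (hf _ _ _ _ h).2, h1.imp ?_⟩
  intro a a' hne z hz hz'
  simp only [mem_map] at hz hz'
  obtain ⟨b, -, rfl⟩ := hz
  obtain ⟨b', -, h⟩ := hz'
  exact hne (hf _ _ _ _ h).1.symm

end lex

/-! ### The tensor of expressions as a function -/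

open Classical in

/-- A canonical sort of a term. -/
noncomputable def can [Nonempty (SortE A)] (TA : Set (Judg A)) (X : PreCtx A) (u : Expr A) :
    SortE A :=
  if h : ∃ U, CanonSort TA X u U then h.choose else Classical.ofNonempty

theorem can_eq [Nonempty (SortE A)] (hPT : PT TA) (hX : Der TA (.ctx X)) {u U}
    (h : CanonSort TA X u U) : can TA X u = U := by
  rw [can, dif_pos ⟨U, h⟩]
  exact (Exists.choose_spec (p := fun U => CanonSort TA X u U) ⟨U, h⟩).unique hPT (hX.ctxOK hPT) h

/-- A term which is typed at a given level over a smaller context. -/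
def St (TA : Set (Judg A)) (p : ℕ) (X : PreCtx A) (u : Expr A) : Prop :=
  ∃ X0 ⊆ X, ∃ U, Lv TA p (.term X0 u U)

/-- A term annotated by a sort to which the tensor operation may be applied. -/
def GA (TA : Set (Judg A)) (p : ℕ) (X : PreCtx A) (u : Expr A) (U : SortE A) : Prop :=
  SdS TA p X U ∧ ((∃ x, u = .var x) ∨ St TA p X u)

theorem GA.pos {p X u} (h : GA TA p X u U) : ∃ k, p = k + 1 := by
  obtain ⟨X0, -, h⟩ := h.1
  rcases p with _ | p
  · exact h.elim
  · exact ⟨p, rfl⟩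

theorem St.canon (hPT : PT TA) {p X} {u : Expr A} (h : St TA p X u) :
    ∃ C, CanonSort TA X u C ∧ SdS TA p X C := by
  obtain ⟨X0, hs, U, h⟩ := h
  obtain ⟨C, hC, hl, -⟩ := h.canon hPT
  refine ⟨C, hC.mono hs, X0, hs, ?_⟩
  rcases p with _ | p
  · exact h.elim
  · have h1 : Lv TA p (.sort X0 C) := hl.pre_succ
    exact h1.mono (Nat.le_succ p)

theorem St.var_mem {p X x} (h : St TA p X (.var x)) : ∃ U, (x, U) ∈ X := by
  obtain ⟨X0, hs, U, h⟩ := h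
  obtain ⟨V, h⟩ := WT.var_mem ⟨U, h.der⟩
  exact ⟨V, hs h⟩

theorem GA.args {p X u} (h : GA TA p X u U) {a} (ha : a ∈ U.args) : St TA p X a := by
  obtain ⟨⟨X0, hs, h⟩, -⟩ := h
  rcases p with _ | p
  · exact h.elim
  · obtain ⟨V, hV⟩ := h.sort_args ha
    exact ⟨X0, hs, V, hV.mono (Nat.le_succ p)⟩

theorem GA.app_st {p X t ts} (h : GA TA p X (.app t ts) U) :
    St TA p X (.app t ts) := by
  rcases h.2 with ⟨x, h⟩ | h
  · simp at h
  · exact h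

theorem GA.app_args {p X t ts} (h : GA TA (p + 1) X (.app t ts) U) {a} (ha : a ∈ ts) :
    St TA p X a := by
  obtain ⟨X0, hs, V, h⟩ := h.app_st
  obtain ⟨V, hV⟩ := h.app_args ha
  exact ⟨X0, hs, V, hV⟩

/-- The variables of a context are tensorable over a smaller context. -/
theorem EC.ga {p X} (h : EC TA p X) {z} (hz : z ∈ X) : GA TA p X (.var z.1) z.2 :=
  ⟨h.sds hz, .inl ⟨_, rfl⟩⟩

section

variable [Nonempty (SortE A)] [Nonempty (SortE B)]

theorem St.ga (hPT : PT TA) {p X} (hX : Der TA (.ctx X)) {u : Expr A} (h : St TA p X u) :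
    GA TA p X u (can TA X u) := by
  obtain ⟨C, hC, hs⟩ := h.canon hPT
  rw [can_eq hPT hX hC]
  exact ⟨hs, .inr h⟩

theorem St.can_mono (hPT : PT TA) {p X Y} (hX : Der TA (.ctx X)) (hY : Der TA (.ctx Y)) {u : Expr A}
    (h : St TA p X u) (hs : X ⊆ Y) : can TA X u = can TA Y u := by
  obtain ⟨C, hC, -⟩ := h.canon hPT
  rw [can_eq hPT hX hC, can_eq hPT hY (hC.mono hs)]

/-- One unfolding of the tensor of annotated terms. -/
noncomputable def stepF (TA : Set (Judg A)) (TB : Set (Judg B)) (X : PreCtx A) (Y : PreCtx B)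
    (G : Expr A → SortE A → Expr B → SortE B → Expr (A.tensor B)) (u : Expr A) (U : SortE A)
    (v : Expr B) (V : SortE B) : Expr (A.tensor B) :=
  match v with
  | .app t ts => .app (Sum.inl (U.head, t)) (lex (fun a b => G a.1 a.2 b (can TB Y b))
      (U.args.map (fun a => (a, can TA X a)) ++ [(u, U)]) ts)
  | .var y => match u with
    | .var x => .var (x, y)
    | .app s ss => .app (Sum.inr (s, V.head)) (lex (fun a b => G a (can TA X a) b.1 b.2)
        ss (V.args.map (fun b => (b, can TB Y b)) ++ [(v, V)]))

/-- The tensor of annotated terms, with a bound on the number of unfoldings. -/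
noncomputable def F (TA : Set (Judg A)) (TB : Set (Judg B)) (X : PreCtx A) (Y : PreCtx B) :
    ℕ → Expr A → SortE A → Expr B → SortE B → Expr (A.tensor B)
  | 0 => stepF TA TB X Y fun _ _ _ _ => .var (Classical.ofNonempty, Classical.ofNonempty)
  | n + 1 => stepF TA TB X Y (F TA TB X Y n)

theorem F_vv (n x U y V) :
    F TA TB X Y n (.var x) U (.var y) V = .var (x, y) := by
  cases n <;> rfl

theorem F_L (n u U t ts V) :
    F TA TB X Y (n + 1) u U (.app t ts) V = .app (Sum.inl (U.head, t))
      (lex (fun a b => F TA TB X Y n a.1 a.2 b (can TB Y b))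
      (U.args.map (fun a => (a, can TA X a)) ++ [(u, U)]) ts) := rfl

theorem F_R (n s ss U y V) :
    F TA TB X Y (n + 1) (.app s ss) U (.var y) V = .app (Sum.inr (s, V.head))
      (lex (fun a b => F TA TB X Y n a (can TA X a) b.1 b.2)
        ss (V.args.map (fun b => (b, can TB Y b)) ++ [(.var y, V)])) := rfl

include pA pB

/-- Induction over pairs of annotated terms. -/
theorem GA.ind (hX : Der TA (.ctx X)) (hY : Der TB (.ctx Y))
    {P : ℕ → ℕ → Expr A → SortE A → Expr B → SortE B → Prop}
    (vv : ∀ p q x U y V, GA TA p X (.var x) U → GA TB q Y (.var y) V → P p q (.var x) U (.var y) V)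
    (hL : ∀ p q u U t ts V, GA TA p X u U → GA TB (q + 1) Y (.app t ts) V → (∀ a ∈ U.args.map
      (fun a => (a, can TA X a)) ++ [(u, U)], ∀ b ∈ ts, GA TA p X a.1 a.2 ∧ GA TB q Y b
      (can TB Y b) ∧ P p q a.1 a.2 b (can TB Y b)) → P p (q + 1) u U (.app t ts) V)
    (hR : ∀ p q s ss U y V, GA TA (p + 1) X (.app s ss) U → GA TB q Y (.var y) V → (∀ a ∈ ss,
      ∀ b ∈ V.args.map (fun b => (b, can TB Y b)) ++ [(.var y, V)], GA TA p X a (can TA X a) ∧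
      GA TB q Y b.1 b.2 ∧ P p q a (can TA X a) b.1 b.2) → P (p + 1) q (.app s ss) U (.var y) V)
    {p q u U v V} (hu : GA TA p X u U) (hv : GA TB q Y v V) : P p q u U v V := by
  generalize hn : p + q = n
  induction n using Nat.strong_induction_on generalizing p q u v U V with
  | _ n ih =>
  have key : ∀ b, b ∈ V.args.map (fun b => (b, can TB Y b)) ++ [(v, V)] → GA TB q Y b.1 b.2 := by
    intro b hb
    rcases mem_append.1 hb with hb | hb
    · obtain ⟨b, hb', rfl⟩ := mem_map.1 hb
      exact (hv.args hb').ga pB hY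
    · obtain rfl : b = (v, V) := by simpa using hb
      exact hv
  have key' : ∀ b, b ∈ U.args.map (fun b => (b, can TA X b)) ++ [(u, U)] → GA TA p X b.1 b.2 := by
    intro b hb
    rcases mem_append.1 hb with hb | hb
    · obtain ⟨b, hb', rfl⟩ := mem_map.1 hb
      exact (hu.args hb').ga pA hX
    · obtain rfl : b = (u, U) := by simpa using hb
      exact hu
  cases v with
  | app t ts =>
    obtain ⟨q, rfl⟩ := hv.pos
    refine hL p q u U t ts V hu hv fun a ha b hb => ?_
    have h2 := (hv.app_args hb).ga pB hY
    exact ⟨key' a ha, h2, ih (p + q) (by omega) (key' a ha) h2 rfl⟩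
  | var y =>
    cases u with
    | var x => exact vv p q x U y V hu hv
    | app s ss =>
      obtain ⟨p, rfl⟩ := hu.pos
      refine hR p q s ss U y V hu hv fun a ha b hb => ?_
      have h2 := (hu.app_args ha).ga pA hX
      exact ⟨h2, key b hb, ih (p + q) (by omega) h2 (key b hb) rfl⟩

theorem F_eq (hX : Der TA (.ctx X)) (hY : Der TB (.ctx Y))
    (hX1 : Der TA (.ctx X1)) (hY1 : Der TB (.ctx Y1)) (hXs : X ⊆ X1) (hYs : Y ⊆ Y1)
    {p q u U v V} (hu : GA TA p X u U) (hv : GA TB q Y v V) :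
    ∀ n m, p + q ≤ n → p + q ≤ m → F TA TB X Y n u U v V = F TA TB X1 Y1 m u U v V := by
  refine GA.ind pA pB hX hY (P := fun p q u U v V => ∀ n m, p + q ≤ n → p + q ≤ m →
    F TA TB X Y n u U v V = F TA TB X1 Y1 m u U v V) ?_ ?_ ?_ hu hv
  · intros
    rw [F_vv, F_vv]
  · intro p q u U t ts V hu hv ih n m hn hm
    obtain ⟨n, rfl⟩ : ∃ k, n = k + 1 := ⟨n - 1, by omega⟩
    obtain ⟨m, rfl⟩ : ∃ k, m = k + 1 := ⟨m - 1, by omega⟩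
    rw [F_L, F_L]
    have e : U.args.map (fun a => (a, can TA X a)) = U.args.map (fun a => (a, can TA X1 a)) :=
      map_congr_left fun a ha => by rw [(hu.args ha).can_mono pA hX hX1 hXs]
    rw [← e]
    congr 1
    refine lex_congr fun a ha b hb => ?_
    rw [(ih a ha b hb).2.2 n m (by omega) (by omega), (hv.app_args hb).can_mono pB hY hY1 hYs]
  · intro p q s ss U y V hu hv ih n m hn hm
    obtain ⟨n, rfl⟩ : ∃ k, n = k + 1 := ⟨n - 1, by omega⟩
    obtain ⟨m, rfl⟩ : ∃ k, m = k + 1 := ⟨m - 1, by omega⟩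
    rw [F_R, F_R]
    have e : V.args.map (fun a => (a, can TB Y a)) = V.args.map (fun a => (a, can TB Y1 a)) :=
      map_congr_left fun a ha => by rw [(hv.args ha).can_mono pB hY hY1 hYs]
    rw [← e]
    congr 1
    refine lex_congr fun a ha b hb => ?_
    rw [(ih a ha b hb).2.2 n m (by omega) (by omega), (hu.app_args ha).can_mono pA hX hX1 hXs]

theorem F_scope (hX : Der TA (.ctx X)) (hY : Der TB (.ctx Y))
    {p q u U v V} (hu : GA TA p X u U) (hv : GA TB q Y v V) :
    ∀ n, p + q ≤ n → ∀ z, Occurs z (F TA TB X Y n u U v V) →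
      ((∃ W, (z.1, W) ∈ X) ∨ u = .var z.1) ∧ ((∃ W, (z.2, W) ∈ Y) ∨ v = .var z.2) := by
  refine GA.ind pA pB hX hY (P := fun p q u U v V => ∀ n, p + q ≤ n → ∀ z,
    Occurs z (F TA TB X Y n u U v V) →
      ((∃ W, (z.1, W) ∈ X) ∨ u = .var z.1) ∧ ((∃ W, (z.2, W) ∈ Y) ∨ v = .var z.2)) ?_ ?_ ?_ hu hv
  · intro p q x U y V hx hy n hn z hz
    rw [F_vv, occurs_var_iff] at hz
    subst hz
    exact ⟨.inr rfl, .inr rfl⟩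
  · intro p q u U t ts V hu hv ih n hn z hz
    obtain ⟨n, rfl⟩ : ∃ k, n = k + 1 := ⟨n - 1, by omega⟩
    rw [F_L, occurs_app_iff] at hz
    obtain ⟨e, he, hz⟩ := hz
    obtain ⟨a, ha, b, hb, rfl⟩ := (mem_lex ..).1 he
    obtain ⟨h1, h2⟩ := (ih a ha b hb).2.2 n (by omega) z hz
    refine ⟨?_, .inl ?_⟩
    · rcases mem_append.1 ha with ha | ha
      · obtain ⟨a, ha', rfl⟩ := mem_map.1 ha
        rcases h1 with h1 | h1
        · exact .inl h1
        · exact .inl ((h1 ▸ hu.args ha' : St TA p X (.var z.1)).var_mem)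
      · obtain rfl : a = (u, U) := by simpa using ha
        exact h1
    · rcases h2 with h2 | h2
      · exact h2
      · exact (h2 ▸ hv.app_args hb : St TB q Y (.var z.2)).var_mem
  · intro p q s ss U y V hu hv ih n hn z hz
    obtain ⟨n, rfl⟩ : ∃ k, n = k + 1 := ⟨n - 1, by omega⟩
    rw [F_R, occurs_app_iff] at hz
    obtain ⟨e, he, hz⟩ := hz
    obtain ⟨a, ha, b, hb, rfl⟩ := (mem_lex ..).1 he
    obtain ⟨h1, h2⟩ := (ih a ha b hb).2.2 n (by omega) z hz
    refine ⟨.inl ?_, ?_⟩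
    · rcases h1 with h1 | h1
      · exact h1
      · exact (h1 ▸ hu.app_args ha : St TA p X (.var z.1)).var_mem
    · rcases mem_append.1 hb with hb | hb
      · obtain ⟨b, hb', rfl⟩ := mem_map.1 hb
        rcases h2 with h2 | h2
        · exact .inl h2
        · exact .inl ((h2 ▸ hv.args hb' : St TB q Y (.var z.2)).var_mem)
      · obtain rfl : b = (.var y, V) := by simpa using hb
        exact h2

omit pA pB

end

section lookup

theorem lookupV_map {α : Type} (l : List α) (key : α → A.Var) (val : α → Expr A) {k : α}
    (hk : k ∈ l) (h : ∀ k' ∈ l, key k' = key k → val k' = val k) :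
    lookupV (l.map fun k => (key k, val k)) (key k) = val k := by
  induction l with
  | nil => simp at hk
  | cons a l ih =>
    simp only [List.map_cons, lookupV]
    split_ifs with h1
    · exact h a (by simp) h1
    · refine ih ?_ fun k' hk' => h k' (List.mem_cons_of_mem _ hk')
      rcases List.mem_cons.1 hk with rfl | hk
      · exact absurd rfl h1
      · exact hk

theorem lookupV_append_left {l l' : List (A.Var × Expr A)} {x : A.Var} (hx : ∃ p ∈ l, p.1 = x) :
    lookupV (l ++ l') x = lookupV l x := by
  induction l with
  | nil => simp at hx
  | cons a l ih =>
    simp only [List.cons_append, lookupV]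
    split_ifs with h1
    · rfl
    · refine ih ?_
      obtain ⟨p, hp, h⟩ := hx
      rcases List.mem_cons.1 hp with rfl | hp
      · exact absurd h h1
      · exact ⟨p, hp, h⟩

theorem lookupV_append_right {l l' : List (A.Var × Expr A)} {x : A.Var} (hx : ∀ p ∈ l, p.1 ≠ x) :
    lookupV (l ++ l') x = lookupV l' x := by
  induction l with
  | nil => rfl
  | cons a l ih =>
    simp only [List.cons_append, lookupV]
    rw [if_neg (hx a (by simp)), ih fun p hp => hx p (List.mem_cons_of_mem _ hp)]

theorem exists_fresh (X : PreCtx A) : ∃ x : A.Var, ∀ z ∈ X, z.1 ≠ x := by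
  classical
  obtain ⟨x, hx⟩ := Infinite.exists_notMem_finset (X.map Prod.fst).toFinset
  refine ⟨x, ?_⟩
  rintro z hz rfl
  exact hx (List.mem_toFinset.2 (mem_map_of_mem hz))

theorem getElem_inj (hY : (Y.map Prod.fst).Nodup) {i j : ℕ} (hi : i < Y.length)
    (hj : j < Y.length) (h : Y[i].1 = Y[j].1) : i = j := by
  rw [List.nodup_iff_injective_get] at hY
  have := @hY ⟨i, by simpa using hi⟩ ⟨j, by simpa using hj⟩ (by simpa using h)
  simpa using this

theorem lookup_pairsR {x : A.Var} (hY : (Y.map Prod.fst).Nodup) {g : ℕ → Expr (A.tensor B)}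
    {j : ℕ} (hj : j < Y.length) :
    lookupV (pairsR x Y g) ((x, Y[j].1) : A.Var × B.Var) = g j := by
  refine lookupV_map (A := A.tensor B) (List.finRange Y.length) (fun j => (x, (Y.get j).1))
    (fun j => g j.1) (k := ⟨j, hj⟩) (List.mem_finRange _) fun k' _ h => ?_
  have h2 := getElem_inj hY k'.2 hj (by simpa using h)
  simp [h2]

theorem lookup_pairsR_ne {x : A.Var} {g : ℕ → Expr (A.tensor B)} {a : A.Var} {b : B.Var}
    (h : a ≠ x) :
    lookupV (pairsR x Y g) ((a, b) : A.Var × B.Var) = .var (a, b) := by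
  refine lookupV_of_not_mem (A := A.tensor B) _ fun p hp e => ?_
  obtain ⟨j, -, rfl⟩ := mem_map.1 hp
  exact h (congrArg Prod.fst e).symm

theorem lookup_pairsL {y : B.Var} (hX : (X.map Prod.fst).Nodup) {g : ℕ → Expr (A.tensor B)}
    {j : ℕ} (hj : j < X.length) :
    lookupV (pairsL X y g) ((X[j].1, y) : A.Var × B.Var) = g j := by
  refine lookupV_map (A := A.tensor B) (List.finRange X.length) (fun j => ((X.get j).1, y))
    (fun j => g j.1) (k := ⟨j, hj⟩) (List.mem_finRange _) fun k' _ h => ?_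
  have h2 := getElem_inj hX k'.2 hj (by simpa using h)
  simp [h2]

theorem pairsL_key {y : B.Var} {g : ℕ → Expr (A.tensor B)} {b : B.Var} {a : A.Var} (h : b ≠ y) :
    ∀ p ∈ pairsL X y g, p.1 ≠ ((a, b) : A.Var × B.Var) := by
  intro p hp e
  obtain ⟨j, -, rfl⟩ := mem_map.1 hp
  exact h (congrArg Prod.snd e).symm

theorem lookup_pairsL_ne {y : B.Var} {g : ℕ → Expr (A.tensor B)} {a : A.Var} {b : B.Var}
    (h : b ≠ y) :
    lookupV (pairsL X y g) ((a, b) : A.Var × B.Var) = .var (a, b) :=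
  lookupV_of_not_mem (A := A.tensor B) _ (pairsL_key h)

theorem lookup_pairs_left {x : A.Var} {y : B.Var} {gx gy : ℕ → Expr (A.tensor B)} {i : ℕ}
    (hi : i < X.length) :
    lookupV (pairsL X y gx ++ pairsR x Y gy) ((X[i].1, y) : A.Var × B.Var) =
      lookupV (pairsL X y gx) ((X[i].1, y) : A.Var × B.Var) :=
  lookupV_append_left (A := A.tensor B)
    ⟨((X[i].1, y), gx i), mem_map.2 ⟨⟨i, hi⟩, List.mem_finRange _, rfl⟩, rfl⟩

theorem lookup_pairs_right {x : A.Var} {y : B.Var} {gx gy : ℕ → Expr (A.tensor B)} {a : A.Var}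
    {b : B.Var} (h : b ≠ y) :
    lookupV (pairsL X y gx ++ pairsR x Y gy) ((a, b) : A.Var × B.Var) =
      lookupV (pairsR x Y gy) ((a, b) : A.Var × B.Var) :=
  lookupV_append_right (A := A.tensor B) (pairsL_key h)

end lookup

section grids

variable {α α' β β' γ : Type}

theorem exists_fn [Nonempty γ] (f : α → γ) (l : List α) :
    ∃ g : ℕ → γ, ∀ i (hi : i < l.length), g i = f l[i] :=
  ⟨fun i => if h : i < l.length then f l[i] else Classical.ofNonempty, fun i hi => by simp [hi]⟩

theorem exists_fn₂ [Nonempty γ] (f : α → β → γ) (l1 : List α) (l2 : List β) :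
    ∃ g : ℕ → ℕ → γ, ∀ i (hi : i < l1.length) j (hj : j < l2.length), g i j = f l1[i] l2[j] :=
  ⟨fun i j => if h : i < l1.length ∧ j < l2.length then f l1[i] l2[j] else Classical.ofNonempty,
    fun i hi j hj => by simp [hi, hj]⟩

theorem isGrid_row {f : α → β → γ} {l : List α'} {g : α' → α} {c : α} {l2 : List β}
    {M : ℕ → ℕ → γ} (h : ∀ i (hi : i < l.length) j (hj : j < l2.length), M i j = f (g l[i]) l2[j])
    (h' : ∀ j (hj : j < l2.length), M l.length j = f c l2[j]) {L : List γ} :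
    IsGrid (l.length + 1) l2.length M L ↔ L = lex f (l.map g ++ [c]) l2 := by
  refine isGrid_lex f (by simp) rfl fun i j hi hj => ?_
  simp only [List.length_append, List.length_map, List.length_singleton] at hi
  rcases Nat.lt_succ_iff_lt_or_eq.1 hi with hi | rfl
  · rw [h i hi j hj, getElem_append_left (by simpa using hi)]
    simp
  · rw [h' j hj]
    simp

theorem isGrid_col {f : α → β → γ} {l : List β'} {g : β' → β} {c : β} {l1 : List α}
    {M : ℕ → ℕ → γ} (h : ∀ i (hi : i < l1.length) j (hj : j < l.length), M i j = f l1[i] (g l[j]))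
    (h' : ∀ i (hi : i < l1.length), M i l.length = f l1[i] c) {L : List γ} :
    IsGrid l1.length (l.length + 1) M L ↔ L = lex f l1 (l.map g ++ [c]) := by
  refine isGrid_lex f rfl (by simp) fun i j hi hj => ?_
  simp only [List.length_append, List.length_map, List.length_singleton] at hj
  rcases Nat.lt_succ_iff_lt_or_eq.1 hj with hj | rfl
  · rw [h i hi j hj, getElem_append_left (by simpa using hj)]
    simp
  · rw [h' i hi]
    simp

end grids

theorem EC.take {p X} (h : EC TA p X) {j : ℕ} (hj : j < X.length) :
    EC TA p (X.take j) ∧ SdS TA p (X.take j) X[j].2 ∧ ∀ z ∈ X.take j, z.1 ≠ X[j].1 := by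
  have h1 : EC TA p (X.take j ++ [X[j]]) := by
    have := h.initial (List.take_prefix (j + 1) X)
    rwa [take_succ_eq_append_getElem hj] at this
  obtain ⟨h2, h3, h4⟩ := h1.of_snoc
  exact ⟨h2, h3, h4⟩

section

variable [Nonempty (SortE A)] [Nonempty (SortE B)]

include pA pB

theorem F_subst (hX : Der TA (.ctx X)) (hY : Der TB (.ctx Y))
    {x : A.Var} {p u U} (hu : GA TA p X u U) {Q K} (hQ : EC TB Q Y) (hK : p + Q ≤ K)
    {σ : A.Var × B.Var → Expr (A.tensor B)}
    (h1 : ∀ z ∈ X, ∀ w ∈ Y, σ (z.1, w.1) = .var (z.1, w.1))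
    (h2 : ∀ w ∈ Y, σ (x, w.1) = F TA TB X Y K u U (.var w.1) w.2) :
    ∀ q v V, GA TB q Y v V → ((∃ y, v = .var y ∧ (y, V) ∈ Y) ∨ ∃ t ts, v = .app t ts) → ∀ m,
      p + q ≤ m →
      (F TA TB X Y m (.var x) U v V).subst σ = F TA TB X Y m u U v V := by
  intro q
  have hx : GA TA p X (.var x) U := ⟨hu.1, .inl ⟨x, rfl⟩⟩
  induction q using Nat.strong_induction_on with
  | _ q ih =>
  rintro v V hv (⟨y, rfl, hy⟩ | ⟨t, ts, rfl⟩) m hm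
  · rw [F_vv, Expr.subst_var]
    refine (h2 _ hy).trans ?_
    rw [F_eq pA pB hX hY hX hY (fun _ h => h) (fun _ h => h) hu (hQ.ga hy) K (K + m) hK (by omega)]
    exact F_eq pA pB hX hY hX hY (fun _ h => h) (fun _ h => h) hu hv (K + m) m (by omega) hm
  · obtain ⟨q, rfl⟩ := hv.pos
    obtain ⟨m, rfl⟩ : ∃ k, m = k + 1 := ⟨m - 1, by omega⟩
    rw [F_L, F_L, Expr.subst_app, lex_map, lex_append, lex_append, lex_single, lex_single]
    congr 2
    · refine lex_congr fun a ha b hb => ?_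
      obtain ⟨a, ha', rfl⟩ := mem_map.1 ha
      refine (Expr.subst_congr _ fun z hz => ?_).trans (Expr.subst_id _)
      obtain ⟨k1, k2⟩ := F_scope pA pB hX hY ((hu.args ha').ga pA hX) ((hv.app_args hb).ga pB hY) m
        (by omega) z hz
      obtain ⟨W1, k1⟩ : ∃ W, (z.1, W) ∈ X := k1.elim id fun h =>
        (h ▸ hu.args ha' : St TA p X (.var z.1)).var_mem
      obtain ⟨W2, k2⟩ : ∃ W, (z.2, W) ∈ Y := k2.elim id fun h =>
        (h ▸ hv.app_args hb : St TB q Y (.var z.2)).var_mem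
      exact h1 _ k1 _ k2
    · refine map_congr_left fun b hb => ih q (by omega) b _ ((hv.app_args hb).ga pB hY) ?_ m
        (by omega)
      cases b with
      | app t ts => exact .inr ⟨_, _, rfl⟩
      | var y =>
        obtain ⟨C, hC, -⟩ := (hv.app_args hb).canon pB
        rw [can_eq pB hY hC]
        exact .inl ⟨y, rfl, canonSort_var.1 hC⟩

theorem TTg_iff (hX : Der TA (.ctx X)) (hY : Der TB (.ctx Y))
    {p q u U v V} (hu : GA TA p X u U) (hv : GA TB q Y v V) {m} (hm : p + q ≤ m) {e} :
    TTg TA TB false ⟨X, u, U⟩ ⟨Y, v, V⟩ e ↔ e = F TA TB X Y m u U v V := by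
  have : Nonempty (Expr (A.tensor B)) := ⟨.var (Classical.ofNonempty, Classical.ofNonempty)⟩
  induction p using Nat.strong_induction_on generalizing X Y q u v U V m e with
  | _ p ihp =>
  induction q using Nat.strong_induction_on generalizing X Y u v U V m e with
  | _ q ihq =>
  have canA {X : PreCtx A} (hX : Der TA (.ctx X)) {p a} (h : St TA p X a) :
      CanonSort TA X a (can TA X a) := by
    obtain ⟨C, hC, -⟩ := h.canon pA
    rwa [can_eq pA hX hC]
  have canB {Y : PreCtx B} (hY : Der TB (.ctx Y)) {p a} (h : St TB p Y a) :
      CanonSort TB Y a (can TB Y a) := by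
    obtain ⟨C, hC, -⟩ := h.canon pB
    rwa [can_eq pB hY hC]
  have keyL {X : PreCtx A} {Y : PreCtx B} (hX : Der TA (.ctx X)) (hY : Der TB (.ctx Y))
      {x U t ts V} (hu : GA TA p X (.var x) U) (hv : GA TB q Y (.app t ts) V) {m}
      (hm : p + q ≤ m) {e} : TTg TA TB false ⟨X, .var x, U⟩ ⟨Y, .app t ts, V⟩ e ↔
        e = F TA TB X Y m (.var x) U (.app t ts) V := by
    obtain ⟨q, rfl⟩ := hv.pos
    obtain ⟨m, rfl⟩ : ∃ k, m = k + 1 := ⟨m - 1, by omega⟩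
    obtain ⟨S, ss⟩ := U
    have sA : ∀ a ∈ ss, St TA p X a := fun a ha => hu.args ha
    have sB : ∀ b ∈ ts, St TB q Y b := fun b hb => hv.app_args hb
    rw [F_L]
    constructor
    · intro h
      cases h with
      | varapp SS TSf hSS hTS M out hM hMx hout =>
      have eS : ∀ i (hi : i < ss.length), SS i = can TA X ss[i] := fun i hi =>
        (can_eq pA hX (hSS i hi)).symm
      have eT : ∀ i (hi : i < ts.length), TSf i = can TB Y ts[i] := fun i hi =>
        (can_eq pB hY (hTS i hi)).symm
      rw [(isGrid_row (f := fun a b => F TA TB X Y m a.1 a.2 b (can TB Y b))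
        (g := fun a => (a, can TA X a)) (c := (.var x, ⟨S, ss⟩)) ?_ ?_).1 hout]
      · intro i hi j hj
        have := hM i hi j hj
        rw [eS i hi, eT j hj] at this
        exact (ihq q (by omega) hX hY ((sA _ (getElem_mem hi)).ga pA hX)
          ((sB _ (getElem_mem hj)).ga pB hY) (by omega)).1 this
      · intro j hj
        have := hMx j hj
        rw [eT j hj] at this
        exact (ihq q (by omega) hX hY hu
          ((sB _ (getElem_mem hj)).ga pB hY) (by omega)).1 this
    · rintro rfl
      obtain ⟨SS, eS⟩ := exists_fn (can TA X) ss
      obtain ⟨TSf, eT⟩ := exists_fn (can TB Y) ts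
      obtain ⟨M, hM⟩ := exists_fn₂ (fun (a : Expr A × SortE A)
        (b : Expr B) => F TA TB X Y m a.1 a.2 b (can TB Y b))
        (ss.map (fun a => (a, can TA X a)) ++ [(.var x, ⟨S, ss⟩)]) ts
      have hM1 : ∀ i (hi : i < ss.length) j (hj : j < ts.length), M i j =
          F TA TB X Y m ss[i] (can TA X ss[i]) ts[j] (can TB Y ts[j]) := by
        intro i hi j hj
        rw [hM i (by simp; omega) j hj, getElem_append_left (by simpa using hi)]
        simp
      have hM2 : ∀ j (hj : j < ts.length), M ss.length j =
          F TA TB X Y m (.var x) ⟨S, ss⟩ ts[j] (can TB Y ts[j]) := by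
        intro j hj
        rw [hM ss.length (by simp) j hj]
        simp
      refine .varapp SS TSf (fun i hi => ?_) (fun i hi => ?_) M _ (fun i hi j hj => ?_)
        (fun j hj => ?_) ((isGrid_row hM1 hM2).2 rfl)
      · rw [eS i hi]
        exact canA hX (sA _ (getElem_mem hi))
      · rw [eT i hi]
        exact canB hY (sB _ (getElem_mem hi))
      · rw [eS i hi, eT j hj]
        exact (ihq q (by omega) hX hY ((sA _ (getElem_mem hi)).ga pA hX)
          ((sB _ (getElem_mem hj)).ga pB hY) (by omega)).2 (hM1 i hi j hj)
      · rw [eT j hj]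
        exact (ihq q (by omega) hX hY hu
          ((sB _ (getElem_mem hj)).ga pB hY) (by omega)).2 (hM2 j hj)
  have keyR {X : PreCtx A} {Y : PreCtx B} (hX : Der TA (.ctx X)) (hY : Der TB (.ctx Y))
      {s ss U y V q} (hu : GA TA p X (.app s ss) U) (hv : GA TB q Y (.var y) V) {m}
      (hm : p + q ≤ m) {e} : TTg TA TB false ⟨X, .app s ss, U⟩ ⟨Y, .var y, V⟩ e ↔
        e = F TA TB X Y m (.app s ss) U (.var y) V := by
    obtain ⟨p, rfl⟩ := hu.pos
    obtain ⟨m, rfl⟩ : ∃ k, m = k + 1 := ⟨m - 1, by omega⟩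
    obtain ⟨T, ts⟩ := V
    have sA : ∀ a ∈ ss, St TA p X a := fun a ha => hu.app_args ha
    have sB : ∀ b ∈ ts, St TB q Y b := fun b hb => hv.args hb
    rw [F_R]
    constructor
    · intro h
      cases h with
      | appvar SS TSf hSS hTS M out hM hMy hout =>
      have eS : ∀ i (hi : i < ss.length), SS i = can TA X ss[i] := fun i hi =>
        (can_eq pA hX (hSS i hi)).symm
      have eT : ∀ i (hi : i < ts.length), TSf i = can TB Y ts[i] := fun i hi =>
        (can_eq pB hY (hTS i hi)).symm
      rw [(isGrid_col (f := fun a b => F TA TB X Y m a (can TA X a) b.1 b.2)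
        (g := fun a => (a, can TB Y a)) (c := (.var y, ⟨T, ts⟩)) ?_ ?_).1 hout]
      · intro i hi j hj
        have := hM i hi j hj
        rw [eS i hi, eT j hj] at this
        exact (ihp p (by omega) hX hY ((sA _ (getElem_mem hi)).ga pA hX)
          ((sB _ (getElem_mem hj)).ga pB hY) (by omega)).1 this
      · intro i hi
        have := hMy i hi
        rw [eS i hi] at this
        exact (ihp p (by omega) hX hY ((sA _ (getElem_mem hi)).ga pA hX) hv
          (by omega)).1 this
    · rintro rfl
      obtain ⟨SS, eS⟩ := exists_fn (can TA X) ss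
      obtain ⟨TSf, eT⟩ := exists_fn (can TB Y) ts
      obtain ⟨M, hM⟩ := exists_fn₂ (fun (a : Expr A) (b : Expr B × SortE B) =>
        F TA TB X Y m a (can TA X a) b.1 b.2) ss (ts.map (fun a => (a, can TB Y a)) ++ [(.var y,
          ⟨T, ts⟩)])
      have hM1 : ∀ i (hi : i < ss.length) j (hj : j < ts.length), M i j =
          F TA TB X Y m ss[i] (can TA X ss[i]) ts[j] (can TB Y ts[j]) := by
        intro i hi j hj
        rw [hM i hi j (by simp; omega), getElem_append_left (by simpa using hj)]
        simp
      have hM2 : ∀ i (hi : i < ss.length), M i ts.length =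
          F TA TB X Y m ss[i] (can TA X ss[i]) (.var y) ⟨T, ts⟩ := by
        intro i hi
        rw [hM i hi ts.length (by simp)]
        simp
      refine .appvar SS TSf (fun i hi => ?_) (fun i hi => ?_) M _ (fun i hi j hj => ?_)
        (fun j hj => ?_) ((isGrid_col (f := fun (a : Expr A) (b : Expr B × SortE B) =>
          F TA TB X Y m a (can TA X a) b.1 b.2) hM1 hM2).2 rfl)
      · rw [eS i hi]
        exact canA hX (sA _ (getElem_mem hi))
      · rw [eT i hi]
        exact canB hY (sB _ (getElem_mem hi))
      · rw [eS i hi, eT j hj]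
        exact (ihp p (by omega) hX hY ((sA _ (getElem_mem hi)).ga pA hX)
          ((sB _ (getElem_mem hj)).ga pB hY) (by omega)).2 (hM1 i hi j hj)
      · rw [eS j hj]
        exact (ihp p (by omega) hX hY ((sA _ (getElem_mem hj)).ga pA hX) hv
          (by omega)).2 (hM2 j hj)
  cases u with
  | var x =>
    cases v with
    | app t ts => exact keyL hX hY hu hv hm
    | var y =>
      rw [F_vv]
      constructor
      · intro h
        cases h
        rfl
      · rintro rfl
        exact .varvar
  | app s ss =>
    cases v with
    | var y => exact keyR hX hY hu hv hm
    | app t ts =>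
      have hx0 (x : A.Var) : GA TA p X (.var x) U := ⟨hu.1, .inl ⟨x, rfl⟩⟩
      obtain ⟨Q, hQ⟩ := hY.lv
      replace hQ := EC.of_lv' hQ
      have hg0 (j : ℕ) (hj : j < Y.length) : GA TB Q (Y.take j) (.var Y[j].1) Y[j].2 :=
        ⟨(hQ.take hj).2.1, .inl ⟨_, rfl⟩⟩
      have hR (j : ℕ) (hj : j < Y.length) {e} := keyR hX (hQ.take hj).1.der hu (hg0 j hj)
        (Nat.le_refl (p + Q)) (e := e)
      have main {x : A.Var} (hx : ∀ z ∈ X, z.1 ≠ x) {g : ℕ → Expr (A.tensor B)}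
          (hg : ∀ j (hj : j < Y.length), g j =
            F TA TB X (Y.take j) (p + Q) (.app s ss) U (.var Y[j].1) Y[j].2) :
          (F TA TB X Y m (.var x) U (.app t ts) V).substL (pairsR x Y g) =
            F TA TB X Y m (.app s ss) U (.app t ts) V := by
        refine F_subst pA pB hX hY hu hQ (Nat.le_refl (p + Q)) (fun z hz w _ =>
          lookup_pairsR_ne (hx z hz)) (fun w hw => ?_) q _ V hv (.inr ⟨_, _, rfl⟩) m hm
        obtain ⟨j, hj, rfl⟩ := List.getElem_of_mem hw
        rw [lookup_pairsR (hY.ctxOK pB).2 hj, hg j hj]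
        exact F_eq pA pB hX (hQ.take hj).1.der hX hY (fun _ h => h) (take_subset _ _) hu
          (hg0 j hj) _ _ le_rfl le_rfl
      constructor
      · intro h
        cases h with
        | appapp_base hx e0 h0 g hg =>
        rw [(keyL hX hY (hx0 _) hv hm).1 h0]
        exact main hx fun j hj => (hR j hj).1 (hg j hj)
      · rintro rfl
        obtain ⟨x, hx⟩ := exists_fresh X
        let g : ℕ → Expr (A.tensor B) := fun j => if hj : j < Y.length then
          F TA TB X (Y.take j) (p + Q) (.app s ss) U (.var Y[j].1) Y[j].2 else Classical.ofNonempty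
        have hg : ∀ j (hj : j < Y.length), g j =
            F TA TB X (Y.take j) (p + Q) (.app s ss) U (.var Y[j].1) Y[j].2 := fun j hj => by
          simp [g, hj]
        rw [← main hx hg]
        exact .appapp_base hx _ ((keyL hX hY (hx0 _) hv hm).2 rfl) g fun j hj =>
          (hR j hj).2 (hg j hj)

omit pA pB

end

/-! ### The tensor operation of the paper as an abstract tensor operation -/

open Classical in

/-- A level at which a term is typed. -/
noncomputable def lvOf (TA : Set (Judg A)) (X : PreCtx A) (u : Expr A) : ℕ :=
  if h : ∃ p U, Lv TA p (.term X u U) then h.choose else 0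

theorem lvOf_spec {u} (h : WT TA X u) : ∃ U, Lv TA (lvOf TA X u) (.term X u U) := by
  have h' : ∃ p U, Lv TA p (.term X u U) :=
    let ⟨U, h⟩ := h; let ⟨p, h⟩ := h.lv; ⟨p, U, h⟩
  rw [lvOf, dif_pos h']
  exact h'.choose_spec

open Classical in

/-- The tensor of two terms over fixed contexts, taken at canonical sorts. -/
noncomputable def tenT (TA : Set (Judg A)) (TB : Set (Judg B)) (X : PreCtx A) (Y : PreCtx B)
    (u : Expr A) (v : Expr B) : Expr (A.tensor B) :=
  if h : Nonempty (SortE A) ∧ Nonempty (SortE B) then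
    haveI := h.1
    haveI := h.2
    F TA TB X Y (lvOf TA X u + lvOf TB Y v) u (can TA X u) v (can TB Y v)
  else match u, v with
    | .var x, .var y => .var (x, y)
    | _, _ => .var (Classical.ofNonempty, Classical.ofNonempty)

theorem tenT_vv (X : PreCtx A) (Y : PreCtx B) (x y) :
    tenT TA TB X Y (.var x) (.var y) = .var (x, y) := by
  unfold tenT
  split_ifs with h
  · have := h.1
    have := h.2
    exact F_vv ..
  · rfl

/-- A term annotated by its canonical sort, typed over a context and tensorable over a smaller
one. -/
structure Arg (TA : Set (Judg A)) (X X1 : PreCtx A) (u : Expr A) (U : SortE A) : Prop where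
  ctx : Der TA (.ctx X)
  ctx1 : Der TA (.ctx X1)
  sub : X ⊆ X1
  ga : ∃ p, GA TA p X u U
  can : CanonSort TA X1 u U
  wt : WT TA X1 u

theorem WT.ga (hPT : PT TA) {u U} (h : WT TA X u) (hc : CanonSort TA X u U) :
    GA TA (lvOf TA X u) X u U := by
  obtain ⟨V, hV⟩ := lvOf_spec h
  have hs : St TA (lvOf TA X u) X u := ⟨X, List.Subset.refl _, V, hV⟩
  obtain ⟨C, hC, hs'⟩ := hs.canon hPT
  rw [hc.unique hPT (hV.der.term_ctx.ctxOK hPT) hC]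
  exact ⟨hs', .inr hs⟩

theorem Arg.of_term (hPT : PT TA) {u U} (h : WT TA X u) (hc : CanonSort TA X u U)
    (hX1 : Der TA (.ctx X1)) (hs : X ⊆ X1) : Arg TA X X1 u U where
  ctx := h.choose_spec.term_ctx
  ctx1 := hX1
  sub := hs
  ga := ⟨_, h.ga hPT hc⟩
  can := hc.mono hs
  wt := ⟨_, h.choose_spec.wk_term hs hX1⟩

theorem Arg.var {x U} (h : Der TA (.sort X U)) (hx : (x, U) ∈ X1) (hX1 : Der TA (.ctx X1))
    (hs : X ⊆ X1) : Arg TA X X1 (.var x) U where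
  ctx := h.sort_ctx
  ctx1 := hX1
  sub := hs
  ga := by
    obtain ⟨p, hp⟩ := h.lv
    exact ⟨p, ⟨X, List.Subset.refl _, hp⟩, .inl ⟨_, rfl⟩⟩
  can := canonSort_var.2 hx
  wt := ⟨_, hX1.vars hx⟩

theorem Arg.args_wt {u U} (h : Arg TA X X1 u U) {a} (ha : a ∈ U.args) :
    WT TA X a := by
  obtain ⟨p, h1⟩ := h.ga
  obtain ⟨X0, hs, V, h2⟩ := h1.args ha
  exact ⟨V, h2.der.wk_term hs h.ctx⟩

theorem WT.can_arg (hPT : PT TA) [Nonempty (SortE A)] {u} (h : WT TA X u)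
    (hX1 : Der TA (.ctx X1)) (hs : X ⊆ X1) : Arg TA X X1 u (can TA X u) := by
  obtain ⟨U, hU⟩ := h
  obtain ⟨C, hC, -⟩ := hU.canon hPT
  rw [can_eq hPT hU.term_ctx hC]
  exact .of_term hPT ⟨U, hU⟩ hC hX1 hs

include pA pB

theorem tenT_eq [Nonempty (SortE A)] [Nonempty (SortE B)] {u U v V}
    (hu : Arg TA X X1 u U) (hv : Arg TB Y Y1 v V) {p q n} (gu : GA TA p X u U)
    (gv : GA TB q Y v V) (hn : p + q ≤ n) :
    F TA TB X Y n u U v V = tenT TA TB X1 Y1 u v := by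
  have h1 := hu.wt.ga pA hu.can
  have h2 := hv.wt.ga pB hv.can
  unfold tenT
  rw [dif_pos ⟨inferInstance, inferInstance⟩, can_eq pA hu.ctx1 hu.can,
    can_eq pB hv.ctx1 hv.can, F_eq pA pB hu.ctx hv.ctx hu.ctx1 hv.ctx1 hu.sub hv.sub gu gv n
      (n + (lvOf TA X1 u + lvOf TB Y1 v)) hn (by omega)]
  exact F_eq pA pB hu.ctx1 hv.ctx1 hu.ctx1 hv.ctx1 (List.Subset.refl _) (List.Subset.refl _) h1 h2
    _ _ (by omega) le_rfl

theorem TTg_tenT {u U v V} (hu : Arg TA X X1 u U)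
    (hv : Arg TB Y Y1 v V) {e} :
    TTg TA TB false ⟨X, u, U⟩ ⟨Y, v, V⟩ e ↔ e = tenT TA TB X1 Y1 u v := by
  have : Nonempty (SortE A) := ⟨U⟩
  have : Nonempty (SortE B) := ⟨V⟩
  obtain ⟨p, gu⟩ := hu.ga
  obtain ⟨q, gv⟩ := hv.ga
  rw [TTg_iff pA pB hu.ctx hv.ctx gu gv le_rfl, tenT_eq pA pB hu hv gu gv le_rfl]

theorem tenT_scope {u U v V} (hu : Arg TA X X1 u U)
    (hv : Arg TB Y Y1 v V) {z} (hz : Occurs z (tenT TA TB X1 Y1 u v)) :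
    ((∃ W, (z.1, W) ∈ X) ∨ u = .var z.1) ∧ ((∃ W, (z.2, W) ∈ Y) ∨ v = .var z.2) := by
  have : Nonempty (SortE A) := ⟨U⟩
  have : Nonempty (SortE B) := ⟨V⟩
  obtain ⟨p, gu⟩ := hu.ga
  obtain ⟨q, gv⟩ := hv.ga
  rw [← tenT_eq pA pB hu hv gu gv le_rfl] at hz
  exact F_scope pA pB hu.ctx hv.ctx gu gv _ le_rfl z hz

omit pA pB

theorem TTg_right_var {u U U' y V e} (h : TTg TA TB false ⟨X, u, U⟩ ⟨Y, .var y, V⟩ e) :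
    TTg TA TB false ⟨X, u, U'⟩ ⟨Y, .var y, V⟩ e := by
  cases h with
  | varvar => exact .varvar
  | appvar SS TSf hSS hTS M out hM hMy hout => exact .appvar SS TSf hSS hTS M out hM hMy hout

theorem TTg_left_var {x U v V V' e} (h : TTg TA TB false ⟨X, .var x, U⟩ ⟨Y, v, V⟩ e) :
    TTg TA TB false ⟨X, .var x, U⟩ ⟨Y, v, V'⟩ e := by
  cases h with
  | varvar => exact .varvar
  | varapp SS TSf hSS hTS M out hM hMy hout => exact .varapp SS TSf hSS hTS M out hM hMy hout

include pA pB

theorem tenT_L {u U t ts} (hu : WT TA X u) (cu : CanonSort TA X u U)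
    (hv : WT TB Y (.app t ts)) :
    tenT TA TB X Y u (.app t ts) =
      .app (Sum.inl (U.head, t)) (lex (tenT TA TB X Y) (U.args ++ [u]) ts) := by
  obtain ⟨V0, hV⟩ := hv
  have : Nonempty (SortE A) := ⟨U⟩
  have : Nonempty (SortE B) := ⟨V0⟩
  have hX := hu.choose_spec.term_ctx
  have hY := hV.term_ctx
  have au := Arg.of_term pA hu cu hX (List.Subset.refl _)
  have av := WT.can_arg pB ⟨_, hV⟩ hY (List.Subset.refl _)
  obtain ⟨p, gu⟩ := au.ga
  obtain ⟨q, gv⟩ := av.ga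
  obtain ⟨q, rfl⟩ := gv.pos
  rw [← tenT_eq pA pB au av gu gv (Nat.le_refl (p + q + 1)), F_L]
  have e : U.args ++ [u] = (U.args.map (fun a => (a, can TA X a)) ++ [(u, U)]).map Prod.fst := by
    simp [Function.comp_def]
  rw [e, lex_mapL]
  congr 1
  refine lex_congr fun a ha b hb => ?_
  have hb' := gv.app_args hb
  have hb1 : WT TB Y b := let ⟨X0, hs, V, h⟩ := hb'; ⟨V, h.der.wk_term hs hY⟩
  have hb2 := hb1.can_arg pB hY (List.Subset.refl _)
  rcases mem_append.1 ha with ha | ha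
  · obtain ⟨a, ha', rfl⟩ := mem_map.1 ha
    exact tenT_eq pA pB ((au.args_wt ha').can_arg pA hX (List.Subset.refl _)) hb2
      ((gu.args ha').ga pA hX) (hb'.ga pB hY) le_rfl
  · obtain rfl : a = (u, U) := by simpa using ha
    exact tenT_eq pA pB au hb2 gu (hb'.ga pB hY) le_rfl

theorem tenT_R {s ss y V} (hu : WT TA X (.app s ss))
    (hv : WT TB Y (.var y)) (cv : CanonSort TB Y (.var y) V) :
    tenT TA TB X Y (.app s ss) (.var y) =
      .app (Sum.inr (s, V.head)) (lex (tenT TA TB X Y) ss (V.args ++ [.var y])) := by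
  obtain ⟨U0, hU⟩ := hu
  have : Nonempty (SortE A) := ⟨U0⟩
  have : Nonempty (SortE B) := ⟨V⟩
  have hY := hv.choose_spec.term_ctx
  have hX := hU.term_ctx
  have au := WT.can_arg pA ⟨_, hU⟩ hX (List.Subset.refl _)
  have av := Arg.of_term pB hv cv hY (List.Subset.refl _)
  obtain ⟨p, gu⟩ := au.ga
  obtain ⟨q, gv⟩ := av.ga
  obtain ⟨p, rfl⟩ := gu.pos
  rw [← tenT_eq pA pB au av gu gv (show p + 1 + q ≤ p + q + 1 by omega), F_R]
  have e : V.args ++ [Expr.var y] =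
      (V.args.map (fun a => (a, can TB Y a)) ++ [(Expr.var y, V)]).map Prod.fst := by
    simp [Function.comp_def]
  rw [e, lex_mapR]
  congr 1
  refine lex_congr fun a ha b hb => ?_
  have ha' := gu.app_args ha
  have ha1 : WT TA X a := let ⟨X0, hs, V, h⟩ := ha'; ⟨V, h.der.wk_term hs hX⟩
  have ha2 := ha1.can_arg pA hX (List.Subset.refl _)
  rcases mem_append.1 hb with hb | hb
  · obtain ⟨b, hb', rfl⟩ := mem_map.1 hb
    exact tenT_eq pA pB ha2 ((av.args_wt hb').can_arg pB hY (List.Subset.refl _))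
      (ha'.ga pA hX) ((gv.args hb').ga pB hY) le_rfl
  · obtain rfl : b = (.var y, V) := by simpa using hb
    exact tenT_eq pA pB ha2 av (ha'.ga pA hX) gv le_rfl

omit pA pB

end

section
variable {A B : Alphabet} {Ax TA : Set (Judg A)} {TB : Set (Judg B)} {chA : PreCtx A → A.Var}
  {chB : PreCtx B → B.Var} {X X1 : PreCtx A} {Y Y1 : PreCtx B} {U : SortE A} {V : SortE B}

variable (pA : PT TA) (pB : PT TB)

/-- The concrete tensor operation on terms, contexts and sorts. -/
noncomputable def tensorOps (TA : Set (Judg A)) (TB : Set (Judg B)) (chA : PreCtx A → A.Var)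
    (chB : PreCtx B → B.Var) : TOps A B (A.tensor B) where
  v := Prod.mk
  pa := Prod.fst
  pb := Prod.snd
  gS := Prod.mk
  gL S t := Sum.inl (S, t)
  gR s T := Sum.inr (s, T)
  fL := True
  fR := False
  grid := lex
  T := tenT TA TB
  chA := chA
  chB := chB

local notation "𝒪" => tensorOps TA TB chA chB

/-- An augmented sort `x : U` over `X`, viewed in a larger context `X1`. -/
structure SArg (TA : Set (Judg A)) (X X1 : PreCtx A) (x : A.Var) (U : SortE A) : Prop where
  sort : Der TA (.sort X U)
  mem : (x, U) ∈ X1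
  ctx1 : Der TA (.ctx X1)
  sub : X ⊆ X1
  fresh : ∀ p ∈ X, p.1 ≠ x

theorem SArg.arg {x U} (h : SArg TA X X1 x U) : Arg TA X X1 (.var x) U :=
  .var h.sort h.mem h.ctx1 h.sub

theorem Der.take (h : Der TA (.ctx X)) {i : ℕ} (hi : i < X.length) :
    SArg TA (X.take i) X X[i].1 X[i].2 := by
  have e : X.take i ++ [(X[i].1, X[i].2)] ++ X.drop (i + 1) = X := by
    refine Eq.trans ?_ (List.take_append_drop (i + 1) X)
    rw [← List.take_concat_get' X i hi]
  have h' := h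
  rw [← e] at h'
  have h' := h'.ctx_split.ctx_snoc
  exact ⟨h'.1, getElem_mem hi, h, take_subset i X, h'.2⟩

theorem Der.snoc {ch : PreCtx A → A.Var} (hch : FreshCh ch) {U} (h : Der TA (.sort X U)) :
    SArg TA X (snocCh ch X U) (ch X) U :=
  ⟨h, mem_append_right _ (List.mem_singleton_self _), h.cons (hch X),
    List.subset_append_left .., hch X⟩

include pA pB

theorem TSo_iff {x U} {y V W} (hU : SArg TA X X1 x U)
    (hV : SArg TB Y Y1 y V) :
    TSo TA TB false X x U Y y V W ↔
      W = (𝒪).W X1 Y1 U (.var x) V (.var y) := by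
  have : Nonempty (SortE A) := ⟨U⟩
  have : Nonempty (SortE B) := ⟨V⟩
  have aU : ∀ a ∈ U.args, ∀ S, CanonSort TA X a S → Arg TA X X1 a S := fun a ha S hS =>
    .of_term pA (hU.sort.sort_args ha) hS hU.ctx1 hU.sub
  have aV : ∀ a ∈ V.args, ∀ S, CanonSort TB Y a S → Arg TB Y Y1 a S := fun a ha S hS =>
    .of_term pB (hV.sort.sort_args ha) hS hV.ctx1 hV.sub
  constructor
  · rintro ⟨hx, hy, SS, TSf, hSS, hTS, M, out, hM, hMx, hMy, hout⟩
    refine congrArg _ (isGrid_dropLast _ rfl rfl ?_ ?_ ?_ hout)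
    · exact fun i j hi hj => (TTg_tenT pA pB (aU _ (getElem_mem hi) _ (hSS i hi))
        (aV _ (getElem_mem hj) _ (hTS j hj))).1 (hM i hi j hj)
    · exact fun i hi => (TTg_tenT pA pB (aU _ (getElem_mem hi) _ (hSS i hi))
        hV.arg).1 (hMy i hi)
    · exact fun j hj => (TTg_tenT pA pB hU.arg
        (aV _ (getElem_mem hj) _ (hTS j hj))).1 (hMx j hj)
  · rintro rfl
    obtain ⟨S, ss⟩ := U
    obtain ⟨T, ts⟩ := V
    have : Nonempty (Expr (A.tensor B)) := ⟨.var (x, y)⟩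
    obtain ⟨M, hM⟩ := exists_fn₂ (tenT TA TB X1 Y1) (ss ++ [.var x]) (ts ++ [.var y])
    obtain ⟨SS, hSS⟩ := exists_fn (can TA X) ss
    obtain ⟨TS, hTS⟩ := exists_fn (can TB Y) ts
    have cS : ∀ i (hi : i < ss.length), CanonSort TA X ss[i] (SS i) := fun i hi => by
      obtain ⟨_, h⟩ := hU.sort.sort_args (getElem_mem hi)
      obtain ⟨C, hC, _⟩ := h.canon pA
      rwa [hSS i hi, can_eq pA h.term_ctx hC]
    have cT : ∀ i (hi : i < ts.length), CanonSort TB Y ts[i] (TS i) := fun i hi => by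
      obtain ⟨_, h⟩ := hV.sort.sort_args (getElem_mem hi)
      obtain ⟨C, hC, _⟩ := h.canon pB
      rwa [hTS i hi, can_eq pB h.term_ctx hC]
    refine .mk hU.fresh hV.fresh SS TS cS cT M _ ?_ ?_ ?_
      ((isGrid_lex _ (by simp) (by simp) fun i j hi hj => hM i hi j hj).2 rfl)
    · intro i hi j hj
      refine (TTg_tenT pA pB (aU _ (getElem_mem hi) _ (cS i hi))
        (aV _ (getElem_mem hj) _ (cT j hj))).2 ?_
      rw [hM i (by simp; omega) j (by simp; omega), getElem_append_left hi,
        getElem_append_left hj]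
    · intro j hj
      refine (TTg_tenT pA pB hU.arg (aV _ (getElem_mem hj) _ (cT j hj))).2 ?_
      rw [hM ss.length (by simp) j (by simp; omega), getElem_append_left hj]
      simp
    · intro i hi
      refine (TTg_tenT pA pB (aU _ (getElem_mem hi) _ (cS i hi)) hV.arg).2 ?_
      rw [hM i (by simp; omega) ts.length (by simp), getElem_append_left hi]
      simp

theorem TCtx_iff (hX : Der TA (.ctx X)) (hY : Der TB (.ctx Y)) {Z} :
    TCtx TA TB false X Y Z ↔ Z = (𝒪).ten X Y := by
  have key : ∀ (M : ℕ → ℕ → (A.tensor B).Var × SortE (A.tensor B)),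
      (∀ i (hi : i < X.length) j (hj : j < Y.length), M i j =
        ((X[i].1, Y[j].1), (𝒪).W X Y X[i].2 (.var X[i].1) Y[j].2
          (.var Y[j].1))) →
      (TCtx TA TB false X Y Z ↔ IsGrid X.length Y.length M Z) := by
    intro M hM
    refine and_congr Iff.rfl ⟨fun h i j hi hj hz => ?_, fun h i j hi hj hz => ?_⟩
    · rw [hM i hi j hj]
      exact Prod.ext (h i j hi hj hz).1 ((TSo_iff pA pB (hX.take hi) (hY.take hj)).1
        (h i j hi hj hz).2)
    · have := h i j hi hj hz
      rw [hM i hi j hj] at this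
      rw [this]
      exact ⟨rfl, (TSo_iff pA pB (hX.take hi) (hY.take hj)).2 rfl⟩
  rcases Nat.eq_zero_or_pos X.length with h0 | h0
  · obtain rfl := List.length_eq_zero_iff.1 h0
    simp only [TCtx, TOps.ten, tensorOps, lex]
    simp
  rcases Nat.eq_zero_or_pos Y.length with h1 | h1
  · obtain rfl := List.length_eq_zero_iff.1 h1
    simp only [TCtx, TOps.ten, tensorOps, lex]
    simp [show List.flatMap (fun _ => []) X = ([] : List ((A.tensor B).Var × SortE (A.tensor B)))
      from List.flatMap_eq_nil_iff.2 fun _ _ => rfl]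
  have : Nonempty ((A.tensor B).Var × SortE (A.tensor B)) :=
    ⟨(X[0].1, Y[0].1), (𝒪).W X Y X[0].2 (.var X[0].1) Y[0].2 (.var Y[0].1)⟩
  obtain ⟨M, hM⟩ := exists_fn₂ (fun (p : A.Var × SortE A) (q : B.Var × SortE B) =>
    (((p.1, q.1), (𝒪).W X Y p.2 (.var p.1) q.2 (.var q.1)) :
      (A.tensor B).Var × SortE (A.tensor B))) X Y
  rw [key M hM]
  exact isGrid_lex _ rfl rfl fun i j hi hj => hM i hi j hj

theorem W_subst_eq {x U} {y V} (hU : SArg TA X X1 x U)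
    (hV : SArg TB Y Y1 y V) {σ τ : A.Var × B.Var → Expr (A.tensor B)}
    (h : ∀ p ∈ X, ∀ q ∈ Y, σ (p.1, q.1) = τ (p.1, q.1)) (hl : ∀ p ∈ X, σ (p.1, y) = τ (p.1, y))
    (hr : ∀ q ∈ Y, σ (x, q.1) = τ (x, q.1)) :
    ((𝒪).W X1 Y1 U (.var x) V (.var y)).subst (A := A.tensor B) σ =
      ((𝒪).W X1 Y1 U (.var x) V (.var y)).subst (A := A.tensor B) τ := by
  have : Nonempty (SortE A) := ⟨U⟩
  have : Nonempty (SortE B) := ⟨V⟩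
  have aU : ∀ a ∈ U.args, Arg TA X X1 a (can TA X a) := fun a ha =>
    (hU.sort.sort_args ha).can_arg pA hU.ctx1 hU.sub
  have aV : ∀ a ∈ V.args, Arg TB Y Y1 a (can TB Y a) := fun a ha =>
    (hV.sort.sort_args ha).can_arg pB hV.ctx1 hV.sub
  have vU : ∀ a ∈ U.args, ∀ z, ((∃ W, (z, W) ∈ X) ∨ a = .var z) → ∃ W, (z, W) ∈ X := by
    rintro a ha z (h | rfl)
    · exact h
    · exact (hU.sort.sort_args ha).var_mem
  have vV : ∀ a ∈ V.args, ∀ z, ((∃ W, (z, W) ∈ Y) ∨ a = .var z) → ∃ W, (z, W) ∈ Y := by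
    rintro a ha z (h | rfl)
    · exact h
    · exact (hV.sort.sort_args ha).var_mem
  refine SortE.subst_congr _ ?_
  rintro ⟨z1, z2⟩ ⟨e, he, hz⟩
  rcases (mem_dropLast_lex _ _ _ _ _ _).1 he with ⟨a, ha, b, hb, rfl⟩ | ⟨a, ha, b, hb, rfl⟩
  · rcases mem_append.1 hb with hb | hb
    · have := tenT_scope pA pB (aU a ha) (aV b hb) hz
      obtain ⟨S, hS⟩ := vU a ha _ this.1
      obtain ⟨T, hT⟩ := vV b hb _ this.2
      exact h _ hS _ hT
    · obtain rfl := mem_singleton.1 hb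
      have := tenT_scope pA pB (aU a ha) hV.arg hz
      obtain ⟨S, hS⟩ := vU a ha _ this.1
      rcases this.2 with ⟨T, hT⟩ | e
      · exact h _ hS _ hT
      · injection e with e
        subst e
        exact hl _ hS
  · rcases mem_append.1 ha with ha | ha
    · have := tenT_scope pA pB (aU a ha) (aV b hb) hz
      obtain ⟨S, hS⟩ := vU a ha _ this.1
      obtain ⟨T, hT⟩ := vV b hb _ this.2
      exact h _ hS _ hT
    · obtain rfl := mem_singleton.1 ha
      have := tenT_scope pA pB hU.arg (aV b hb) hz
      obtain ⟨S, hS⟩ := vV b hb _ this.2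
      rcases this.1 with ⟨T, hT⟩ | e
      · exact h _ hT _ hS
      · injection e with e
        subst e
        exact hr _ hS

omit pA pB

theorem lookup_L {y : B.Var} {F : Expr A → Expr (A.tensor B)} {g : ℕ → Expr (A.tensor B)}
    (hX : (X.map Prod.fst).Nodup) (hg : ∀ i (hi : i < X.length), g i = F (.var (X[i]'hi).1)) {p}
    (hp : p ∈ X) :
    lookupV (pairsL X y g) (p.1, y) = F (.var p.1) := by
  obtain ⟨i, hi, rfl⟩ := mem_iff_getElem.1 hp
  rw [lookup_pairsL hX hi, hg i hi]

theorem lookup_R {x : A.Var} {F : Expr B → Expr (A.tensor B)} {g : ℕ → Expr (A.tensor B)}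
    (hY : (Y.map Prod.fst).Nodup) (hg : ∀ i (hi : i < Y.length), g i = F (.var (Y[i]'hi).1)) {p}
    (hp : p ∈ Y) :
    lookupV (pairsR x Y g) (x, p.1) = F (.var p.1) := by
  obtain ⟨i, hi, rfl⟩ := mem_iff_getElem.1 hp
  rw [lookup_pairsR hY hi, hg i hi]

include pA pB

theorem substL_L {X2 : PreCtx A} {x U} {Y2 : PreCtx B} {y V}
    (hU : SArg TA X X1 x U) (hV : SArg TB Y Y1 y V) {v} {g : ℕ → Expr (A.tensor B)}
    (hg : ∀ i (hi : i < X.length), g i = tenT TA TB X2 Y2 (.var (X[i]'hi).1) v) :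
    ((𝒪).W X1 Y1 U (.var x) V (.var y)).substL (pairsL X y g) =
      ((𝒪).W X1 Y1 U (.var x) V (.var y)).subst
        ((𝒪).TS X2 Y2 .var (upd .var y v)) := by
  have e : ∀ q ∈ Y, ∀ a, lookupV (pairsL X y g) (a, q.1) =
      (𝒪).TS X2 Y2 .var (upd .var y v) (a, q.1) := fun q hq a =>
    (lookup_pairsL_ne (hV.fresh q hq)).trans
      ((congrArg _ (upd_ne _ _ (hV.fresh q hq))).trans (tenT_vv ..)).symm
  exact W_subst_eq pA pB hU hV (fun p hp q hq => e q hq _) (fun p hp =>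
    (lookup_L (F := fun a => tenT TA TB X2 Y2 a v) (hU.sort.sort_ctx.ctxOK pA).2 hg hp).trans
      (congrArg _ (upd_self _ _ _)).symm) fun q hq => e q hq _

theorem substL_R {X2 : PreCtx A} {x U} {Y2 : PreCtx B} {y V}
    (hU : SArg TA X X1 x U) (hV : SArg TB Y Y1 y V) {u} {g : ℕ → Expr (A.tensor B)}
    (hg : ∀ i (hi : i < Y.length), g i = tenT TA TB X2 Y2 u (.var (Y[i]'hi).1)) :
    ((𝒪).W X1 Y1 U (.var x) V (.var y)).substL (pairsR x Y g) =
      ((𝒪).W X1 Y1 U (.var x) V (.var y)).subst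
        ((𝒪).TS X2 Y2 (upd .var x u) .var) := by
  have e : ∀ p ∈ X, ∀ b, lookupV (pairsR x Y g) (p.1, b) =
      (𝒪).TS X2 Y2 (upd .var x u) .var (p.1, b) := fun p hp b =>
    (lookup_pairsR_ne (hU.fresh p hp)).trans
      ((congrArg (fun w => tenT TA TB X2 Y2 w (.var b)) (upd_ne _ _ (hU.fresh p hp))).trans
        (tenT_vv ..)).symm
  exact W_subst_eq pA pB hU hV (fun p hp q hq => e p hp _) (fun p hp => e p hp _) fun q hq =>
    (lookup_R (F := tenT TA TB X2 Y2 u) (hV.sort.sort_ctx.ctxOK pB).2 hg hq).trans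
      (congrArg (fun w => tenT TA TB X2 Y2 w (.var q.1)) (upd_self _ _ _)).symm

theorem substL_LR {x U} {y V} (hU : SArg TA X X1 x U)
    (hV : SArg TB Y Y1 y V) {u v} {g g' : ℕ → Expr (A.tensor B)}
    (hg : ∀ i (hi : i < X.length), g i = tenT TA TB X Y (.var (X[i]'hi).1) v)
    (hg' : ∀ i (hi : i < Y.length), g' i = tenT TA TB X Y u (.var (Y[i]'hi).1)) :
    ((𝒪).W X1 Y1 U (.var x) V (.var y)).substL
        (pairsL X y g ++ pairsR x Y g') =
      ((𝒪).W X1 Y1 U (.var x) V (.var y)).subst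
        ((𝒪).TS X Y (upd .var x u) (upd .var y v)) := by
  refine W_subst_eq pA pB hU hV (fun p hp q hq => ?_) (fun p hp => ?_) (fun q hq => ?_)
  · exact (lookup_pairs_right (hV.fresh q hq)).trans ((lookup_pairsR_ne (hU.fresh p hp)).trans
      ((congrArg₂ (tenT TA TB X Y) (upd_ne _ _ (hU.fresh p hp))
        (upd_ne _ _ (hV.fresh q hq))).trans (tenT_vv ..)).symm)
  · have e : lookupV (pairsL X y g ++ pairsR x Y g') (p.1, y) =
        lookupV (pairsL X y g) ((p.1, y) : A.Var × B.Var) := by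
      obtain ⟨i, hi, rfl⟩ := mem_iff_getElem.1 hp
      exact lookup_pairs_left hi
    exact e.trans ((lookup_L (F := fun a => tenT TA TB X Y a v)
      (hU.sort.sort_ctx.ctxOK pA).2 hg hp).trans
      (congrArg₂ (tenT TA TB X Y) (upd_ne _ _ (hU.fresh p hp)) (upd_self _ _ _)).symm)
  · exact (lookup_pairs_right (hV.fresh q hq)).trans
      ((lookup_R (F := tenT TA TB X Y u) (hV.sort.sort_ctx.ctxOK pB).2 hg' hq).trans
      (congrArg₂ (tenT TA TB X Y) (upd_self _ _ _) (upd_ne _ _ (hV.fresh q hq))).symm)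

omit pB

theorem intro_canon {s U} (hax : introTerm X s U ∈ TA)
    (h : Der TA (introTerm X s U)) : CanonSort TA X (.app s (ctxVars X)) U := by
  have := CanonSort.app_map (X := X) pA hax h.term_sort .var
  rwa [SortE.subst_id] at this

theorem intro_arg {s U} (hax : introTerm X s U ∈ TA) (h : Der TA (introTerm X s U)) :
    Arg TA X X (.app s (ctxVars X)) U :=
  .of_term pA ⟨_, h⟩ (intro_canon pA hax h) h.term_ctx (List.Subset.refl _)

include pB

theorem TTg_var_right {u U y V e} (h : Der TA (.term X u U))
    (hv : Arg TB Y Y1 (.var y) V) :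
    TTg TA TB false ⟨X, u, U⟩ ⟨Y, .var y, V⟩ e ↔ e = tenT TA TB X Y1 u (.var y) := by
  obtain ⟨C, hC, _⟩ := h.canon pA
  rw [← TTg_tenT pA pB (.of_term pA ⟨_, h⟩ hC h.term_ctx (List.Subset.refl _)) hv]
  exact ⟨TTg_right_var, TTg_right_var⟩

theorem TTg_var_left {x U v V e} (hu : Arg TA X X1 (.var x) U)
    (h : Der TB (.term Y v V)) :
    TTg TA TB false ⟨X, .var x, U⟩ ⟨Y, v, V⟩ e ↔ e = tenT TA TB X1 Y (.var x) v := by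
  obtain ⟨C, hC, _⟩ := h.canon pB
  rw [← TTg_tenT pA pB hu (.of_term pB ⟨_, h⟩ hC h.term_ctx (List.Subset.refl _))]
  exact ⟨TTg_left_var, TTg_left_var⟩

omit pA pB

theorem Der.take_arg (hX : Der TA (.ctx X)) (hX1 : Der TA (.ctx X1)) (hs : X ⊆ X1) {i : ℕ}
    (hi : i < X.length) :
    Arg TA (X.take i) X1 (.var X[i].1) X[i].2 :=
  have a := hX.take hi
  .var a.sort (hs a.mem) hX1 (List.Subset.trans a.sub hs)

theorem exists_L (z : A.Var × B.Var) (pA : PT TA) (pB : PT TB) (hX : Der TA (.ctx X))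
    (hX1 : Der TA (.ctx X1)) (hs : X ⊆ X1) {v V} (hv : Der TB (.term Y v V)) :
    ∃ g : ℕ → Expr (A.tensor B), (∀ i (hi : i < X.length),
      TTg TA TB false ⟨X.take i, .var (X[i]'hi).1, (X[i]'hi).2⟩ ⟨Y, v, V⟩ (g i)) ∧
      ∀ i (hi : i < X.length), g i = tenT TA TB X1 Y (.var (X[i]'hi).1) v :=
  have : Nonempty (Expr (A.tensor B)) := ⟨.var z⟩
  have ⟨g, hg⟩ := exists_fn (fun p : A.Var × SortE A => tenT TA TB X1 Y (.var p.1) v) X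
  ⟨g, fun i hi => (TTg_var_left pA pB (hX.take_arg hX1 hs hi) hv).2 (hg i hi), hg⟩

theorem exists_R (z : A.Var × B.Var) (pA : PT TA) (pB : PT TB) (hY : Der TB (.ctx Y))
    (hY1 : Der TB (.ctx Y1)) (hs : Y ⊆ Y1) {u U} (hu : Der TA (.term X u U)) :
    ∃ g : ℕ → Expr (A.tensor B), (∀ i (hi : i < Y.length),
      TTg TA TB false ⟨X, u, U⟩ ⟨Y.take i, .var (Y[i]'hi).1, (Y[i]'hi).2⟩ (g i)) ∧
      ∀ i (hi : i < Y.length), g i = tenT TA TB X Y1 u (.var (Y[i]'hi).1) :=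
  have : Nonempty (Expr (A.tensor B)) := ⟨.var z⟩
  have ⟨g, hg⟩ := exists_fn (fun p : B.Var × SortE B => tenT TA TB X Y1 u (.var p.1)) Y
  ⟨g, fun i hi => (TTg_var_right pA pB hu (hY.take_arg hY1 hs hi)).2 (hg i hi), hg⟩

local notation "𝒲" U:max V:max => TOps.W (𝒪) (snocCh chA X U) (snocCh chB Y V) U (Expr.var (chA X)) V (Expr.var (chB Y))

section rules

variable (pA : PT TA) (pB : PT TB) (fA : FreshCh chA) (fB : FreshCh chB)

include pA pB fA fB

theorem TJudg_ss {U} {V} (hU : Der TA (.sort X U)) (hV : Der TB (.sort Y V)) {K} :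
    TJudg TA TB chA chB false (.sort X U) (.sort Y V) K ↔
      K = .sort ((𝒪).par (snocCh chA X U) (snocCh chB Y V)) ((𝒪).W (snocCh chA X U)
        (snocCh chB Y V) U (.var (chA X)) V (.var (chB Y))) := by
  have sU := hU.snoc fA
  have sV := hV.snoc fB
  have hC := fun Z => TCtx_iff (chA := chA) (chB := chB) pA pB sU.ctx1 sV.ctx1 (Z := Z)
  have hW := fun W => TSo_iff (chA := chA) (chB := chB) pA pB sU sV (W := W)
  constructor
  · rintro ⟨h1, h2⟩
    rw [← (hW _).1 ‹_›, TOps.par, ← (hC _).1 ‹_›]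
  · rintro rfl
    exact .ss ((hC _).2 rfl) ((hW _).2 rfl)

theorem TJudg_st {U} {v V} (hU : Der TA (.sort X U)) (hv : Der TB (.term Y v V)) {K} :
    TJudg TA TB chA chB false (.sort X U) (.term Y v V) K ↔
      K = .term ((𝒪).ten (snocCh chA X U) Y) (tenT TA TB (snocCh chA X U) Y (.var (chA X)) v)
        ((𝒲 U V).subst
          ((𝒪).TS (snocCh chA X U) Y .var (upd .var (chB Y) v))) := by
  have sU := hU.snoc fA
  have sV := hv.term_sort.snoc fB
  have hC := fun Z => TCtx_iff (chA := chA) (chB := chB) pA pB sU.ctx1 hv.term_ctx (Z := Z)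
  have hW := fun W => TSo_iff (chA := chA) (chB := chB) pA pB sU sV (W := W)
  constructor
  · intro h
    cases h with | st hZ he hW' hg =>
    rw [← (hC _).1 hZ, ← (TTg_var_left pA pB sU.arg hv).1 he, ← substL_L pA pB sU sV fun i hi =>
      (TTg_var_left pA pB (hU.sort_ctx.take_arg sU.ctx1 sU.sub hi) hv).1 (hg i hi),
      ← (hW _).1 hW']
  · rintro rfl
    obtain ⟨g, hg, hg'⟩ := exists_L (chA X, chB Y) pA pB hU.sort_ctx sU.ctx1 sU.sub hv
    rw [← substL_L pA pB sU sV hg']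
    exact .st ((hC _).2 rfl) ((TTg_var_left pA pB sU.arg hv).2 rfl) ((hW _).2 rfl) hg

theorem TJudg_ts {u U} {V} (hu : Der TA (.term X u U)) (hV : Der TB (.sort Y V)) {K} :
    TJudg TA TB chA chB false (.term X u U) (.sort Y V) K ↔
      K = .term ((𝒪).ten X (snocCh chB Y V)) (tenT TA TB X (snocCh chB Y V) u (.var (chB Y)))
        ((𝒲 U V).subst
          ((𝒪).TS X (snocCh chB Y V) (upd .var (chA X) u) .var)) := by
  have sU := hu.term_sort.snoc fA
  have sV := hV.snoc fB
  have hC := fun Z => TCtx_iff (chA := chA) (chB := chB) pA pB hu.term_ctx sV.ctx1 (Z := Z)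
  have hW := fun W => TSo_iff (chA := chA) (chB := chB) pA pB sU sV (W := W)
  constructor
  · intro h
    cases h with | ts hZ he hW' hg =>
    rw [← (hC _).1 hZ, ← (TTg_var_right pA pB hu sV.arg).1 he, ← substL_R pA pB sU sV fun i hi =>
      (TTg_var_right pA pB hu (hV.sort_ctx.take_arg sV.ctx1 sV.sub hi)).1 (hg i hi),
      ← (hW _).1 hW']
  · rintro rfl
    obtain ⟨g, hg, hg'⟩ := exists_R (chA X, chB Y) pA pB hV.sort_ctx sV.ctx1 sV.sub hu
    rw [← substL_R pA pB sU sV hg']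
    exact .ts ((hC _).2 rfl) ((TTg_var_right pA pB hu sV.arg).2 rfl) ((hW _).2 rfl) hg

theorem TJudg_seqs {U U'} {V} (hU : Der TA (.sort X U)) (hU' : Der TA (.sort X U'))
    (hV : Der TB (.sort Y V)) :
    TJudg TA TB chA chB false (.sortEq X U U') (.sort Y V)
      (.sortEq ((𝒪).par (snocCh chA X U) (snocCh chB Y V))
        (𝒲 U V)
        ((𝒪).W (snocCh chA X U') (snocCh chB Y V) U' (.var (chA X)) V (.var (chB Y)))) :=
  .seqs ((TCtx_iff pA pB (hU.snoc fA).ctx1 (hV.snoc fB).ctx1).2 rfl)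
    ((TSo_iff pA pB (hU.snoc fA) (hV.snoc fB)).2 rfl)
    ((TSo_iff pA pB (hU'.snoc fA) (hV.snoc fB)).2 rfl)

theorem TJudg_sseq {U} {V V'} (hU : Der TA (.sort X U)) (hV : Der TB (.sort Y V))
    (hV' : Der TB (.sort Y V')) :
    TJudg TA TB chA chB false (.sort X U) (.sortEq Y V V')
      (.sortEq ((𝒪).par (snocCh chA X U) (snocCh chB Y V))
        (𝒲 U V)
        (𝒲 U V')) :=
  .sseq ((TCtx_iff pA pB (hU.snoc fA).ctx1 (hV.snoc fB).ctx1).2 rfl)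
    ((TSo_iff pA pB (hU.snoc fA) (hV.snoc fB)).2 rfl)
    ((TSo_iff pA pB (hU.snoc fA) (hV'.snoc fB)).2 rfl)

theorem TJudg_seqt {U U'} {v V} (hU : Der TA (.sort X U)) (hU' : Der TA (.sort X U'))
    (hv : Der TB (.term Y v V)) :
    TJudg TA TB chA chB false (.sortEq X U U') (.term Y v V)
      (.termEq ((𝒪).ten (snocCh chA X U) Y) (tenT TA TB (snocCh chA X U) Y (.var (chA X)) v)
        (tenT TA TB (snocCh chA X U') Y (.var (chA X)) v)
        ((𝒲 U V).subst
          ((𝒪).TS (snocCh chA X U) Y .var (upd .var (chB Y) v)))) := by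
  have sU := hU.snoc fA
  have sV := hv.term_sort.snoc fB
  obtain ⟨g, hg, hg'⟩ := exists_L (chA X, chB Y) pA pB hU.sort_ctx sU.ctx1 sU.sub hv
  rw [← substL_L pA pB sU sV hg']
  exact .seqt ((TCtx_iff pA pB sU.ctx1 hv.term_ctx).2 rfl) ((TTg_var_left pA pB sU.arg hv).2 rfl)
    ((TTg_var_left pA pB (hU'.snoc fA).arg hv).2 rfl) ((TSo_iff pA pB sU sV).2 rfl) hg

theorem TJudg_tseq {u U} {V V'} (hu : Der TA (.term X u U)) (hV : Der TB (.sort Y V))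
    (hV' : Der TB (.sort Y V')) :
    TJudg TA TB chA chB false (.term X u U) (.sortEq Y V V')
      (.termEq ((𝒪).ten X (snocCh chB Y V)) (tenT TA TB X (snocCh chB Y V) u (.var (chB Y)))
        (tenT TA TB X (snocCh chB Y V') u (.var (chB Y)))
        ((𝒲 U V).subst
          ((𝒪).TS X (snocCh chB Y V) (upd .var (chA X) u) .var))) := by
  have sU := hu.term_sort.snoc fA
  have sV := hV.snoc fB
  obtain ⟨g, hg, hg'⟩ := exists_R (chA X, chB Y) pA pB hV.sort_ctx sV.ctx1 sV.sub hu
  rw [← substL_R pA pB sU sV hg']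
  exact .tseq ((TCtx_iff pA pB hu.term_ctx sV.ctx1).2 rfl) ((TTg_var_right pA pB hu sV.arg).2 rfl)
    ((TTg_var_right pA pB hu (hV'.snoc fB).arg).2 rfl) ((TSo_iff pA pB sU sV).2 rfl) hg

theorem TJudg_steq {U} {v v' V} (hU : Der TA (.sort X U)) (hv : Der TB (.term Y v V))
    (hv' : Der TB (.term Y v' V)) :
    TJudg TA TB chA chB false (.sort X U) (.termEq Y v v' V)
      (.termEq ((𝒪).ten (snocCh chA X U) Y) (tenT TA TB (snocCh chA X U) Y (.var (chA X)) v)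
        (tenT TA TB (snocCh chA X U) Y (.var (chA X)) v')
        ((𝒲 U V).subst
          ((𝒪).TS (snocCh chA X U) Y .var (upd .var (chB Y) v)))) := by
  have sU := hU.snoc fA
  have sV := hv.term_sort.snoc fB
  obtain ⟨g, hg, hg'⟩ := exists_L (chA X, chB Y) pA pB hU.sort_ctx sU.ctx1 sU.sub hv
  rw [← substL_L pA pB sU sV hg']
  exact .steq ((TCtx_iff pA pB sU.ctx1 hv.term_ctx).2 rfl) ((TTg_var_left pA pB sU.arg hv).2 rfl)
    ((TTg_var_left pA pB sU.arg hv').2 rfl) ((TSo_iff pA pB sU sV).2 rfl) hg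

theorem TJudg_teqs {u u' U} {V} (hu : Der TA (.term X u U)) (hu' : Der TA (.term X u' U))
    (hV : Der TB (.sort Y V)) :
    TJudg TA TB chA chB false (.termEq X u u' U) (.sort Y V)
      (.termEq ((𝒪).ten X (snocCh chB Y V)) (tenT TA TB X (snocCh chB Y V) u (.var (chB Y)))
        (tenT TA TB X (snocCh chB Y V) u' (.var (chB Y)))
        ((𝒲 U V).subst
          ((𝒪).TS X (snocCh chB Y V) (upd .var (chA X) u) .var))) := by
  have sU := hu.term_sort.snoc fA
  have sV := hV.snoc fB
  obtain ⟨g, hg, hg'⟩ := exists_R (chA X, chB Y) pA pB hV.sort_ctx sV.ctx1 sV.sub hu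
  rw [← substL_R pA pB sU sV hg']
  exact .teqs ((TCtx_iff pA pB hu.term_ctx sV.ctx1).2 rfl) ((TTg_var_right pA pB hu sV.arg).2 rfl)
    ((TTg_var_right pA pB hu' sV.arg).2 rfl) ((TSo_iff pA pB sU sV).2 rfl) hg

end rules

theorem ctxVars_snocCh (X : PreCtx A) (U) :
    ctxVars X ++ [.var (chA X)] = ctxVars (snocCh chA X U) := by
  simp [ctxVars, snocCh]

theorem ctxVars_ten (X : PreCtx A) (Y : PreCtx B) :
    lex (tenT TA TB X1 Y1) (ctxVars X) (ctxVars Y) = ctxVars ((𝒪).ten X Y) := by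
  have e : ctxVars ((𝒪).ten X Y) = _ := lex_map _ _ _ _
  rw [e, ctxVars, ctxVars, lex_mapL, lex_mapR]
  exact lex_congr fun a _ b _ => tenT_vv ..

theorem W_vars (X : PreCtx A) (Y : PreCtx B) (S T) :
    (𝒪).W X1 Y1 ⟨S, ctxVars X⟩ (.var (chA X)) ⟨T, ctxVars Y⟩ (.var (chB Y)) =
      ⟨(S, T), ctxVars ((𝒪).par (snocCh chA X ⟨S, ctxVars X⟩) (snocCh chB Y ⟨T, ctxVars Y⟩))⟩ := by
  unfold TOps.W TOps.par
  have e : ∀ Z : PreCtx (A.tensor B), ctxVars Z.dropLast = (ctxVars Z).dropLast :=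
    fun Z => List.map_dropLast
  rw [e, ← ctxVars_ten (X1 := X1) (Y1 := Y1), ← ctxVars_snocCh, ← ctxVars_snocCh]
  rfl

include pA

theorem Der.snoc_wt (fA : FreshCh chA) {U} (h : Der TA (.sort X U)) :
    WT TA (snocCh chA X U) (.var (chA X)) ∧ CanonSort TA (snocCh chA X U) (.var (chA X)) U :=
  ⟨⟨_, (h.snoc fA).ctx1.vars (h.snoc fA).mem⟩, canonSort_var.2 (h.snoc fA).mem⟩

include pB

theorem T_varsL (fA : FreshCh chA) {S} {t V}
    (hU : Der TA (introSort X S)) (hv : Der TB (introTerm Y t V)) :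
    tenT TA TB (snocCh chA X ⟨S, ctxVars X⟩) Y (.var (chA X)) (.app t (ctxVars Y)) =
      .app (Sum.inl (S, t)) (ctxVars ((𝒪).ten (snocCh chA X ⟨S, ctxVars X⟩) Y)) := by
  have h := hU.snoc_wt pA fA
  rw [tenT_L pA pB h.1 h.2 ⟨_, hv⟩, ctxVars_snocCh X ⟨S, ctxVars X⟩, ctxVars_ten]

theorem T_varsR (fB : FreshCh chB) {s U} {T}
    (hu : Der TA (introTerm X s U)) (hV : Der TB (introSort Y T)) :
    tenT TA TB X (snocCh chB Y ⟨T, ctxVars Y⟩) (.app s (ctxVars X)) (.var (chB Y)) =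
      .app (Sum.inr (s, T)) (ctxVars ((𝒪).ten X (snocCh chB Y ⟨T, ctxVars Y⟩))) := by
  have h := hV.snoc_wt pB fB
  rw [tenT_R pA pB ⟨_, hu⟩ h.1 h.2, ctxVars_snocCh Y ⟨T, ctxVars Y⟩, ctxVars_ten]

theorem TTd_intro (fB : FreshCh chB) {s U} {t V}
    (hu : Der TA (introTerm X s U)) (hv : Der TB (introTerm Y t V)) (z : A.Var × B.Var) :
    TTd TA TB false ⟨X, .app s (ctxVars X), U⟩ ⟨Y, .app t (ctxVars Y), V⟩
      ((𝒪).op.L Y X V (.app t (ctxVars Y)) s (ctxVars X)) := by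
  have sV := hv.term_sort.snoc fB
  have hR : TTg TA TB false ⟨X, .app s (ctxVars X), U⟩ ⟨Y, .var (chB Y), V⟩ _ :=
    (TTg_var_right pA pB hu sV.arg).2 rfl
  obtain ⟨g, hg, hg'⟩ := exists_L z pA pB hu.term_ctx hu.term_ctx (List.Subset.refl _) hv
  refine (?_ : _ = (𝒪).op.L Y X V (.app t (ctxVars Y)) s (ctxVars X)) ▸
    TTd.appapp_base sV.fresh _ hR g hg
  have h := hv.term_sort.snoc_wt pB fB
  rw [tenT_R pA pB ⟨_, hu⟩ h.1 h.2]
  refine (Expr.subst_app (A := A.tensor B) ..).trans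
    (congrArg (Expr.app (A := A.tensor B) (Sum.inr (s, V.head))) ((lex_map ..).trans ?_))
  refine List.flatMap_congr fun a ha => ?_
  obtain ⟨p, hp, rfl⟩ := mem_map.1 ha
  have a1 : ∀ {i} (hi : i < X.length), Arg TA (X.take i) X (.var X[i].1) X[i].2 :=
    Der.take_arg hu.term_ctx hu.term_ctx (List.Subset.refl _)
  rw [map_append, map_append]
  refine congrArg₂ _ (map_congr_left fun b hb => ?_) (congrArg (fun e => [e]) ?_)
  · have : Nonempty (SortE B) := ⟨V⟩
    obtain ⟨i, hi, rfl⟩ := mem_iff_getElem.1 hp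
    have hb' := hv.term_sort.sort_args hb
    have ab := hb'.can_arg pB hv.term_ctx (List.Subset.refl _)
    have ab' := hb'.can_arg pB sV.ctx1 sV.sub
    have e : tenT TA TB X (snocCh chB Y V) (.var X[i].1) b = tenT TA TB X Y (.var X[i].1) b :=
      (TTg_tenT pA pB (a1 hi) ab).1 ((TTg_tenT pA pB (a1 hi) ab').2 rfl)
    beta_reduce
    rw [e]
    refine (Expr.subst_congr (A := A.tensor B) _ fun w hw => ?_).trans (Expr.subst_id _)
    refine lookup_pairsL_ne fun hy => ?_
    obtain ⟨W, hW⟩ | rfl := (tenT_scope pA pB (a1 hi) ab hw).2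
    · exact sV.fresh _ hW hy
    · obtain ⟨W, hW⟩ := hb'.var_mem
      exact sV.fresh _ hW hy
  · beta_reduce
    rw [tenT_vv]
    exact (Expr.subst_var (A := A.tensor B) ..).trans
      (lookup_L (F := fun a => tenT TA TB X Y a _) (hu.term_ctx.ctxOK pA).2 hg' hp)

theorem TJudg_tt (fA : FreshCh chA) (fB : FreshCh chB) {s U} {t V}
    (hsx : introTerm X s U ∈ TA) (htx : introTerm Y t V ∈ TB) (hu : Der TA (introTerm X s U))
    (hv : Der TB (introTerm Y t V)) :
    TJudg TA TB chA chB false (introTerm X s U) (introTerm Y t V)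
      (.termEq ((𝒪).ten X Y) ((𝒪).L X Y U (.app s (ctxVars X)) t (ctxVars Y))
        ((𝒪).op.L Y X V (.app t (ctxVars Y)) s (ctxVars X))
        ((𝒲 U V).subst
          ((𝒪).TS X Y (upd .var (chA X) (.app s (ctxVars X)))
            (upd .var (chB Y) (.app t (ctxVars Y)))))) := by
  have sU := hu.term_sort.snoc fA
  have sV := hv.term_sort.snoc fB
  obtain ⟨g, hg, h1⟩ := exists_L (chA X, chB Y) pA pB hu.term_ctx hu.term_ctx
    (List.Subset.refl _) hv
  obtain ⟨g', hg', h2⟩ := exists_R (chA X, chB Y) pA pB hv.term_ctx hv.term_ctx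
    (List.Subset.refl _) hu
  have cu := intro_canon pA hsx hu
  rw [← substL_LR pA pB sU sV h1 h2]
  exact .tt ((TCtx_iff pA pB hu.term_ctx hv.term_ctx).2 rfl)
    ((TTg_tenT pA pB (intro_arg pA hsx hu) (intro_arg pB htx hv)).2
      (tenT_L pA pB ⟨_, hu⟩ cu ⟨_, hv⟩).symm)
    (TTd_intro pA pB fB hu hv (chA X, chB Y)) ((TSo_iff pA pB sU sV).2 rfl) hg hg'

omit pA pB

section presentation

variable (pA : PT TA) (pB : PT TB) (dA : ∀ J ∈ TA, Der TA J) (dB : ∀ J ∈ TB, Der TB J)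
  (fA : FreshCh chA) (fB : FreshCh chB)

include pA pB dA dB fA fB

theorem sort_tensorAx {Z W} (h : .sort Z W ∈ tensorAx TA TB chA chB) :
    ∃ X S Y T, introSort X S ∈ TA ∧ introSort Y T ∈ TB ∧
      Z = (𝒪).par (snocCh chA X ⟨S, ctxVars X⟩) (snocCh chB Y ⟨T, ctxVars Y⟩) ∧
      W = ⟨(S, T), ctxVars Z⟩ := by
  obtain ⟨J, J', hJ, hJ', h⟩ := h
  cases J <;> cases J' <;> try (cases h; done)
  rename_i X U Y V
  obtain ⟨S, ss⟩ := U
  obtain ⟨T, ts⟩ := V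
  obtain rfl : ss = _ := pA.sort_shape _ _ hJ
  obtain rfl : ts = _ := pB.sort_shape _ _ hJ'
  rw [TJudg_ss pA pB fA fB (dA _ hJ) (dB _ hJ')] at h
  injection h with h1 h2
  rw [W_vars] at h2
  exact ⟨X, S, Y, T, hJ, hJ', h1, by rw [h2, h1]⟩

theorem term_tensorAx {Z e W} (h : .term Z e W ∈ tensorAx TA TB chA chB) :
    (∃ X S Y t V, introSort X S ∈ TA ∧ introTerm Y t V ∈ TB ∧
      Z = (𝒪).ten (snocCh chA X ⟨S, ctxVars X⟩) Y ∧ e = .app (Sum.inl (S, t)) (ctxVars Z) ∧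
      W = ((𝒪).W (snocCh chA X ⟨S, ctxVars X⟩) (snocCh chB Y V) ⟨S, ctxVars X⟩ (.var (chA X)) V
        (.var (chB Y))).subst ((𝒪).TS (snocCh chA X ⟨S, ctxVars X⟩) Y .var
          (upd .var (chB Y) (.app t (ctxVars Y))))) ∨
    (∃ X s U Y T, introTerm X s U ∈ TA ∧ introSort Y T ∈ TB ∧
      Z = (𝒪).ten X (snocCh chB Y ⟨T, ctxVars Y⟩) ∧ e = .app (Sum.inr (s, T)) (ctxVars Z) ∧
      W = ((𝒪).W (snocCh chA X U) (snocCh chB Y ⟨T, ctxVars Y⟩) U (.var (chA X)) ⟨T, ctxVars Y⟩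
        (.var (chB Y))).subst ((𝒪).TS X (snocCh chB Y ⟨T, ctxVars Y⟩)
          (upd .var (chA X) (.app s (ctxVars X))) .var)) := by
  obtain ⟨J, J', hJ, hJ', h⟩ := h
  cases J <;> cases J' <;> try (cases h; done)
  · rename_i X U Y v V
    obtain ⟨S, ss⟩ := U
    obtain rfl : ss = _ := pA.sort_shape _ _ hJ
    obtain ⟨t, rfl⟩ := pB.term_shape _ _ _ hJ'
    rw [TJudg_st pA pB fA fB (dA _ hJ) (dB _ hJ'),
      T_varsL (chB := chB) pA pB fA (dA _ hJ) (dB _ hJ')] at h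
    injection h with h1 h2 h3
    exact .inl ⟨X, S, Y, t, V, hJ, hJ', h1, by rw [h2, h1], h3⟩
  · rename_i X u U Y V
    obtain ⟨T, ts⟩ := V
    obtain rfl : ts = _ := pB.sort_shape _ _ hJ'
    obtain ⟨s, rfl⟩ := pA.term_shape _ _ _ hJ
    rw [TJudg_ts pA pB fA fB (dA _ hJ) (dB _ hJ'),
      T_varsR (chA := chA) pA pB fB (dA _ hJ) (dB _ hJ')] at h
    injection h with h1 h2 h3
    exact .inr ⟨X, s, U, Y, T, hJ, hJ', h1, by rw [h2, h1], h3⟩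

theorem tensorAx_pt : PT (tensorAx TA TB chA chB) where
  sort_shape Z W h := by
    obtain ⟨X, S, Y, T, -, -, -, rfl⟩ := sort_tensorAx pA pB dA dB fA fB h
    rfl
  term_shape Z e W h := by
    obtain ⟨X, S, Y, t, V, -, -, -, rfl, -⟩ | ⟨X, S, Y, t, V, -, -, -, rfl, -⟩ :=
      term_tensorAx pA pB dA dB fA fB h <;> exact ⟨_, rfl⟩
  sort_uniq h h' := by
    obtain ⟨X, S, Y, T, h1, h2, rfl, e⟩ := sort_tensorAx pA pB dA dB fA fB h
    obtain ⟨X', S', Y', T', h1', h2', rfl, e'⟩ := sort_tensorAx pA pB dA dB fA fB h'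
    injection e with e
    injection e' with e'
    obtain ⟨rfl, rfl⟩ := Prod.mk.inj (e.symm.trans e')
    rw [pA.sort_uniq h1 h1', pB.sort_uniq h2 h2']
  term_uniq h h' := by
    obtain ⟨X, S, Y, t, V, h1, h2, rfl, e, rfl⟩ | ⟨X, S, Y, t, V, h1, h2, rfl, e, rfl⟩ :=
      term_tensorAx pA pB dA dB fA fB h <;>
    obtain ⟨X', S', Y', t', V', h1', h2', rfl, e', rfl⟩ |
      ⟨X', S', Y', t', V', h1', h2', rfl, e', rfl⟩ := term_tensorAx pA pB dA dB fA fB h' <;>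
    injection e with e <;> injection e' with e' <;> have e := e.symm.trans e'
    · obtain ⟨rfl, rfl⟩ := Prod.mk.inj (Sum.inl.inj e)
      obtain rfl := pA.sort_uniq h1 h1'
      obtain ⟨rfl, rfl⟩ := pB.term_uniq h2 h2'
      exact ⟨rfl, rfl⟩
    · cases e
    · cases e
    · obtain ⟨rfl, rfl⟩ := Prod.mk.inj (Sum.inr.inj e)
      obtain rfl := pB.sort_uniq h2 h2'
      obtain ⟨rfl, rfl⟩ := pA.term_uniq h1 h1'
      exact ⟨rfl, rfl⟩

theorem tensorOps_TD : TD (𝒪) TA TB (tensorAx TA TB chA chB) where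
  l := {
    pt := pA
    ptC := tensorAx_pt pA pB dA dB fA fB
    fresh := fA
    pa_v := fun _ _ => rfl
    ff := .inl trivial
    T_vv := tenT_vv
    T_L := fun _ _ hu cu hv _ => tenT_L pA pB hu cu hv
    grid_map := lex_map
    grid_mapL := lex_mapL
    mem_grid := mem_lex
    mem_dropLast := mem_dropLast_lex
    grid_split := lex_split
    grid_nodup := nodup_lex
    ruleSS := fun {X S Y T} h h' hX hY hc => by
      have := (TJudg_ss pA pB fA fB (hX.sA h) (hY.sA h')).2 rfl
      rw [W_vars] at this
      have m : _ ∈ tensorAx TA TB chA chB := ⟨_, _, h, h', this⟩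
      change Der _ (.sort _ ((𝒪).W _ _ _ (.var (chA _)) _ (.var (chB _))))
      rw [W_vars]
      exact Der.sA m hc
    ruleST := fun {X S Y t V W} h h' hX hv e hW => by
      subst e
      have := (TJudg_st pA pB fA fB (hX.sA h) hv).2 rfl
      rw [T_varsL (chB := chB) pA pB fA (hX.sA h) hv] at this
      have m : _ ∈ tensorAx TA TB chA chB := ⟨_, _, h, h', this⟩
      have := Der.tA m hW
      rw [introTerm, ← T_varsL (chB := chB) pA pB fA (hX.sA h) hv] at this
      exact this
    ruleTT := fun h h' hu hv e h1 h2 => by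
      subst e
      exact Der.teqA ⟨_, _, h, h', TJudg_tt pA pB fA fB h h' hu hv⟩ h1 h2
    ruleSEs := fun h h' hU hY h1 h2 => Der.seqA
      ⟨_, _, h, h', TJudg_seqs pA pB fA fB hU.sortEq_left hU.sortEq_right (hY.sA h')⟩ h1 h2
    ruleSEt := fun h h' hU hv e h1 h2 => by
      subst e
      exact Der.teqA ⟨_, _, h, h', TJudg_seqt pA pB fA fB hU.sortEq_left hU.sortEq_right hv⟩
        h1 h2
    ruleTEs := fun h h' hu hY e h1 h2 => by
      subst e
      exact Der.teqA ⟨_, _, h, h', TJudg_teqs pA pB fA fB hu.termEq_left hu.termEq_right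
        (hY.sA h')⟩ h1 h2 }
  r := {
    pt := pB
    ptC := tensorAx_pt pA pB dA dB fA fB
    fresh := fB
    pa_v := fun _ _ => rfl
    ff := .inr trivial
    T_vv := fun _ _ _ _ => tenT_vv ..
    T_L := fun _ _ hu cu hv h => by
      obtain ⟨x, rfl⟩ := h.resolve_right id
      exact tenT_R pA pB hv hu cu
    grid_map := fun _ _ _ _ => lex_map ..
    grid_mapL := fun _ _ _ _ => lex_mapR ..
    mem_grid := fun f l1 l2 z => (mem_lex (fun a b => f b a) l2 l1 z).trans
      ⟨fun ⟨b, hb, a, ha, e⟩ => ⟨a, ha, b, hb, e⟩, fun ⟨b, hb, a, ha, e⟩ => ⟨a, ha, b, hb, e⟩⟩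
    mem_dropLast := fun f l1 a l2 b z => (mem_dropLast_lex (fun a b => f b a) l2 b l1 a z).trans
      ⟨fun h => h.symm.imp (fun ⟨b, hb, a, ha, e⟩ => ⟨a, ha, b, hb, e⟩)
        fun ⟨b, hb, a, ha, e⟩ => ⟨a, ha, b, hb, e⟩,
      fun h => h.symm.imp (fun ⟨b, hb, a, ha, e⟩ => ⟨a, ha, b, hb, e⟩)
        fun ⟨b, hb, a, ha, e⟩ => ⟨a, ha, b, hb, e⟩⟩
    grid_split := fun f l1 l2 pre z h => by
      obtain ⟨b1, b, a1, a, hb, ha, e, h1, h2⟩ := lex_split (fun a b => f b a) l2 l1 pre z h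
      exact ⟨a1, a, b1, b, ha, hb, e, fun x hx y hy => h2 y hy x hx, fun x hx y hy => h1 y hy x hx⟩
    grid_nodup := fun f l1 l2 h1 h2 h => nodup_lex (fun a b => f b a) l2 l1 h2 h1
      fun a b a' b' e => (h _ _ _ _ e).symm
    ruleSS := fun {X S Y T} h h' hX hY hc => by
      have := (TJudg_ss pA pB fA fB (hY.sA h') (hX.sA h)).2 rfl
      rw [W_vars] at this
      have m : _ ∈ tensorAx TA TB chA chB := ⟨_, _, h', h, this⟩
      change Der _ (.sort _ ((𝒪).W _ _ _ (.var (chA _)) _ (.var (chB _))))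
      rw [W_vars]
      exact Der.sA m hc
    ruleST := fun {X S Y t V W} h h' hX hv e hW => by
      subst e
      have := (TJudg_ts pA pB fA fB hv (hX.sA h)).2 rfl
      rw [T_varsR (chA := chA) pA pB fB hv (hX.sA h)] at this
      have m : _ ∈ tensorAx TA TB chA chB := ⟨_, _, h', h, this⟩
      have := Der.tA m hW
      rw [introTerm, ← T_varsR (chA := chA) pA pB fB hv (hX.sA h)] at this
      exact this
    ruleTT := fun h h' hu hv e h1 h2 => by
      subst e
      have m : _ ∈ tensorAx TA TB chA chB := ⟨_, _, h', h, TJudg_tt pA pB fA fB h' h hv hu⟩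
      exact (Der.teqA m h2 h1).t2
    ruleSEs := fun h h' hU hY h1 h2 => Der.seqA
      ⟨_, _, h', h, TJudg_sseq pA pB fA fB (hY.sA h') hU.sortEq_left hU.sortEq_right⟩ h1 h2
    ruleSEt := fun h h' hU hv e h1 h2 => by
      subst e
      exact Der.teqA ⟨_, _, h', h, TJudg_tseq pA pB fA fB hv hU.sortEq_left hU.sortEq_right⟩
        h1 h2
    ruleTEs := fun h h' hu hY e h1 h2 => by
      subst e
      exact Der.teqA ⟨_, _, h', h, TJudg_steq pA pB fA fB (hY.sA h') hu.termEq_left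
        hu.termEq_right⟩ h1 h2 }

end presentation

theorem IsMor.exists_map (hPT : PT Ax) {Y : PreCtx A} {f} (h : IsMor Ax X Y f) :
    ∃ σ : A.Var → Expr A, f = Y.map (fun p => σ p.1) ∧ Der Ax (.ctx X) ∧ Der Ax (.ctx Y) ∧
      IsSub Ax X Y σ := by
  obtain ⟨hX, hY, hl, hf⟩ := h
  rw [derivable_iff hPT] at hX hY
  have ok := hY.ctxOK hPT
  exact ⟨sb Y f, (map_sb Y ok.2 f hl).symm, hX, hY,
    forall_sb ok hl (P := fun u U => Der Ax (.term X u U)) fun i hi hif =>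
      (derivable_iff hPT).1 (hf i hi hif)⟩

theorem MorEq.exists_map (hPT : PT Ax) {Y : PreCtx A} {f g} (h : MorEq Ax X Y f g) :
    ∃ σ τ : A.Var → Expr A, f = Y.map (fun p => σ p.1) ∧ g = Y.map (fun p => τ p.1) ∧
      Der Ax (.ctx X) ∧ Der Ax (.ctx Y) ∧ IsSub Ax X Y σ ∧ IsSub Ax X Y τ ∧
      ∀ p ∈ Y, Der Ax (.termEq X (σ p.1) (τ p.1) (p.2.subst σ)) := by
  obtain ⟨hf, hg, h⟩ := h
  have lf := hf.2.2.1
  have lg := hg.2.2.1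
  have ok := ((derivable_iff hPT).1 hf.2.1).ctxOK hPT
  have hX := (derivable_iff hPT).1 hf.1
  refine ⟨sb Y f, sb Y g, (map_sb Y ok.2 f lf).symm, (map_sb Y ok.2 g lg).symm, hX,
    (derivable_iff hPT).1 hf.2.1, ?_, ?_, ?_⟩
  · exact forall_sb ok lf (P := fun u U => Der Ax (.term X u U)) fun i hi hif =>
      (derivable_iff hPT).1 (hf.2.2.2 i hi hif)
  · exact forall_sb ok lg (P := fun u U => Der Ax (.term X u U)) fun i hi hif =>
      (derivable_iff hPT).1 (hg.2.2.2 i hi hif)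
  · exact forall_sb₂ ok lf lg (P := fun u v U => Der Ax (.termEq X u v U)) fun i hi hif hig =>
      (derivable_iff hPT).1 (h i hi hif hig)

theorem IsMor.of_map (hPT : PT Ax) {Y : PreCtx A} {σ : A.Var → Expr A} (hX : Der Ax (.ctx X))
    (hY : Der Ax (.ctx Y)) (h : IsSub Ax X Y σ) :
    IsMor Ax X Y (Y.map fun p => σ p.1) := by
  refine ⟨(derivable_iff hPT).2 hX, (derivable_iff hPT).2 hY, by simp, fun i hi hif => ?_⟩
  rw [subPre_map (hY.ctxOK hPT), derivable_iff hPT, List.getElem_map]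
  exact h _ (getElem_mem _)

theorem MorEq.of_map (hPT : PT Ax) {Y : PreCtx A} {σ τ : A.Var → Expr A} (hX : Der Ax (.ctx X))
    (hY : Der Ax (.ctx Y)) (hσ : IsSub Ax X Y σ) (hτ : IsSub Ax X Y τ)
    (h : ∀ p ∈ Y, EqT Ax X (σ p.1) (τ p.1)) :
    MorEq Ax X Y (Y.map fun p => σ p.1) (Y.map fun p => τ p.1) := by
  refine ⟨.of_map hPT hX hY hσ, .of_map hPT hX hY hτ, fun i hi hif hig => ?_⟩
  rw [subPre_map (hY.ctxOK hPT), derivable_iff hPT, List.getElem_map, List.getElem_map]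
  exact (h _ (getElem_mem _)).at hPT (hσ _ (getElem_mem _))

theorem TMor.eq_lex (pA : PT TA) (pB : PT TB) {f g e} (hX : Der TA (.ctx X))
    (hY : Der TB (.ctx Y)) (h : TMor TA TB false X f Y g e) (hf : ∀ u ∈ f, WT TA X u)
    (hg : ∀ v ∈ g, WT TB Y v) :
    e = lex (tenT TA TB X Y) f g := by
  obtain ⟨hl, h⟩ := h
  refine List.ext_getElem (by rw [hl, length_lex]) fun k h1 h2 => ?_
  obtain ⟨i, hi, j, hj, rfl⟩ := grid_index (by rwa [hl] at h1)
  obtain ⟨U, V, hU, hV, ht⟩ := h i j hi hj h1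
  rw [getElem_lex _ _ _ hi hj]
  exact (TTg_tenT pA pB (.of_term pA (hf _ (getElem_mem _)) hU hX (List.Subset.refl _))
    (.of_term pB (hg _ (getElem_mem _)) hV hY (List.Subset.refl _))).1 ht

theorem TMor.eq_map (D : TD (𝒪) TA TB TC) (pA : PT TA) (pB : PT TB) {X' : PreCtx A}
    {Y' : PreCtx B} {τ : A.Var → Expr A} {ρ : B.Var → Expr B} {e} (hX : Der TA (.ctx X))
    (hY : Der TB (.ctx Y)) (hτ : IsSub TA X X' τ) (hρ : IsSub TB Y Y' ρ)
    (h : TMor TA TB false X (X'.map fun p => τ p.1) Y (Y'.map fun p => ρ p.1) e) :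
    e = ((𝒪).ten X' Y').map fun z => (𝒪).TS X Y τ ρ z.1 := by
  rw [TMor.eq_lex pA pB hX hY h, lex_mapL, lex_mapR]
  · have e1 : ((𝒪).ten X' Y').map (fun z => (𝒪).TS X Y τ ρ z.1) = _ := lex_map _ _ _ _
    rw [e1]
    exact lex_congr fun a _ b _ => (D.TS_v (x := a.1) (y := b.1)).symm
  · intro u hu
    obtain ⟨p, hp, rfl⟩ := mem_map.1 hu
    exact ⟨_, hτ p hp⟩
  · intro u hu
    obtain ⟨p, hp, rfl⟩ := mem_map.1 hu
    exact ⟨_, hρ p hp⟩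

theorem TD.morEq (D : TD (𝒪) TA TB TC) (pA : PT TA) (pB : PT TB) (pC : PT TC) {Xc : PreCtx A}
    {f f' : List (Expr A)} {Yc : PreCtx B} {g g' : List (Expr B)} {Z W : PreCtx (A.tensor B)}
    {e e' : List (Expr (A.tensor B))} (hf : MorEq TA X Xc f f') (hg : MorEq TB Y Yc g g')
    (hZ : TCtx TA TB false X Y Z) (hW : TCtx TA TB false Xc Yc W)
    (he : TMor TA TB false X f Y g e) (he' : TMor TA TB false X f' Y g' e') :
    MorEq TC Z W e e' := by
  obtain ⟨τ, τ', rfl, rfl, hX, hXc, hτ, hτ', ht⟩ := hf.exists_map pA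
  obtain ⟨ρ, ρ', rfl, rfl, hY, hYc, hρ, hρ', hr⟩ := hg.exists_map pB
  obtain rfl := (TCtx_iff (chA := chA) (chB := chB) pA pB hX hY).1 hZ
  obtain rfl := (TCtx_iff (chA := chA) (chB := chB) pA pB hXc hYc).1 hW
  obtain rfl := he.eq_map D pA pB hX hY hτ hρ
  obtain rfl := he'.eq_map D pA pB hX hY hτ' hρ'
  refine .of_map pC (D.ctx_ten hX hY) (D.ctx_ten hXc hYc) (D.mor hX hXc hτ hY hYc hρ)
    (D.mor hX hXc hτ' hY hYc hρ') fun z hz => ?_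
  obtain ⟨p, hp, q, hq, rfl⟩ := D.mem_ten.1 hz
  rw [D.TS_v, D.TS_v]
  exact (D.te (ht p hp) (hρ q hq)).trans pC (D.op.te (hr q hq) (hτ' p hp))

theorem TD.compEq (D : TD (𝒪) TA TB TC) (pA : PT TA) (pB : PT TB) (pC : PT TC)
    {X' X'' : PreCtx A} {f f' : List (Expr A)} {Y' Y'' : PreCtx B} {g g' : List (Expr B)}
    {Z Z' Z'' : PreCtx (A.tensor B)} {e e' ec : List (Expr (A.tensor B))} (hf : IsMor TA X X' f)
    (hf' : IsMor TA X' X'' f') (hg : IsMor TB Y Y' g) (hg' : IsMor TB Y' Y'' g')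
    (hZ : TCtx TA TB false X Y Z) (hZ' : TCtx TA TB false X' Y' Z')
    (hZ'' : TCtx TA TB false X'' Y'' Z'') (he : TMor TA TB false X f Y g e)
    (he' : TMor TA TB false X' f' Y' g' e')
    (hec : TMor TA TB false X (compMor X' f f') Y (compMor Y' g g') ec) :
    MorEq TC Z Z'' (compMor Z' e e') ec := by
  obtain ⟨τ, rfl, hX, hX', hτ⟩ := hf.exists_map pA
  obtain ⟨τ', rfl, -, hX'', hτ'⟩ := hf'.exists_map pA
  obtain ⟨ρ, rfl, hY, hY', hρ⟩ := hg.exists_map pB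
  obtain ⟨ρ', rfl, -, hY'', hρ'⟩ := hg'.exists_map pB
  obtain rfl := (TCtx_iff (chA := chA) (chB := chB) pA pB hX hY).1 hZ
  obtain rfl := (TCtx_iff (chA := chA) (chB := chB) pA pB hX' hY').1 hZ'
  obtain rfl := (TCtx_iff (chA := chA) (chB := chB) pA pB hX'' hY'').1 hZ''
  obtain rfl := he.eq_map D pA pB hX hY hτ hρ
  obtain rfl := he'.eq_map D pA pB hX' hY' hτ' hρ'
  have comp_map : ∀ {A : Alphabet} {Ax : Set (Judg A)} (p : PT Ax) {X X' : PreCtx A} {τ τ'},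
      IsSub Ax X X' τ' → compMor X (X.map fun p => τ p.1) (X'.map fun p => τ' p.1) =
        X'.map fun p => (τ' p.1).subst τ := by
    intro A Ax hPT X X' τ τ' h
    rw [compMor, map_map]
    exact map_congr_left fun p hp => esubstL_map τ ((h p hp).escoped hPT)
  have m := D.mor hX hX' hτ hY hY' hρ
  have m' := D.mor hX' hX'' hτ' hY' hY'' hρ'
  rw [comp_map pA hτ', comp_map pB hρ'] at hec
  have cτ := hτ'.comp hτ hX
  have cρ := hρ'.comp hρ hY
  obtain rfl := hec.eq_map D pA pB hX hY cτ cρ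
  rw [comp_map pC m']
  have hC := D.ctx_ten hX hY
  refine .of_map (σ := fun z => ((𝒪).TS X' Y' τ' ρ' z).subst ((𝒪).TS X Y τ ρ)) pC hC
    (D.ctx_ten hX'' hY'') (m'.comp m hC) (D.mor hX hX'' cτ hY hY'' cρ) fun z hz => ?_
  obtain ⟨p, hp, q, hq, rfl⟩ := D.mem_ten.1 hz
  rw [D.TS_v, D.TS_v]
  exact (D.s1 hX hX' hτ hY hY' hρ ⟨_, hτ' p hp⟩ ⟨_, hρ' q hq⟩).symm

theorem TD.id_eq (D : TD (𝒪) TA TB TC) (pA : PT TA) (pB : PT TB) {Z e} (hX : Der TA (.ctx X))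
    (hY : Der TB (.ctx Y)) (hZ : TCtx TA TB false X Y Z)
    (h : TMor TA TB false X (ctxVars X) Y (ctxVars Y) e) : e = ctxVars Z := by
  obtain rfl := (TCtx_iff (chA := chA) (chB := chB) pA pB hX hY).1 hZ
  rw [h.eq_lex pA pB hX hY]
  · exact ctxVars_ten X Y
  · intro u hu
    obtain ⟨p, hp, rfl⟩ := mem_map.1 hu
    exact ⟨_, hX.vars hp⟩
  · intro u hu
    obtain ⟨p, hp, rfl⟩ := mem_map.1 hu
    exact ⟨_, hY.vars hp⟩

theorem Der.ctx_take (h : Der Ax (.ctx X)) (i : ℕ) : Der Ax (.ctx (X.take i)) :=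
  let ⟨_, hp⟩ := h.exists_ec
  (hp.initial (List.take_prefix i X)).der

theorem CtxEq.exists_steps (hPT : PT Ax) {X' : PreCtx A} (h : CtxEq Ax X X') :
    ∃ σ : A.Var → Expr A, ctxVars X = X'.map (fun p => σ p.1) ∧
      ∀ i (hi : i < X.length) (hi' : i < X'.length), ∃ p,
        CStep Ax p (X.take i) X[i].1 X[i].2 (X'.take i) X'[i].1 X'[i].2 σ := by
  obtain ⟨hl, hX, hX', h⟩ := h
  rw [derivable_iff hPT] at hX hX'
  have ok := hX'.ctxOK hPT
  have lv : (ctxVars X).length = X'.length := by simp [ctxVars, hl]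
  have hv : ∀ i (hi : i < X.length) (hi' : i < X'.length),
      sb X' (ctxVars X) X'[i].1 = .var X[i].1 := fun i hi hi' => by
    rw [← getElem_sb ok lv hi' (by omega)]
    simp [ctxVars]
  have hs : ∀ i (hi : i < X.length) (hi' : i < X'.length),
      Der Ax (.sortEq (X.take i) X[i].2 (X'[i].2.subst (sb X' (ctxVars X)))) := fun i hi hi' => by
    have := (derivable_iff hPT).1 (h i hi hi')
    rwa [← subPre_eq ok _ lv i hi', subPre, ctxVars, ← List.map_take]
  refine ⟨_, (map_sb X' ok.2 _ lv).symm, fun i hi hi' => ?_⟩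
  have hi1 := hX.ctx_take i
  have sub : IsSub Ax (X.take i) (X'.take i) (sb X' (ctxVars X)) := by
    intro z hz
    obtain ⟨k, hk, rfl⟩ := mem_iff_getElem.1 hz
    rw [List.length_take] at hk
    rw [List.getElem_take, hv k (by omega) (by omega)]
    refine .seqt ((hs k (by omega) (by omega)).wk_sortEq
      (List.take_subset_take_left _ (by omega)) hi1) (hi1.vars (p := X[k]) ?_)
    exact mem_take_iff_getElem.2 ⟨k, by omega, rfl⟩
  obtain ⟨p, hp⟩ := (hs i hi hi').lv
  obtain ⟨q, hq⟩ := sub.exists_lsub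
  have hx := hX.ctx_take (i + 1)
  have hx' := hX'.ctx_take (i + 1)
  rw [take_succ_eq_append_getElem hi] at hx
  rw [take_succ_eq_append_getElem hi'] at hx'
  exact ⟨p + q, .inl (hp.mono (by omega)), hq.mono_level (by omega), hx', hv i hi hi',
    hx.ctx_snoc.2⟩

theorem getElem_ten (X : PreCtx A) (Y : PreCtx B) {i j : ℕ} (hi : i < X.length) (hj : j < Y.length)
    (h : i * Y.length + j < ((𝒪).ten X Y).length) :
    ((𝒪).ten X Y)[i * Y.length + j] = ((X[i].1, Y[j].1),
      (𝒪).W X Y X[i].2 (.var X[i].1) Y[j].2 (.var Y[j].1)) := getElem_lex _ _ _ hi hj h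

theorem TD.ten_take (D : TD (𝒪) TA TB TC) (hX : Der TA (.ctx X)) (hY : Der TB (.ctx Y))
    {a b k : ℕ} (h : ∀ i j, i < a → j < b → i * Y.length + j < k) :
    (𝒪).ten (X.take a) (Y.take b) ⊆ ((𝒪).ten X Y).take k := by
  intro z hz
  obtain ⟨r, hr, s, hs, rfl⟩ := D.mem_ten.1 hz
  have h1 := (hX.ctx_take a).vars hr
  have h2 := (hY.ctx_take b).vars hs
  obtain ⟨i, hi, rfl⟩ := mem_take_iff_getElem.1 hr
  obtain ⟨j, hj, rfl⟩ := mem_take_iff_getElem.1 hs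
  rw [D.W_mono hX hY (take_subset _ _) (take_subset _ _) h1.term_sort ⟨_, h1⟩
    h2.term_sort ⟨_, h2⟩]
  have hl : ((𝒪).ten X Y).length = _ := length_lex _ _ _
  have hlt := grid_index_lt (show i < X.length by omega) (show j < Y.length by omega)
  have hk := h i j (by omega) (by omega)
  exact mem_take_iff_getElem.2 ⟨i * Y.length + j, by omega,
    getElem_ten X Y (by omega) (by omega) (by omega)⟩

theorem TD.ctxEq (D : TD (𝒪) TA TB TC) (pA : PT TA) (pB : PT TB) (pC : PT TC) {X' : PreCtx A}
    {Y' : PreCtx B} {Z Z'} (h1 : CtxEq TA X X') (h2 : CtxEq TB Y Y')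
    (hZ : TCtx TA TB false X Y Z) (hZ' : TCtx TA TB false X' Y' Z') : CtxEq TC Z Z' := by
  have hX := (derivable_iff pA).1 h1.2.1
  have hX' := (derivable_iff pA).1 h1.2.2.1
  have hY := (derivable_iff pB).1 h2.2.1
  have hY' := (derivable_iff pB).1 h2.2.2.1
  obtain rfl := (TCtx_iff (chA := chA) (chB := chB) pA pB hX hY).1 hZ
  obtain rfl := (TCtx_iff (chA := chA) (chB := chB) pA pB hX' hY').1 hZ'
  obtain ⟨σ, eσ, hσ⟩ := h1.exists_steps pA
  obtain ⟨ρ, eρ, hρ⟩ := h2.exists_steps pB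
  have lX := h1.1
  have lY := h2.1
  have lZ : ((𝒪).ten X Y).length = _ := length_lex _ _ _
  have lZ' : ((𝒪).ten X' Y').length = _ := length_lex _ _ _
  have hC := D.ctx_ten hX hY
  have hC' := D.ctx_ten hX' hY'
  have ok := hC'.ctxOK pC
  have ev : ctxVars ((𝒪).ten X Y) = ((𝒪).ten X' Y').map fun z => (𝒪).TS X Y σ ρ z.1 := by
    rw [← ctxVars_ten X Y (X1 := X) (Y1 := Y), eσ, eρ, lex_mapL, lex_mapR]
    have e1 : ((𝒪).ten X' Y').map (fun z => (𝒪).TS X Y σ ρ z.1) = _ := lex_map _ _ _ _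
    rw [e1]
    exact lex_congr fun a _ b _ => (D.TS_v (x := a.1) (y := b.1)).symm
  refine ⟨by rw [lZ, lZ', lX, lY], (derivable_iff pC).2 hC, (derivable_iff pC).2 hC',
    fun k hk hk' => (derivable_iff pC).2 ?_⟩
  have e0 := subPre_map ok ((𝒪).TS X Y σ ρ) k hk'
  rw [← ev, subPre, ctxVars, ← List.map_take] at e0
  rw [show ctxVars (((𝒪).ten X Y).take k) = _ from rfl, ctxVars, e0]
  have sc := ok.scoped (getElem_mem hk')
  obtain ⟨i, hi, j, hj, rfl⟩ := grid_index (by rwa [lZ] at hk)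
  have e1 := getElem_ten (chA := chA) (chB := chB) X Y hi hj hk
  have e2 : ((𝒪).ten X' Y')[i * Y.length + j].2 = (𝒪).W X' Y' X'[i].2 (.var X'[i].1) Y'[j].2
      (.var Y'[j].1) := by
    have := getElem_ten (TA := TA) (TB := TB) (chA := chA) (chB := chB) X' Y'
      (i := i) (j := j) (by omega) (by omega) (by rw [← lY]; exact hk')
    simp only [← lY] at this
    rw [this]
  have hi' : i < X'.length := by omega
  have hj' : j < Y'.length := by omega
  obtain ⟨p, sX⟩ := hσ i hi hi'
  obtain ⟨q, sY⟩ := hρ j hj hj'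
  have main := sX.sortEq D sY (hC.ctx_take (i * Y.length + j))
    (by
      have := D.ten_take hX hY (a := i) (b := j + 1) (k := i * Y.length + j) fun i' j' h h' => by
        nlinarith
      rwa [take_succ_eq_append_getElem hj] at this)
    (by
      have := D.ten_take hX hY (a := i + 1) (b := j) (k := i * Y.length + j) fun i' j' h h' => by
        nlinarith
      rwa [take_succ_eq_append_getElem hi] at this)
  have w1 := (hX.ctx_take (i + 1)).vars (p := X[i])
    (mem_take_iff_getElem.2 ⟨i, by omega, rfl⟩)
  have w2 := (hY.ctx_take (j + 1)).vars (p := Y[j])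
    (mem_take_iff_getElem.2 ⟨j, by omega, rfl⟩)
  have w1' := (hX'.ctx_take (i + 1)).vars (p := X'[i])
    (mem_take_iff_getElem.2 ⟨i, by omega, rfl⟩)
  have w2' := (hY'.ctx_take (j + 1)).vars (p := Y'[j])
    (mem_take_iff_getElem.2 ⟨j, by omega, rfl⟩)
  have m1 := D.W_mono hX hY (take_subset _ _) (take_subset _ _) w1.term_sort ⟨_, w1⟩
    w2.term_sort ⟨_, w2⟩
  have m2 := D.W_mono hX' hY' (take_subset _ _) (take_subset _ _) w1'.term_sort ⟨_, w1'⟩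
    w2'.term_sort ⟨_, w2'⟩
  rw [take_succ_eq_append_getElem hi, take_succ_eq_append_getElem hj] at m1
  rw [take_succ_eq_append_getElem hi', take_succ_eq_append_getElem hj'] at m2
  rw [show X.take i ++ [(X[i].1, X[i].2)] = X.take i ++ [X[i]] from rfl,
    show Y.take j ++ [(Y[j].1, Y[j].2)] = Y.take j ++ [Y[j]] from rfl, m1,
    show X'.take i ++ [(X'[i].1, X'[i].2)] = X'.take i ++ [X'[i]] from rfl,
    show Y'.take j ++ [(Y'[j].1, Y'[j].2)] = Y'.take j ++ [Y'[j]] from rfl, m2] at main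
  rw [e1, e2]
  rw [e2] at sc
  convert main using 2
  refine SortE.subst_congr _ fun z hz => ?_
  obtain ⟨w, hw, rfl⟩ := mem_map.1 (sc z hz)
  obtain ⟨r, hr, s, hs, rfl⟩ := D.mem_ten.1 hw
  obtain ⟨a, ha⟩ : ∃ a, σ r.1 = .var a := by
    have := mem_map_of_mem (f := fun p => σ p.1) hr
    rw [← eσ] at this
    obtain ⟨c, -, hc⟩ := mem_map.1 this
    exact ⟨_, hc.symm⟩
  obtain ⟨b, hb⟩ : ∃ b, ρ s.1 = .var b := by
    have := mem_map_of_mem (f := fun p => ρ p.1) hs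
    rw [← eρ] at this
    obtain ⟨c, -, hc⟩ := mem_map.1 this
    exact ⟨_, hc.symm⟩
  rw [D.TS_v, D.TS_v, ha, hb, D.l.T_vv, D.l.T_vv]

end

/-- The assignments `[X] ⊗ [Y] := [X ⊗ Y]` and
`[f] ⊗ [g] := [f ⊗ g]` define a functor `⊗ : 𝒞(𝔸) × 𝒞(𝔹) → 𝒞(𝔸⊗𝔹)`:
(well-definedness on objects and morphisms) tensoring preserves derivable context
equalities and derivable morphism equalities; (functoriality) the tensor of the
identities `(x₁,…,x_m)` and `(y₁,…,yₙ)` is the identity `(x₁y₁,…,x_myₙ)` of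
`X ⊗ Y`, and `(f'∘f) ⊗ (g'∘g) ≡ (f'⊗g') ∘ (f⊗g)` is derivable. -/
theorem tensor_functor
    (A B : Alphabet) (TA : Set (Judg A)) (TB : Set (Judg B))
    (hA : IsGAT TA) (hB : IsGAT TB)
    (chA : PreCtx A → A.Var) (hchA : FreshCh chA)
    (chB : PreCtx B → B.Var) (hchB : FreshCh chB) :
    -- well-definedness on objects
    (∀ (X X' : PreCtx A) (Y Y' : PreCtx B) (Z Z' : PreCtx (A.tensor B)),
        CtxEq TA X X' → CtxEq TB Y Y' →
        TCtx TA TB false X Y Z → TCtx TA TB false X' Y' Z' →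
        CtxEq (tensorAx TA TB chA chB) Z Z') ∧
    -- well-definedness on morphisms
    (∀ (X Xc : PreCtx A) (f f' : List (Expr A)) (Y Yc : PreCtx B)
        (g g' : List (Expr B)) (Z W : PreCtx (A.tensor B))
        (e e' : List (Expr (A.tensor B))),
        MorEq TA X Xc f f' → MorEq TB Y Yc g g' →
        TCtx TA TB false X Y Z → TCtx TA TB false Xc Yc W →
        TMor TA TB false X f Y g e → TMor TA TB false X f' Y g' e' →
        MorEq (tensorAx TA TB chA chB) Z W e e') ∧
    -- identities
    (∀ (X : PreCtx A) (Y : PreCtx B) (Z : PreCtx (A.tensor B))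
        (e : List (Expr (A.tensor B))),
        Derivable TA (.ctx X) → Derivable TB (.ctx Y) →
        TCtx TA TB false X Y Z →
        TMor TA TB false X (ctxVars X) Y (ctxVars Y) e →
        e = ctxVars Z) ∧
    -- composition
    (∀ (X X' X'' : PreCtx A) (f f' : List (Expr A)) (Y Y' Y'' : PreCtx B)
        (g g' : List (Expr B)) (ZXY Z' Z'' : PreCtx (A.tensor B))
        (e e' ec : List (Expr (A.tensor B))),
        IsMor TA X X' f → IsMor TA X' X'' f' →
        IsMor TB Y Y' g → IsMor TB Y' Y'' g' →
        TCtx TA TB false X Y ZXY → TCtx TA TB false X' Y' Z' →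
        TCtx TA TB false X'' Y'' Z'' →
        TMor TA TB false X f Y g e → TMor TA TB false X' f' Y' g' e' →
        TMor TA TB false X (compMor X' f f') Y (compMor Y' g g') ec →
        MorEq (tensorAx TA TB chA chB) ZXY Z'' (compMor Z' e e') ec) := by
  have pA := hA.1.pt
  have pB := hB.1.pt
  have dA : ∀ J ∈ TA, Der TA J := fun J h => (derivable_iff pA).1 (hA.2 J h)
  have dB : ∀ J ∈ TB, Der TB J := fun J h => (derivable_iff pB).1 (hB.2 J h)
  have pC := tensorAx_pt pA pB dA dB hchA hchB
  have D := tensorOps_TD pA pB dA dB hchA hchB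
  refine ⟨fun _ _ _ _ _ _ h1 h2 h3 h4 => D.ctxEq pA pB pC h1 h2 h3 h4,
    fun _ _ _ _ _ _ _ _ _ _ _ _ h1 h2 h3 h4 h5 h6 => D.morEq pA pB pC h1 h2 h3 h4 h5 h6,
    fun _ _ _ _ h1 h2 h3 h4 =>
      D.id_eq pA pB ((derivable_iff pA).1 h1) ((derivable_iff pB).1 h2) h3 h4,
    fun _ _ _ _ _ _ _ _ _ _ _ _ _ _ _ _ h1 h2 h3 h4 h5 h6 h7 h8 h9 h10 =>
      D.compEq pA pB pC h1 h2 h3 h4 h5 h6 h7 h8 h9 h10⟩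

end GATPaper
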